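/- Let f(Z), g(Z) ∈ ℤ[Z] satisfy the nondegeneracy condition and let K be an imaginary quadratic field. Then for every ε > 0 there is a constant C (depending only on f, g, K, ε) such that for all real T ≥ 1 and x ≥ 2, one has Σ_{r,s ∈ F(T), Δ(r+s) ≠ 0} π_{E(r+s)}(K; x) ≤ C (T⁴ x^{5/6} + T^{2+ε} x^{4/3}), where the sum runs over ordered pairs (r, s) ∈ F(T) × F(T). -/

import Mathlib

open Polynomial Finset

attribute [local instance 10] Classical.propDecidable

noncomputable section

/-- The discriminant polynomial `Δ = -16(4f³+27g²)`. -/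
def Dpoly (f g : Polynomial ℤ) : Polynomial ℤ := -16 * (4 * f ^ 3 + 27 * g ^ 2)

/-- Nondegeneracy: `Δ ≠ 0` as a polynomial and the `j`-invariant
`j = -1728(4f)³/Δ` is not a constant rational function, i.e. `-1728(4f)³`
is not a rational multiple of `Δ`. -/
def Nondeg (f g : Polynomial ℤ) : Prop :=
  Dpoly f g ≠ 0 ∧
    ¬∃ c : ℚ, (-1728 : Polynomial ℚ) * (4 * f.map (Int.castRingHom ℚ)) ^ 3 =
      Polynomial.C c * (Dpoly f g).map (Int.castRingHom ℚ)

/-- The set `F(T) = {u/v ∈ ℚ : gcd(u,v) = 1, 1 ≤ u, v ≤ T}`. -/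
def FT (T : ℝ) : Finset ℚ :=
  ((Finset.Icc (1 : ℤ) ⌊T⌋ ×ˢ Finset.Icc (1 : ℤ) ⌊T⌋).filter
      fun w => Int.gcd w.1 w.2 = 1).image fun w => (w.1 : ℚ) / (w.2 : ℚ)

/-- Reduction of a rational number `t` modulo `p`, as `num·den⁻¹` in `ZMod p`. -/
def redQ (p : ℕ) (t : ℚ) : ZMod p := (t.num : ZMod p) * (t.den : ZMod p)⁻¹

/-- The number of `𝔽_p`-points of the curve `Y² = X³ + AX + B`
(affine points together with the point at infinity). -/
def numPoints (p : ℕ) (A B : ZMod p) : ℕ :=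
  1 + Nat.card {P : ZMod p × ZMod p // P.2 ^ 2 = P.1 ^ 3 + A * P.1 + B}

/-- The Frobenius trace `p + 1 - #E(𝔽_p)` of `Y² = X³ + AX + B` over `𝔽_p`. -/
def frobTrace (p : ℕ) (A B : ZMod p) : ℤ := (p : ℤ) + 1 - numPoints p A B

/-- `a_p(E(t))`: the Frobenius trace of the reduction modulo `p` of the curve
`E(t) : Y² = X³ + f(t)X + g(t)`. -/
def apE (f g : Polynomial ℤ) (p : ℕ) (t : ℚ) : ℤ :=
  frobTrace p ((f.map (Int.castRingHom (ZMod p))).eval (redQ p t))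
    ((g.map (Int.castRingHom (ZMod p))).eval (redQ p t))

/-- Good reduction of `E(t)` at `p`: the denominator of `t` is coprime to `p`
and `Δ(t) ≢ 0 (mod p)`. -/
def goodRed (f g : Polynomial ℤ) (p : ℕ) (t : ℚ) : Prop :=
  ¬(p ∣ t.den) ∧ ((Dpoly f g).map (Int.castRingHom (ZMod p))).eval (redQ p t) ≠ 0

/-- `π_{E(t)}(𝔄; x)`: the number of primes `p ≤ x` of good reduction for `E(t)`
with `a_p(E(t)) = a_p`. -/
def piSeq (f g : Polynomial ℤ) (a : ℕ → ℤ) (t : ℚ) (x : ℝ) : ℕ :=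
  ((Finset.Icc 1 ⌊x⌋₊).filter fun p =>
      p.Prime ∧ goodRed f g p t ∧ apE f g p t = a p).card

/-- `π_{E(t)}(K; x)` for `K = ℚ(√d)`: the number of primes `p ≤ x` of good
reduction for `E(t)` with `a_p(E(t)) ≠ 0` and `a_p(E(t))² - 4p = d·m²`. -/
def piK (f g : Polynomial ℤ) (d : ℤ) (t : ℚ) (x : ℝ) : ℕ :=
  ((Finset.Icc 1 ⌊x⌋₊).filter fun p =>
      p.Prime ∧ goodRed f g p t ∧ apE f g p t ≠ 0 ∧
        ∃ m : ℤ, 0 < m ∧ (apE f g p t) ^ 2 - 4 * (p : ℤ) = d * m ^ 2).card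

/-- The Frobenius angle `ψ_p(E(t)) ∈ [0, π]`, with `cos ψ_p = a_p/(2√p)`. -/
def psiE (f g : Polynomial ℤ) (p : ℕ) (t : ℚ) : ℝ :=
  Real.arccos ((apE f g p t : ℝ) / (2 * Real.sqrt p))

/-- `π_{E(t)}(α, β; x)`: the number of primes `p ≤ x` of good reduction for
`E(t)` with `ψ_p(E(t)) ∈ [α, β]`. -/
def piAngle (f g : Polynomial ℤ) (α β : ℝ) (t : ℚ) (x : ℝ) : ℕ :=
  ((Finset.Icc 1 ⌊x⌋₊).filter fun p =>
      p.Prime ∧ goodRed f g p t ∧ psiE f g p t ∈ Set.Icc α β).card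

/-- The Sato–Tate density `μ_ST(α, β) = (2/π) ∫_α^β sin²θ dθ`. -/
def muST (α β : ℝ) : ℝ := (2 / Real.pi) * ∫ θ in α..β, Real.sin θ ^ 2

/-- `π(x)`: the number of primes `p ≤ x`. -/
def primePi (x : ℝ) : ℕ := ((Finset.Icc 1 ⌊x⌋₊).filter Nat.Prime).card

/-- `e_p(w) = exp(2πi w/p)`. -/
def ep (p : ℕ) (w : ZMod p) : ℂ :=
  Complex.exp (2 * (Real.pi : ℂ) * Complex.I * (w.val : ℂ) / (p : ℂ))

set_option linter.unusedSectionVars false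

/-- An elliptic curve in short Weierstrass form `Y² = X³ + AX + B`. -/
structure Ell (k : Type*) [Field k] where
  A : k
  B : k
  disc : 4 * A ^ 3 + 27 * B ^ 2 ≠ 0

/-- Fields of characteristic different from `2` and `3`. -/
class CharGood (k : Type*) [Field k] : Prop where
  two : (2 : k) ≠ 0
  three : (3 : k) ≠ 0

namespace Ell
variable {k : Type*} [Field k]

/-- The associated Weierstrass curve. -/
def W (E : Ell k) : WeierstrassCurve.Affine k := ⟨0, 0, 0, E.A, E.B⟩

/-- The group of rational points. -/
abbrev Pt (E : Ell k) := E.W.Point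

/-- The `xc`-coordinate, with junk value `0` at the origin. -/
def xc {E : Ell k} : E.Pt → k
  | .zero => 0
  | .some x _ _ => x

/-- The `yc`-coordinate, with junk value `0` at the origin. -/
def yc {E : Ell k} : E.Pt → k
  | .zero => 0
  | .some _ y _ => y

/-- The cubic `X³ + AX + B`. -/
def f (E : Ell k) : k[X] := X ^ 3 + C E.A * X + C E.B

@[simp] lemma eval_f (E : Ell k) (x : k) : E.f.eval x = x ^ 3 + E.A * x + E.B := by simp [f]

variable {E : Ell k}

lemma some_nz {x y : k} (h : E.W.Nonsingular x y) :
    (WeierstrassCurve.Affine.Point.some x y h : E.Pt) ≠ 0 :=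
  WeierstrassCurve.Affine.Point.some_ne_zero h

lemma nonsing [CharGood k] {x y : k} (h : y ^ 2 = x ^ 3 + E.A * x + E.B) :
    E.W.Nonsingular x y := by
  rw [WeierstrassCurve.Affine.nonsingular_iff, WeierstrassCurve.Affine.equation_iff]
  have h2 : (2 : k) ≠ 0 := CharGood.two
  simp only [W]
  refine ⟨by linear_combination h, ?_⟩
  by_contra hc
  push Not at hc
  obtain ⟨hc1, hc2⟩ := hc
  have hy : y = 0 := by
    have : 2 * y = 0 := by linear_combination hc2
    simpa [h2] using this
  have h1 : 3 * x ^ 2 + E.A = 0 := by linear_combination -hc1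
  subst hy
  apply E.disc
  have h3 : E.A = -(3 * x ^ 2) := by linear_combination h1
  have h4 : E.B = 2 * x ^ 3 := by rw [h3] at h; linear_combination -h
  rw [h3, h4]; ring

lemma eqn {P : E.Pt} (hP : P ≠ 0) : yc P ^ 2 = xc P ^ 3 + E.A * xc P + E.B := by
  rcases P with _ | ⟨x, y, h⟩
  · exact absurd rfl hP
  · have := (WeierstrassCurve.Affine.equation_iff ..).1 h.1
    simp only [W] at this
    simp only [xc, yc]
    linear_combination this

lemma eqn' {P : E.Pt} (hP : P ≠ 0) : yc P ^ 2 = E.f.eval (xc P) := by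
  rw [eqn hP, eval_f]

lemma exists_pt [CharGood k] {x y : k} (h : y ^ 2 = x ^ 3 + E.A * x + E.B) :
    ∃ P : E.Pt, P ≠ 0 ∧ xc P = x ∧ yc P = y :=
  ⟨.some x y (nonsing h), some_nz _, rfl, rfl⟩

lemma pt_ext {P Q : E.Pt} (hP : P ≠ 0) (hQ : Q ≠ 0) (hx : xc P = xc Q) (hy : yc P = yc Q) :
    P = Q := by
  rcases P with _ | ⟨x, y, h⟩
  · exact absurd rfl hP
  rcases Q with _ | ⟨x', y', h'⟩
  · exact absurd rfl hQ
  simp only [xc, yc] at hx hy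
  subst hx hy
  rfl

@[simp] lemma X_neg (P : E.Pt) : xc (-P) = xc P := by
  rcases P with _ | ⟨x, y, h⟩
  · rfl
  · rfl

@[simp] lemma Y_neg (P : E.Pt) : yc (-P) = -yc P := by
  rcases P with _ | ⟨x, y, h⟩
  · exact (neg_zero).symm
  · rw [WeierstrassCurve.Affine.Point.neg_some]
    simp [yc, W, WeierstrassCurve.Affine.negY]

lemma eq_or_neg_of_X_eq {P Q : E.Pt} (hP : P ≠ 0) (hQ : Q ≠ 0) (hx : xc P = xc Q) :
    P = Q ∨ P = -Q := by
  have h1 := eqn hP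
  have h2 := eqn hQ
  rw [hx] at h1
  have : (yc P - yc Q) * (yc P + yc Q) = 0 := by linear_combination h1 - h2
  rcases mul_eq_zero.1 this with h | h
  · exact Or.inl (pt_ext hP hQ hx (by linear_combination h))
  · exact Or.inr (pt_ext hP (neg_ne_zero.2 hQ) (by simp [hx]) (by rw [Y_neg]; linear_combination h))

lemma add_chord {P Q : E.Pt} (hP : P ≠ 0) (hQ : Q ≠ 0) (hx : xc P ≠ xc Q) :
    P + Q ≠ 0 ∧ xc (P + Q) = ((yc P - yc Q) / (xc P - xc Q)) ^ 2 - xc P - xc Q ∧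
    yc (P + Q) = (yc P - yc Q) / (xc P - xc Q) * (xc P - xc (P + Q)) - yc P := by
  rcases P with _ | ⟨x, y, h⟩
  · exact absurd rfl hP
  rcases Q with _ | ⟨x', y', h'⟩
  · exact absurd rfl hQ
  simp only [xc] at hx
  rw [WeierstrassCurve.Affine.Point.add_of_X_ne hx]
  refine ⟨some_nz _, ?_, ?_⟩
  · simp [xc, yc, W, WeierstrassCurve.Affine.addX, WeierstrassCurve.Affine.slope_of_X_ne hx]
  · simp [xc, yc, W, WeierstrassCurve.Affine.addX, WeierstrassCurve.Affine.addY,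
      WeierstrassCurve.Affine.negAddY, WeierstrassCurve.Affine.negY,
      WeierstrassCurve.Affine.slope_of_X_ne hx]
    ring

lemma add_self [CharGood k] {P : E.Pt} (hP : P ≠ 0) (hy : yc P ≠ 0) :
    P + P ≠ 0 ∧ xc (P + P) = ((3 * xc P ^ 2 + E.A) / (2 * yc P)) ^ 2 - 2 * xc P ∧
    yc (P + P) = (3 * xc P ^ 2 + E.A) / (2 * yc P) * (xc P - xc (P + P)) - yc P := by
  rcases P with _ | ⟨x, y, h⟩
  · exact absurd rfl hP
  have h2 : (2 : k) ≠ 0 := CharGood.two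
  have hn : y ≠ E.W.negY x y := by
    simp only [WeierstrassCurve.Affine.negY, W]
    intro hc
    apply hy
    have : 2 * y = 0 := by linear_combination hc
    exact (mul_eq_zero.1 this).resolve_left h2
  rw [WeierstrassCurve.Affine.Point.add_self_of_Y_ne hn]
  have hs : E.W.slope x x y y = (3 * x ^ 2 + E.A) / (2 * y) := by
    rw [WeierstrassCurve.Affine.slope_of_Y_ne rfl hn]
    simp [W, WeierstrassCurve.Affine.negY, two_mul]
  refine ⟨some_nz _, ?_, ?_⟩
  · simp [xc, yc, WeierstrassCurve.Affine.addX, hs]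
    simp [W]; ring
  · simp [xc, yc, WeierstrassCurve.Affine.addX, WeierstrassCurve.Affine.addY,
      WeierstrassCurve.Affine.negAddY, WeierstrassCurve.Affine.negY, hs]
    simp [W]; ring

lemma Y_eq_zero_iff [CharGood k] {P : E.Pt} : yc P = 0 ↔ P + P = 0 := by
  constructor
  · intro h
    by_cases hP : P = 0
    · simp [hP]
    have : P = -P := pt_ext hP (neg_ne_zero.2 hP) (by simp) (by simp [h])
    nth_rewrite 2 [this]; simp
  · intro h
    by_contra hy
    by_cases hP : P = 0
    · subst hP; exact hy rfl
    exact (add_self hP hy).1 h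

lemma finite_X_fiber (c : k) : {P : E.Pt | xc P = c}.Finite := by
  by_cases h : ∃ Q : E.Pt, Q ≠ 0 ∧ xc Q = c
  · obtain ⟨Q, hQ, hc⟩ := h
    refine Set.Finite.subset (Set.toFinite {0, Q, -Q}) fun P hP => ?_
    by_cases h0 : P = 0
    · simp [h0]
    · rcases eq_or_neg_of_X_eq h0 hQ (by rw [hc]; exact hP) with h | h <;> simp [h]
  · push Not at h
    refine Set.Finite.subset (Set.toFinite {0}) fun P hP => ?_
    by_contra h0
    exact h P h0 hP

lemma tendsto_X : Filter.Tendsto (xc : E.Pt → k) Filter.cofinite Filter.cofinite :=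
  Filter.Tendsto.cofinite_of_finite_preimage_singleton fun c => finite_X_fiber c

lemma ev_X {p : k → Prop} (h : ∀ᶠ x in Filter.cofinite, p x) :
    ∀ᶠ P : E.Pt in Filter.cofinite, p (xc P) := tendsto_X.eventually h

lemma ev_ne (Q : E.Pt) : ∀ᶠ P : E.Pt in Filter.cofinite, P ≠ Q := by
  simp [Filter.eventually_cofinite]

lemma ev_poly_ne {a : k[X]} (ha : a ≠ 0) : ∀ᶠ x in Filter.cofinite, a.eval x ≠ 0 := by
  rw [Filter.eventually_cofinite]
  refine Set.Finite.subset (a.roots.toFinset.finite_toSet) fun x hx => ?_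
  simp only [Set.mem_ofPred_eq, not_not] at hx
  simp [ha, hx]

lemma ev_polyX_ne {a : k[X]} (ha : a ≠ 0) :
    ∀ᶠ P : E.Pt in Filter.cofinite, a.eval (xc P) ≠ 0 := ev_X (ev_poly_ne ha)

lemma tendsto_add (Q : E.Pt) :
    Filter.Tendsto (fun P : E.Pt => P + Q) Filter.cofinite Filter.cofinite :=
  (add_left_injective Q).tendsto_cofinite

lemma tendsto_neg : Filter.Tendsto (fun P : E.Pt => -P) Filter.cofinite Filter.cofinite :=
  neg_injective.tendsto_cofinite

lemma f_monic (E : Ell k) : E.f.Monic := by unfold f; monicity!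
lemma f_natDegree (E : Ell k) : E.f.natDegree = 3 := by unfold f; compute_degree!
lemma f_ne (E : Ell k) : E.f ≠ 0 := E.f_monic.ne_zero

lemma ev_Y_ne : ∀ᶠ P : E.Pt in Filter.cofinite, yc P ≠ 0 := by
  filter_upwards [ev_polyX_ne E.f_ne, ev_ne 0] with P h1 h2 h3
  apply h1
  rw [← eqn' h2, h3]; simp

section closed
variable [IsAlgClosed k] [CharGood k]

lemma X_surj (x : k) : ∃ P : E.Pt, P ≠ 0 ∧ xc P = x := by
  obtain ⟨y, hy⟩ := IsAlgClosed.exists_pow_nat_eq (x ^ 3 + E.A * x + E.B) (n := 2) (by norm_num)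
  obtain ⟨P, h1, h2, -⟩ := exists_pt hy
  exact ⟨P, h1, h2⟩

lemma of_ev_X {p : k → Prop} (h : ∀ᶠ P : E.Pt in Filter.cofinite, p (xc P)) :
    ∀ᶠ x in Filter.cofinite, p x := by
  rw [Filter.eventually_cofinite] at *
  refine Set.Finite.subset (h.image xc) fun x hx => ?_
  obtain ⟨P, -, hP⟩ := X_surj (E := E) x
  exact ⟨P, by simpa [hP] using hx, hP⟩

instance : Infinite E.Pt := by
  have : Infinite k := IsAlgClosed.instInfinite
  refine Infinite.of_surjective (xc : E.Pt → k) fun x => ?_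
  obtain ⟨P, -, h⟩ := X_surj (E := E) x
  exact ⟨P, h⟩

lemma poly_eq_of_ev {a b : k[X]} (h : ∀ᶠ x in Filter.cofinite, a.eval x = b.eval x) : a = b := by
  have : Infinite k := IsAlgClosed.instInfinite
  by_contra hne
  obtain ⟨x, h1, h2⟩ := (h.and (ev_poly_ne (sub_ne_zero.2 hne))).exists
  simp [h1] at h2

lemma poly_eq_of_evX {a b : k[X]}
    (h : ∀ᶠ P : E.Pt in Filter.cofinite, a.eval (xc P) = b.eval (xc P)) : a = b :=
  poly_eq_of_ev (of_ev_X h)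

end closed
end Ell

namespace Ell
variable {k : Type*} [Field k] [IsAlgClosed k] [CharGood k] {E E' E'' : Ell k}

/-- Rational functions on a curve, up to finitely many values. -/
def IsRat (h : E.Pt → k) : Prop := ∃ a b d : k[X], d ≠ 0 ∧
  ∀ᶠ P in Filter.cofinite, d.eval (xc P) * h P = a.eval (xc P) + b.eval (xc P) * yc P

lemma norm_ne {a b : k[X]} (h : a ^ 2 - b ^ 2 * E.f = 0) : a = 0 ∧ b = 0 := by
  have h' : a ^ 2 = b ^ 2 * E.f := by linear_combination h
  by_cases hb : b = 0
  · subst hb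
    simpa using h
  · exfalso
    have := congrArg natDegree h'
    rw [natDegree_mul (pow_ne_zero _ hb) E.f_ne, natDegree_pow, natDegree_pow, f_natDegree] at this
    omega

lemma IsRat.congr {h h' : E.Pt → k} (hh : IsRat h) (e : ∀ᶠ P in Filter.cofinite, h' P = h P) :
    IsRat h' := by
  obtain ⟨a, b, d, hd, H⟩ := hh
  refine ⟨a, b, d, hd, ?_⟩
  filter_upwards [H, e] with P h1 h2
  rw [h2, h1]

lemma IsRat.const (c : k) : IsRat (fun _ : E.Pt => c) :=
  ⟨C c, 0, 1, one_ne_zero, by simp⟩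
lemma IsRat.x : IsRat (xc : E.Pt → k) := ⟨X, 0, 1, one_ne_zero, by simp⟩
lemma IsRat.y : IsRat (yc : E.Pt → k) := ⟨0, 1, 1, one_ne_zero, by simp⟩

lemma IsRat.add {h h' : E.Pt → k} (hh : IsRat h) (hh' : IsRat h') :
    IsRat (fun P => h P + h' P) := by
  obtain ⟨a, b, d, hd, H⟩ := hh
  obtain ⟨a', b', d', hd', H'⟩ := hh'
  refine ⟨a * d' + a' * d, b * d' + b' * d, d * d', mul_ne_zero hd hd', ?_⟩
  filter_upwards [H, H'] with P h1 h2
  simp only [eval_add, eval_mul]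
  linear_combination d'.eval (xc P) * h1 + d.eval (xc P) * h2

lemma IsRat.mul {h h' : E.Pt → k} (hh : IsRat h) (hh' : IsRat h') :
    IsRat (fun P => h P * h' P) := by
  obtain ⟨a, b, d, hd, H⟩ := hh
  obtain ⟨a', b', d', hd', H'⟩ := hh'
  refine ⟨a * a' + b * b' * E.f, a * b' + a' * b, d * d', mul_ne_zero hd hd', ?_⟩
  filter_upwards [H, H', ev_ne 0] with P h1 h2 h3
  simp only [eval_add, eval_mul, ← eqn' h3]
  linear_combination d'.eval (xc P) * h' P * h1 + (a.eval (xc P) + b.eval (xc P) * yc P) * h2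

lemma IsRat.neg {h : E.Pt → k} (hh : IsRat h) : IsRat (fun P => - h P) :=
  ((IsRat.const (-1)).mul hh).congr (by simp)

lemma IsRat.sub {h h' : E.Pt → k} (hh : IsRat h) (hh' : IsRat h') :
    IsRat (fun P => h P - h' P) := (hh.add hh'.neg).congr (by simp [sub_eq_add_neg])

lemma IsRat.pow {h : E.Pt → k} (hh : IsRat h) (n : ℕ) : IsRat (fun P => h P ^ n) := by
  induction n with
  | zero => simpa using IsRat.const 1
  | succ n ih => simpa [pow_succ] using ih.mul hh

lemma IsRat.eval {h : E.Pt → k} (hh : IsRat h) (a : k[X]) : IsRat (fun P => a.eval (h P)) := by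
  induction a using Polynomial.induction_on' with
  | add p q hp hq => simpa using hp.add hq
  | monomial n c => simpa using (IsRat.const c).mul (hh.pow n)

lemma IsRat.zero_or {h : E.Pt → k} (hh : IsRat h) :
    (∀ᶠ P in Filter.cofinite, h P = 0) ∨ (∀ᶠ P in Filter.cofinite, h P ≠ 0) := by
  obtain ⟨a, b, d, hd, H⟩ := hh
  by_cases hn : a ^ 2 - b ^ 2 * E.f = 0
  · left
    obtain ⟨rfl, rfl⟩ := norm_ne hn
    filter_upwards [H, ev_polyX_ne hd] with P h1 h2
    simpa [h2] using h1
  · right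
    filter_upwards [H, ev_polyX_ne hn, ev_ne 0] with P h1 h2 h3 h4
    apply h2
    simp only [eval_sub, eval_mul, eval_pow, ← eqn' h3]
    rw [h4] at h1
    linear_combination - (a.eval (xc P) - b.eval (xc P) * yc P) * h1

lemma IsRat.inv {h : E.Pt → k} (hh : IsRat h) : IsRat (fun P => (h P)⁻¹) := by
  rcases hh.zero_or with h0 | h0
  · exact (IsRat.const 0).congr (by filter_upwards [h0] with P hP; simp [hP])
  obtain ⟨a, b, d, hd, H⟩ := hh
  have hn : a ^ 2 - b ^ 2 * E.f ≠ 0 := by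
    intro hn
    obtain ⟨rfl, rfl⟩ := norm_ne hn
    obtain ⟨P, h1, h2, h3⟩ := (H.and (h0.and (ev_polyX_ne hd))).exists
    simp [h2, h3] at h1
  refine ⟨a * d, -b * d, _, hn, ?_⟩
  filter_upwards [H, h0, ev_ne 0] with P h1 h2 h3
  simp only [eval_sub, eval_mul, eval_pow, ← eqn' h3, eval_neg]
  field_simp
  linear_combination -(a.eval (xc P) - b.eval (xc P) * yc P) * h1

lemma IsRat.div {h h' : E.Pt → k} (hh : IsRat h) (hh' : IsRat h') :
    IsRat (fun P => h P / h' P) := (hh.mul hh'.inv).congr (by simp [div_eq_mul_inv])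

lemma IsRat.even {h : E.Pt → k} (hh : IsRat h) (he : ∀ᶠ P in Filter.cofinite, h (-P) = h P) :
    ∃ a d : k[X], d ≠ 0 ∧ ∀ᶠ P in Filter.cofinite, d.eval (xc P) * h P = a.eval (xc P) := by
  obtain ⟨a, b, d, hd, H⟩ := hh
  refine ⟨a, d, hd, ?_⟩
  filter_upwards [tendsto_neg.eventually H, H, he] with P h1 h2 h3
  rw [h3, X_neg, Y_neg] at h1
  have : 2 * (d.eval (xc P) * h P) = 2 * a.eval (xc P) := by linear_combination h1 + h2
  exact mul_left_cancel₀ CharGood.two this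

lemma IsRat.odd {h : E.Pt → k} (hh : IsRat h) (he : ∀ᶠ P in Filter.cofinite, h (-P) = - h P) :
    ∃ a d : k[X], d ≠ 0 ∧ ∀ᶠ P in Filter.cofinite, d.eval (xc P) * h P = yc P * a.eval (xc P) := by
  obtain ⟨a, b, d, hd, H⟩ := hh
  refine ⟨b, d, hd, ?_⟩
  filter_upwards [tendsto_neg.eventually H, H, he] with P h1 h2 h3
  rw [h3, X_neg, Y_neg] at h1
  have : 2 * (d.eval (xc P) * h P) = 2 * (yc P * b.eval (xc P)) := by linear_combination h2 - h1
  exact mul_left_cancel₀ CharGood.two this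

/-- Rational maps between curves, as almost everywhere defined maps on points. -/
def IsRatPt (u : E.Pt → E'.Pt) : Prop :=
  (∀ᶠ P in Filter.cofinite, u P = 0) ∨
    ((∀ᶠ P in Filter.cofinite, u P ≠ 0) ∧ IsRat (fun P => xc (u P)) ∧ IsRat (fun P => yc (u P)))

lemma IsRatPt.congr {u v : E.Pt → E'.Pt} (hu : IsRatPt u)
    (e : ∀ᶠ P in Filter.cofinite, v P = u P) : IsRatPt v := by
  rcases hu with h | ⟨h1, h2, h3⟩
  · left; filter_upwards [h, e] with P h1 h2; rw [h2, h1]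
  · right
    exact ⟨by filter_upwards [h1, e] with P h1 h2; rwa [h2],
      h2.congr (by filter_upwards [e] with P h; rw [h]),
      h3.congr (by filter_upwards [e] with P h; rw [h])⟩

lemma IsRatPt.const (Q : E'.Pt) : IsRatPt (fun _ : E.Pt => Q) := by
  by_cases h : Q = 0
  · left; simp [h]
  · right; exact ⟨by simp [h], IsRat.const _, IsRat.const _⟩

lemma IsRatPt.id : IsRatPt (fun P : E.Pt => P) := Or.inr ⟨ev_ne 0, IsRat.x, IsRat.y⟩

lemma IsRatPt.neg {u : E.Pt → E'.Pt} (hu : IsRatPt u) : IsRatPt (fun P => - u P) := by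
  rcases hu with h | ⟨h1, h2, h3⟩
  · left; simpa using h
  · right; refine ⟨by simpa using h1, by simpa using h2, by simpa using h3.neg⟩

lemma IsRatPt.add {u v : E.Pt → E'.Pt} (hu : IsRatPt u) (hv : IsRatPt v) :
    IsRatPt (fun P => u P + v P) := by
  have hu0 := hu
  rcases hu with h | ⟨h1, h2, h3⟩
  · exact hv.congr (by filter_upwards [h] with P h; simp [h])
  rcases hv with h' | ⟨h1', h2', h3'⟩
  · exact hu0.congr (by filter_upwards [h'] with P h; simp [h])
  rcases (h2.sub h2').zero_or with hx | hx
  · rcases (h3.add h3').zero_or with hy | hy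
    · left
      filter_upwards [h1, h1', hx, hy] with P a b c d
      have : u P = - v P := pt_ext a (neg_ne_zero.2 b) (by rw [X_neg]; linear_combination c)
        (by rw [Y_neg]; linear_combination d)
      simp [this]
    · right
      have key : ∀ᶠ P in Filter.cofinite, v P = u P ∧ yc (u P) ≠ 0 := by
        filter_upwards [h1, h1', hx, hy] with P a b c d
        rcases eq_or_neg_of_X_eq a b (sub_eq_zero.1 c) with h | h
        · refine ⟨h.symm, fun h0 => d ?_⟩
          rw [← h, h0]; simp
        · exfalso; apply d; rw [h]; simp
      have hX : IsRat (fun P => ((3 * xc (u P) ^ 2 + E'.A) / (2 * yc (u P))) ^ 2 - 2 * xc (u P)) :=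
        (((((IsRat.const 3).mul (h2.pow 2)).add (IsRat.const _)).div
          ((IsRat.const 2).mul h3)).pow 2).sub ((IsRat.const 2).mul h2)
      have hX' : IsRat (fun P => xc (u P + v P)) := hX.congr (by
        filter_upwards [h1, key] with P a ⟨b, c⟩
        rw [b, (add_self a c).2.1])
      refine ⟨?_, hX', ?_⟩
      · filter_upwards [h1, key] with P a ⟨b, c⟩
        rw [b]; exact (add_self a c).1
      · refine (((((IsRat.const 3).mul (h2.pow 2)).add (IsRat.const E'.A)).div
          ((IsRat.const 2).mul h3)).mul (h2.sub hX')).sub h3 |>.congr ?_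
        filter_upwards [h1, key] with P a ⟨b, c⟩
        rw [b, (add_self a c).2.2]
  · right
    have hs : ∀ᶠ P in Filter.cofinite, xc (u P) ≠ xc (v P) := by
      filter_upwards [hx] with P h; exact sub_ne_zero.1 h
    have hX : IsRat (fun P => xc (u P + v P)) :=
      ((((h3.sub h3').div (h2.sub h2')).pow 2).sub h2).sub h2' |>.congr (by
        filter_upwards [h1, h1', hs] with P a b c
        rw [(add_chord a b c).2.1])
    refine ⟨?_, hX, ?_⟩
    · filter_upwards [h1, h1', hs] with P a b c
      exact (add_chord a b c).1
    · refine (((h3.sub h3').div (h2.sub h2')).mul (h2.sub hX)).sub h3 |>.congr ?_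
      filter_upwards [h1, h1', hs] with P a b c
      rw [(add_chord a b c).2.2]

lemma IsRatPt.sub {u v : E.Pt → E'.Pt} (hu : IsRatPt u) (hv : IsRatPt v) :
    IsRatPt (fun P => u P - v P) := by simpa [sub_eq_add_neg] using hu.add hv.neg

lemma IsRatPt.eq_or {u v : E.Pt → E'.Pt} (hu : IsRatPt u) (hv : IsRatPt v) :
    (∀ᶠ P in Filter.cofinite, u P = v P) ∨ (∀ᶠ P in Filter.cofinite, u P ≠ v P) := by
  rcases hu.sub hv with h | ⟨h, -⟩
  · left; filter_upwards [h] with P h; exact sub_eq_zero.1 h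
  · right; filter_upwards [h] with P h; exact sub_ne_zero.1 h

lemma IsRat.comp {u : E.Pt → E'.Pt} (hu : IsRatPt u)
    (ht : Filter.Tendsto u Filter.cofinite Filter.cofinite) {h : E'.Pt → k} (hh : IsRat h) :
    IsRat (fun P => h (u P)) := by
  rcases hu with h0 | ⟨h1, h2, h3⟩
  · exact (IsRat.const (h 0)).congr (by filter_upwards [h0] with P h; rw [h])
  obtain ⟨a, b, d, hd, H⟩ := hh
  refine (((h2.eval a).add ((h2.eval b).mul h3)).div (h2.eval d)).congr ?_
  filter_upwards [ht.eventually H, ht.eventually (ev_polyX_ne hd)] with P h1 h2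
  rw [eq_div_iff h2]
  linear_combination h1

lemma IsRatPt.comp {u : E.Pt → E'.Pt} (hu : IsRatPt u)
    (ht : Filter.Tendsto u Filter.cofinite Filter.cofinite) {v : E'.Pt → E''.Pt}
    (hv : IsRatPt v) : IsRatPt (fun P => v (u P)) := by
  rcases hv with h | ⟨h1, h2, h3⟩
  · exact Or.inl (ht.eventually h)
  · exact Or.inr ⟨ht.eventually h1, IsRat.comp hu ht h2, IsRat.comp hu ht h3⟩

lemma IsRatPt.trans (Q : E.Pt) : IsRatPt (fun P : E.Pt => P + Q) :=
  IsRatPt.id.add (IsRatPt.const Q)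

end Ell

namespace Ell
variable {k : Type*} [Field k] [IsAlgClosed k] [CharGood k] {E E' E'' : Ell k}

/-- The polynomial `(X - q)² (X(P+Q) - r)(X(P-Q) - r)` in `X = X(P)`, where `q = X(Q)`. -/
def Tp (E : Ell k) (q r : k) : k[X] :=
  (X - C q) ^ 2 * C (r ^ 2) - 2 * ((X + C q) * (X * C q + C E.A) + 2 * C E.B) * C r +
    ((X * C q - C E.A) ^ 2 - 4 * C E.B * (X + C q))

lemma Tp_eval_eq (E : Ell k) (q r x : k) : (E.Tp q r).eval x =
    (x - q) ^ 2 * r ^ 2 - 2 * ((x + q) * (x * q + E.A) + 2 * E.B) * r +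
    ((x * q - E.A) ^ 2 - 4 * E.B * (x + q)) := by
  simp [Tp]
  ring

lemma sum_X {P Q : E.Pt} (hP : P ≠ 0) (hQ : Q ≠ 0) (h : xc P ≠ xc Q) :
    (xc (P + Q) + xc (P - Q)) * (xc P - xc Q) ^ 2 =
      2 * ((xc P + xc Q) * (xc P * xc Q + E.A) + 2 * E.B) := by
  have h1 := eqn hP
  have h2 := eqn hQ
  rw [sub_eq_add_neg P Q, (add_chord hP hQ h).2.1,
    (add_chord hP (neg_ne_zero.2 hQ) (by simpa using h)).2.1]
  simp only [X_neg, Y_neg]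
  have hD : xc P - xc Q ≠ 0 := sub_ne_zero.2 h
  field_simp
  linear_combination 2 * h1 + 2 * h2

lemma prod_X {P Q : E.Pt} (hP : P ≠ 0) (hQ : Q ≠ 0) (h : xc P ≠ xc Q) :
    (xc (P + Q) * xc (P - Q)) * (xc P - xc Q) ^ 2 =
      (xc P * xc Q - E.A) ^ 2 - 4 * E.B * (xc P + xc Q) := by
  have h1 := eqn hP
  have h2 := eqn hQ
  rw [sub_eq_add_neg P Q, (add_chord hP hQ h).2.1,
    (add_chord hP (neg_ne_zero.2 hQ) (by simpa using h)).2.1]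
  simp only [X_neg, Y_neg]
  have hD : xc P - xc Q ≠ 0 := sub_ne_zero.2 h
  have e : ((yc P - yc Q) / (xc P - xc Q)) ^ 2 - xc P - xc Q =
      ((yc P - yc Q) ^ 2 - (xc P + xc Q) * (xc P - xc Q) ^ 2) / (xc P - xc Q) ^ 2 := by
    field_simp
    ring
  have e' : ((yc P - -yc Q) / (xc P - xc Q)) ^ 2 - xc P - xc Q =
      ((yc P + yc Q) ^ 2 - (xc P + xc Q) * (xc P - xc Q) ^ 2) / (xc P - xc Q) ^ 2 := by
    field_simp
    ring
  rw [e, e']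
  have : ((yc P - yc Q) ^ 2 - (xc P + xc Q) * (xc P - xc Q) ^ 2) *
      ((yc P + yc Q) ^ 2 - (xc P + xc Q) * (xc P - xc Q) ^ 2) =
      ((xc P * xc Q - E.A) ^ 2 - 4 * E.B * (xc P + xc Q)) * (xc P - xc Q) ^ 2 := by
    have e3 : ((yc P - yc Q) ^ 2 - (xc P + xc Q) * (xc P - xc Q) ^ 2) *
      ((yc P + yc Q) ^ 2 - (xc P + xc Q) * (xc P - xc Q) ^ 2) =
      (yc P ^ 2 - yc Q ^ 2) ^ 2 - 2 * (xc P + xc Q) * (xc P - xc Q) ^ 2 * (yc P ^ 2 + yc Q ^ 2)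
        + ((xc P + xc Q) * (xc P - xc Q) ^ 2) ^ 2 := by ring
    rw [e3, h1, h2]; ring
  field_simp
  linear_combination this

lemma Tp_eval {P Q : E.Pt} (hP : P ≠ 0) (hQ : Q ≠ 0) (h : xc P ≠ xc Q) (r : k) :
    (E.Tp (xc Q) r).eval (xc P) =
      (xc (P + Q) - r) * (xc (P - Q) - r) * (xc P - xc Q) ^ 2 := by
  rw [Tp_eval_eq]
  linear_combination r * sum_X hP hQ h - prod_X hP hQ h

lemma Tp_natDegree_le (q r : k) : (E.Tp q r).natDegree ≤ 2 := by
  unfold Tp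
  compute_degree

lemma Tp_coeff (q r : k) : (E.Tp q r).coeff 2 = (r - q) ^ 2 := by
  have : E.Tp q r = C ((r - q) ^ 2) * X ^ 2 +
      C (-2 * q * r ^ 2 - 2 * (q ^ 2 + E.A) * r - 2 * q * E.A - 4 * E.B) * X ^ 1
      + C (q ^ 2 * r ^ 2 - 2 * (q * E.A + 2 * E.B) * r + E.A ^ 2 - 4 * E.B * q) := by
    simp only [Tp, map_add, map_sub, map_mul, map_pow, map_ofNat, map_neg]
    ring
  rw [this]
  generalize -2 * q * r ^ 2 - 2 * (q ^ 2 + E.A) * r - 2 * q * E.A - 4 * E.B = b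
  generalize q ^ 2 * r ^ 2 - 2 * (q * E.A + 2 * E.B) * r + E.A ^ 2 - 4 * E.B * q = c
  generalize (r - q) ^ 2 = a
  simp

lemma Tp_natDegree {q r : k} (h : r ≠ q) : (E.Tp q r).natDegree = 2 :=
  natDegree_eq_of_le_of_coeff_ne_zero (Tp_natDegree_le q r)
    (by rw [Tp_coeff]; exact pow_ne_zero _ (sub_ne_zero.2 h))

/-- The polynomial `(X - q)^(2 deg G) G(X(P+Q)) G(X(P-Q))` in `X = X(P)`. -/
def TT (E : Ell k) (q : k) (G : k[X]) : k[X] :=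
  C (G.leadingCoeff ^ 2) * (G.roots.map fun r => E.Tp q r).prod

lemma card_roots_closed (G : k[X]) : Multiset.card G.roots = G.natDegree :=
  ((IsAlgClosed.splits G).natDegree_eq_card_roots).symm

lemma TT_eval {P Q : E.Pt} (hP : P ≠ 0) (hQ : Q ≠ 0) (h : xc P ≠ xc Q) (G : k[X]) :
    (E.TT (xc Q) G).eval (xc P) = G.eval (xc (P + Q)) * G.eval (xc (P - Q)) *
      ((xc P - xc Q) ^ 2) ^ G.natDegree := by
  have h1 := fun x => (IsAlgClosed.splits G).eval_eq_prod_roots x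
  rw [h1, h1, TT, ← card_roots_closed G]
  simp only [eval_mul, eval_C, eval_multiset_prod, Multiset.map_map, Function.comp_def]
  rw [Multiset.map_congr rfl fun r _ => Tp_eval hP hQ h r]
  simp only [Multiset.prod_map_mul, Multiset.map_const', Multiset.prod_replicate]
  ring

lemma TT_natDegree_le (q : k) (G : k[X]) : (E.TT q G).natDegree ≤ 2 * G.natDegree := by
  refine (natDegree_C_mul_le _ _).trans ?_
  refine (natDegree_multiset_prod_le _).trans ?_
  rw [← card_roots_closed G, Multiset.map_map]
  refine (Multiset.sum_le_card_nsmul _ 2 ?_).trans ?_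
  · simp only [Multiset.mem_map]
    rintro _ ⟨r, _, rfl⟩
    exact Tp_natDegree_le q r
  · simp [mul_comm]

lemma TT_natDegree {q : k} {G : k[X]} (hG : G.eval q ≠ 0) :
    (E.TT q G).natDegree = 2 * G.natDegree ∧ E.TT q G ≠ 0 := by
  have hG0 : G ≠ 0 := by rintro rfl; simp at hG
  have hr : ∀ r ∈ G.roots, r ≠ q := by
    rintro r hr rfl
    exact hG (by simpa [hG0] using hr)
  have hne : (0 : k[X]) ∉ G.roots.map fun r => E.Tp q r := by
    simp only [Multiset.mem_map, not_exists, not_and]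
    intro r h h0
    have := Tp_natDegree (E := E) (hr r h)
    rw [h0] at this
    simp at this
  have hlc : G.leadingCoeff ^ 2 ≠ 0 := pow_ne_zero _ (leadingCoeff_ne_zero.2 hG0)
  constructor
  · rw [TT, natDegree_C_mul hlc, natDegree_multiset_prod _ hne, Multiset.map_map,
      Multiset.map_congr rfl (f := natDegree ∘ fun r => E.Tp q r) (g := fun _ => 2)
        (fun r h => Tp_natDegree (E := E) (hr r h)),
      ← card_roots_closed G]
    simp [mul_comm]
  · exact mul_ne_zero (C_ne_zero.2 hlc) (Multiset.prod_ne_zero hne)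

/-- The map `φ` is given on `X`-coordinates, almost everywhere, by `U / V`, which has a pole
at infinity. -/
structure AeR (φ : E.Pt → E'.Pt) (U V : k[X]) : Prop where
  cop : IsCoprime U V
  deg : V.natDegree < U.natDegree
  nz : V ≠ 0
  ev : ∀ᶠ P in Filter.cofinite, V.eval (xc P) ≠ 0 ∧ φ P ≠ 0 ∧
    xc (φ P) = U.eval (xc P) / V.eval (xc P)

lemma AeR.not_both {φ : E.Pt → E'.Pt} {U V : k[X]} (h : AeR φ U V) {q : k}
    (h1 : U.eval q = 0) : V.eval q ≠ 0 := by
  intro h2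
  obtain ⟨a, b, hab⟩ := h.cop
  have := congrArg (eval q) hab
  simp [h1, h2] at this

lemma ev_sub {p : E.Pt → Prop} (Q : E.Pt) (h : ∀ᶠ P in Filter.cofinite, p P) :
    ∀ᶠ P in Filter.cofinite, p (P - Q) := by
  simpa [sub_eq_add_neg] using (tendsto_add (-Q)).eventually h

lemma natDegree_sub_C_mul {U V : k[X]} (h : V.natDegree < U.natDegree) (w : k) :
    (U - C w * V).natDegree = U.natDegree :=
  natDegree_sub_eq_left_of_natDegree_lt ((natDegree_C_mul_le _ _).trans_lt h)

lemma AeR.translate {φ : E.Pt → E'.Pt} {U V : k[X]} (H : AeR φ U V) {Q : E.Pt} (hQ : Q ≠ 0)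
    {c : E'.Pt} (hc : ∀ᶠ P in Filter.cofinite, φ (P + Q) = φ P + c ∧ φ (P - Q) = φ P - c) :
    (c = 0 ∧ V.eval (xc Q) = 0) ∨
    (c ≠ 0 ∧ V.eval (xc Q) ≠ 0 ∧ xc c = U.eval (xc Q) / V.eval (xc Q)) := by
  have hdeg := H.deg
  have hV := H.nz
  have hU : U ≠ 0 := by rintro rfl; simp at hdeg
  set n := U.natDegree with hn
  set m := V.natDegree with hm
  by_cases h0 : c = 0
  · left
    refine ⟨h0, ?_⟩
    by_contra hq
    have key : E.TT (xc Q) U * V ^ 2 =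
        E.TT (xc Q) V * ((X - C (xc Q)) ^ 2) ^ (n - m) * U ^ 2 := by
      refine poly_eq_of_evX (E := E) ?_
      filter_upwards [H.ev, (tendsto_add Q).eventually H.ev, ev_sub Q H.ev, hc, ev_ne 0,
        ev_ne Q, ev_ne (-Q)] with P ⟨a1, _, a3⟩ ⟨b1, _, b3⟩ ⟨c1, _, c3⟩ ⟨d1, d2⟩ e1 e2 e3
      have hx : xc P ≠ xc Q := fun h => by
        rcases eq_or_neg_of_X_eq e1 hQ h with h | h
        exacts [e2 h, e3 h]
      simp only [eval_mul, eval_pow, eval_sub, eval_X, eval_C]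
      rw [TT_eval e1 hQ hx, TT_eval e1 hQ hx, ← hn, ← hm]
      have hnm : ((xc P - xc Q) ^ 2) ^ n =
        ((xc P - xc Q) ^ 2) ^ m * ((xc P - xc Q) ^ 2) ^ (n - m) := by
        rw [← pow_add]; congr 1; omega
      rw [hnm]
      rw [d1, h0, add_zero, a3, div_eq_div_iff a1 b1] at b3
      rw [d2, h0, sub_zero, a3, div_eq_div_iff a1 c1] at c3
      linear_combination (-(eval (xc (P - Q)) U) * eval (xc P) V * b3
        - eval (xc P) U * eval (xc (P + Q)) V * c3) *
        ((xc P - xc Q) ^ 2) ^ m * ((xc P - xc Q) ^ 2) ^ (n - m)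
    obtain ⟨h1, h2⟩ := TT_natDegree (E := E) hq
    have := congrArg natDegree key
    rw [natDegree_mul (mul_ne_zero h2 (pow_ne_zero _ (pow_ne_zero _ (X_sub_C_ne_zero _))))
      (pow_ne_zero _ hU), natDegree_mul h2 (pow_ne_zero _ (pow_ne_zero _ (X_sub_C_ne_zero _))),
      natDegree_pow, natDegree_pow, natDegree_pow, natDegree_X_sub_C, h1] at this
    have h3 : (E.TT (xc Q) U * V ^ 2).natDegree ≤ 2 * n + 2 * m := by
      refine natDegree_mul_le.trans (add_le_add (TT_natDegree_le _ _) ?_)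
      rw [natDegree_pow]
    omega
  · right
    refine ⟨h0, ?_⟩
    set w := xc c with hw
    set G := U - C w * V with hG
    have hGn : G.natDegree = n := natDegree_sub_C_mul hdeg w
    have hG0 : G ≠ 0 := by intro h; rw [h] at hGn; simp at hGn; omega
    suffices hq : G.eval (xc Q) = 0 by
      have hVq : V.eval (xc Q) ≠ 0 := by
        intro h
        apply H.not_both (q := xc Q) _ h
        simpa [hG, h] using hq
      refine ⟨hVq, ?_⟩
      rw [eq_div_iff hVq]
      simp only [hG, eval_sub, eval_mul, eval_C] at hq
      linear_combination -hq
    by_contra hq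
    set L : k[X] := C (-2 * w * w ^ 2 - 2 * (w ^ 2 + E'.A) * w - 2 * w * E'.A - 4 * E'.B) * U
      + C (w ^ 2 * w ^ 2 - 2 * (w * E'.A + 2 * E'.B) * w + E'.A ^ 2 - 4 * E'.B * w) * V with hL
    have hL' : ∀ x, V.eval x ≠ 0 → L.eval x = V.eval x * (E'.Tp w w).eval (U.eval x / V.eval x) := by
      intro x hx
      rw [Tp_eval_eq]
      simp only [hL, eval_add, eval_mul, eval_C]
      field_simp
      ring
    have key : E.TT (xc Q) G * G ^ 2 =
        E.TT (xc Q) V * ((X - C (xc Q)) ^ 2) ^ (n - m) * (V * L) := by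
      refine poly_eq_of_evX (E := E) ?_
      filter_upwards [H.ev, (tendsto_add Q).eventually H.ev, ev_sub Q H.ev, hc, ev_ne 0,
        ev_ne Q, ev_ne (-Q), ev_polyX_ne hG0] with P ⟨a1, a2, a3⟩ ⟨b1, _, b3⟩ ⟨c1, _, c3⟩ ⟨d1, d2⟩
          e1 e2 e3 e4
      have hx : xc P ≠ xc Q := fun h => by
        rcases eq_or_neg_of_X_eq e1 hQ h with h | h
        exacts [e2 h, e3 h]
      have hx' : xc (φ P) ≠ xc c := by
        rw [a3]
        intro h
        apply e4
        rw [div_eq_iff a1] at h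
        simp only [hG, eval_sub, eval_mul, eval_C, h, ← hw]
        ring
      simp only [eval_mul, eval_pow, eval_sub, eval_X, eval_C]
      rw [TT_eval e1 hQ hx, TT_eval e1 hQ hx, hGn, ← hm, hL' _ a1, ← a3, hw, Tp_eval a2 h0 hx',
        ← d1, ← d2, a3, b3, c3]
      have hnm : ((xc P - xc Q) ^ 2) ^ n =
        ((xc P - xc Q) ^ 2) ^ m * ((xc P - xc Q) ^ 2) ^ (n - m) := by
        rw [← pow_add]; congr 1; omega
      rw [hnm]
      simp only [hG, eval_sub, eval_mul, eval_C, ← hw]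
      field_simp
    obtain ⟨h1, h2⟩ := TT_natDegree (E := E) hq
    have := congrArg natDegree key
    rw [natDegree_mul h2 (pow_ne_zero _ hG0), natDegree_pow, h1, hGn] at this
    have h3 : (E.TT (xc Q) V * ((X - C (xc Q)) ^ 2) ^ (n - m) * (V * L)).natDegree ≤
        2 * m + (n - m) * (2 * 1) + (m + n) := by
      refine natDegree_mul_le.trans (add_le_add (natDegree_mul_le.trans
        (add_le_add (TT_natDegree_le _ _) ?_)) (natDegree_mul_le.trans (add_le_add le_rfl ?_)))
      · rw [natDegree_pow, natDegree_pow, natDegree_X_sub_C]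
      · refine (natDegree_add_le _ _).trans (max_le ((natDegree_C_mul_le _ _)) ?_)
        exact (natDegree_C_mul_le _ _).trans hdeg.le
    omega

/-- The map `φ` is given on `X`-coordinates by `U / V`, which has a pole at infinity. -/
structure HasR (φ : E.Pt → E'.Pt) (U V : k[X]) : Prop extends AeR φ U V where
  all : ∀ P, P ≠ 0 → (φ P = 0 ∧ V.eval (xc P) = 0) ∨
    (φ P ≠ 0 ∧ V.eval (xc P) ≠ 0 ∧ xc (φ P) = U.eval (xc P) / V.eval (xc P))

lemma AeR.hasR {φ : E.Pt →+ E'.Pt} {U V : k[X]} (H : AeR φ U V) : HasR φ U V :=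
  ⟨H, fun P hP => H.translate hP (by simp)⟩

end Ell

namespace Ell
variable {k : Type*} [Field k] [IsAlgClosed k] [CharGood k] {E E' E'' : Ell k}

lemma exists_coprime (a d : k[X]) (hd : d ≠ 0) :
    ∃ U V g, a = g * U ∧ d = g * V ∧ IsCoprime U V ∧ g ≠ 0 := by
  obtain ⟨U, hU⟩ := EuclideanDomain.gcd_dvd_left a d
  obtain ⟨V, hV⟩ := EuclideanDomain.gcd_dvd_right a d
  have hg : EuclideanDomain.gcd a d ≠ 0 := fun h => hd (EuclideanDomain.gcd_eq_zero_iff.1 h).2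
  have hb := EuclideanDomain.gcd_eq_gcd_ab a d
  refine ⟨U, V, EuclideanDomain.gcd a d, hU, hV, ?_, hg⟩
  generalize EuclideanDomain.gcdA a d = r at hb
  generalize EuclideanDomain.gcdB a d = s at hb
  generalize EuclideanDomain.gcd a d = g at *
  refine ⟨r, s, mul_left_cancel₀ hg ?_⟩
  calc g * (r * U + s * V) = (g * U) * r + (g * V) * s := by ring
    _ = g * 1 := by rw [← hU, ← hV, ← hb, mul_one]

lemma cop_eval {U V : k[X]} (h : IsCoprime U V) {q : k} (h1 : U.eval q = 0) : V.eval q ≠ 0 := by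
  intro h2
  obtain ⟨a, b, hab⟩ := h
  have := congrArg (Polynomial.eval q) hab
  simp [h1, h2] at this

lemma isCoprime_of_eval {U V : k[X]} (h : ∀ q, U.eval q = 0 → V.eval q ≠ 0) : IsCoprime U V := by
  rw [Polynomial.isCoprime_iff_aeval_ne_zero_of_isAlgClosed k k]
  intro a
  by_cases ha : U.eval a = 0
  · right; simpa [Polynomial.coe_aeval_eq_eval] using h a ha
  · left; simpa [Polynomial.coe_aeval_eq_eval] using ha

section hom
variable {φ ψ : E.Pt →+ E'.Pt}

lemma ev_add_both {p : E.Pt → Prop} (Q : E.Pt) (h : ∀ᶠ P in Filter.cofinite, p P) :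
    ∃ P, p P ∧ p (P + Q) := (h.and ((tendsto_add Q).eventually h)).exists

lemma hom_ev_ne (hφ : IsRatPt φ) (h : φ ≠ 0) : ∀ᶠ P in Filter.cofinite, φ P ≠ 0 := by
  rcases hφ with h0 | ⟨h0, _⟩
  · exfalso
    apply h
    ext Q
    obtain ⟨P, h1, h2⟩ := ev_add_both Q h0
    simpa [h1] using h2
  · exact h0

lemma hom_eq_of_ev (h : ∀ᶠ P in Filter.cofinite, φ P = ψ P) : φ = ψ := by
  ext Q
  obtain ⟨P, h1, h2⟩ := ev_add_both Q h
  simpa [h1] using h2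

lemma hom_finite_ker (hφ : IsRatPt φ) (h : φ ≠ 0) : {P | φ P = 0}.Finite := by
  simpa [Filter.eventually_cofinite] using hom_ev_ne hφ h

lemma hom_tendsto (hφ : IsRatPt φ) (h : φ ≠ 0) :
    Filter.Tendsto φ Filter.cofinite Filter.cofinite := by
  refine Filter.Tendsto.cofinite_of_finite_preimage_singleton fun R => ?_
  by_cases hR : ∃ P0, φ P0 = R
  · obtain ⟨P0, rfl⟩ := hR
    refine ((hom_finite_ker hφ h).image (fun P => P + P0)).subset fun P hP => ?_
    refine ⟨P - P0, ?_, by simp⟩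
    have : φ P = φ P0 := hP
    simp [this]
  · suffices φ ⁻¹' {R} = ∅ by rw [this]; exact Set.finite_empty
    refine Set.eq_empty_of_forall_notMem fun P => ?_
    simp only [Set.mem_preimage, Set.mem_singleton_iff]
    exact fun h => hR ⟨P, h⟩

lemma rat_reduced {u : E.Pt → E'.Pt} (hu : IsRatPt u) (h0 : ∀ᶠ P in Filter.cofinite, u P ≠ 0)
    (he : ∀ P, u (-P) = - u P) : ∃ U V : k[X], V ≠ 0 ∧ IsCoprime U V ∧
      ∀ᶠ P in Filter.cofinite, V.eval (xc P) ≠ 0 ∧ u P ≠ 0 ∧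
        xc (u P) = U.eval (xc P) / V.eval (xc P) := by
  rcases hu with h | ⟨h1, hx, hy⟩
  · obtain ⟨P, h1, h2⟩ := (h.and h0).exists
    exact absurd h1 h2
  obtain ⟨a, d, hd, H⟩ := hx.even (by simp [he])
  obtain ⟨U, V, g, rfl, rfl, hc, hg⟩ := exists_coprime a d hd
  have hV : V ≠ 0 := right_ne_zero_of_mul hd
  refine ⟨U, V, hV, hc, ?_⟩
  filter_upwards [H, h1, ev_polyX_ne hV, ev_polyX_ne hg] with P H h1 h2 h3
  refine ⟨h2, h1, ?_⟩
  rw [eq_div_iff h2]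
  apply mul_left_cancel₀ h3
  simp only [eval_mul] at H
  linear_combination H

lemma coeff_mul_top {a b : k[X]} {m n : ℕ} (ha : a.natDegree ≤ m) (hb : b.natDegree ≤ n) :
    (a * b).coeff (m + n) = a.coeff m * b.coeff n := coeff_mul_add_eq_of_natDegree_le ha hb

lemma two_tors {w : k} (h : w ^ 3 + E.A * w + E.B = 0) : ∃ Z : E.Pt, Z ≠ 0 ∧ xc Z = w ∧
    yc Z = 0 ∧ Z + Z = 0 ∧ 3 * w ^ 2 + E.A ≠ 0 ∧ ∀ P : E.Pt, P ≠ 0 → xc P ≠ w →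
      P + Z ≠ 0 ∧ xc (P + Z) = w + (3 * w ^ 2 + E.A) / (xc P - w) := by
  obtain ⟨Z, h1, h2, h3⟩ := exists_pt (E := E) (x := w) (y := 0) (by rw [h]; ring)
  refine ⟨Z, h1, h2, h3, Y_eq_zero_iff.1 h3, ?_, ?_⟩
  · intro h4
    apply E.disc
    have hA : E.A = -3 * w ^ 2 := by linear_combination h4
    have hB : E.B = 2 * w ^ 3 := by linear_combination h - w * h4
    rw [hA, hB]; ring
  · intro P hP hw
    have hx : xc P ≠ xc Z := by rwa [h2]
    obtain ⟨a1, a2, -⟩ := add_chord hP h1 hx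
    refine ⟨a1, ?_⟩
    rw [a2, h2, h3]
    have := eqn hP
    have hd := sub_ne_zero.2 hw
    field_simp
    linear_combination this + h

lemma exists_AeR (hφ : IsRatPt φ) (h : φ ≠ 0) : ∃ U V, AeR φ U V := by
  have h0 := hom_ev_ne hφ h
  obtain ⟨U, V, hV, hc, H⟩ := rat_reduced hφ h0 (by simp)
  refine ⟨U, V, hc, ?_, hV, H⟩
  by_contra hdeg
  push Not at hdeg
  set m := V.natDegree with hm
  set v := V.leadingCoeff with hv
  have hv0 : v ≠ 0 := leadingCoeff_ne_zero.2 hV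
  have hvm : V.coeff m = v := rfl
  set w := U.coeff m / v with hw
  have hum : U.coeff m = w * v := by rw [hw]; field_simp
  -- the limit is a `2`-torsion point
  have hroot : w ^ 3 + E'.A * w + E'.B = 0 := by
    by_contra hne
    obtain ⟨h1, hx, hy⟩ := hφ.resolve_left fun h => by
      obtain ⟨P, h1, h2⟩ := (h.and h0).exists
      exact absurd h1 h2
    obtain ⟨a, d, hd, Hy⟩ := hy.odd (by simp)
    have key : E.f * (a ^ 2 * V ^ 3) =
        d ^ 2 * (U ^ 3 + C E'.A * U * V ^ 2 + C E'.B * V ^ 3) := by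
      apply poly_eq_of_evX (E := E)
      filter_upwards [H, Hy, ev_ne 0] with P ⟨h1, h2, h3⟩ h4 h5
      have e1 := eqn h2
      have e2 := eqn' h5
      rw [h3] at e1
      field_simp at e1
      simp only [eval_mul, eval_pow, eval_add, eval_C]
      rw [← e2]
      calc _ = (yc P * eval (xc P) a) ^ 2 * eval (xc P) V ^ 3 := by ring
        _ = _ := by rw [← h4]; linear_combination (eval (xc P) d) ^ 2 * e1
    set S := U ^ 3 + C E'.A * U * V ^ 2 + C E'.B * V ^ 3 with hS
    have hSc : S.coeff (m + m + m) = v ^ 3 * (w ^ 3 + E'.A * w + E'.B) := by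
      have e : ∀ a b c : k[X], a.natDegree ≤ m → b.natDegree ≤ m → c.natDegree ≤ m →
          (a * b * c).coeff (m + m + m) = a.coeff m * b.coeff m * c.coeff m := by
        intro a b c ha hb hc
        rw [coeff_mul_top ((natDegree_mul_le).trans (add_le_add ha hb)) hc, coeff_mul_top ha hb]
      have : S = U * U * U + C E'.A * (U * V * V) + C E'.B * (V * V * V) := by rw [hS]; ring
      rw [this, coeff_add, coeff_add, coeff_C_mul, coeff_C_mul, e _ _ _ hdeg hdeg hdeg,
        e _ _ _ hdeg le_rfl le_rfl, e _ _ _ le_rfl le_rfl le_rfl, hum, hvm]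
      ring
    have hSd : S.natDegree = m + m + m := by
      apply natDegree_eq_of_le_of_coeff_ne_zero
      · rw [hS]
        refine (natDegree_add_le_of_degree_le (natDegree_add_le_of_degree_le ?_ ?_) ?_)
        · exact natDegree_pow_le.trans (by linarith)
        · refine natDegree_mul_le.trans ?_
          have := natDegree_C_mul_le E'.A U
          have := natDegree_pow_le (p := V) (n := 2)
          omega
        · refine (natDegree_C_mul_le _ _).trans (natDegree_pow_le.trans (by linarith))
      · rw [hSc]; exact mul_ne_zero (pow_ne_zero _ hv0) hne
    have hS0 : S ≠ 0 := by
      intro h; apply mul_ne_zero (pow_ne_zero 3 hv0) hne; rw [← hSc, h, coeff_zero]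
    have ha : a ≠ 0 := by
      rintro rfl
      simp only [ne_eq, OfNat.ofNat_ne_zero, not_false_eq_true, zero_pow, zero_mul, mul_zero] at key
      exact mul_ne_zero (pow_ne_zero 2 hd) hS0 key.symm
    have := congrArg natDegree key
    rw [natDegree_mul E.f_ne (mul_ne_zero (pow_ne_zero _ ha) (pow_ne_zero _ hV)),
      natDegree_mul (pow_ne_zero _ ha) (pow_ne_zero _ hV), natDegree_mul (pow_ne_zero _ hd) hS0,
      natDegree_pow, natDegree_pow, natDegree_pow, hSd, f_natDegree] at this
    omega
  obtain ⟨Z, hZ0, hZx, hZy, hZZ, hκ, hadd⟩ := two_tors hroot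
  set κ := 3 * w ^ 2 + E'.A with hκd
  have hno : ¬ ∀ᶠ P in Filter.cofinite, φ P + φ P = Z := by
    intro h
    obtain ⟨Q, hQ⟩ := h.exists
    obtain ⟨P, h1, h2⟩ := ev_add_both Q h
    apply hZ0
    have : φ (P + Q) + φ (P + Q) = (φ P + φ P) + (φ Q + φ Q) := by rw [map_add]; abel
    rw [h2, h1, hQ, hZZ] at this
    exact this
  set V' := U - C w * V with hV'
  by_cases hV'0 : V' = 0
  · have : ∀ᶠ P in Filter.cofinite, φ P = Z := by
      filter_upwards [H] with P ⟨h1, h2, h3⟩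
      have : U = C w * V := sub_eq_zero.1 hV'0
      have hx : xc (φ P) = xc Z := by rw [h3, hZx, this]; simp [h1]
      rcases eq_or_neg_of_X_eq h2 hZ0 hx with h | h
      · exact h
      · rw [h]; exact neg_eq_of_add_eq_zero_left hZZ
    obtain ⟨Q, hQ⟩ := this.exists
    obtain ⟨P, h1, h2⟩ := ev_add_both Q this
    rw [map_add, h1, hQ] at h2
    exact hZ0 (by simpa using h2)
  set U' := C w * V' + C κ * V with hU'
  have hVd : V'.natDegree < m ∨ (m = 0 ∧ V'.natDegree = 0) := by
    have h1 : V'.natDegree ≤ m :=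
      (natDegree_sub_le _ _).trans (max_le hdeg (natDegree_C_mul_le _ _))
    have h2 : V'.coeff m = 0 := by rw [hV', coeff_sub, coeff_C_mul, hum, hvm, sub_self]
    rcases h1.lt_or_eq with h3 | h3
    · exact Or.inl h3
    · exfalso
      rw [← h3] at h2
      exact hV'0 (leadingCoeff_eq_zero.1 h2)
  have hm0 : m ≠ 0 := by
    intro h3
    have h1 : V'.natDegree ≤ m :=
      (natDegree_sub_le _ _).trans (max_le hdeg (natDegree_C_mul_le _ _))
    have h2 : V'.coeff m = 0 := by rw [hV', coeff_sub, coeff_C_mul, hum, hvm, sub_self]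
    have h4 : V'.natDegree = m := by omega
    rw [← h4] at h2
    exact hV'0 (leadingCoeff_eq_zero.1 h2)
  have hVd' : V'.natDegree < m := by omega
  have hκV : (C κ * V).natDegree = m := natDegree_C_mul hκ
  have hUd : U'.natDegree = m := by
    rw [hU', natDegree_add_eq_right_of_natDegree_lt, hκV]
    rw [hκV]; exact (natDegree_C_mul_le _ _).trans_lt hVd'
  have hA : AeR (fun P => φ P + Z) U' V' := by
    refine ⟨?_, by omega, hV'0, ?_⟩
    · have h1 : IsCoprime V V' := by
        rw [hV', sub_eq_add_neg, ← neg_mul]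
        exact IsCoprime.add_mul_right_right hc.symm _
      have h2 : IsCoprime (C κ * V) V' :=
        (isCoprime_mul_unit_left_left (isUnit_C.2 hκ.isUnit) V V').2 h1
      rw [hU', add_comm]
      exact IsCoprime.add_mul_right_left h2 _
    · filter_upwards [H, ev_polyX_ne hV'0] with P ⟨h1, h2, h3⟩ h4
      have h5 : xc (φ P) - w = V'.eval (xc P) / V.eval (xc P) := by
        rw [h3, hV']; simp; field_simp
      have h6 : xc (φ P) ≠ w := by
        rw [← sub_ne_zero, h5]; exact div_ne_zero h4 h1
      obtain ⟨h7, h8⟩ := hadd _ h2 h6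
      refine ⟨h4, h7, ?_⟩
      rw [h8, h5, hU']
      simp only [eval_add, eval_mul, eval_C]
      field_simp
  apply hno
  filter_upwards [hA.ev, ev_ne 0] with Q ⟨h1, h2, h3⟩ hQ
  rcases hA.translate hQ (c := φ Q) (by
    refine Filter.Eventually.of_forall fun P => ⟨?_, ?_⟩
    · simp only [map_add]; abel
    · simp only [map_sub]; abel) with h4 | ⟨h4, _, h5⟩
  · exact absurd h4.2 h1
  · rcases eq_or_neg_of_X_eq h2 h4 (by rw [h3, h5]) with h6 | h6
    · exact absurd (add_eq_left.1 h6) hZ0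
    · have hZn : -Z = Z := neg_eq_of_add_eq_zero_left hZZ
      rw [← hZn]
      apply eq_neg_of_add_eq_zero_left
      calc φ Q + φ Q + Z = (φ Q + Z) + φ Q := by abel
        _ = 0 := by rw [h6]; abel

end hom
end Ell

namespace Ell
variable {k : Type*} [Field k] [IsAlgClosed k] [CharGood k] {E E' E'' : Ell k}

/-- The homogenisation `V ^ n * F(U / V)`. -/
def hc (F : k[X]) (n : ℕ) (U V : k[X]) : k[X] :=
  ∑ i ∈ range (n + 1), C (F.coeff i) * (U ^ i * V ^ (n - i))

lemma hc_eval {F : k[X]} {n : ℕ} (hF : F.natDegree ≤ n) {U V : k[X]} {x : k}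
    (hx : V.eval x ≠ 0) : (hc F n U V).eval x = V.eval x ^ n * F.eval (U.eval x / V.eval x) := by
  rw [hc, eval_finsetSum, eval_eq_sum_range' (Nat.lt_succ_of_le hF), mul_sum]
  refine sum_congr rfl fun i hi => ?_
  have hi' : i ≤ n := Nat.lt_succ_iff.1 (mem_range.1 hi)
  simp only [eval_mul, eval_C, eval_pow]
  rw [div_pow]
  obtain ⟨j, rfl⟩ := Nat.exists_eq_add_of_le hi'
  rw [Nat.add_sub_cancel_left, pow_add]
  field_simp

lemma hc_eval_zero {F : k[X]} {n : ℕ} {U V : k[X]} {x : k}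
    (hx : V.eval x = 0) : (hc F n U V).eval x = F.coeff n * U.eval x ^ n := by
  rw [hc, eval_finsetSum, sum_range_succ, sum_eq_zero]
  · simp
  · intro i hi
    have : n - i ≠ 0 := by have := mem_range.1 hi; omega
    simp [hx, this]

lemma hc_natDegree_le {F : k[X]} {n : ℕ} {U V : k[X]} (h : V.natDegree ≤ U.natDegree) :
    (hc F n U V).natDegree ≤ n * U.natDegree := by
  refine natDegree_sum_le_of_forall_le _ _ fun i hi => ?_
  have hi' : i ≤ n := Nat.lt_succ_iff.1 (mem_range.1 hi)
  refine (natDegree_C_mul_le _ _).trans (natDegree_mul_le.trans ?_)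
  obtain ⟨j, rfl⟩ := Nat.exists_eq_add_of_le hi'
  rw [Nat.add_sub_cancel_left, add_mul]
  exact add_le_add natDegree_pow_le (natDegree_pow_le.trans (Nat.mul_le_mul_left _ h))

lemma hc_coeff {F : k[X]} {n : ℕ} {U V : k[X]} (h : V.natDegree < U.natDegree) :
    (hc F n U V).coeff (n * U.natDegree) = F.coeff n * U.leadingCoeff ^ n := by
  rw [hc, finsetSum_coeff, sum_range_succ, sum_eq_zero]
  · simp [coeff_pow_mul_natDegree]
  · intro i hi
    have hi' : i < n := mem_range.1 hi
    rw [coeff_C_mul]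
    refine mul_eq_zero_of_right _ (coeff_eq_zero_of_natDegree_lt ?_)
    refine natDegree_mul_le.trans_lt ?_
    obtain ⟨j, rfl⟩ := Nat.exists_eq_add_of_le hi'
    have : i.succ + j - i = j + 1 := by omega
    rw [this]
    calc _ ≤ i * U.natDegree + (j + 1) * V.natDegree := add_le_add natDegree_pow_le natDegree_pow_le
      _ < i * U.natDegree + (j + 1) * U.natDegree := by
        have := Nat.mul_lt_mul_of_pos_left h (Nat.succ_pos j); simpa using this
      _ = _ := by rw [Nat.succ_eq_add_one]; ring

lemma AeR.comp {φ : E.Pt → E'.Pt} {ψ : E'.Pt → E''.Pt} {U V U' V' : k[X]}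
    (hφ : AeR φ U V) (hψ : AeR ψ U' V')
    (ht : Filter.Tendsto φ Filter.cofinite Filter.cofinite) :
    AeR (fun P => ψ (φ P)) (hc U' U'.natDegree U V) (hc V' U'.natDegree U V) ∧
      (hc U' U'.natDegree U V).natDegree = U'.natDegree * U.natDegree := by
  have hd := hφ.deg
  have hd' := hψ.deg
  have hU : U.leadingCoeff ≠ 0 := leadingCoeff_ne_zero.2 (by rintro rfl; simp at hd)
  have hU' : U'.leadingCoeff ≠ 0 := leadingCoeff_ne_zero.2 (by rintro rfl; simp at hd')
  set n := U'.natDegree with hn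
  have hlc : U'.coeff n = U'.leadingCoeff := rfl
  have hUd : (hc U' n U V).natDegree = n * U.natDegree := by
    refine natDegree_eq_of_le_of_coeff_ne_zero (hc_natDegree_le hd.le) ?_
    rw [hc_coeff hd, hlc]
    exact mul_ne_zero hU' (pow_ne_zero _ hU)
  have hpos : 0 < n * U.natDegree := Nat.mul_pos (by omega) (by omega)
  have hVd : (hc V' n U V).natDegree < n * U.natDegree := by
    refine lt_of_le_of_ne (hc_natDegree_le hd.le) fun h => ?_
    have h1 := hc_coeff (F := V') (n := n) hd
    rw [coeff_eq_zero_of_natDegree_lt hd', zero_mul, ← h] at h1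
    have : hc V' n U V = 0 := leadingCoeff_eq_zero.1 h1
    rw [this] at h
    simp at h
    omega
  have hev : ∀ᶠ P in Filter.cofinite, (hc V' n U V).eval (xc P) ≠ 0 ∧ ψ (φ P) ≠ 0 ∧
      xc (ψ (φ P)) = (hc U' n U V).eval (xc P) / (hc V' n U V).eval (xc P) := by
    filter_upwards [hφ.ev, ht.eventually hψ.ev] with P ⟨h1, h2, h3⟩ ⟨h4, h5, h6⟩
    have hVn := pow_ne_zero n h1
    rw [hc_eval hd'.le h1, hc_eval le_rfl h1, ← h3, h6]
    refine ⟨mul_ne_zero hVn h4, h5, ?_⟩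
    rw [mul_div_mul_left _ _ hVn]
  refine ⟨⟨isCoprime_of_eval fun q hq hq' => ?_, by omega, ?_, hev⟩, hUd⟩
  · by_cases hv : V.eval q = 0
    · rw [hc_eval_zero hv, hlc] at hq
      have := (mul_eq_zero.1 hq).resolve_left hU'
      exact hφ.not_both ((pow_eq_zero_iff (by omega)).1 this) hv
    · rw [hc_eval le_rfl hv] at hq
      rw [hc_eval hd'.le hv] at hq'
      exact hψ.not_both ((mul_eq_zero.1 hq).resolve_left (pow_ne_zero _ hv))
        ((mul_eq_zero.1 hq').resolve_left (pow_ne_zero _ hv))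
  · intro h
    obtain ⟨P, h1, -⟩ := hev.exists
    rw [h] at h1
    simp at h1

lemma AeR.unique {φ : E.Pt → E'.Pt} {U V U' V' : k[X]} (h : AeR φ U V) (h' : AeR φ U' V') :
    U.natDegree = U'.natDegree := by
  have key : U * V' = U' * V := by
    apply poly_eq_of_evX (E := E)
    filter_upwards [h.ev, h'.ev] with P ⟨h1, _, h3⟩ ⟨h4, _, h6⟩
    rw [h3] at h6
    field_simp at h6
    simp only [eval_mul]
    linear_combination h6
  have hU : U ≠ 0 := by rintro rfl; simpa using h.deg
  have hU' : U' ≠ 0 := by rintro rfl; simpa using h'.deg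
  have d1 : U ∣ U' := h.cop.dvd_of_dvd_mul_right (by rw [← key]; exact dvd_mul_right _ _)
  have d2 : U' ∣ U := h'.cop.dvd_of_dvd_mul_right (by rw [key]; exact dvd_mul_right _ _)
  exact le_antisymm (natDegree_le_of_dvd d1 hU') (natDegree_le_of_dvd d2 hU)

/-- The degree of a rational homomorphism. -/
def hdeg (φ : E.Pt →+ E'.Pt) : ℕ :=
  if h : ∃ U V, AeR φ U V then (Classical.choose h).natDegree else 0

lemma AeR.hdeg_eq {φ : E.Pt →+ E'.Pt} {U V : k[X]} (h : AeR φ U V) : hdeg φ = U.natDegree := by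
  have hex : ∃ U V, AeR φ U V := ⟨U, V, h⟩
  rw [hdeg, dif_pos hex]
  exact (Classical.choose_spec (Classical.choose_spec hex)).unique h

lemma hdeg_zero : hdeg (0 : E.Pt →+ E'.Pt) = 0 := by
  rw [hdeg, dif_neg]
  rintro ⟨U, V, h⟩
  obtain ⟨P, _, h2, _⟩ := h.ev.exists
  exact h2 rfl

lemma hdeg_pos {φ : E.Pt →+ E'.Pt} (hφ : IsRatPt φ) (h : φ ≠ 0) : 0 < hdeg φ := by
  obtain ⟨U, V, H⟩ := exists_AeR hφ h
  rw [H.hdeg_eq]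
  exact Nat.zero_lt_of_lt H.deg

lemma hdeg_eq_zero {φ : E.Pt →+ E'.Pt} (hφ : IsRatPt φ) (h : hdeg φ = 0) : φ = 0 := by
  by_contra h'
  exact (hdeg_pos hφ h').ne' h

lemma hdeg_neg {φ : E.Pt →+ E'.Pt} (hφ : IsRatPt φ) : hdeg (-φ) = hdeg φ := by
  by_cases h : φ = 0
  · subst h; simp
  obtain ⟨U, V, H⟩ := exists_AeR hφ h
  rw [H.hdeg_eq]
  refine AeR.hdeg_eq (V := V) ⟨H.cop, H.deg, H.nz, ?_⟩
  filter_upwards [H.ev] with P h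
  simpa using h

lemma rat_comp {φ : E.Pt →+ E'.Pt} {ψ : E'.Pt →+ E''.Pt} (hφ : IsRatPt φ) (hψ : IsRatPt ψ) :
    IsRatPt (ψ.comp φ) := by
  by_cases h : φ = 0
  · subst h
    exact (IsRatPt.const 0).congr (by simp)
  · exact hφ.comp (hom_tendsto hφ h) hψ

lemma hdeg_comp {φ : E.Pt →+ E'.Pt} {ψ : E'.Pt →+ E''.Pt} (hφ : IsRatPt φ) (hψ : IsRatPt ψ) :
    hdeg (ψ.comp φ) = hdeg ψ * hdeg φ := by
  by_cases h : φ = 0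
  · subst h
    simp [hdeg_zero]
  by_cases h' : ψ = 0
  · subst h'
    simp [hdeg_zero]
  obtain ⟨U, V, H⟩ := exists_AeR hφ h
  obtain ⟨U', V', H'⟩ := exists_AeR hψ h'
  obtain ⟨h1, h2⟩ := H.comp H' (hom_tendsto hφ h)
  rw [H.hdeg_eq, H'.hdeg_eq, ← h2]
  exact AeR.hdeg_eq (φ := ψ.comp φ) h1

/-- The numerator of the doubling map. -/
def dblNum (E : Ell k) : k[X] := (X ^ 2 - C E.A) ^ 2 - 8 * C E.B * X

lemma dbl_bezout (E : Ell k) (x : k) :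
    (12 * x ^ 2 + 16 * E.A) * (E.dblNum.eval x) - (12 * x ^ 3 - 20 * E.A * x - 108 * E.B) *
      (E.f.eval x) = 4 * (4 * E.A ^ 3 + 27 * E.B ^ 2) := by
  simp [dblNum, f]
  ring

lemma four_ne : (4 : k) ≠ 0 := by
  have : (2 : k) ≠ 0 := CharGood.two
  have h : (4 : k) = 2 * 2 := by norm_num
  rw [h]; exact mul_ne_zero this this

lemma dblNum_ne {x : k} (h : E.f.eval x = 0) : E.dblNum.eval x ≠ 0 := by
  intro h'
  have := dbl_bezout E x
  rw [h, h', mul_zero, mul_zero, sub_zero] at this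
  exact mul_ne_zero four_ne E.disc this.symm

lemma AeR_two : AeR (fun P : E.Pt => P + P) E.dblNum (C 4 * E.f) := by
  have hd : (C 4 * E.f).natDegree = 3 := by rw [natDegree_C_mul four_ne, f_natDegree]
  have hd' : E.dblNum.natDegree = 4 := by unfold dblNum; compute_degree!
  have h0 : C 4 * E.f ≠ 0 := by intro h; simp [h] at hd
  refine ⟨(isCoprime_of_eval fun q h h' => ?_), by omega, h0, ?_⟩
  · simp only [eval_mul, eval_C] at h'
    exact dblNum_ne ((mul_eq_zero.1 h').resolve_left four_ne) h
  · filter_upwards [ev_polyX_ne h0, ev_ne 0, ev_Y_ne] with P h1 h2 h3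
    obtain ⟨h4, h5, -⟩ := add_self h2 h3
    refine ⟨h1, h4, ?_⟩
    have e := eqn' h2
    have e' := eqn h2
    rw [h5, eq_div_iff h1]
    simp only [eval_mul, eval_C]
    rw [← e]
    have h2' : (2 : k) ≠ 0 := CharGood.two
    field_simp
    simp [dblNum]
    linear_combination (-32 * xc P) * e'

end Ell

namespace Ell
variable {k : Type*} [Field k] [IsAlgClosed k] [CharGood k] {E E' E'' : Ell k}

lemma triple_dvd {a0 a1 a2 b0 b1 b2 : k[X]}
    (ha : ∀ q, a0.eval q = 0 → a1.eval q = 0 → a2.eval q ≠ 0)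
    (h02 : a0 * b2 = a2 * b0) (h12 : a1 * b2 = a2 * b1) : a2 ∣ b2 := by
  have hc : IsCoprime a0 (EuclideanDomain.gcd a1 a2) := by
    refine isCoprime_of_eval fun q h h' => ?_
    obtain ⟨u, hu⟩ := EuclideanDomain.gcd_dvd_left a1 a2
    obtain ⟨v, hv⟩ := EuclideanDomain.gcd_dvd_right a1 a2
    refine ha q h ?_ ?_
    · rw [hu, eval_mul, h', zero_mul]
    · rw [hv, eval_mul, h', zero_mul]
  obtain ⟨r, s, hrs⟩ := hc
  rw [EuclideanDomain.gcd_eq_gcd_ab] at hrs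
  generalize EuclideanDomain.gcdA a1 a2 = u at hrs
  generalize EuclideanDomain.gcdB a1 a2 = v at hrs
  refine ⟨r * b0 + s * u * b1 + s * v * b2, ?_⟩
  linear_combination (-b2) * hrs + r * h02 + s * u * h12

lemma triple_natDegree {a0 a1 a2 b0 b1 b2 : k[X]}
    (ha : ∀ q, a0.eval q = 0 → a1.eval q = 0 → a2.eval q ≠ 0)
    (hb : ∀ q, b0.eval q = 0 → b1.eval q = 0 → b2.eval q ≠ 0)
    (h02 : a0 * b2 = a2 * b0) (h12 : a1 * b2 = a2 * b1) (h : a2 ≠ 0) (h' : b2 ≠ 0) :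
    a2.natDegree = b2.natDegree :=
  le_antisymm (natDegree_le_of_dvd (triple_dvd ha h02 h12) h')
    (natDegree_le_of_dvd (triple_dvd (b0 := a0) (b1 := a1) hb (by linear_combination -h02)
      (by linear_combination -h12)) h)

lemma hdeg_two : hdeg (AddMonoidHom.id E.Pt + AddMonoidHom.id E.Pt) = 4 := by
  rw [AeR.hdeg_eq (φ := AddMonoidHom.id E.Pt + AddMonoidHom.id E.Pt) AeR_two]
  unfold dblNum; compute_degree!

lemma hdeg_id : hdeg (AddMonoidHom.id E.Pt) = 1 := by
  rw [AeR.hdeg_eq (φ := AddMonoidHom.id E.Pt) (U := X) (V := 1)]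
  · simp
  · refine ⟨isCoprime_one_right, by simp, one_ne_zero, ?_⟩
    filter_upwards [ev_ne 0] with P hP
    simpa using hP

lemma rat_id : IsRatPt (AddMonoidHom.id E.Pt) := IsRatPt.id
lemma rat_zero : IsRatPt (0 : E.Pt →+ E'.Pt) := IsRatPt.const 0
lemma rat_add {φ ψ : E.Pt →+ E'.Pt} (hφ : IsRatPt φ) (hψ : IsRatPt ψ) : IsRatPt ⇑(φ + ψ) :=
  hφ.add hψ
lemma rat_neg {φ : E.Pt →+ E'.Pt} (hφ : IsRatPt φ) : IsRatPt ⇑(-φ) := hφ.neg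
lemma rat_sub {φ ψ : E.Pt →+ E'.Pt} (hφ : IsRatPt φ) (hψ : IsRatPt ψ) : IsRatPt ⇑(φ - ψ) :=
  hφ.sub hψ

lemma hdeg_double {φ : E.Pt →+ E'.Pt} (hφ : IsRatPt φ) : hdeg (φ + φ) = 4 * hdeg φ := by
  have : φ + φ = (AddMonoidHom.id E'.Pt + AddMonoidHom.id E'.Pt).comp φ := by ext; simp
  rw [this, hdeg_comp hφ (rat_add rat_id rat_id), hdeg_two]

lemma parallelogram {φ ψ : E.Pt →+ E'.Pt} (hφ : IsRatPt φ) (hψ : IsRatPt ψ) :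
    hdeg (φ + ψ) + hdeg (φ - ψ) = 2 * hdeg φ + 2 * hdeg ψ := by
  by_cases h1 : φ = 0
  · subst h1; rw [zero_add, zero_sub, hdeg_neg hψ, hdeg_zero]; ring
  by_cases h2 : ψ = 0
  · subst h2; rw [add_zero, sub_zero, hdeg_zero]; ring
  by_cases h3 : φ + ψ = 0
  · have : φ = -ψ := eq_neg_of_add_eq_zero_left h3
    rw [h3, this, hdeg_zero, show -ψ - ψ = -(ψ + ψ) by abel, hdeg_neg (rat_add hψ hψ),
      hdeg_double hψ, hdeg_neg hψ]; ring
  by_cases h4 : φ - ψ = 0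
  · have : φ = ψ := sub_eq_zero.1 h4
    subst this
    rw [h4, hdeg_zero, hdeg_double hφ]; ring
  obtain ⟨u₁, v₁, H₁⟩ := exists_AeR hφ h1
  obtain ⟨u₂, v₂, H₂⟩ := exists_AeR hψ h2
  obtain ⟨u₃, v₃, H₃⟩ := exists_AeR (rat_add hφ hψ) h3
  obtain ⟨u₄, v₄, H₄⟩ := exists_AeR (rat_sub hφ hψ) h4
  rw [H₁.hdeg_eq, H₂.hdeg_eq, H₃.hdeg_eq, H₄.hdeg_eq]
  set Q0 := (u₁ * v₂ - u₂ * v₁) ^ 2 with hQ0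
  set Q1 := 2 * ((u₁ * v₂ + u₂ * v₁) * (u₁ * u₂ + C E'.A * (v₁ * v₂))
    + 2 * C E'.B * (v₁ ^ 2 * v₂ ^ 2)) with hQ1
  set Q2 := (u₁ * u₂ - C E'.A * (v₁ * v₂)) ^ 2
    - 4 * C E'.B * (v₁ * v₂) * (u₁ * v₂ + u₂ * v₁) with hQ2
  have n1 : u₁ ≠ 0 := by rintro rfl; simpa using H₁.deg
  have n2 : u₂ ≠ 0 := by rintro rfl; simpa using H₂.deg
  have n3 : u₃ ≠ 0 := by rintro rfl; simpa using H₃.deg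
  have n4 : u₄ ≠ 0 := by rintro rfl; simpa using H₄.deg
  have key : ∀ᶠ P : E.Pt in Filter.cofinite,
      (Q1.eval (xc P) * (v₃ * v₄).eval (xc P) = Q0.eval (xc P) * (u₃ * v₄ + u₄ * v₃).eval (xc P)) ∧
      (Q2.eval (xc P) * (v₃ * v₄).eval (xc P) = Q0.eval (xc P) * (u₃ * u₄).eval (xc P)) ∧
      (Q2.eval (xc P) * (u₃ * v₄ + u₄ * v₃).eval (xc P) =
        Q1.eval (xc P) * (u₃ * u₄).eval (xc P)) := by
    filter_upwards [H₁.ev, H₂.ev, H₃.ev, H₄.ev] with P ⟨a1, b1, c1⟩ ⟨a2, b2, c2⟩ ⟨a3, b3, c3⟩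
      ⟨a4, b4, c4⟩
    simp only [AddMonoidHom.add_apply, AddMonoidHom.sub_apply] at b3 b4 c3 c4
    have hx : xc (φ P) ≠ xc (ψ P) := by
      intro hx
      rcases eq_or_neg_of_X_eq b1 b2 hx with h | h
      · exact b4 (by rw [h, sub_self])
      · exact b3 (by rw [h, neg_add_cancel])
    have s1 := sum_X b1 b2 hx
    have s2 := prod_X b1 b2 hx
    rw [c1, c2, c3, c4] at s1 s2
    have hq : Q0.eval (xc P) ≠ 0 := by
      rw [hQ0]
      simp only [eval_pow, eval_sub, eval_mul]
      refine pow_ne_zero _ fun h => hx ?_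
      rw [c1, c2, div_eq_div_iff a1 a2]
      linear_combination h
    have e1 : Q1.eval (xc P) * (v₃ * v₄).eval (xc P) =
        Q0.eval (xc P) * (u₃ * v₄ + u₄ * v₃).eval (xc P) := by
      rw [hQ1, hQ0]
      simp only [eval_pow, eval_sub, eval_mul, eval_add, eval_C, eval_ofNat]
      field_simp at s1
      apply mul_left_cancel₀ (mul_ne_zero a1 a2)
      linear_combination (-(eval (xc P) v₁ * eval (xc P) v₂)) * s1
    have e2 : Q2.eval (xc P) * (v₃ * v₄).eval (xc P) =
        Q0.eval (xc P) * (u₃ * u₄).eval (xc P) := by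
      rw [hQ2, hQ0]
      simp only [eval_pow, eval_sub, eval_mul, eval_add, eval_C, eval_ofNat]
      field_simp at s2
      apply mul_left_cancel₀ (mul_ne_zero a1 a2)
      linear_combination (-(eval (xc P) v₁ * eval (xc P) v₂)) * s2
    refine ⟨e1, e2, mul_left_cancel₀ hq ?_⟩
    linear_combination (-(Q2.eval (xc P))) * e1 + Q1.eval (xc P) * e2
  have k1 : Q0 * (u₃ * u₄) = Q2 * (v₃ * v₄) := by
    apply poly_eq_of_evX (E := E)
    filter_upwards [key] with P ⟨_, h, _⟩
    rw [eval_mul (p := Q0), eval_mul (p := Q2), h]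
  have k2 : Q1 * (u₃ * u₄) = Q2 * (u₃ * v₄ + u₄ * v₃) := by
    apply poly_eq_of_evX (E := E)
    filter_upwards [key] with P ⟨_, _, h⟩
    rw [eval_mul (p := Q1), eval_mul (p := Q2), h]
  have hQ2d : Q2.natDegree = 2 * u₁.natDegree + 2 * u₂.natDegree := by
    have d1 := H₁.deg
    have d2 := H₂.deg
    have e1 : (C E'.A * (v₁ * v₂)).natDegree < (u₁ * u₂).natDegree := by
      rw [natDegree_mul n1 n2]
      exact (natDegree_C_mul_le _ _).trans_lt (natDegree_mul_le.trans_lt (by omega))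
    have e2 : ((u₁ * u₂ - C E'.A * (v₁ * v₂)) ^ 2).natDegree =
        2 * u₁.natDegree + 2 * u₂.natDegree := by
      rw [natDegree_pow, natDegree_sub_eq_left_of_natDegree_lt e1, natDegree_mul n1 n2]; ring
    rw [hQ2, natDegree_sub_eq_left_of_natDegree_lt, e2]
    rw [e2]
    have e3 : (u₁ * v₂ + u₂ * v₁).natDegree ≤ u₁.natDegree + u₂.natDegree :=
      natDegree_add_le_of_degree_le (natDegree_mul_le.trans (by omega))
        (natDegree_mul_le.trans (by omega))
    have : 4 * C E'.B * (v₁ * v₂) * (u₁ * v₂ + u₂ * v₁) =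
      C (4 * E'.B) * ((v₁ * v₂) * (u₁ * v₂ + u₂ * v₁)) := by
        rw [C_mul, show (C 4 : k[X]) = 4 from rfl]; ring
    rw [this]
    have e4 := natDegree_mul_le (p := v₁) (q := v₂)
    exact (natDegree_C_mul_le _ _).trans_lt (natDegree_mul_le.trans_lt (by omega))
  have d1 := H₁.deg
  have hQ2n : Q2 ≠ 0 := by intro h; rw [h] at hQ2d; simp at hQ2d; omega
  have fin := triple_natDegree (a0 := Q0) (a1 := Q1) (a2 := Q2) (b0 := v₃ * v₄)
    (b1 := u₃ * v₄ + u₄ * v₃) (b2 := u₃ * u₄) ?_ ?_ k1 k2 hQ2n (mul_ne_zero n3 n4)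
  · rw [hQ2d, natDegree_mul n3 n4] at fin
    omega
  · intro q h0 h1 h2
    rw [hQ0] at h0
    rw [hQ1] at h1
    rw [hQ2] at h2
    simp only [eval_pow, eval_sub, eval_mul, eval_add, eval_C, eval_ofNat] at h0 h1 h2
    have h0 := pow_eq_zero_iff (two_ne_zero) |>.1 h0
    have c1 := fun h => cop_eval H₁.cop (q := q) h
    have c2 := fun h => cop_eval H₂.cop (q := q) h
    generalize eval q u₁ = a at *
    generalize eval q v₁ = b at *
    generalize eval q u₂ = c at *
    generalize eval q v₂ = d at *
    by_cases hb : b = 0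
    · subst hb
      have ha : a ≠ 0 := fun h => c1 h rfl
      have hd : d = 0 := by simpa [ha] using h0
      subst hd
      have hc : c ≠ 0 := fun h => c2 h rfl
      simp [ha, hc] at h2
    · by_cases hd : d = 0
      · subst hd
        have hc : c ≠ 0 := fun h => c2 h rfl
        simp [hc, hb] at h0
      obtain ⟨r, rfl⟩ : ∃ r, a = r * b := ⟨a / b, by field_simp⟩
      have hc : c = r * d := by apply mul_right_cancel₀ hb; linear_combination -h0
      subst hc
      have f1 : E'.f.eval r = 0 := by
        have : (4 * (b ^ 2 * d ^ 2)) * E'.f.eval r = 0 := by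
          rw [eval_f]; linear_combination h1
        exact (mul_eq_zero.1 this).resolve_left
          (mul_ne_zero four_ne (mul_ne_zero (pow_ne_zero _ hb) (pow_ne_zero _ hd)))
      apply dblNum_ne f1
      have : (b ^ 2 * d ^ 2) * E'.dblNum.eval r = 0 := by
        simp only [dblNum, eval_sub, eval_mul, eval_pow, eval_X, eval_C, eval_ofNat]
        linear_combination h2
      exact (mul_eq_zero.1 this).resolve_left
          ((mul_ne_zero (pow_ne_zero _ hb) (pow_ne_zero _ hd)))
  · intro q h0 h1 h2
    simp only [eval_mul, eval_add] at h0 h1 h2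
    have c1 := fun h => cop_eval H₃.cop (q := q) h
    have c2 := fun h => cop_eval H₄.cop (q := q) h
    rcases mul_eq_zero.1 h2 with h | h
    · have := c1 h
      have h4 : eval q v₄ = 0 := by simpa [this] using h0
      rw [h, h4] at h1
      have : eval q u₄ = 0 := by simpa [this] using h1
      exact c2 this h4
    · have := c2 h
      have h4 : eval q v₃ = 0 := by simpa [this] using h0
      rw [h, h4] at h1
      have : eval q u₃ = 0 := by simpa [this] using h1
      exact c1 this h4

/-- The bilinear form attached to the degree. -/
def bd (φ ψ : E.Pt →+ E'.Pt) : ℤ := hdeg (φ + ψ) - hdeg φ - hdeg ψ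

lemma bd_comm (φ ψ : E.Pt →+ E'.Pt) : bd φ ψ = bd ψ φ := by rw [bd, bd, add_comm]; ring

lemma bd_add {a b c : E.Pt →+ E'.Pt} (ha : IsRatPt a) (hb : IsRatPt b) (hc : IsRatPt c) :
    bd a (b + c) = bd a b + bd a c := by
  have p1 := parallelogram (rat_add ha hb) hc
  have p2 := parallelogram ha (rat_sub hb hc)
  have p3 := parallelogram (rat_add ha hc) hb
  have p4 := parallelogram hb hc
  rw [show a + (b - c) = a + b - c by abel, show a - (b - c) = a + c - b by abel] at p2
  rw [show a + c + b = a + b + c by abel] at p3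
  unfold bd
  rw [show a + (b + c) = a + b + c by abel]
  omega

lemma bd_zero (a : E.Pt →+ E'.Pt) : bd a 0 = 0 := by simp [bd, hdeg_zero]

lemma bd_neg {a b : E.Pt →+ E'.Pt} (ha : IsRatPt a) (hb : IsRatPt b) : bd a (-b) = - bd a b := by
  have := bd_add ha hb (rat_neg hb)
  rw [add_neg_cancel, bd_zero] at this
  linarith

lemma rat_nsmul {φ : E.Pt →+ E'.Pt} (hφ : IsRatPt φ) (n : ℕ) : IsRatPt ⇑(n • φ) := by
  induction n with
  | zero => rw [zero_nsmul]; exact rat_zero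
  | succ n ih => rw [succ_nsmul]; exact rat_add ih hφ

lemma rat_zsmul {φ : E.Pt →+ E'.Pt} (hφ : IsRatPt φ) (n : ℤ) : IsRatPt ⇑(n • φ) := by
  obtain ⟨m, rfl | rfl⟩ := n.eq_nat_or_neg
  · rw [natCast_zsmul]; exact rat_nsmul hφ m
  · rw [neg_smul, natCast_zsmul]; exact rat_neg (rat_nsmul hφ m)

lemma bd_zsmul {a b : E.Pt →+ E'.Pt} (ha : IsRatPt a) (hb : IsRatPt b) (n : ℤ) :
    bd a (n • b) = n * bd a b := by
  have hn : ∀ m : ℕ, bd a (m • b) = m * bd a b := by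
    intro m
    induction m with
    | zero => simp [bd_zero]
    | succ m ih => rw [succ_nsmul, bd_add ha (rat_nsmul hb m) hb, ih]; push_cast; ring
  obtain ⟨m, rfl | rfl⟩ := n.eq_nat_or_neg
  · rw [natCast_zsmul, hn]
  · rw [neg_smul, natCast_zsmul, bd_neg ha (rat_nsmul hb m), hn]; simp

lemma bd_self {a : E.Pt →+ E'.Pt} (ha : IsRatPt a) : bd a a = 2 * hdeg a := by
  rw [bd, hdeg_double ha]; push_cast; ring

lemma hdeg_add (a b : E.Pt →+ E'.Pt) : (hdeg (a + b) : ℤ) = hdeg a + hdeg b + bd a b := by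
  rw [bd]; ring

lemma hdeg_zsmul {a : E.Pt →+ E'.Pt} (ha : IsRatPt a) (n : ℤ) :
    (hdeg (n • a) : ℤ) = n ^ 2 * hdeg a := by
  have h1 := bd_self (rat_zsmul ha n)
  rw [bd_zsmul (rat_zsmul ha n) ha, bd_comm, bd_zsmul ha ha, bd_self ha] at h1
  linarith

lemma hdeg_nsmul {a : E.Pt →+ E'.Pt} (ha : IsRatPt a) (n : ℕ) :
    hdeg (n • a) = n ^ 2 * hdeg a := by
  have := hdeg_zsmul ha n
  rw [natCast_zsmul] at this
  exact_mod_cast this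

lemma bd_comp_left {a b : E.Pt →+ E'.Pt} {c : E'.Pt →+ E''.Pt} (ha : IsRatPt a) (hb : IsRatPt b)
    (hc : IsRatPt c) : bd (c.comp a) (c.comp b) = hdeg c * bd a b := by
  have : c.comp a + c.comp b = c.comp (a + b) := by ext; simp
  rw [bd, this, hdeg_comp (rat_add ha hb) hc, hdeg_comp ha hc, hdeg_comp hb hc, bd]
  push_cast; ring

end Ell

namespace Ell
variable {k : Type*} [Field k] [IsAlgClosed k] [CharGood k] {E E' E'' : Ell k}

lemma HasR.exists_root {φ : E.Pt → E'.Pt} {U V : k[X]} (H : HasR φ U V) (v : k) {x : k}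
    (hx : (U - C v * V).eval x = 0) {P : E.Pt} (hP : P ≠ 0) (hxP : xc P = x) :
    φ P ≠ 0 ∧ xc (φ P) = v := by
  have hV : V.eval x ≠ 0 := by
    intro h
    have : U.eval x = 0 := by simpa [h] using hx
    exact H.toAeR.not_both this h
  subst hxP
  rcases H.all P hP with h | h
  · exact absurd h.2 hV
  · refine ⟨h.1, ?_⟩
    rw [h.2.2, div_eq_iff hV]
    simp only [eval_sub, eval_mul, eval_C] at hx
    linear_combination hx

lemma hom_surj {φ : E.Pt →+ E'.Pt} (hφ : IsRatPt φ) (h : φ ≠ 0) : Function.Surjective φ := by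
  intro Q
  by_cases hQ : Q = 0
  · exact ⟨0, by simp [hQ]⟩
  obtain ⟨U, V, H⟩ := exists_AeR hφ h
  have hd := natDegree_sub_C_mul H.deg (xc Q)
  have h0 := H.deg
  obtain ⟨x, hx⟩ := IsAlgClosed.exists_root (U - C (xc Q) * V)
    (by intro h; rw [natDegree_eq_of_degree_eq_some (n := 0) h] at hd; omega)
  obtain ⟨P, hP, hxP⟩ := X_surj (E := E) x
  obtain ⟨h1, h2⟩ := H.hasR.exists_root _ hx hP hxP
  rcases eq_or_neg_of_X_eq h1 hQ h2 with h | h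
  · exact ⟨P, h⟩
  · exact ⟨-P, by rw [map_neg, h, neg_neg]⟩

/-- The images of the translates of a generic point by the kernel. -/
lemma ker_inj {φ : E.Pt →+ E'.Pt} {P : E.Pt} (hP : φ P + φ P ≠ 0) :
    Function.Injective (fun κ : φ.ker => xc (P + (κ : E.Pt))) := by
  have hP0 : φ P ≠ 0 := by rintro h; simp [h] at hP
  have hne : ∀ κ : φ.ker, P + (κ : E.Pt) ≠ 0 := by
    intro κ h
    have := congrArg φ h
    rw [map_add, κ.2, add_zero, map_zero] at this
    exact hP0 this
  rintro κ κ' h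
  rcases eq_or_neg_of_X_eq (hne κ) (hne κ') h with h | h
  · exact Subtype.ext (add_left_cancel h)
  · have := congrArg φ h
    rw [map_neg, map_add, map_add, κ.2, κ'.2, add_zero] at this
    exact absurd (by nth_rewrite 1 [this]; simp) hP

lemma ev_double_ne : ∀ᶠ P : E.Pt in Filter.cofinite, P + P ≠ 0 := by
  filter_upwards [ev_Y_ne] with P h h'
  exact h (Y_eq_zero_iff.2 h')

lemma ker_card_eq {φ : E.Pt →+ E'.Pt} {U V : k[X]} (H : AeR φ U V) {P : E.Pt}
    (hP : φ P + φ P ≠ 0) :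
    Nat.card φ.ker = (U - C (xc (φ P)) * V).roots.toFinset.card := by
  have hd := natDegree_sub_C_mul H.deg (xc (φ P))
  have h0 := H.deg
  have hne : U - C (xc (φ P)) * V ≠ 0 := by intro h; rw [h] at hd; simp at hd; omega
  have hP0 : φ P ≠ 0 := by rintro h; simp [h] at hP
  have hne' : ∀ κ : φ.ker, P + (κ : E.Pt) ≠ 0 := by
    intro κ h
    have := congrArg φ h
    rw [map_add, κ.2, add_zero, map_zero] at this
    exact hP0 this
  rw [← Nat.card_range_of_injective (ker_inj hP), Nat.card_coe_set_eq, ← Set.ncard_coe_finset]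
  congr 1
  ext x
  simp only [Set.mem_range, SetLike.mem_coe, Multiset.mem_toFinset, mem_roots hne, IsRoot.def]
  constructor
  · rintro ⟨κ, rfl⟩
    have e : φ (P + (κ : E.Pt)) = φ P := by rw [map_add, κ.2, add_zero]
    rcases H.hasR.all _ (hne' κ) with h | h
    · rw [e] at h; exact absurd h.1 hP0
    · have h3 := h.2.2
      rw [e, eq_div_iff h.2.1] at h3
      simp only [eval_sub, eval_mul, eval_C]
      linear_combination -h3
  · intro hx
    obtain ⟨R, hR, hxR⟩ := X_surj (E := E) x
    obtain ⟨h1, h2⟩ := H.hasR.exists_root _ hx hR hxR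
    rcases eq_or_neg_of_X_eq h1 hP0 h2 with h | h
    · exact ⟨⟨R - P, by simp [AddMonoidHom.mem_ker, h]⟩, by simpa using hxR⟩
    · exact ⟨⟨-R - P, by simp [AddMonoidHom.mem_ker, h]⟩, by simpa using hxR⟩

/-- A rational homomorphism is separable if its kernel has the maximal possible size. -/
def Sep (φ : E.Pt →+ E'.Pt) : Prop := Nat.card φ.ker = hdeg φ

/-- The Wronskian. -/
def wr (U V : k[X]) : k[X] := derivative U * V - U * derivative V

lemma nodup_of_wr {U V : k[X]} (hd : V.natDegree < U.natDegree) {v : k}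
    (h : ∀ x, (wr U V).eval x = 0 → V.eval x ≠ 0 → v ≠ U.eval x / V.eval x)
    (hc : IsCoprime U V) :
    (U - C v * V).roots.toFinset.card = U.natDegree := by
  have hd' := natDegree_sub_C_mul hd v
  have hne : U - C v * V ≠ 0 := by intro h; rw [h] at hd'; simp at hd'; omega
  rw [Multiset.toFinset_card_of_nodup, card_roots_closed, hd']
  rw [nodup_roots_iff_of_splits hne (IsAlgClosed.splits _)]
  refine isCoprime_of_eval fun x h1 h2 => ?_
  have hV : V.eval x ≠ 0 := by
    intro h
    exact cop_eval hc (by simpa [h] using h1) h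
  have h1' : U.eval x = v * V.eval x := by simpa [sub_eq_zero] using h1
  have h2' : (derivative U).eval x = v * (derivative V).eval x := by
    simpa [sub_eq_zero] using h2
  refine h x ?_ hV (by rw [h1']; field_simp)
  simp only [wr, eval_sub, eval_mul, h1', h2']
  ring

lemma ev_nodup {U V : k[X]} (hd : V.natDegree < U.natDegree) (hW : wr U V ≠ 0)
    (hc : IsCoprime U V) :
    ∀ᶠ v in Filter.cofinite, (U - C v * V).roots.toFinset.card = U.natDegree := by
  have : (Set.image (fun x => U.eval x / V.eval x) ((wr U V).roots.toFinset : Set k)).Finite :=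
    Set.Finite.image _ (finite_toSet _)
  filter_upwards [this.eventually_cofinite_notMem] with v hv
  refine nodup_of_wr hd (fun x h1 h2 h3 => hv ⟨x, by simp [hW, h1], h3.symm⟩) hc

lemma sep_of_wr {φ : E.Pt →+ E'.Pt} (hφ : IsRatPt φ) (h0 : φ ≠ 0) {U V : k[X]} (H : AeR φ U V)
    (hW : wr U V ≠ 0) : Sep φ := by
  have ht := hom_tendsto hφ h0
  obtain ⟨P, h1, h2⟩ := ((ht.eventually ev_double_ne).and
    (ht.eventually (ev_X (ev_nodup H.deg hW H.cop)))).exists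
  rw [Sep, ker_card_eq H h1, H.hdeg_eq, h2]

lemma wr_ne {U V : k[X]} (hc : IsCoprime U V) (hd : V.natDegree < U.natDegree)
    (h : (U.natDegree : k) ≠ 0) : wr U V ≠ 0 := by
  intro hW
  have h1 : U ∣ derivative U := by
    refine hc.dvd_of_dvd_mul_right (z := V) ⟨derivative V, ?_⟩
    exact sub_eq_zero.1 hW
  have h2 : (derivative U).natDegree < U.natDegree := natDegree_derivative_lt (by omega)
  have h3 : derivative U = 0 := eq_zero_of_dvd_of_natDegree_lt h1 h2
  have h4 : (derivative U).coeff (U.natDegree - 1) = 0 := by rw [h3, coeff_zero]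
  rw [coeff_derivative, Nat.sub_add_cancel (by omega)] at h4
  rcases mul_eq_zero.1 h4 with h5 | h5
  · have : U = 0 := leadingCoeff_eq_zero.1 h5
    subst this; simp at hd
  · apply h
    have : ((U.natDegree - 1 + 1 : ℕ) : k) = 0 := by exact_mod_cast h5
    rwa [Nat.sub_add_cancel (by omega)] at this

lemma sep_of_deg {φ : E.Pt →+ E'.Pt} (hφ : IsRatPt φ) (h : (hdeg φ : k) ≠ 0) : Sep φ := by
  have h0 : φ ≠ 0 := by rintro rfl; simp [hdeg_zero] at h
  obtain ⟨U, V, H⟩ := exists_AeR hφ h0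
  rw [H.hdeg_eq] at h
  exact sep_of_wr hφ h0 H (wr_ne H.cop H.deg h)

/-- For a separable homomorphism, the generic fibre has distinct abscissae. -/
lemma Sep.ev_nodup {φ : E.Pt →+ E'.Pt} (hφ : IsRatPt φ) (h0 : φ ≠ 0) {U V : k[X]} (H : AeR φ U V)
    (hs : Sep φ) :
    ∀ᶠ v in Filter.cofinite, (U - C v * V).roots.toFinset.card = U.natDegree := by
  refine of_ev_X (E := E') ?_
  filter_upwards [ev_double_ne] with Q hQ
  obtain ⟨P, rfl⟩ := hom_surj hφ h0 Q
  rw [← ker_card_eq H hQ, hs, H.hdeg_eq]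

end Ell

namespace Ell
variable {k : Type*} [Field k] [IsAlgClosed k] [CharGood k] {E E' E'' : Ell k}

lemma exists_map (σ : k →+* k) (hA : σ E.A = E.A) (hB : σ E.B = E.B) (P : E.Pt) : ∃ Q : E.Pt, (P = 0 → Q = 0) ∧
    (P ≠ 0 → Q ≠ 0 ∧ xc Q = σ (xc P) ∧ yc Q = σ (yc P)) := by
  by_cases hP : P = 0
  · exact ⟨0, by simp [hP]⟩
  · obtain ⟨Q, h⟩ := exists_pt (E := E) (x := σ (xc P)) (y := σ (yc P)) (by
      have := congrArg σ (eqn hP)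
      simpa [hA, hB] using this)
    exact ⟨Q, by simp [hP], fun _ => h⟩

section mapPt
variable (σ : k →+* k) (hA : σ E.A = E.A) (hB : σ E.B = E.B)

/-- The map on points induced by a field endomorphism fixing the coefficients. -/
def mapPt (P : E.Pt) : E.Pt := Classical.choose (exists_map σ hA hB P)

lemma mapPt_zero : mapPt σ hA hB (0 : E.Pt) = 0 :=
  (Classical.choose_spec (exists_map σ hA hB 0)).1 rfl

lemma mapPt_ne {P : E.Pt} (hP : P ≠ 0) : mapPt σ hA hB P ≠ 0 ∧
    xc (mapPt σ hA hB P) = σ (xc P) ∧ yc (mapPt σ hA hB P) = σ (yc P) :=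
  (Classical.choose_spec (exists_map σ hA hB P)).2 hP

lemma mapPt_neg (P : E.Pt) : mapPt σ hA hB (-P) = - mapPt σ hA hB P := by
  by_cases hP : P = 0
  · simp [hP, mapPt_zero]
  · have h1 := mapPt_ne σ hA hB hP
    have h2 := mapPt_ne σ hA hB (neg_ne_zero.2 hP)
    exact pt_ext h2.1 (neg_ne_zero.2 h1.1) (by simp [h1, h2]) (by simp [h1, h2])

lemma mapPt_add (P Q : E.Pt) : mapPt σ hA hB (P + Q) = mapPt σ hA hB P + mapPt σ hA hB Q := by
  have s2 : σ 2 = 2 := map_ofNat σ 2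
  have s3 : σ 3 = 3 := map_ofNat σ 3
  by_cases hP : P = 0
  · simp [hP, mapPt_zero]
  by_cases hQ : Q = 0
  · simp [hQ, mapPt_zero]
  have h1 := mapPt_ne σ hA hB hP
  have h2 := mapPt_ne σ hA hB hQ
  by_cases hx : xc P = xc Q
  · by_cases hn : P = -Q
    · simp [hn, mapPt_neg, mapPt_zero]
    · have he := (eq_or_neg_of_X_eq hP hQ hx).resolve_right hn
      subst he
      have hy : yc P ≠ 0 := fun h => hn (eq_neg_of_add_eq_zero_left (Y_eq_zero_iff.1 h))
      obtain ⟨a1, a2, a3⟩ := add_self hP hy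
      obtain ⟨b1, b2, b3⟩ := add_self h1.1 (by rw [h1.2.2]; simpa using hy)
      have h3 := mapPt_ne σ hA hB a1
      have ex : xc (mapPt σ hA hB (P + P)) = xc (mapPt σ hA hB P + mapPt σ hA hB P) := by
        rw [h3.2.1, a2, b2, h1.2.1, h1.2.2]; simp [hA, s2, s3]
      refine pt_ext h3.1 b1 ex ?_
      rw [b3, ← ex, h3.2.1, h3.2.2, h1.2.1, h1.2.2, a3]; simp [hA, s2, s3]
  · obtain ⟨a1, a2, a3⟩ := add_chord hP hQ hx
    obtain ⟨b1, b2, b3⟩ := add_chord h1.1 h2.1 (by rw [h1.2.1, h2.2.1]; exact fun h => hx (σ.injective h))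
    have h3 := mapPt_ne σ hA hB a1
    have ex : xc (mapPt σ hA hB (P + Q)) = xc (mapPt σ hA hB P + mapPt σ hA hB Q) := by
      rw [h3.2.1, a2, b2, h1.2.1, h1.2.2, h2.2.1, h2.2.2]; simp
    refine pt_ext h3.1 b1 ex ?_
    rw [b3, ← ex, h3.2.1, h3.2.2, h1.2.1, h1.2.2, h2.2.1, h2.2.2, a3]; simp

/-- `mapPt` as a homomorphism. -/
def mapHom : E.Pt →+ E.Pt where
  toFun := mapPt σ hA hB
  map_zero' := mapPt_zero σ hA hB
  map_add' := mapPt_add σ hA hB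
end mapPt

section frob
variable (p : ℕ) [Fact p.Prime] [CharP k p]
variable (hA : frobenius k p E.A = E.A) (hB : frobenius k p E.B = E.B)

/-- The Frobenius endomorphism. -/
def frob : E.Pt →+ E.Pt := mapHom (frobenius k p) hA hB

lemma frob_ne {P : E.Pt} (hP : P ≠ 0) : frob p hA hB P ≠ 0 ∧
    xc (frob p hA hB P) = xc P ^ p ∧ yc (frob p hA hB P) = yc P ^ p :=
  mapPt_ne (frobenius k p) hA hB hP

lemma frob_rat : IsRatPt (frob p hA hB) := by
  right
  refine ⟨?_, (IsRat.x.pow p).congr ?_, (IsRat.y.pow p).congr ?_⟩ <;>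
  filter_upwards [ev_ne 0] with P hP
  · exact (frob_ne p hA hB hP).1
  · exact (frob_ne p hA hB hP).2.1
  · exact (frob_ne p hA hB hP).2.2

lemma frob_AeR : AeR (frob p hA hB) (X ^ p) 1 := by
  refine ⟨isCoprime_one_right, by simpa using (Fact.out : p.Prime).pos, one_ne_zero, ?_⟩
  filter_upwards [ev_ne 0] with P hP
  simpa using ⟨(frob_ne p hA hB hP).1, (frob_ne p hA hB hP).2.1⟩

lemma hdeg_frob : hdeg (frob p hA hB) = p := by rw [(frob_AeR p hA hB).hdeg_eq]; simp

lemma odd_p (k : Type*) [Field k] [CharGood k] (p : ℕ) [Fact p.Prime] [CharP k p] : ∃ m, p = 2 * m + 1 := by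
  rcases (Fact.out : p.Prime).eq_two_or_odd' with h | h
  · exfalso
    have := CharP.cast_eq_zero k p
    rw [h] at this
    exact CharGood.two (k := k) (by exact_mod_cast this)
  · exact h

lemma frob_wr_aux {f : k[X]} (hm : f.Monic) (hd : f.natDegree = 3) {m : ℕ} (hp : p = 2 * m + 1)
    {U V : k[X]} (hV : V ≠ 0) (hW : wr U V = 0)
    (h : (f * (1 + f ^ m) ^ 2 - (X + X ^ p) * (X - X ^ p) ^ 2) * V = U * (X - X ^ p) ^ 2) :
    False := by
  have c2 : (C (2 : k) : k[X]) = 2 := map_ofNat C 2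
  set D : k[X] := X - X ^ p with hD
  set g := f ^ m with hg
  have hp1 := (Fact.out : p.Prime).one_lt
  have hpk : (p : k[X]) = 0 := CharP.cast_eq_zero k[X] p
  have hDd : derivative D = 1 := by
    simp only [hD, derivative_sub, derivative_X, derivative_X_pow]
    rw [show (C (p : k) : k[X]) = (p : k[X]) by simp, hpk]; simp
  have hDc : D.coeff p = -1 := by
    simp [hD, coeff_X, hp1.ne]
  have hD0 : D ≠ 0 := by intro h; simp [h] at hDc
  have hDn : D.natDegree ≤ p := by
    refine (natDegree_sub_le _ _).trans ?_
    simp; omega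
  have hfg : 2 * f * derivative g = - derivative f * g := by
    have h2m : (2 * (m : k[X])) = -1 := by
      have : ((2 * m + 1 : ℕ) : k[X]) = 0 := by rw [← hp]; exact hpk
      push_cast at this
      linear_combination this
    rcases Nat.eq_zero_or_pos m with h0 | h0
    · subst h0; omega
    · obtain ⟨n, rfl⟩ := Nat.exists_eq_add_of_lt h0
      simp only [zero_add] at *
      rw [hg, derivative_pow]
      simp only [Nat.add_sub_cancel, map_natCast]
      rw [pow_succ]
      linear_combination (f ^ n * f * derivative f) * h2m
  set N := f * (1 + g) ^ 2 - (X + X ^ p) * D ^ 2 with hN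
  have hXp : derivative (X + X ^ p : k[X]) = 1 := by
    simp only [derivative_add, derivative_X, derivative_X_pow]
    rw [show (C (p : k) : k[X]) = (p : k[X]) by simp, hpk]; simp
  have hNd : derivative N = (1 + g) * derivative f - D ^ 2 - 2 * (X + X ^ p) * D := by
    have : derivative N = derivative f * (1 + g) ^ 2 + f * (2 * (1 + g) * derivative g) -
      (derivative (X + X ^ p : k[X]) * D ^ 2 + (X + X ^ p) * (2 * D * derivative D)) := by
      simp only [hN, derivative_sub, derivative_mul, derivative_pow, derivative_add]
      simp [c2]
    rw [this, hXp, hDd]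
    linear_combination (1 + g) * hfg
  have h2 : derivative N * D = 2 * N := by
    have h' := congrArg derivative h
    simp only [derivative_mul, derivative_pow, hDd] at h'
    have hW' : derivative U * V = U * derivative V := sub_eq_zero.1 hW
    have : V ^ 2 * D ^ 3 * (derivative N * D - 2 * N) = 0 := by
      simp only [Nat.cast_ofNat, C_ofNat, Nat.add_one_sub_one, pow_one, mul_one] at h'
      linear_combination V * D ^ 4 * h' - (D ^ 2 * derivative V + 2 * V * D) * D ^ 2 * h
        + D ^ 6 * hW'
    rcases mul_eq_zero.1 this with h3 | h3
    · exact absurd h3 (mul_ne_zero (pow_ne_zero _ hV) (pow_ne_zero _ hD0))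
    · exact sub_eq_zero.1 h3
  have h3 : (1 + g) * derivative f * D = D ^ 3 + 2 * (f * ((1 + g) ^ 2)) := by
    rw [hNd, hN] at h2
    linear_combination h2
  have hgm : g.Monic := hm.pow m
  have hgd : g.natDegree = 3 * m := by rw [hg, hm.natDegree_pow, hd]; ring
  have h1g : (1 + g).natDegree ≤ 3 * m := by
    refine (natDegree_add_le _ _).trans ?_
    simp [hgd]
  have hm0 : 0 < m := by omega
  have h1gc : (1 + g).coeff (3 * m) = 1 := by
    rw [coeff_add, ← hgd, hgm.coeff_natDegree, coeff_one]
    simp [hgd, hm0.ne']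
  have hfd : (derivative f).natDegree ≤ 2 := by
    have := natDegree_derivative_le f; omega
  have hL : ((1 + g) * derivative f * D).coeff (3 * p) = 0 := by
    apply coeff_eq_zero_of_natDegree_lt
    have a := natDegree_mul_le (p := (1 + g) * derivative f) (q := D)
    have b := natDegree_mul_le (p := 1 + g) (q := derivative f)
    omega
  have h4 : (f * ((1 + g) ^ 2)).coeff (3 * p) = 1 := by
    rw [show 3 * p = 3 + 2 * (3 * m) by omega]
    rw [coeff_mul_add_eq_of_natDegree_le hd.le (by
      refine natDegree_pow_le.trans ?_; omega)]
    rw [coeff_pow_of_natDegree_le h1g, h1gc]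
    rw [← hd, hm.coeff_natDegree]; ring
  rw [h3, coeff_add, show (2 : k[X]) * (f * (1 + g) ^ 2) = C 2 * (f * (1 + g) ^ 2) by rw [c2],
    coeff_C_mul, h4] at hL
  have h5 : (D ^ 3).coeff (3 * p) = -1 := by
    rw [coeff_pow_of_natDegree_le hDn, hDc]; ring
  rw [h5] at hL
  norm_num at hL

lemma id_sub_frob_ne : AddMonoidHom.id E.Pt - frob p hA hB ≠ 0 := by
  intro h
  have := congrArg hdeg (sub_eq_zero.1 h)
  rw [hdeg_id, hdeg_frob] at this
  exact (Fact.out : p.Prime).one_lt.ne this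

lemma id_sub_frob_rat : IsRatPt ⇑(AddMonoidHom.id E.Pt - frob p hA hB) :=
  rat_sub rat_id (frob_rat p hA hB)

lemma id_sub_frob_sep : Sep (AddMonoidHom.id E.Pt - frob p hA hB) := by
  obtain ⟨U, V, H⟩ := exists_AeR (id_sub_frob_rat p hA hB) (id_sub_frob_ne p hA hB)
  refine sep_of_wr (id_sub_frob_rat p hA hB) (id_sub_frob_ne p hA hB) H fun hW => ?_
  obtain ⟨m, hm⟩ := odd_p k p
  have hp1 := (Fact.out : p.Prime).one_lt
  refine frob_wr_aux p E.f_monic E.f_natDegree hm H.nz hW ?_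
  apply poly_eq_of_evX (E := E)
  have hD0 : (X - X ^ p : k[X]) ≠ 0 := by
    intro h
    have := congrArg (fun q => coeff q p) h
    simp [coeff_X, hp1.ne] at this
  filter_upwards [H.ev, ev_polyX_ne hD0, ev_ne 0] with P hP hD hP0
  obtain ⟨h1, h2, h3⟩ := frob_ne p hA hB hP0
  have hx : xc P ≠ xc (-(frob p hA hB P)) := by
    rw [X_neg, h2]; simpa [sub_eq_zero] using hD
  obtain ⟨a1, a2, -⟩ := add_chord hP0 (neg_ne_zero.2 h1) hx
  rw [← sub_eq_add_neg, X_neg, Y_neg, h2, h3] at a2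
  have h4 := hP.2.2
  rw [AddMonoidHom.sub_apply, AddMonoidHom.id_apply, a2, eq_div_iff hP.1] at h4
  have hyp : yc P ^ p = yc P * E.f.eval (xc P) ^ m := by
    rw [← eqn' hP0, hm]; ring
  have hd' : xc P - xc P ^ p ≠ 0 := by simpa using hD
  rw [hyp] at h4
  simp only [eval_mul, eval_sub, eval_add, eval_pow, eval_X, eval_one]
  rw [← h4, ← eqn' hP0]
  field_simp
  ring

end frob

section count
variable (p : ℕ) [Fact p.Prime] [Algebra (ZMod p) k] [CharP k p]

lemma mem_base {x : k} (h : x ^ p = x) : ∃ a : ZMod p, algebraMap (ZMod p) k a = x := by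
  have h1 := (Subfield.mem_bot_iff_pow_eq_self k p).2 h
  rw [← ZMod.fieldRange_castHom_eq_bot p] at h1
  obtain ⟨a, rfl⟩ := h1
  exact ⟨a, by rw [Subsingleton.elim (algebraMap (ZMod p) k) (ZMod.castHom dvd_rfl k)]⟩

lemma frob_base (a : ZMod p) : frobenius k p (algebraMap (ZMod p) k a) = algebraMap (ZMod p) k a := by
  rw [frobenius_def, ← map_pow, ZMod.pow_card]

lemma card_fixed (A B : ZMod p) (hEA : E.A = algebraMap (ZMod p) k A)
    (hEB : E.B = algebraMap (ZMod p) k B) (hA : frobenius k p E.A = E.A)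
    (hB : frobenius k p E.B = E.B) :
    Nat.card (AddMonoidHom.id E.Pt - frob p hA hB).ker = numPoints p A B := by
  have hinj := (algebraMap (ZMod p) k).injective
  set S := {P : ZMod p × ZMod p // P.2 ^ 2 = P.1 ^ 3 + A * P.1 + B}
  have hex : ∀ s : S, ∃ P : E.Pt, P ≠ 0 ∧ xc P = algebraMap (ZMod p) k s.1.1 ∧
      yc P = algebraMap (ZMod p) k s.1.2 := fun s => exists_pt (E := E) (by
    have := congrArg (algebraMap (ZMod p) k) s.2
    simpa [hEA, hEB] using this)
  choose F hF using hex
  have hmem : ∀ P : E.Pt, P ∈ (AddMonoidHom.id E.Pt - frob p hA hB).ker ↔ P = frob p hA hB P := by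
    intro P
    rw [AddMonoidHom.mem_ker, AddMonoidHom.sub_apply, sub_eq_zero, AddMonoidHom.id_apply]
  have hFm : ∀ s, F s ∈ (AddMonoidHom.id E.Pt - frob p hA hB).ker := by
    intro s
    obtain ⟨h1, h2, h3⟩ := hF s
    obtain ⟨g1, g2, g3⟩ := frob_ne p hA hB h1
    rw [hmem]
    refine pt_ext h1 g1 ?_ ?_
    · rw [g2, h2, ← map_pow, ZMod.pow_card]
    · rw [g3, h3, ← map_pow, ZMod.pow_card]
  let G : Option S → (AddMonoidHom.id E.Pt - frob p hA hB).ker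
    | none => 0
    | some s => ⟨F s, hFm s⟩
  have hG : Function.Bijective G := by
    constructor
    · rintro (_ | s) (_ | s') h
      · rfl
      · exact absurd (congrArg Subtype.val h).symm (hF s').1
      · exact absurd (congrArg Subtype.val h) (hF s).1
      · have h' : F s = F s' := congrArg Subtype.val h
        congr 1
        apply Subtype.ext
        apply Prod.ext
        · apply hinj; rw [← (hF s).2.1, h', (hF s').2.1]
        · apply hinj; rw [← (hF s).2.2, h', (hF s').2.2]
    · rintro ⟨P, hP⟩
      by_cases h0 : P = 0
      · exact ⟨none, Subtype.ext h0.symm⟩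
      obtain ⟨g1, g2, g3⟩ := frob_ne p hA hB h0
      rw [hmem] at hP
      rw [← hP] at g2 g3
      obtain ⟨a, ha⟩ := mem_base p g2.symm
      obtain ⟨b, hb⟩ := mem_base p g3.symm
      have hs : b ^ 2 = a ^ 3 + A * a + B := by
        apply hinj
        simp only [map_pow, map_add, map_mul, ha, hb, ← hEA, ← hEB]
        exact eqn h0
      refine ⟨some ⟨(a, b), hs⟩, Subtype.ext ?_⟩
      obtain ⟨f1, f2, f3⟩ := hF ⟨(a, b), hs⟩
      exact pt_ext f1 h0 (by rw [f2, ha]) (by rw [f3, hb])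
  rw [← Nat.card_congr (Equiv.ofBijective G hG), Finite.card_option, numPoints, add_comm]

/-- A curve over `𝔽_p` has an endomorphism squaring to the Frobenius discriminant. -/
lemma exists_sq (A B : ZMod p) (hEA : E.A = algebraMap (ZMod p) k A)
    (hEB : E.B = algebraMap (ZMod p) k B) :
    ∃ α : E.Pt →+ E.Pt, IsRatPt α ∧ ∀ P, α (α P) = (frobTrace p A B ^ 2 - 4 * p) • P := by
  have hA : frobenius k p E.A = E.A := by rw [hEA]; exact frob_base p A
  have hB : frobenius k p E.B = E.B := by rw [hEB]; exact frob_base p B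
  set i := AddMonoidHom.id E.Pt with hi
  set π := frob p hA hB with hπ
  have ri : IsRatPt ⇑i := rat_id
  have rπ : IsRatPt ⇑π := frob_rat p hA hB
  have rππ : IsRatPt ⇑(π.comp π) := rat_comp rπ rπ
  set a := frobTrace p A B with ha
  have h1 : (hdeg (i - π) : ℤ) = p + 1 - a := by
    rw [← id_sub_frob_sep p hA hB, card_fixed p A B hEA hEB hA hB, ha, frobTrace]; ring
  have di : (hdeg i : ℤ) = 1 := by rw [hi, hdeg_id]; rfl
  have dπ : hdeg π = p := hdeg_frob p hA hB
  have b1 : bd i π = a := by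
    have := hdeg_add i (-π)
    rw [← sub_eq_add_neg, h1, hdeg_neg rπ, bd_neg ri rπ, di, dπ] at this
    linarith
  have h2 : (hdeg (i + π) : ℤ) = p + 1 + a := by rw [hdeg_add, di, dπ, b1]; ring
  have h3 : (hdeg (i - π.comp π) : ℤ) = (p + 1) ^ 2 - a ^ 2 := by
    have : i - π.comp π = (i - π).comp (i + π) := by ext P; simp [i]; abel
    rw [this, hdeg_comp (rat_add ri rπ) (rat_sub ri rπ)]
    push_cast
    rw [h1, h2]; ring
  have b2 : bd i (π.comp π) = a ^ 2 - 2 * p := by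
    have := hdeg_add i (-(π.comp π))
    rw [← sub_eq_add_neg, h3, hdeg_neg rππ, bd_neg ri rππ, di, hdeg_comp rπ rπ, dπ] at this
    push_cast at this
    linarith
  have b3 : bd π (π.comp π) = p * a := by
    have := bd_comp_left ri rπ rπ
    rw [b1, dπ] at this
    rw [← this]; rfl
  have rz : IsRatPt ⇑(π.comp π + (-a) • π + (p : ℤ) • i) :=
    rat_add (rat_add rππ (rat_zsmul rπ _)) (rat_zsmul ri _)
  have hz : π.comp π + (-a) • π + (p : ℤ) • i = 0 := by
    apply hdeg_eq_zero rz
    have e1 := hdeg_add (π.comp π + (-a) • π) ((p : ℤ) • i)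
    rw [hdeg_add (π.comp π), hdeg_zsmul rπ, hdeg_zsmul ri, di, dπ, hdeg_comp rπ rπ, dπ,
      bd_zsmul rππ rπ, bd_comm _ π, b3,
      bd_zsmul (rat_add rππ (rat_zsmul rπ _)) ri, bd_comm _ i, bd_add ri rππ (rat_zsmul rπ _),
      bd_zsmul ri rπ, b1, b2] at e1
    push_cast at e1
    have : (hdeg (π.comp π + (-a) • π + (p : ℤ) • i) : ℤ) = 0 := by rw [e1]; ring
    exact_mod_cast this
  refine ⟨(2 : ℤ) • π - a • i, rat_sub (rat_zsmul rπ _) (rat_zsmul ri _), fun P => ?_⟩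
  have hP : π (π P) = a • π P - (p : ℤ) • P := by
    have := DFunLike.congr_fun hz P
    simp [i] at this
    rw [add_assoc, add_eq_zero_iff_eq_neg] at this
    rw [this]; abel
  simp only [AddMonoidHom.sub_apply, AddMonoidHom.smul_apply, map_sub, map_zsmul, hP, i,
    AddMonoidHom.id_apply]
  module

end count
end Ell

namespace Ell
variable {k : Type*} [Field k] [IsAlgClosed k] [CharGood k] {E E' E'' : Ell k}

lemma dvd_of_nodup {M L : k[X]} (hM : M.roots.toFinset.card = M.natDegree) (hM0 : M ≠ 0)
    (h : ∀ x, M.eval x = 0 → L.eval x = 0) : M ∣ L := by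
  by_cases hL : L = 0
  · simp [hL]
  have hn : M.roots.Nodup := by
    rw [← Multiset.toFinset_card_eq_card_iff_nodup, hM, card_roots_closed]
  have hle : M.roots ≤ L.roots := by
    rw [Multiset.le_iff_subset hn]
    intro x hx
    rw [mem_roots hL]
    exact h x ((mem_roots hM0).1 hx)
  exact (IsAlgClosed.splits M).dvd_of_roots_le_roots hM0 hle

lemma ev_not_dvd {U V : k[X]} (hc : IsCoprime U V) (hd : V.natDegree < U.natDegree) {L : k[X]}
    (hL : L ≠ 0) : ∀ᶠ v in Filter.cofinite, ¬ (U - C v * V) ∣ L := by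
  have hf : (Set.image (fun x => U.eval x / V.eval x) (L.roots.toFinset : Set k)).Finite :=
    Set.Finite.image _ (finite_toSet _)
  filter_upwards [hf.eventually_cofinite_notMem] with v hv hdv
  apply hv
  have h1 := natDegree_sub_C_mul hd v
  obtain ⟨x, hx⟩ := IsAlgClosed.exists_root (U - C v * V)
    (by intro h; rw [natDegree_eq_of_degree_eq_some (n := 0) h] at h1; omega)
  obtain ⟨c, rfl⟩ := hdv
  rw [IsRoot.def] at hx
  have hV : V.eval x ≠ 0 := fun h => cop_eval hc (by simpa [h] using hx) h
  refine ⟨x, by simp [hL, hx], ?_⟩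
  simp only [eval_sub, eval_mul, eval_C] at hx
  rw [div_eq_iff hV]; linear_combination hx

/-- A Lüroth-type descent: a rational function constant on generic fibres of `U / V` is a rational
function of `U / V`. -/
lemma descent {U V : k[X]} (hc : IsCoprime U V) (hd : V.natDegree < U.natDegree) (hV : V ≠ 0) :
    ∀ (n : ℕ) (A B : k[X]), A.natDegree ≤ n → B.natDegree ≤ n →
    (∀ᶠ v in Filter.cofinite, ∃ s t : k, (s ≠ 0 ∨ t ≠ 0) ∧ (U - C v * V) ∣ C s * A - C t * B) →
    ∃ a b : k[X], (a ≠ 0 ∨ b ≠ 0) ∧ ∀ᶠ x in Filter.cofinite,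
      b.eval (U.eval x / V.eval x) * A.eval x = a.eval (U.eval x / V.eval x) * B.eval x := by
  intro n
  induction n using Nat.strong_induction_on with
  | _ n ih =>
  intro A B hA hB H
  have : Infinite k := IsAlgClosed.instInfinite
  have hdeg : ∀ s t : k, (C s * A - C t * B).natDegree ≤ n := fun s t =>
    (natDegree_sub_le _ _).trans (max_le ((natDegree_C_mul_le _ _).trans hA)
      ((natDegree_C_mul_le _ _).trans hB))
  have hzero : ∀ s t : k, (s ≠ 0 ∨ t ≠ 0) → C s * A - C t * B = 0 →
      ∃ a b : k[X], (a ≠ 0 ∨ b ≠ 0) ∧ ∀ᶠ x in Filter.cofinite,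
      b.eval (U.eval x / V.eval x) * A.eval x = a.eval (U.eval x / V.eval x) * B.eval x := by
    intro s t hst h0
    refine ⟨C t, C s, by rw [or_comm]; simpa using hst, Filter.Eventually.of_forall fun x => ?_⟩
    have := congrArg (eval x) h0
    simp only [eval_sub, eval_mul, eval_C, eval_zero] at this ⊢
    linear_combination this
  obtain ⟨w1, s1, t1, hst1, A1, hA1⟩ := H.exists
  by_cases hL1 : C s1 * A - C t1 * B = 0
  · exact hzero s1 t1 hst1 hL1
  obtain ⟨w2, ⟨s2, t2, hst2, B1, hB1⟩, hw2⟩ := (H.and (ev_not_dvd hc hd hL1)).exists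
  by_cases hL2 : C s2 * A - C t2 * B = 0
  · exact hzero s2 t2 hst2 hL2
  have hdet : s1 * t2 - s2 * t1 ≠ 0 := by
    intro h0
    apply hw2
    have : ∃ r : k, s1 = r * s2 ∧ t1 = r * t2 := by
      by_cases hs : s2 = 0
      · have ht : t2 ≠ 0 := by simpa [hs] using hst2
        refine ⟨t1 / t2, ?_, by field_simp⟩
        have : s1 * t2 = 0 := by rw [hs] at h0; simpa using h0
        rw [hs]; simpa [ht] using this
      · refine ⟨s1 / s2, by field_simp, ?_⟩
        field_simp; linear_combination -h0
    obtain ⟨r, h1, h2⟩ := this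
    refine Dvd.intro (B1 * C r) ?_
    rw [← mul_assoc, ← hB1, h1, h2]; simp only [C_mul]; ring
  have hM : ∀ w L, L ≠ 0 → L.natDegree ≤ n → ∀ Q, L = (U - C w * V) * Q →
      Q.natDegree ≤ n - 1 ∧ 0 < n := by
    intro w L hL hLn Q hQ
    have hU := natDegree_sub_C_mul hd w
    have h1 : U - C w * V ≠ 0 := by rintro h; rw [h] at hQ; simp [hQ] at hL
    have h2 : Q ≠ 0 := by rintro rfl; simp [hQ] at hL
    rw [hQ, natDegree_mul h1 h2, hU] at hLn
    omega
  obtain ⟨dA, hn⟩ := hM w1 _ hL1 (hdeg s1 t1) A1 hA1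
  obtain ⟨dB, -⟩ := hM w2 _ hL2 (hdeg s2 t2) B1 hB1
  obtain ⟨a1, b1, hab, hev⟩ := ih (n - 1) (by omega) A1 B1 dA dB (by
    filter_upwards [H, (Set.finite_singleton w1).eventually_cofinite_notMem,
      (Set.finite_singleton w2).eventually_cofinite_notMem] with v ⟨s, t, hst, hdv⟩ h1 h2
    have h1' : v - w1 ≠ 0 := sub_ne_zero.2 (by simpa using h1)
    have h2' : v - w2 ≠ 0 := sub_ne_zero.2 (by simpa using h2)
    -- coordinates of `(s, t)` in the new basis
    have e1 : s * t2 - s2 * t ≠ 0 ∨ s * t1 - s1 * t ≠ 0 := by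
      by_contra! h
      rcases hst with h3 | h3
      · exact mul_ne_zero hdet h3 (by linear_combination s1 * h.1 - s2 * h.2)
      · exact mul_ne_zero hdet h3 (by linear_combination t1 * h.1 - t2 * h.2)
    refine ⟨(v - w1) * (s * t2 - s2 * t), (v - w2) * (s * t1 - s1 * t), ?_, ?_⟩
    · rcases e1 with h | h
      · exact Or.inl (mul_ne_zero h1' h)
      · exact Or.inr (mul_ne_zero h2' h)
    · have hcop : IsCoprime (U - C v * V) V := by
        simpa [sub_eq_add_neg] using hc.add_mul_right_left (-C v)
      refine hcop.dvd_of_dvd_mul_left ?_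
      have : V * (C ((v - w1) * (s * t2 - s2 * t)) * A1 - C ((v - w2) * (s * t1 - s1 * t)) * B1) =
          C (s1 * t2 - s2 * t1) * (C s * A - C t * B) - (U - C v * V) *
            (C (s * t2 - s2 * t) * A1 - C (s * t1 - s1 * t) * B1) := by
        have hA1' : C s1 * A - C t1 * B = (U - C v * V) * A1 + C (v - w1) * V * A1 := by
          rw [hA1, C_sub]; ring
        have hB1' : C s2 * A - C t2 * B = (U - C v * V) * B1 + C (v - w2) * V * B1 := by
          rw [hB1, C_sub]; ring
        simp only [C_mul, C_sub] at hA1' hB1' ⊢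
        linear_combination (C s * C t2 - C s2 * C t) * (-hA1') + (C s * C t1 - C s1 * C t) * hB1'
      rw [this]
      exact dvd_sub (hdv.mul_left _) (dvd_mul_right _ _))
  refine ⟨C t1 * (b1 * (X - C w2)) - C t2 * (a1 * (X - C w1)),
    C s1 * (b1 * (X - C w2)) - C s2 * (a1 * (X - C w1)), ?_, ?_⟩
  · by_contra! h
    have hdet' : (C (s1 * t2 - s2 * t1) : k[X]) ≠ 0 := by rw [Ne, C_eq_zero]; exact hdet
    have ha : C (s1 * t2 - s2 * t1) * (a1 * (X - C w1)) = 0 := by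
      simp only [C_mul, C_sub]; linear_combination C t1 * h.2 - C s1 * h.1
    have hb : C (s1 * t2 - s2 * t1) * (b1 * (X - C w2)) = 0 := by
      simp only [C_mul, C_sub]; linear_combination C t2 * h.2 - C s2 * h.1
    have ha' := (mul_eq_zero.1 ((mul_eq_zero.1 ha).resolve_left hdet')).resolve_right
      (X_sub_C_ne_zero _)
    have hb' := (mul_eq_zero.1 ((mul_eq_zero.1 hb).resolve_left hdet')).resolve_right
      (X_sub_C_ne_zero _)
    simp [ha', hb'] at hab
  · filter_upwards [hev, ev_poly_ne hV] with x hx hVx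
    have e1 := congrArg (eval x) hA1
    have e2 := congrArg (eval x) hB1
    simp only [eval_sub, eval_mul, eval_C, eval_X] at e1 e2 ⊢
    have hU : U.eval x = (U.eval x / V.eval x) * V.eval x := by field_simp
    set r := U.eval x / V.eval x
    rw [hU] at e1 e2
    linear_combination (b1.eval r * (r - w2)) * e1 - (a1.eval r * (r - w1)) * e2 +
      (r - w1) * (r - w2) * V.eval x * hx

end Ell

namespace Ell
variable {k : Type*} [Field k] [IsAlgClosed k] [CharGood k] {E E' E'' : Ell k}

lemma ev_of_comp {χ : E.Pt →+ E'.Pt} (hχ : IsRatPt χ) (h0 : χ ≠ 0) {p : E'.Pt → Prop}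
    (h : ∀ᶠ P in Filter.cofinite, p (χ P)) : ∀ᶠ Q in Filter.cofinite, p Q := by
  rw [Filter.eventually_cofinite] at h ⊢
  refine (h.image χ).subset fun Q hQ => ?_
  obtain ⟨P, rfl⟩ := hom_surj hχ h0 Q
  exact ⟨P, hQ, rfl⟩

lemma IsRat.descend {χ : E.Pt →+ E'.Pt} (hχ : IsRatPt χ) (h0 : χ ≠ 0) (hs : Sep χ)
    {h : E'.Pt → k} (he : ∀ᶠ Q in Filter.cofinite, h (-Q) = h Q)
    (hr : IsRat (fun P => h (χ P))) :
    IsRat h := by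
  obtain ⟨U, V, H⟩ := exists_AeR hχ h0
  have ht := hom_tendsto hχ h0
  obtain ⟨A, B, hB, hAB⟩ := hr.even (by
    filter_upwards [ht.eventually he] with P hP
    rw [map_neg, hP])
  have hAB' : ∀ᶠ Q in Filter.cofinite, ∀ P, χ P = Q → B.eval (xc P) * h Q = A.eval (xc P) := by
    rw [Filter.eventually_cofinite] at hAB ⊢
    refine (hAB.image χ).subset fun Q hQ => ?_
    simp only [Set.mem_ofPred_eq, not_forall] at hQ
    obtain ⟨P, rfl, hP⟩ := hQ
    exact ⟨P, hP, rfl⟩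
  have key : ∀ᶠ v in Filter.cofinite, ∃ s t : k, (s ≠ 0 ∨ t ≠ 0) ∧
      (U - C v * V) ∣ C s * A - C t * B := by
    refine of_ev_X (E := E') ?_
    filter_upwards [hAB', he, ev_X (Sep.ev_nodup hχ h0 H hs), tendsto_neg.eventually hAB', ev_ne 0]
      with Q h1 h2 h3 h4 hQ
    refine ⟨1, h Q, by simp, dvd_of_nodup (by rw [h3, natDegree_sub_C_mul H.deg]) ?_ ?_⟩
    · intro h
      have := natDegree_sub_C_mul H.deg (xc Q)
      have := H.deg
      rw [h] at *; simp at *; omega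
    · intro x hx
      obtain ⟨P, hP, rfl⟩ := X_surj (E := E) x
      obtain ⟨h5, h6⟩ := H.hasR.exists_root _ hx hP rfl
      simp only [eval_sub, eval_mul, eval_C]
      rcases eq_or_neg_of_X_eq h5 hQ h6 with h | h
      · linear_combination - h1 P h
      · have := h4 P h
        rw [h2] at this
        linear_combination - this
  obtain ⟨a, b, hab, hev⟩ := descent H.cop H.deg H.nz (max A.natDegree B.natDegree) A B
    (le_max_left _ _) (le_max_right _ _) key
  have hfin : ∀ᶠ Q in Filter.cofinite, b.eval (xc Q) * h Q = a.eval (xc Q) := by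
    refine ev_of_comp hχ h0 ?_
    filter_upwards [ev_X hev, hAB, ev_X (ev_poly_ne hB), H.ev] with P h1 h2 h3 ⟨_, _, h4⟩
    rw [← h4] at h1
    apply mul_left_cancel₀ h3
    linear_combination h1 + b.eval (xc (χ P)) * h2
  refine ⟨a, 0, b, ?_, by simpa using hfin⟩
  rintro rfl
  have ha : a ≠ 0 := by simpa using hab
  obtain ⟨Q, h1, h2⟩ := (hfin.and (ev_polyX_ne ha)).exists
  simp at h1
  exact h2 h1.symm

/-- A homomorphism killing the kernel of a separable one factors through it. -/
lemma factor {χ : E.Pt →+ E'.Pt} (hχ : IsRatPt χ) (h0 : χ ≠ 0) (hs : Sep χ)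
    {β : E.Pt →+ E''.Pt} (hβ : IsRatPt β) (hk : χ.ker ≤ β.ker) :
    ∃ γ : E'.Pt →+ E''.Pt, IsRatPt γ ∧ ∀ P, γ (χ P) = β P := by
  let γ := χ.liftOfSurjective (hom_surj hχ h0) ⟨β, hk⟩
  have hγ : ∀ P, γ (χ P) = β P := fun P => by
    exact χ.liftOfRightInverse_comp_apply _
      (Function.rightInverse_surjInv (hom_surj hχ h0)) ⟨β, hk⟩ P
  refine ⟨γ, ?_, hγ⟩
  rcases hβ with hb | ⟨h1, h2, h3⟩
  · left
    exact ev_of_comp hχ h0 (by simpa only [hγ] using hb)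
  · right
    have hx : IsRat (fun P => xc (γ P)) := IsRat.descend hχ h0 hs
      (Filter.Eventually.of_forall fun Q => by simp) (by simpa only [hγ] using h2)
    refine ⟨ev_of_comp hχ h0 (by simpa only [hγ] using h1), hx, ?_⟩
    rcases hχ with hc | ⟨_, _, hcy⟩
    · exact absurd (hom_eq_of_ev (ψ := 0) (by simpa using hc)) h0
    have hχ : IsRatPt χ := Or.inr ⟨by assumption, by assumption, hcy⟩
    have hq : IsRat (fun P => yc (γ P) / yc P) := by
      refine IsRat.descend hχ h0 hs (Filter.Eventually.of_forall fun Q => by simp [neg_div_neg_eq]) ?_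
      simpa only [hγ] using h3.div hcy
    refine (hq.mul IsRat.y).congr ?_
    filter_upwards [ev_Y_ne] with P hP
    rw [div_mul_cancel₀ _ hP]

end Ell

namespace Ell
variable {k : Type*} [Field k] [IsAlgClosed k] [CharGood k] {E E' E'' : Ell k}

lemma exists_sq_of_coprime {x y w : k[X]} (h : IsCoprime x y) (hw : x * y = w ^ 2) :
    ∃ r, x = r ^ 2 := by
  obtain ⟨d, c, hd⟩ := exists_associated_pow_of_mul_eq_pow' h hw
  obtain ⟨c', hc', hc⟩ := isUnit_iff.1 c.isUnit
  obtain ⟨r, hr⟩ := IsAlgClosed.exists_pow_nat_eq c' (n := 2) (by norm_num)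
  refine ⟨d * C r, ?_⟩
  rw [← hd, ← hc, ← hr, C_pow]; ring

/-- If four independent combinations of two coprime polynomials are squares, the polynomials are
constant. -/
lemma const_of_four_sq : ∀ (n : ℕ) (a b : k[X]) (s t : Fin 4 → k), IsCoprime a b →
    a.natDegree ≤ n → b.natDegree ≤ n → (∀ i j, i ≠ j → s i * t j - s j * t i ≠ 0) →
    (∀ i, ∃ w : k[X], C (s i) * a + C (t i) * b = w ^ 2) → a.natDegree = 0 ∧ b.natDegree = 0 := by
  intro n
  induction n using Nat.strong_induction_on with
  | _ n ih =>
  intro a b s t hc ha hb hst hw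
  by_cases hn : n = 0
  · subst hn; omega
  choose w hw using hw
  have h01 := hst 0 1 (by decide)
  have ea : C (s 0 * t 1 - s 1 * t 0) * a = C (t 1) * w 0 ^ 2 - C (t 0) * w 1 ^ 2 := by
    rw [← hw, ← hw]; simp only [C_sub, C_mul]; ring
  have eb : C (s 0 * t 1 - s 1 * t 0) * b = C (s 0) * w 1 ^ 2 - C (s 1) * w 0 ^ 2 := by
    rw [← hw, ← hw]; simp only [C_sub, C_mul]; ring
  have hcw : IsCoprime (w 0) (w 1) := by
    refine isCoprime_of_eval fun q h0 h1 => ?_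
    have e1 := congrArg (eval q) ea
    have e2 := congrArg (eval q) eb
    simp only [eval_mul, eval_C, eval_sub, eval_pow, h0, h1] at e1 e2
    refine cop_eval hc (q := q) ?_ ?_
    · apply mul_left_cancel₀ h01; rw [e1]; ring
    · apply mul_left_cancel₀ h01; rw [e2]; ring
  have hdw : ∀ i, (w i).natDegree ≤ n / 2 := by
    intro i
    have : (w i ^ 2).natDegree ≤ n := by
      rw [← hw]
      exact natDegree_add_le_of_degree_le ((natDegree_C_mul_le _ _).trans ha)
        ((natDegree_C_mul_le _ _).trans hb)
    rw [natDegree_pow] at this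
    omega
  -- the other two combinations
  have hsplit : ∀ i, i ≠ 0 → i ≠ 1 → ∃ γ : k, γ ≠ 0 ∧
      (s i * t 1 - s 1 * t i) * γ ^ 2 = s i * t 0 - s 0 * t i ∧
      (∃ r, w 0 - C γ * w 1 = r ^ 2) ∧ (∃ r, w 0 + C γ * w 1 = r ^ 2) := by
    intro i hi0 hi1
    have hα := hst i 1 hi1
    have hβ := hst i 0 hi0
    obtain ⟨γ, hγ⟩ := IsAlgClosed.exists_pow_nat_eq
      ((s i * t 0 - s 0 * t i) / (s i * t 1 - s 1 * t i)) (n := 2) (by norm_num)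
    obtain ⟨δ, hδ⟩ := IsAlgClosed.exists_pow_nat_eq
      ((s 0 * t 1 - s 1 * t 0) / (s i * t 1 - s 1 * t i)) (n := 2) (by norm_num)
    have hγ0 : γ ≠ 0 := by
      rintro rfl
      have : (s i * t 0 - s 0 * t i) / (s i * t 1 - s 1 * t i) ≠ 0 := div_ne_zero hβ hα
      exact this (by rw [← hγ]; ring)
    rw [eq_div_iff hα] at hγ hδ
    have hprod : (w 0 - C γ * w 1) * (w 0 + C γ * w 1) = (C δ * w i) ^ 2 := by
      have hne : (C (s i * t 1 - s 1 * t i) : k[X]) ≠ 0 := by rw [Ne, C_eq_zero]; exact hα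
      apply mul_left_cancel₀ hne
      have h1 : (C (s i * t 1 - s 1 * t i) : k[X]) * C γ ^ 2 = C (s i * t 0 - s 0 * t i) := by
        rw [← C_pow, ← C_mul, mul_comm, hγ]
      have h2 : (C (s i * t 1 - s 1 * t i) : k[X]) * C δ ^ 2 = C (s 0 * t 1 - s 1 * t 0) := by
        rw [← C_pow, ← C_mul, mul_comm, hδ]
      have h3 : C (s i * t 1 - s 1 * t i) * ((w 0 - C γ * w 1) * (w 0 + C γ * w 1)) =
        C (s i * t 1 - s 1 * t i) * w 0 ^ 2 - C (s i * t 0 - s 0 * t i) * w 1 ^ 2 := by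
        linear_combination -w 1 ^ 2 * h1
      rw [h3, mul_pow, ← mul_assoc, h2, ← hw, ← hw, ← hw]
      simp only [C_sub, C_mul]; ring
    have hcop : IsCoprime (w 0 - C γ * w 1) (w 0 + C γ * w 1) := by
      refine isCoprime_of_eval fun q h0 h1 => ?_
      simp only [eval_mul, eval_C, eval_sub, eval_add] at h0 h1
      have e0 : (w 0).eval q = 0 := by
        apply mul_left_cancel₀ CharGood.two; linear_combination h0 + h1
      have e1 : (w 1).eval q = 0 := by
        apply mul_left_cancel₀ hγ0; linear_combination h1 - e0
      exact cop_eval hcw e0 e1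
    exact ⟨γ, hγ0, by rw [mul_comm, hγ], exists_sq_of_coprime hcop hprod,
      exists_sq_of_coprime hcop.symm (by rw [mul_comm]; exact hprod)⟩
  obtain ⟨γ, hγ0, hγ, r1, r2⟩ := hsplit 2 (by decide) (by decide)
  obtain ⟨δ, hδ0, hδ, r3, r4⟩ := hsplit 3 (by decide) (by decide)
  have h23 := hst 2 3 (by decide)
  have hne : γ ^ 2 - δ ^ 2 ≠ 0 := by
    intro h
    apply mul_ne_zero h01 h23
    linear_combination -(s 3 * t 1 - s 1 * t 3) * hγ + (s 2 * t 1 - s 1 * t 2) * hδ + (s 2 * t 1 - s 1 * t 2) * (s 3 * t 1 - s 1 * t 3) * h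
  have hm : γ - δ ≠ 0 := fun h => hne (by linear_combination (γ + δ) * h)
  have hp : γ + δ ≠ 0 := fun h => hne (by linear_combination (γ - δ) * h)
  have h2 : (2 : k) ≠ 0 := CharGood.two
  have h2γ := mul_ne_zero h2 hγ0
  have h2δ := mul_ne_zero h2 hδ0
  obtain ⟨hw0, hw1⟩ := ih (n / 2) (by omega) (w 0) (w 1) (fun _ => 1) ![-γ, γ, -δ, δ] hcw (hdw 0) (hdw 1)
    (by
      have key : ∀ u v : k, u - v ≠ 0 → 1 * u - 1 * v ≠ 0 := by simp
      intro i j hij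
      apply key
      fin_cases i <;> fin_cases j <;> first | exact absurd rfl hij | skip
      all_goals
        simp only [Fin.zero_eta, Fin.mk_one, Fin.reduceFinMk, Matrix.cons_val]
        intro h
        first
          | exact h2γ (by linear_combination h)
          | exact h2γ (by linear_combination -h)
          | exact h2δ (by linear_combination h)
          | exact h2δ (by linear_combination -h)
          | exact hm (by linear_combination h)
          | exact hm (by linear_combination -h)
          | exact hp (by linear_combination h)
          | exact hp (by linear_combination -h))
    (by
      intro i
      fin_cases i
      · simpa [sub_eq_add_neg] using r1
      · simpa using r2
      · simpa [sub_eq_add_neg] using r3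
      · simpa using r4)
  have hsq : ∀ c d : k, (C c * w 0 ^ 2 - C d * w 1 ^ 2).natDegree = 0 := by
    intro c d
    rw [eq_C_of_natDegree_eq_zero hw0, eq_C_of_natDegree_eq_zero hw1, ← C_pow, ← C_pow, ← C_mul,
      ← C_mul, ← C_sub, natDegree_C]
  have hsq' : ∀ c d : k, (C c * w 1 ^ 2 - C d * w 0 ^ 2).natDegree = 0 := by
    intro c d
    rw [eq_C_of_natDegree_eq_zero hw0, eq_C_of_natDegree_eq_zero hw1, ← C_pow, ← C_pow, ← C_mul,
      ← C_mul, ← C_sub, natDegree_C]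
  constructor
  · rw [← natDegree_C_mul h01, ea, hsq]
  · rw [← natDegree_C_mul h01, eb, hsq']

/-- The three distinct abscissae of the points of order two. -/
lemma exists_roots (E : Ell k) : ∃ e1 e2 e3 : k, e1 ≠ e2 ∧ e1 ≠ e3 ∧ e2 ≠ e3 ∧
    e1 + e2 + e3 = 0 ∧ E.A = e1 * e2 + e1 * e3 + e2 * e3 ∧ E.B = -(e1 * e2 * e3) ∧
    ∀ x, E.f.eval x = (x - e1) * (x - e2) * (x - e3) := by
  have hc : Multiset.card E.f.roots = 3 := by rw [card_roots_closed, f_natDegree]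
  obtain ⟨e1, e2, e3, he⟩ := Multiset.card_eq_three.1 hc
  have hf : E.f = (X - C e1) * (X - C e2) * (X - C e3) := by
    have := (IsAlgClosed.splits E.f).eq_prod_roots_of_monic (f_monic E)
    rw [he] at this
    rw [this]; simp [mul_assoc]
  have hev : ∀ x, E.f.eval x = (x - e1) * (x - e2) * (x - e3) := fun x => by rw [hf]; simp
  have h0 := hev 0
  have h1 := hev 1
  have h2 := hev (-1)
  rw [eval_f] at h0 h1 h2
  have hB : E.B = -(e1 * e2 * e3) := by linear_combination h0
  have hs : e1 + e2 + e3 = 0 := by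
    apply mul_left_cancel₀ CharGood.two; linear_combination h1 + h2 - 2 * h0
  have hA : E.A = e1 * e2 + e1 * e3 + e2 * e3 := by
    apply mul_left_cancel₀ CharGood.two; linear_combination h1 - h2
  have hd : 4 * E.A ^ 3 + 27 * E.B ^ 2 = - ((e1 - e2) * (e1 - e3) * (e2 - e3)) ^ 2 := by
    have : e3 = - e1 - e2 := by linear_combination hs
    rw [hA, hB, this]; ring
  have hne : (e1 - e2) * (e1 - e3) * (e2 - e3) ≠ 0 := by
    intro h; apply E.disc; rw [hd, h]; ring
  refine ⟨e1, e2, e3, ?_, ?_, ?_, hs, hA, hB, hev⟩ <;> rintro rfl <;> simp at hne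

/-- Even rational maps between curves are constant. -/
lemma const_of_even {u : E.Pt → E'.Pt} (hu : IsRatPt u) (he : ∀ᶠ P in Filter.cofinite, u (-P) = u P) :
    ∃ Q, ∀ᶠ P in Filter.cofinite, u P = Q := by
  have hu0 := hu
  rcases hu with h | ⟨h1, h2, h3⟩
  · exact ⟨0, h⟩
  obtain ⟨a, d, hd, hx⟩ := h2.even (by filter_upwards [he] with P h; rw [h])
  obtain ⟨a', d', hd', hy⟩ := h3.even (by filter_upwards [he] with P h; rw [h])
  obtain ⟨U, V, g, rfl, rfl, hc, hg⟩ := exists_coprime a d hd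
  have hV : V ≠ 0 := by rintro rfl; simp at hd
  have hxV : ∀ᶠ P in Filter.cofinite, V.eval (xc P) ≠ 0 ∧ xc (u P) = U.eval (xc P) / V.eval (xc P) := by
    filter_upwards [hx, ev_polyX_ne hg, ev_polyX_ne hV] with P h1 h2 h3
    refine ⟨h3, ?_⟩
    rw [eq_div_iff h3]
    apply mul_left_cancel₀ h2
    simp only [eval_mul] at h1
    linear_combination h1
  obtain ⟨e1, e2, e3, h12, h13, h23, hs, hA, hB, hf⟩ := exists_roots E'
  set p1 := U - C e1 * V with hp1
  set p2 := U - C e2 * V with hp2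
  set p3 := U - C e3 * V with hp3
  have hkey : d' ^ 2 * (V * (p1 * (p2 * p3))) = (a' * V ^ 2) ^ 2 := by
    refine poly_eq_of_evX (E := E) ?_
    filter_upwards [hxV, hy, h1] with P ⟨h1, h2⟩ h3 h4
    have h5 := eqn' h4
    rw [hf, h2] at h5
    have h6 : yc (u P) ^ 2 * V.eval (xc P) ^ 4 = V.eval (xc P) * ((U.eval (xc P) - e1 * V.eval (xc P)) *
      ((U.eval (xc P) - e2 * V.eval (xc P)) * (U.eval (xc P) - e3 * V.eval (xc P)))) := by
      rw [h5]; field_simp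
    simp only [hp1, hp2, hp3, eval_mul, eval_pow, eval_sub, eval_C]
    rw [← h6, ← h3]; ring
  obtain ⟨c, hc'⟩ : d' ∣ a' * V ^ 2 := by
    rw [← UniqueFactorizationMonoid.pow_dvd_pow_iff_dvd two_ne_zero]; exact ⟨_, hkey.symm⟩
  have hsq : V * (p1 * (p2 * p3)) = c ^ 2 := by
    apply mul_left_cancel₀ (pow_ne_zero 2 hd'); rw [hkey, hc']; ring
  have copV : ∀ e, IsCoprime (U - C e * V) V := fun e => by
    simpa [sub_eq_add_neg] using hc.add_mul_right_left (-C e)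
  have cop : ∀ e e', e ≠ e' → IsCoprime (U - C e * V) (U - C e' * V) := by
    intro e e' hee
    refine isCoprime_of_eval fun q h0 h1 => ?_
    simp only [eval_mul, eval_C, eval_sub] at h0 h1
    have e0 : V.eval q = 0 := by
      apply mul_left_cancel₀ (sub_ne_zero.2 hee); linear_combination h1 - h0
    have e1 : U.eval q = 0 := by linear_combination h0 + e * e0
    exact cop_eval hc e1 e0
  have s0 := exists_sq_of_coprime (((copV e1).mul_left ((copV e2).mul_left (copV e3))).symm) hsq
  have s1 := exists_sq_of_coprime (x := p1) (y := V * (p2 * p3)) ((copV e1).mul_right ((cop _ _ h12).mul_right (cop _ _ h13)))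
    (by rw [← hsq]; ring)
  have s2 := exists_sq_of_coprime (x := p2) (y := V * (p1 * p3)) ((copV e2).mul_right ((cop _ _ h12.symm).mul_right (cop _ _ h23)))
    (by rw [← hsq]; ring)
  have s3 := exists_sq_of_coprime (x := p3) (y := V * (p1 * p2)) ((copV e3).mul_right ((cop _ _ h13.symm).mul_right (cop _ _ h23.symm)))
    (by rw [← hsq]; ring)
  obtain ⟨dU, dV⟩ := const_of_four_sq (max U.natDegree V.natDegree) U V ![0, 1, 1, 1] ![1, -e1, -e2, -e3]
    hc (le_max_left _ _) (le_max_right _ _) (by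
      have g12 := sub_ne_zero.2 h12
      have g13 := sub_ne_zero.2 h13
      have g23 := sub_ne_zero.2 h23
      intro i j hij
      fin_cases i <;> fin_cases j <;> first | exact absurd rfl hij | skip
      all_goals
        simp only [Fin.zero_eta, Fin.mk_one, Fin.reduceFinMk, Matrix.cons_val]
        intro h
        first
          | exact one_ne_zero (α := k) (by linear_combination h)
          | exact one_ne_zero (α := k) (by linear_combination -h)
          | exact g12 (by linear_combination h)
          | exact g12 (by linear_combination -h)
          | exact g13 (by linear_combination h)
          | exact g13 (by linear_combination -h)
          | exact g23 (by linear_combination h)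
          | exact g23 (by linear_combination -h))
    (by
      intro i
      fin_cases i
      · simpa using s0
      · simpa [sub_eq_add_neg, hp1] using s1
      · simpa [sub_eq_add_neg, hp2] using s2
      · simpa [sub_eq_add_neg, hp3] using s3)
  rw [eq_C_of_natDegree_eq_zero dU, eq_C_of_natDegree_eq_zero dV] at hxV
  simp only [eval_C] at hxV
  obtain ⟨P0, hP0, hx0⟩ := (h1.and hxV).exists
  rcases hu0.eq_or (IsRatPt.const (u P0)) with h | h
  · exact ⟨_, h⟩
  · refine ⟨- u P0, ?_⟩
    filter_upwards [h, h1, hxV] with P a b c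
    exact (eq_or_neg_of_X_eq b hP0 (by rw [c.2, hx0.2])).resolve_left a

end Ell

namespace Ell
variable {k : Type*} [Field k] [IsAlgClosed k] [CharGood k] {E E' E'' : Ell k}

lemma exists_half (Q : E.Pt) : ∃ R : E.Pt, R + R = Q := by
  have h0 : AddMonoidHom.id E.Pt + AddMonoidHom.id E.Pt ≠ 0 := by
    intro h
    have := hdeg_two (E := E)
    rw [h, hdeg_zero] at this; simp at this
  obtain ⟨R, hR⟩ := hom_surj (rat_add rat_id rat_id) h0 Q
  exact ⟨R, by simpa using hR⟩

lemma AeR.tendsto {φ : E.Pt → E'.Pt} {U V : k[X]} (H : AeR φ U V) :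
    Filter.Tendsto φ Filter.cofinite Filter.cofinite := by
  refine Filter.Tendsto.cofinite_of_finite_preimage_singleton fun R => ?_
  have h1 := natDegree_sub_C_mul H.deg (xc R)
  have h2 : U - C (xc R) * V ≠ 0 := by
    intro h; have := H.deg; rw [h] at h1; simp at h1; omega
  have h3 : ∀ᶠ P in Filter.cofinite, φ P ≠ R := by
    filter_upwards [H.ev, ev_polyX_ne h2] with P ⟨a, b, c⟩ d h
    apply d
    rw [← h, c]
    simp only [eval_sub, eval_mul, eval_C]
    field_simp; simp
  have h4 : {P | φ P = R}.Finite := by simpa [Filter.eventually_cofinite] using h3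
  exact h4

/-- An odd nonconstant rational map is almost everywhere a homomorphism. -/
lemma exists_hom {φ : E.Pt → E'.Pt} (hφ : IsRatPt φ) {U V : k[X]} (H : AeR φ U V)
    (ho : ∀ᶠ P in Filter.cofinite, φ (-P) = - φ P) :
    ∃ c : E.Pt →+ E'.Pt, IsRatPt c ∧ ∀ᶠ P in Filter.cofinite, φ P = c P := by
  have s1 : ∀ Q, ∃ c, ∀ᶠ P in Filter.cofinite, φ (P + Q) - φ (P - Q) = c := by
    intro Q
    refine const_of_even ?_ ?_
    · exact (IsRatPt.comp (IsRatPt.trans Q) (tendsto_add Q) hφ).sub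
        (by simpa [sub_eq_add_neg] using
          IsRatPt.comp (IsRatPt.trans (-Q)) (tendsto_add (-Q)) hφ)
    · filter_upwards [(tendsto_add Q).eventually ho, ev_sub Q ho] with P h1 h2
      have e1 : -P + Q = -(P - Q) := by abel
      have e2 : -P - Q = -(P + Q) := by abel
      rw [e1, e2, h1, h2]; abel
  have s2 : ∀ Q, ∃ c, ∀ᶠ P in Filter.cofinite, φ (P + Q) = φ P + c := by
    intro Q'
    obtain ⟨Q, rfl⟩ := exists_half Q'
    obtain ⟨c, hc⟩ := s1 Q
    refine ⟨c, ?_⟩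
    filter_upwards [(tendsto_add Q).eventually hc] with P h
    rw [← h, add_assoc, add_sub_cancel_right]; abel
  choose c hc using s2
  have hadd : ∀ Q Q', c (Q + Q') = c Q + c Q' := by
    intro Q Q'
    obtain ⟨P, h1, h2, h3⟩ :=
      ((hc (Q + Q')).and ((hc Q).and ((tendsto_add Q).eventually (hc Q')))).exists
    rw [add_assoc, h2, h1] at h3
    exact add_left_cancel (h3.trans (add_assoc _ _ _))
  let c' : E.Pt →+ E'.Pt := AddMonoidHom.mk' c hadd
  have hpm : ∀ᶠ P in Filter.cofinite, c P = φ P ∨ c P = - φ P := by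
    filter_upwards [H.ev, ev_ne 0] with Q ⟨h1, h2, h3⟩ hQ
    have := H.translate hQ (c := c Q) (by
      filter_upwards [hc Q, hc (-Q)] with P a b
      refine ⟨a, ?_⟩
      have : c (-Q) = - c Q := map_neg c' Q
      rw [sub_eq_add_neg, b, this, sub_eq_add_neg])
    rcases this with ⟨_, h⟩ | ⟨h4, _, h5⟩
    · exact absurd h h1
    · exact eq_or_neg_of_X_eq h4 h2 (by rw [h5, h3])
  have h2φ : ∀ᶠ P in Filter.cofinite, φ P + φ P ≠ 0 := H.tendsto.eventually ev_double_ne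
  obtain ⟨Q, hQ1, hQ2⟩ := (hpm.and h2φ).exists
  have h2c : c Q + c Q ≠ 0 := by
    rcases hQ1 with h | h
    · rwa [h]
    · rw [h]; intro h'; apply hQ2; rw [← neg_eq_zero, ← h']; abel
  have hfin : ∀ᶠ P in Filter.cofinite, c P = φ P := by
    filter_upwards [hpm, (tendsto_add Q).eventually hpm, hc Q, h2φ] with P h1 h2 h3 h4
    rcases h1 with h1 | h1
    · exact h1
    exfalso
    rw [hadd, h3, h1] at h2
    rcases h2 with h2 | h2
    · have := add_right_cancel h2
      exact h4 (by nth_rewrite 1 [← this]; abel)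
    · rw [neg_add] at h2
      have := add_left_cancel h2
      exact h2c (by nth_rewrite 1 [this]; abel)
  exact ⟨c', hφ.congr hfin, by filter_upwards [hfin] with P h; exact h.symm⟩

end Ell

namespace Ell
variable {k : Type*} [Field k] [IsAlgClosed k] [CharGood k] {E E' E'' : Ell k}

/-- The numerator of `x(P + Q) + x(P - Q)` as a polynomial in `x(P)`, with `q = x(Q)`. -/
def sNum (E : Ell k) (q : k) : k[X] := C 2 * ((X + C q) * (C q * X + C E.A) + C (2 * E.B))

lemma sNum_eval (q x : k) : (E.sNum q).eval x = 2 * ((x + q) * (q * x + E.A) + 2 * E.B) := by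
  simp [sNum]

lemma sNum_deriv (q x : k) : (derivative (E.sNum q)).eval x = 2 * ((q * x + E.A) + (x + q) * q) := by
  simp [sNum]

lemma sNum_natDegree (q : k) : (E.sNum q).natDegree ≤ 2 := by
  unfold sNum; compute_degree

lemma sum_Y {P Q : E.Pt} (hP : P ≠ 0) (hQ : Q ≠ 0) (h : xc P ≠ xc Q) :
    (yc (P + Q) + yc (P - Q)) * (xc P - xc Q) ^ 3 = yc P *
      ((derivative (E.sNum (xc Q))).eval (xc P) * (xc P - xc Q) - 2 * (E.sNum (xc Q)).eval (xc P)) := by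
  have h1 := eqn hP
  have h2 := eqn hQ
  have h3 := add_chord hP (neg_ne_zero.2 hQ) (by simpa using h)
  rw [sub_eq_add_neg P Q, h3.2.2, h3.2.1, (add_chord hP hQ h).2.2, (add_chord hP hQ h).2.1,
    sNum_eval, sNum_deriv]
  simp only [X_neg, Y_neg]
  have hD : xc P - xc Q ≠ 0 := sub_ne_zero.2 h
  field_simp
  linear_combination -2 * yc P * h1 - 6 * yc P * h2

/-- An even function, invariant under translation by a point at which it has a pole, cannot vanish
at infinity. -/
lemma inv_zero {G : E.Pt → k} {N D : k[X]} (hc : IsCoprime N D) (hD : D ≠ 0)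
    (hd : N.natDegree < D.natDegree)
    (hG : ∀ᶠ P in Filter.cofinite, G P * D.eval (xc P) = N.eval (xc P))
    {Q : E.Pt} (hQ : Q ≠ 0) (hDQ : D.eval (xc Q) = 0)
    (hi : ∀ᶠ P in Filter.cofinite, G (P + Q) = G P) : False := by
  have hNQ : N.eval (xc Q) ≠ 0 := fun h => cop_eval hc h hDQ
  have hN : N ≠ 0 := by rintro rfl; simp at hNQ
  have hi' : ∀ᶠ P in Filter.cofinite, G (P - Q) = G P := by
    filter_upwards [ev_sub Q hi] with P h
    rw [← h, sub_add_cancel]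
  have key : N ^ 2 * (E.TT (xc Q) D * (X - C (xc Q)) ^ (2 * N.natDegree)) =
      D ^ 2 * (E.TT (xc Q) N * (X - C (xc Q)) ^ (2 * D.natDegree)) := by
    refine poly_eq_of_evX (E := E) ?_
    filter_upwards [hG, (tendsto_add Q).eventually hG, ev_sub Q hG, hi, hi', ev_ne 0,
      ev_polyX_ne (X_sub_C_ne_zero (xc Q))] with P h1 h2 h3 h4 h5 h6 h7
    have h7' : xc P ≠ xc Q := by simpa [sub_eq_zero] using h7
    simp only [eval_mul, eval_pow, ← pow_mul, TT_eval h6 hQ h7', eval_sub, eval_X, eval_C]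
    rw [h4] at h2
    rw [h5] at h3
    rw [← h1, ← h2, ← h3]; ring
  have hX : ∀ m, ((X - C (xc Q)) ^ m : k[X]).natDegree = m := fun m => by
    rw [natDegree_pow, natDegree_X_sub_C, mul_one]
  have hX0 : ∀ m, ((X - C (xc Q)) ^ m : k[X]) ≠ 0 := fun m => pow_ne_zero _ (X_sub_C_ne_zero _)
  obtain ⟨d1, d2⟩ := TT_natDegree (E := E) hNQ
  have hT : E.TT (xc Q) D ≠ 0 := by
    intro h
    rw [h] at key
    simp only [zero_mul, mul_zero] at key
    exact mul_ne_zero (pow_ne_zero 2 hD) (mul_ne_zero d2 (hX0 _)) key.symm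
  have := congrArg natDegree key
  rw [natDegree_mul (pow_ne_zero _ hN) (mul_ne_zero hT (hX0 _)), natDegree_mul hT (hX0 _), hX,
    natDegree_mul (pow_ne_zero _ hD) (mul_ne_zero d2 (hX0 _)), natDegree_mul d2 (hX0 _), hX, d1,
    natDegree_pow, natDegree_pow] at this
  have h1 := TT_natDegree_le (E := E) (xc Q) D
  omega

end Ell

namespace Ell
variable {k : Type*} [Field k] [IsAlgClosed k] [CharGood k] {E E' E'' : Ell k}

/-- The nonzero elements of a finite subgroup. -/
structure FinSub (s : Finset E.Pt) : Prop where
  zero : 0 ∉ s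
  neg : ∀ Q ∈ s, -Q ∈ s
  add : ∀ Q ∈ s, ∀ R ∈ s, Q + R = 0 ∨ Q + R ∈ s

def vDen (s : Finset E.Pt) : k[X] := ∏ Q ∈ s, (X - C (xc Q))

lemma vDen_monic (s : Finset E.Pt) : (vDen s).Monic := monic_prod_of_monic _ _ fun _ _ => monic_X_sub_C _

lemma vDen_natDegree (s : Finset E.Pt) : (vDen s).natDegree = s.card := by
  rw [vDen, natDegree_prod_of_monic _ _ fun _ _ => monic_X_sub_C _]; simp

lemma vDen_eval {s : Finset E.Pt} {x : k} : (vDen s).eval x = 0 ↔ ∃ Q ∈ s, xc Q = x := by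
  rw [vDen, eval_prod, prod_eq_zero_iff]
  simp only [eval_sub, eval_X, eval_C, sub_eq_zero, eq_comm]

lemma FinSub.exists_term {s : Finset E.Pt} (hs : FinSub s) {Q : E.Pt} (hQ : Q ∈ s) :
    ∃ T : k[X], T * (X - C (xc Q)) ^ 2 = E.sNum (xc Q) * vDen s := by
  have hQ0 : Q ≠ 0 := by rintro rfl; exact hs.zero hQ
  by_cases h2 : -Q = Q
  · have hy : yc Q = 0 := Y_eq_zero_iff.2 (by nth_rewrite 1 [← h2]; simp)
    have h1 : (X - C (xc Q)) ∣ E.sNum (xc Q) := by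
      rw [dvd_iff_isRoot, IsRoot.def, sNum_eval]
      have := eqn hQ0
      rw [hy] at this
      linear_combination -4 * this
    obtain ⟨a, ha⟩ := h1
    obtain ⟨b, hb⟩ : (X - C (xc Q)) ∣ vDen s := dvd_prod_of_mem (fun Q => (X - C (xc Q) : k[X])) hQ
    exact ⟨a * b, by rw [ha, hb]; ring⟩
  · have h : (X - C (xc Q)) ^ 2 ∣ vDen s := by
      rw [vDen, ← mul_prod_erase _ _ hQ, ← mul_prod_erase (s.erase Q) _ (mem_erase.2 ⟨h2, hs.neg Q hQ⟩),
        X_neg, ← mul_assoc, sq]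
      exact dvd_mul_right _ _
    obtain ⟨b, hb⟩ := h
    exact ⟨E.sNum (xc Q) * b, by rw [hb]; ring⟩

/-- The summands of the numerator of Vélu's map. -/
def vT (s : Finset E.Pt) (Q : E.Pt) : k[X] :=
  if h : ∃ T : k[X], T * (X - C (xc Q)) ^ 2 = E.sNum (xc Q) * vDen s then h.choose else 0

lemma FinSub.vT_spec {s : Finset E.Pt} (hs : FinSub s) {Q : E.Pt} (hQ : Q ∈ s) :
    vT s Q * (X - C (xc Q)) ^ 2 = E.sNum (xc Q) * vDen s := by
  have h := hs.exists_term hQ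
  rw [vT, dif_pos h]
  exact h.choose_spec

lemma FinSub.vT_natDegree {s : Finset E.Pt} (hs : FinSub s) {Q : E.Pt} (hQ : Q ∈ s) :
    (vT s Q).natDegree ≤ s.card := by
  by_cases h : vT s Q = 0
  · simp [h]
  have h1 := congrArg natDegree (hs.vT_spec hQ)
  rw [natDegree_mul h (pow_ne_zero _ (X_sub_C_ne_zero _)), natDegree_pow, natDegree_X_sub_C] at h1
  have h2 := (natDegree_mul_le (p := E.sNum (xc Q)) (q := vDen s))
  rw [vDen_natDegree] at h2
  have := sNum_natDegree (E := E) (xc Q)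
  omega

def vNum (s : Finset E.Pt) : k[X] := X * vDen s + C (2⁻¹) * ∑ Q ∈ s, vT s Q

lemma FinSub.vNum_aux {s : Finset E.Pt} (hs : FinSub s) :
    (C (2⁻¹) * ∑ Q ∈ s, vT s Q : k[X]).natDegree ≤ s.card :=
  (natDegree_C_mul_le _ _).trans (natDegree_sum_le_of_forall_le _ _ fun _ hQ => hs.vT_natDegree hQ)

lemma FinSub.vNum_natDegree {s : Finset E.Pt} (hs : FinSub s) : (vNum s).natDegree = s.card + 1 ∧
    (vNum s).Monic := by
  have hX : (X * vDen s).natDegree = s.card + 1 := by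
    rw [natDegree_X_mul (vDen_monic s).ne_zero, vDen_natDegree]
  have h := hs.vNum_aux
  refine ⟨?_, ?_⟩
  · rw [vNum, natDegree_add_eq_left_of_natDegree_lt (by omega), hX]
  · exact (monic_X.mul (vDen_monic s)).add_of_left (degree_lt_degree (by omega))

def vX (s : Finset E.Pt) (P : E.Pt) : k := xc P + ∑ Q ∈ s, xc (P + Q)
def vY (s : Finset E.Pt) (P : E.Pt) : k := yc P + ∑ Q ∈ s, yc (P + Q)

lemma FinSub.sum_neg {s : Finset E.Pt} (hs : FinSub s) (F : E.Pt → k) :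
    ∑ Q ∈ s, F (-Q) = ∑ Q ∈ s, F Q :=
  sum_nbij' (fun Q => -Q) (fun Q => -Q) hs.neg hs.neg (by simp) (by simp) (by simp)

lemma FinSub.sum_half {s : Finset E.Pt} (hs : FinSub s) (P : E.Pt) (F : E.Pt → k) :
    ∑ Q ∈ s, F (P + Q) = 2⁻¹ * ∑ Q ∈ s, (F (P + Q) + F (P - Q)) := by
  have h2 : (2 : k) ≠ 0 := CharGood.two
  have := hs.sum_neg (fun Q => F (P + Q))
  simp only [← sub_eq_add_neg] at this
  rw [sum_add_distrib, this]
  field_simp; ring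

lemma ev_sum_ne (s : Finset E.Pt) : ∀ᶠ P : E.Pt in Filter.cofinite,
    P ≠ 0 ∧ (vDen s).eval (xc P) ≠ 0 ∧ ∀ Q ∈ s, xc P ≠ xc Q := by
  filter_upwards [ev_ne 0, ev_polyX_ne (vDen_monic s).ne_zero] with P h1 h2
  refine ⟨h1, h2, fun Q hQ h => h2 (vDen_eval.2 ⟨Q, hQ, h.symm⟩)⟩

lemma FinSub.vX_eq {s : Finset E.Pt} (hs : FinSub s) {P : E.Pt} (hP : P ≠ 0)
    (hD : (vDen s).eval (xc P) ≠ 0) :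
    vX s P * (vDen s).eval (xc P) = (vNum s).eval (xc P) := by
  have hne : ∀ Q ∈ s, xc P ≠ xc Q := fun Q hQ h => hD (vDen_eval.2 ⟨Q, hQ, h.symm⟩)
  rw [vX, hs.sum_half P xc, vNum]
  simp only [eval_add, eval_mul, eval_X, eval_C, eval_finsetSum]
  have : (∑ Q ∈ s, (xc (P + Q) + xc (P - Q))) * (vDen s).eval (xc P) =
      ∑ Q ∈ s, (vT s Q).eval (xc P) := by
    rw [sum_mul]
    refine sum_congr rfl fun Q hQ => ?_
    have h0 : Q ≠ 0 := by rintro rfl; exact hs.zero hQ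
    have h1 := sum_X hP h0 (hne Q hQ)
    have h2 := congrArg (eval (xc P)) (hs.vT_spec hQ)
    simp only [eval_mul, eval_pow, eval_sub, eval_X, eval_C, sNum_eval] at h2
    apply mul_right_cancel₀ (pow_ne_zero 2 (sub_ne_zero.2 (hne Q hQ)))
    linear_combination (vDen s).eval (xc P) * h1 - h2
  linear_combination 2⁻¹ * this

lemma wr_eval (U V : k[X]) (x : k) : (wr U V).eval x =
    (derivative U).eval x * V.eval x - U.eval x * (derivative V).eval x := by simp [wr]

lemma FinSub.vY_eq {s : Finset E.Pt} (hs : FinSub s) {P : E.Pt} (hP : P ≠ 0)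
    (hD : (vDen s).eval (xc P) ≠ 0) :
    vY s P * (vDen s).eval (xc P) ^ 2 = yc P * (wr (vNum s) (vDen s)).eval (xc P) := by
  have hne : ∀ Q ∈ s, xc P ≠ xc Q := fun Q hQ h => hD (vDen_eval.2 ⟨Q, hQ, h.symm⟩)
  rw [vY, hs.sum_half P yc, wr_eval, vNum]
  simp only [derivative_add, derivative_mul, derivative_X, derivative_C, derivative_sum,
    eval_add, eval_mul, eval_X, eval_C, eval_finsetSum, eval_one, eval_zero]
  have : (∑ Q ∈ s, (yc (P + Q) + yc (P - Q))) * (vDen s).eval (xc P) ^ 2 =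
      yc P * ((∑ Q ∈ s, (derivative (vT s Q)).eval (xc P)) * (vDen s).eval (xc P)
        - (∑ Q ∈ s, (vT s Q).eval (xc P)) * (derivative (vDen s)).eval (xc P)) := by
    rw [sum_mul, sum_mul, sum_mul, ← sum_sub_distrib, mul_sum]
    refine sum_congr rfl fun Q hQ => ?_
    have h0 : Q ≠ 0 := by rintro rfl; exact hs.zero hQ
    have h1 := sum_Y hP h0 (hne Q hQ)
    have h2 := congrArg (eval (xc P)) (hs.vT_spec hQ)
    have h3 := congrArg (fun p => eval (xc P) (derivative p)) (hs.vT_spec hQ)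
    simp only [derivative_mul, derivative_pow, derivative_sub, derivative_X, derivative_C, eval_add,
      eval_mul, eval_pow, eval_sub, eval_X, eval_C, Nat.cast_ofNat,
      Nat.add_one_sub_one, pow_one, sub_zero, mul_one] at h2 h3
    have hx := sub_ne_zero.2 (hne Q hQ)
    apply mul_right_cancel₀ (pow_ne_zero 3 hx)
    set x := xc P
    set q := xc Q
    set D := (vDen s).eval x
    linear_combination D ^ 2 * h1 - yc P * D * (x - q) * h3 + yc P * ((derivative (vDen s)).eval x * (x - q) + 2 * D) * h2
  linear_combination 2⁻¹ * this

end Ell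

namespace Ell
variable {k : Type*} [Field k] [IsAlgClosed k] [CharGood k] {E E' E'' : Ell k}

lemma FinSub.add_mem {s : Finset E.Pt} (hs : FinSub s) {Q R : E.Pt} (hQ : Q ∈ insert 0 s)
    (hR : R ∈ insert 0 s) : Q + R ∈ insert 0 s := by
  rw [mem_insert] at *
  rcases hQ with rfl | hQ
  · simpa using hR
  rcases hR with rfl | hR
  · right; simpa using hQ
  · exact hs.add Q hQ R hR

lemma FinSub.neg_mem {s : Finset E.Pt} (hs : FinSub s) {Q : E.Pt} (hQ : Q ∈ insert 0 s) :
    -Q ∈ insert 0 s := by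
  rw [mem_insert] at *
  rcases hQ with rfl | hQ
  · simp
  · exact Or.inr (hs.neg Q hQ)

lemma FinSub.sum_translate {s : Finset E.Pt} (hs : FinSub s) {R : E.Pt} (hR : R ∈ insert 0 s)
    (P : E.Pt) (F : E.Pt → k) :
    F (P + R) + ∑ Q ∈ s, F (P + R + Q) = F P + ∑ Q ∈ s, F (P + Q) := by
  have e : ∀ P, F P + ∑ Q ∈ s, F (P + Q) = ∑ Q ∈ insert 0 s, F (P + Q) := fun P => by
    rw [sum_insert hs.zero, add_zero]
  rw [e, e]
  refine sum_nbij' (fun Q => R + Q) (fun Q => -R + Q) (fun Q hQ => hs.add_mem hR hQ)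
    (fun Q hQ => hs.add_mem (hs.neg_mem hR) hQ) (by simp) (by simp) (by simp [add_assoc])

lemma FinSub.coprime {s : Finset E.Pt} (hs : FinSub s) : IsCoprime (vNum s) (vDen s) := by
  obtain ⟨U, V, g, hU, hV, hc, hg⟩ := exists_coprime (vNum s) (vDen s) (vDen_monic s).ne_zero
  have hVne : V ≠ 0 := by rintro rfl; exact (vDen_monic s).ne_zero (by rw [hV, mul_zero])
  have hUne : U ≠ 0 := by rintro rfl; exact hs.vNum_natDegree.2.ne_zero (by rw [hU, mul_zero])
  have d1 := hs.vNum_natDegree.1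
  have d2 := vDen_natDegree s
  rw [hU, natDegree_mul hg hUne] at d1
  rw [hV, natDegree_mul hg hVne] at d2
  have hgen : ∀ᶠ P : E.Pt in Filter.cofinite, ∀ Q ∈ insert 0 s,
      (P + Q ≠ 0 ∧ (vDen s).eval (xc (P + Q)) ≠ 0) ∧ P + P ≠ Q := by
    rw [Filter.eventually_all_finset]
    intro Q _
    have h2 : Filter.Tendsto (fun P : E.Pt => P + P) Filter.cofinite Filter.cofinite :=
      (AeR_two (E := E)).tendsto
    filter_upwards [(tendsto_add Q).eventually (ev_sum_ne s), h2.eventually (ev_ne Q)] with P h1 h2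
    exact ⟨⟨h1.1, h1.2.1⟩, h2⟩
  obtain ⟨P, hP⟩ := hgen.exists
  have hle : s.card + 1 ≤ U.natDegree := by
    rw [← natDegree_sub_C_mul (show V.natDegree < U.natDegree by omega) (vX s P),
      ← card_insert_of_notMem hs.zero]
    have hne : U - C (vX s P) * V ≠ 0 := by
      intro h
      have := natDegree_sub_C_mul (show V.natDegree < U.natDegree by omega) (vX s P)
      rw [h] at this; simp at this; omega
    have hinj : Set.InjOn (fun Q => xc (P + Q)) (insert 0 s : Finset E.Pt) := by
      intro Q hQ R hR h
      rcases eq_or_neg_of_X_eq (hP Q hQ).1.1 (hP R hR).1.1 h with h | h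
      · exact add_left_cancel h
      · exfalso
        refine (hP (-(Q + R)) (hs.neg_mem (hs.add_mem hQ hR))).2 ?_
        have : P + P = (P + Q) + (P + R) - (Q + R) := by abel
        rw [this, h]; abel
    rw [← card_image_of_injOn hinj]
    refine (card_le_card ?_).trans ((Multiset.toFinset_card_le _).trans (card_roots' _))
    intro x hx
    obtain ⟨Q, hQ, rfl⟩ := mem_image.1 hx
    rw [Multiset.mem_toFinset, mem_roots hne, IsRoot.def]
    have h1 := hs.vX_eq (hP Q hQ).1.1 (hP Q hQ).1.2
    have h2 := (hP Q hQ).1.2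
    rw [show vX s (P + Q) = vX s P from hs.sum_translate hQ P xc, hU, hV, eval_mul, eval_mul] at h1
    rw [hV, eval_mul] at h2
    simp only [eval_sub, eval_mul, eval_C]
    apply mul_left_cancel₀ (left_ne_zero_of_mul h2)
    linear_combination -h1
  obtain ⟨c, rfl⟩ : ∃ c, g = C c := ⟨_, eq_C_of_natDegree_eq_zero (by omega)⟩
  have hc' : IsUnit (C c) := isUnit_C.2 (isUnit_iff_ne_zero.2 (by simpa using hg))
  rw [hU, hV, isCoprime_mul_unit_left hc']
  exact hc

lemma FinSub.wr_monic {s : Finset E.Pt} (hs : FinSub s) :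
    (wr (vNum s) (vDen s)).Monic ∧ (wr (vNum s) (vDen s)).natDegree = 2 * s.card := by
  set R := C (2⁻¹) * ∑ Q ∈ s, vT s Q with hR
  have hd : R.natDegree ≤ s.card := hs.vNum_aux
  have e : wr (vNum s) (vDen s) = vDen s ^ 2 + wr R (vDen s) := by
    rw [vNum, ← hR]
    simp only [wr, derivative_add, derivative_mul, derivative_X]; ring
  have hm := (vDen_monic s).pow 2
  have hmd : (vDen s ^ 2).natDegree = 2 * s.card := by rw [natDegree_pow, vDen_natDegree]
  have hlt : (wr R (vDen s)).degree < (vDen s ^ 2).degree := by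
    rw [degree_eq_natDegree hm.ne_zero, hmd]
    by_cases h0 : s.card = 0
    · have h1 : derivative R = 0 := by
        rw [eq_C_of_natDegree_eq_zero (p := R) (by omega), derivative_C]
      have h2 : derivative (vDen s) = 0 := by
        rw [eq_C_of_natDegree_eq_zero (p := vDen s) (by rw [vDen_natDegree, h0]), derivative_C]
      rw [wr, h1, h2]
      simp only [zero_mul, mul_zero, sub_zero, degree_zero]
      exact WithBot.bot_lt_coe _
    · refine degree_le_natDegree.trans_lt ?_
      have a1 := natDegree_derivative_le R
      have a2 := natDegree_derivative_le (vDen s)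
      have a3 := natDegree_sub_le (derivative R * vDen s) (R * derivative (vDen s))
      have a4 := natDegree_mul_le (p := derivative R) (q := vDen s)
      have a5 := natDegree_mul_le (p := R) (q := derivative (vDen s))
      rw [vDen_natDegree] at a2 a4
      have : (wr R (vDen s)).natDegree < 2 * s.card := by
        rw [wr]
        have := le_max_iff.1 a3
        omega
      exact_mod_cast this
  rw [e]
  exact ⟨hm.add_of_left hlt, by rw [natDegree_add_eq_left_of_degree_lt hlt, hmd]⟩

lemma sub_top {K M : k[X]} {d : ℕ} (hK : K.degree < ((d + 1 : ℕ) : WithBot ℕ)) (hM : M.Monic)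
    (hd : M.natDegree = d) : (K - C (K.coeff d) * M).degree < ((d : ℕ) : WithBot ℕ) := by
  rw [degree_lt_iff_coeff_zero] at hK ⊢
  intro m hm
  rw [coeff_sub, coeff_C_mul]
  rcases hm.eq_or_lt with rfl | h
  · have : M.coeff d = 1 := by rw [← hd]; exact hM
    rw [this]; ring
  · rw [hK m h, coeff_eq_zero_of_natDegree_lt (p := M) (by omega)]; ring

lemma FinSub.cubic {s : Finset E.Pt} (hs : FinSub s) : ∃ a b c : k,
    E.f * wr (vNum s) (vDen s) ^ 2 = vNum s ^ 3 * vDen s + C a * (vNum s ^ 2 * vDen s ^ 2) +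
      C b * (vNum s * vDen s ^ 3) + C c * vDen s ^ 4 := by
  set N := vNum s with hN
  set D := vDen s with hD
  set W := wr N D with hW
  obtain ⟨wm, wd⟩ := hs.wr_monic
  obtain ⟨nd, nm⟩ := hs.vNum_natDegree
  have dm : D.Monic := vDen_monic s
  have dd : D.natDegree = s.card := vDen_natDegree s
  rw [← hN, ← hD, ← hW] at wm wd
  rw [← hN] at nd nm
  have fm := f_monic E
  have hm0 : (E.f * W ^ 2).Monic := fm.mul (wm.pow 2)
  have hd0 : (E.f * W ^ 2).natDegree = 4 * s.card + 3 := by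
    rw [fm.natDegree_mul (wm.pow 2), natDegree_pow, wd, f_natDegree]; ring
  have m1 := (nm.pow 3).mul dm
  have d1 : (N ^ 3 * D).natDegree = 4 * s.card + 3 := by
    rw [(nm.pow 3).natDegree_mul dm, natDegree_pow, nd, dd]; ring
  have m2 := (nm.pow 2).mul (dm.pow 2)
  have d2 : (N ^ 2 * D ^ 2).natDegree = 4 * s.card + 2 := by
    rw [(nm.pow 2).natDegree_mul (dm.pow 2), natDegree_pow, natDegree_pow, nd, dd]; ring
  have m3 := nm.mul (dm.pow 3)
  have d3 : (N * D ^ 3).natDegree = 4 * s.card + 1 := by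
    rw [nm.natDegree_mul (dm.pow 3), natDegree_pow, nd, dd]; ring
  have m4 := dm.pow 4
  have d4 : (D ^ 4).natDegree = 4 * s.card := by rw [natDegree_pow, dd]
  have h0 : (E.f * W ^ 2).degree < ((4 * s.card + 3 + 1 : ℕ) : WithBot ℕ) := by
    rw [degree_eq_natDegree hm0.ne_zero, hd0]; exact_mod_cast Nat.lt_succ_self _
  have h1 := sub_top h0 m1 d1
  have hc1 : (E.f * W ^ 2).coeff (4 * s.card + 3) = 1 := by rw [← hd0]; exact hm0
  rw [hc1] at h1
  have h2 := sub_top h1 m2 d2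
  generalize (E.f * W ^ 2 - C 1 * (N ^ 3 * D)).coeff (4 * s.card + 2) = a at h2
  have h3 := sub_top h2 m3 d3
  generalize (E.f * W ^ 2 - C 1 * (N ^ 3 * D) - C a * (N ^ 2 * D ^ 2)).coeff (4 * s.card + 1) = b at h3
  have h4 := sub_top h3 m4 d4
  generalize (E.f * W ^ 2 - C 1 * (N ^ 3 * D) - C a * (N ^ 2 * D ^ 2) - C b * (N * D ^ 3)).coeff (4 * s.card) = c at h4
  refine ⟨a, b, c, ?_⟩
  set K := E.f * W ^ 2 - C 1 * (N ^ 3 * D) - C a * (N ^ 2 * D ^ 2) - C b * (N * D ^ 3) - C c * D ^ 4 with hK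
  suffices hK0 : K = 0 by
    rw [hK0, map_one] at hK
    linear_combination -hK
  by_contra hK0
  let G : E.Pt → k := fun P => vY s P ^ 2 - vX s P ^ 3 - a * vX s P ^ 2 - b * vX s P - c
  have hG : ∀ᶠ P in Filter.cofinite, G P * (D ^ 4).eval (xc P) = K.eval (xc P) := by
    filter_upwards [ev_sum_ne s] with P ⟨h5, h6, _⟩
    have e1 := hs.vX_eq h5 h6
    have e2 := hs.vY_eq h5 h6
    have e3 := eqn' h5
    simp only [hK, eval_sub, eval_mul, eval_pow, eval_C, ← e3]
    rw [← hN, ← hD] at e1 e2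
    rw [← hW] at e2
    rw [← e1, ← mul_pow, ← e2]
    simp only [G]; ring
  obtain ⟨N1, D1, g, hN1, hD1, hc, hg⟩ := exists_coprime K (D ^ 4) m4.ne_zero
  have hN1' : N1 ≠ 0 := by rintro rfl; exact hK0 (by rw [hN1, mul_zero])
  have hD1' : D1 ≠ 0 := by rintro rfl; exact m4.ne_zero (by rw [hD1, mul_zero])
  have hlt : N1.natDegree < D1.natDegree := by
    have h5 := (natDegree_lt_iff_degree_lt hK0).2 h4
    rw [hN1, natDegree_mul hg hN1'] at h5
    rw [hD1, natDegree_mul hg hD1'] at d4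
    omega
  obtain ⟨q, hq⟩ := IsAlgClosed.exists_root D1 (by
    intro h; rw [natDegree_eq_of_degree_eq_some (n := 0) h] at hlt; omega)
  have hDq : D.eval q = 0 := by
    have : (D ^ 4).eval q = 0 := by rw [hD1, eval_mul, hq.eq_zero, mul_zero]
    rw [eval_pow] at this
    exact pow_eq_zero_iff (by norm_num) |>.1 this
  obtain ⟨Q, hQ, rfl⟩ := vDen_eval.1 hDq
  refine inv_zero (G := G) hc hD1' hlt ?_ (Q := Q) (by rintro rfl; exact hs.zero hQ) hq ?_
  · filter_upwards [hG, ev_polyX_ne hg] with P h5 h6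
    rw [hN1, hD1, eval_mul, eval_mul] at h5
    apply mul_left_cancel₀ h6
    linear_combination h5
  · refine Filter.Eventually.of_forall fun P => ?_
    have h5 : vX s (P + Q) = vX s P := hs.sum_translate (mem_insert_of_mem hQ) P xc
    have h6 : vY s (P + Q) = vY s P := hs.sum_translate (mem_insert_of_mem hQ) P yc
    simp only [G, h5, h6]

end Ell

namespace Ell
variable {k : Type*} [Field k] [IsAlgClosed k] [CharGood k] {E E' E'' : Ell k}

lemma f_sq {g : k[X]} (h : g ^ 2 ∣ E.f) : IsUnit g := by
  by_contra hu
  have hg0 : g ≠ 0 := by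
    rintro rfl
    simp [f_ne] at h
  obtain ⟨e, he⟩ := IsAlgClosed.exists_root g (fun h0 => hu (isUnit_iff_degree_eq_zero.2 h0))
  have h1 : (X - C e) ^ 2 ∣ E.f := (pow_dvd_pow_of_dvd (dvd_iff_isRoot.2 he) 2).trans h
  obtain ⟨q, hq⟩ := h1
  have h2 : e ^ 3 + E.A * e + E.B = 0 := by rw [← eval_f, hq]; simp
  have h3 : 3 * e ^ 2 + E.A = 0 := by
    have e1 : (derivative E.f).eval e = 3 * e ^ 2 + E.A := by simp [f]; norm_num
    rw [← e1, hq]; simp [derivative_mul, derivative_pow]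
  apply E.disc
  have h4 : E.A = -(3 * e ^ 2) := by linear_combination h3
  have h5 : E.B = 2 * e ^ 3 := by rw [h4] at h2; linear_combination h2
  rw [h4, h5]; ring

lemma disc_ne {U V : k[X]} {A B : k} (hc : IsCoprime U V) (hd : V.natDegree < U.natDegree)
    (hn : (U.natDegree : k) ≠ 0)
    (h : E.f * wr U V ^ 2 = (U ^ 3 + C A * U * V ^ 2 + C B * V ^ 3) * V) :
    4 * A ^ 3 + 27 * B ^ 2 ≠ 0 := by
  intro hD
  have h2 : (2 : k) ≠ 0 := CharGood.two
  have h3 : (3 : k) ≠ 0 := CharGood.three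
  obtain ⟨e, hA, hB⟩ : ∃ e, A = -3 * e ^ 2 ∧ B = 2 * e ^ 3 := by
    by_cases hA : A = 0
    · refine ⟨0, by simp [hA], ?_⟩
      have : 3 ^ 3 * B ^ 2 = 0 := by rw [hA] at hD; linear_combination hD
      have : B ^ 2 = 0 := by
        rcases mul_eq_zero.1 this with h | h
        · exact absurd h (pow_ne_zero _ h3)
        · exact h
      simpa using this
    · refine ⟨-3 * B / (2 * A), ?_, ?_⟩
      · field_simp
        linear_combination hD
      · field_simp
        linear_combination B * hD
  set g := U - C e * V with hg
  have hgd : g.natDegree = U.natDegree := natDegree_sub_C_mul hd e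
  have hW : wr U V = wr g V := by
    simp only [wr, hg, derivative_sub, derivative_mul, derivative_C]; ring
  have hfac : E.f * wr g V ^ 2 = g ^ 2 * ((U + C (2 * e) * V) * V) := by
    rw [← hW, h, hA, hB, hg]
    simp only [map_mul, map_pow, map_neg, map_ofNat]; ring
  have hg0 : g ≠ 0 := by intro h0; rw [h0] at hgd; simp at hgd; omega
  have hgV : IsCoprime g V := by
    have := hc.add_mul_right_left (-C e)
    rwa [show U + -C e * V = g by rw [hg]; ring] at this
  obtain ⟨w1, g1, q, hw1, hg1, hcop, hq⟩ := exists_coprime (wr g V) g hg0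
  have h4 : g1 ^ 2 ∣ E.f * w1 ^ 2 := by
    refine ⟨(U + C (2 * e) * V) * V, ?_⟩
    apply mul_left_cancel₀ (pow_ne_zero 2 hq)
    rw [hw1] at hfac
    have hg2 : g ^ 2 = q ^ 2 * g1 ^ 2 := by rw [hg1]; ring
    rw [hg2] at hfac
    linear_combination hfac
  have h5 : g1 ^ 2 ∣ E.f := (hcop.symm.pow).dvd_of_dvd_mul_right h4
  have h6 : g ∣ wr g V := by
    obtain ⟨u, hu⟩ := f_sq h5
    rw [hw1, hg1]
    exact mul_dvd_mul_left q (by rw [← hu]; exact u.isUnit.dvd)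
  have h7 : g ∣ derivative g := by
    refine hgV.dvd_of_dvd_mul_right (z := V) ?_
    have := dvd_add h6 (dvd_mul_right g (derivative V))
    rwa [wr, sub_add_cancel] at this
  have h8 : derivative g = 0 := by
    by_contra h0
    have := natDegree_le_of_dvd h7 h0
    have := natDegree_derivative_le g
    omega
  have h9 := congrArg (coeff · (g.natDegree - 1)) h8
  simp only [coeff_derivative, coeff_zero] at h9
  rw [Nat.sub_add_cancel (by omega)] at h9
  rcases mul_eq_zero.1 h9 with h | h
  · exact hg0 (leadingCoeff_eq_zero.1 h)
  · apply hn
    rw [← hgd, ← h]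
    have : g.natDegree = (g.natDegree - 1) + 1 := by omega
    nth_rewrite 1 [this]; push_cast; rfl

lemma exists_of_curve {U V W : k[X]} (hc : IsCoprime U V) (hd : V.natDegree < U.natDegree)
    (hV : V ≠ 0)
    (h : E.f * W ^ 2 = (U ^ 3 + C E'.A * U * V ^ 2 + C E'.B * V ^ 3) * V) :
    ∃ c : E.Pt →+ E'.Pt, IsRatPt c ∧ AeR c U V ∧
      ∀ᶠ P in Filter.cofinite, yc (c P) * V.eval (xc P) ^ 2 = yc P * W.eval (xc P) := by
  have hex : ∀ P : E.Pt, ∃ Q : E'.Pt, (P ≠ 0 → V.eval (xc P) ≠ 0 → Q ≠ 0 ∧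
      xc Q = U.eval (xc P) / V.eval (xc P) ∧
      yc Q = yc P * W.eval (xc P) / V.eval (xc P) ^ 2) := by
    intro P
    by_cases hP : P ≠ 0 ∧ V.eval (xc P) ≠ 0
    · obtain ⟨h1, h2⟩ := hP
      have h3 := congrArg (eval (xc P)) h
      simp only [eval_mul, eval_pow, eval_add, eval_C, ← eqn' h1] at h3
      obtain ⟨Q, hQ⟩ := exists_pt (E := E') (x := U.eval (xc P) / V.eval (xc P))
        (y := yc P * W.eval (xc P) / V.eval (xc P) ^ 2) (by
          field_simp
          linear_combination h3)
      exact ⟨Q, fun _ _ => hQ⟩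
    · exact ⟨0, fun h1 h2 => absurd ⟨h1, h2⟩ hP⟩
  choose φ hφ using hex
  have hev : ∀ᶠ P : E.Pt in Filter.cofinite, P ≠ 0 ∧ V.eval (xc P) ≠ 0 :=
    (ev_ne 0).and (ev_polyX_ne hV)
  have hr : IsRatPt φ := by
    right
    refine ⟨?_, ?_, ?_⟩
    · filter_upwards [hev] with P ⟨h1, h2⟩ using (hφ P h1 h2).1
    · refine ((IsRat.x.eval U).div (IsRat.x.eval V)).congr ?_
      filter_upwards [hev] with P ⟨h1, h2⟩ using (hφ P h1 h2).2.1
    · refine ((IsRat.y.mul (IsRat.x.eval W)).div ((IsRat.x.eval V).pow 2)).congr ?_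
      filter_upwards [hev] with P ⟨h1, h2⟩ using (hφ P h1 h2).2.2
  have H : AeR φ U V := ⟨hc, hd, hV, by
    filter_upwards [hev] with P ⟨h1, h2⟩ using ⟨h2, (hφ P h1 h2).1, (hφ P h1 h2).2.1⟩⟩
  obtain ⟨c, hc1, hc2⟩ := exists_hom hr H (by
    filter_upwards [hev, tendsto_neg.eventually hev] with P ⟨h1, h2⟩ ⟨h3, h4⟩
    obtain ⟨a1, a2, a3⟩ := hφ P h1 h2
    obtain ⟨b1, b2, b3⟩ := hφ (-P) h3 h4
    refine pt_ext b1 (by simpa using a1) ?_ ?_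
    · rw [b2, X_neg, X_neg, a2]
    · rw [b3, X_neg, Y_neg, Y_neg, a3]; ring)
  refine ⟨c, hc1, ⟨hc, hd, hV, ?_⟩, ?_⟩
  · filter_upwards [H.ev, hc2] with P h1 h2
    rw [← h2]; exact h1
  · filter_upwards [hev, hc2] with P ⟨h1, h2⟩ h3
    rw [← h3, (hφ P h1 h2).2.2]
    field_simp

/-- The normal form of a quotient map. -/
def VeluForm (c : E.Pt →+ E'.Pt) : Prop := ∃ U V : k[X], AeR c U V ∧ U.Monic ∧ V.Monic ∧
  U.natDegree = V.natDegree + 1 ∧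
  E.f * wr U V ^ 2 = (U ^ 3 + C E'.A * U * V ^ 2 + C E'.B * V ^ 3) * V

theorem FinSub.quotient {s : Finset E.Pt} (hs : FinSub s) (hn : ((s.card + 1 : ℕ) : k) ≠ 0) :
    ∃ (E' : Ell k) (c : E.Pt →+ E'.Pt), IsRatPt c ∧ c ≠ 0 ∧ hdeg c = s.card + 1 ∧ Sep c ∧
      (∀ P, c P = 0 ↔ P ∈ insert 0 s) ∧ VeluForm c := by
  obtain ⟨a, b, c, h⟩ := hs.cubic
  have h3 : (3 : k) ≠ 0 := CharGood.three
  obtain ⟨nd, nm⟩ := hs.vNum_natDegree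
  have dm := vDen_monic s
  have dd := vDen_natDegree s
  have hc := hs.coprime
  set N := vNum s
  set D := vDen s with hD
  set U := N - C (-(a / 3)) * D with hU
  have hUd : U.natDegree = s.card + 1 := by rw [hU, natDegree_sub_C_mul (by omega), nd]
  have hW : wr N D = wr U D := by
    simp only [wr, hU, derivative_sub, derivative_mul, derivative_C]; ring
  have hUc : IsCoprime U D := by
    have := hc.add_mul_right_left (-C (-(a / 3)))
    rwa [show N + -C (-(a / 3)) * D = U by rw [hU]; ring] at this
  have h' : E.f * wr U D ^ 2 = (U ^ 3 + C (b - a ^ 2 / 3) * U * D ^ 2 +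
      C (c - a * b / 3 + 2 * a ^ 3 / 27) * D ^ 3) * D := by
    have e3 : ∃ t, a = 3 * t := ⟨a / 3, by field_simp⟩
    obtain ⟨t, rfl⟩ := e3
    rw [← hW, h, hU, show 3 * t / 3 = t by field_simp, show (3 * t) ^ 2 / 3 = 3 * t ^ 2 by field_simp,
      show 3 * t * b / 3 = t * b by field_simp,
      show 2 * (3 * t) ^ 3 / 27 = 2 * t ^ 3 by
        rw [show (27 : k) = 3 ^ 3 by norm_num]; field_simp]
    simp only [map_mul, map_sub, map_add, map_pow, map_neg, map_ofNat]
    ring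
  have hdisc := disc_ne hUc (by omega) (by rw [hUd]; exact hn) h'
  let E0 : Ell k := ⟨_, _, hdisc⟩
  obtain ⟨γ, hγ, H, -⟩ := exists_of_curve (E := E) (E' := E0) hUc (by omega) dm.ne_zero h'
  have hdeg' : hdeg γ = s.card + 1 := by rw [H.hdeg_eq, hUd]
  refine ⟨E0, γ, hγ, ?_, hdeg', sep_of_deg hγ (by rw [hdeg']; exact hn), fun P => ?_,
    U, D, H, ?_, dm, by rw [hUd, dd], h'⟩
  · rintro rfl; rw [hdeg_zero] at hdeg'; omega
  · by_cases hP : P = 0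
    · simp [hP]
    rw [mem_insert, or_iff_right hP]
    have h1 : γ P = 0 ↔ D.eval (xc P) = 0 := by
      rcases H.hasR.all P hP with h | h
      · simp [h.1, h.2]
      · simp [h.1, h.2.1]
    rw [h1, hD, vDen_eval]
    constructor
    · rintro ⟨Q, hQ, hx⟩
      rcases eq_or_neg_of_X_eq (by rintro rfl; exact hs.zero hQ) hP hx with h | h
      · rwa [← h]
      · rw [show P = -Q by rw [h, neg_neg]]; exact hs.neg Q hQ
    · intro h; exact ⟨P, h, rfl⟩
  · rw [hU]
    refine nm.sub_of_left ?_
    rw [degree_eq_natDegree nm.ne_zero, nd]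
    refine degree_le_natDegree.trans_lt ?_
    exact_mod_cast (natDegree_C_mul_le _ _).trans_lt (by rw [dd]; exact Nat.lt_succ_self _)

end Ell

namespace Ell
variable {k : Type*} [Field k] [IsAlgClosed k] [CharGood k] {E E' E'' : Ell k}

theorem exists_quotient (H : AddSubgroup E.Pt) [Finite H] (hn : (Nat.card H : k) ≠ 0) :
    ∃ (E' : Ell k) (c : E.Pt →+ E'.Pt), IsRatPt c ∧ c ≠ 0 ∧ hdeg c = Nat.card H ∧ Sep c ∧
      c.ker = H ∧ VeluForm c := by
  have hf : (H : Set E.Pt).Finite := Set.toFinite _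
  set s := hf.toFinset.erase 0 with hs
  have h0 : (0 : E.Pt) ∈ hf.toFinset := by simp [H.zero_mem]
  have hi : insert 0 s = hf.toFinset := insert_erase h0
  have hcard : s.card + 1 = Nat.card H := by
    rw [hs, card_erase_add_one h0, ← Nat.card_eq_card_finite_toFinset]; rfl
  have hS : FinSub s := by
    refine ⟨by simp [hs], ?_, ?_⟩
    · intro Q hQ
      simp only [hs, mem_erase, Set.Finite.mem_toFinset, SetLike.mem_coe] at hQ ⊢
      exact ⟨by simpa using hQ.1, H.neg_mem hQ.2⟩
    · intro Q hQ R hR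
      simp only [hs, mem_erase, Set.Finite.mem_toFinset, SetLike.mem_coe] at hQ hR ⊢
      by_cases h : Q + R = 0
      · exact Or.inl h
      · exact Or.inr ⟨h, H.add_mem hQ.2 hR.2⟩
  obtain ⟨E', c, h1, h2, h3, h4, h5, h6⟩ := hS.quotient (by rw [hcard]; exact hn)
  refine ⟨E', c, h1, h2, by rw [h3, hcard], h4, ?_, h6⟩
  ext P
  rw [AddMonoidHom.mem_ker, h5, hi]; simp

/-- Multiplication by `n`. -/
def mulN (E : Ell k) (n : ℕ) : E.Pt →+ E.Pt := n • AddMonoidHom.id E.Pt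

@[simp] lemma mulN_apply (n : ℕ) (P : E.Pt) : mulN E n P = n • P := rfl

lemma mulN_rat (n : ℕ) : IsRatPt (mulN E n) := rat_nsmul rat_id n

lemma mulN_hdeg (n : ℕ) : hdeg (mulN E n) = n ^ 2 := by
  rw [mulN, hdeg_nsmul rat_id, hdeg_id, mul_one]

lemma mulN_ne {n : ℕ} (h : (n : k) ≠ 0) : mulN E n ≠ 0 := by
  intro h0
  have := mulN_hdeg (E := E) n
  rw [h0, hdeg_zero] at this
  have : n = 0 := by simpa using this.symm
  simp [this] at h

lemma mulN_sep {n : ℕ} (h : (n : k) ≠ 0) : Sep (mulN E n) :=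
  sep_of_deg (mulN_rat n) (by rw [mulN_hdeg]; push_cast; exact pow_ne_zero 2 h)

lemma card_tors {n : ℕ} (h : (n : k) ≠ 0) : Nat.card (mulN E n).ker = n ^ 2 := by
  rw [mulN_sep h, mulN_hdeg]

lemma mulN_surj {n : ℕ} (h : (n : k) ≠ 0) : Function.Surjective (mulN E n) :=
  hom_surj (mulN_rat n) (mulN_ne h)

/-- `E` has an endomorphism with square `D`. -/
def HasSqrt (D : ℤ) (E : Ell k) : Prop :=
  ∃ α : E.Pt →+ E.Pt, IsRatPt α ∧ ∀ P, α (α P) = D • P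

lemma range_card {l : ℕ} (hl : l.Prime) (h : (l : k) ≠ 0) {α : E.Pt →+ E.Pt}
    (h2 : ∀ P, l • P = 0 → α (α P) = 0) (hne : ∃ P, l • P = 0 ∧ α P ≠ 0) :
    ∃ H : AddSubgroup E.Pt, Nat.card H = l ∧ ∀ Q, Q ∈ H ↔ ∃ P, l • P = 0 ∧ α P = Q := by
  set K := (mulN E l).ker with hK
  have hKm : ∀ P, P ∈ K ↔ l • P = 0 := fun P => by rw [hK, AddMonoidHom.mem_ker, mulN_apply]
  have hKc : Nat.card K = l ^ 2 := card_tors h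
  have hfin : Finite K := Nat.finite_of_card_ne_zero (by rw [hKc]; exact pow_ne_zero 2 hl.ne_zero)
  let φ : K →+ E.Pt := α.comp K.subtype
  have hmem : ∀ Q, Q ∈ φ.range ↔ ∃ P, l • P = 0 ∧ α P = Q := by
    intro Q
    constructor
    · rintro ⟨P, rfl⟩; exact ⟨P, (hKm _).1 P.2, rfl⟩
    · rintro ⟨P, h1, rfl⟩; exact ⟨⟨P, (hKm _).2 h1⟩, rfl⟩
  refine ⟨φ.range, ?_, hmem⟩
  have hmul : Nat.card φ.ker * Nat.card φ.range = l ^ 2 := by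
    rw [← AddSubgroup.index_ker, AddSubgroup.card_mul_index, hKc]
  have hle : Nat.card φ.range ≤ Nat.card φ.ker := by
    refine Nat.card_le_card_of_injective (fun Q : φ.range => (⟨⟨Q, ?_⟩, ?_⟩ : φ.ker)) ?_
    · obtain ⟨P, h1, h3⟩ := (hmem Q).1 Q.2
      rw [hKm, ← h3, ← map_nsmul, h1, map_zero]
    · obtain ⟨P, h1, h3⟩ := (hmem Q).1 Q.2
      rw [AddMonoidHom.mem_ker]
      change α Q = 0
      rw [← h3]; exact h2 P h1
    · intro Q R hQR
      exact Subtype.ext (congrArg (fun z : φ.ker => ((z : K) : E.Pt)) hQR)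
  have hne1 : Nat.card φ.range ≠ 1 := by
    intro h1
    obtain ⟨P, h3, h4⟩ := hne
    rw [AddSubgroup.card_eq_one] at h1
    have : α P ∈ φ.range := (hmem _).2 ⟨P, h3, rfl⟩
    rw [h1] at this
    exact h4 (by simpa using this)
  have hdvd : Nat.card φ.range ∣ l ^ 2 := ⟨_, by rw [← hmul, mul_comm]⟩
  obtain ⟨i, hi, hi'⟩ := (Nat.dvd_prime_pow hl).1 hdvd
  interval_cases i
  · exact absurd hi' hne1
  · rwa [pow_one] at hi'
  · exfalso
    rw [hi'] at hle hmul
    have h4 : 1 < l ^ 2 := Nat.one_lt_pow (by norm_num) hl.one_lt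
    nlinarith

lemma HasSqrt.descend {l : ℕ} (hl : l.Prime) (h : (l : k) ≠ 0) {D : ℤ}
    (hE : HasSqrt (D * l ^ 2) E) : HasSqrt D E ∨ ∃ (E0 : Ell k) (c : E0.Pt →+ E.Pt),
      HasSqrt D E0 ∧ IsRatPt c ∧ hdeg c = l := by
  obtain ⟨α, hα, hsq⟩ := hE
  have hs : Function.Surjective (fun P : E.Pt => l • P) := mulN_surj h
  have hll : ∀ P : E.Pt, (D * (l : ℤ) ^ 2) • P = D • (l • (l • P)) := by
    intro P
    rw [mul_smul, sq, mul_smul, natCast_zsmul, natCast_zsmul]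
  by_cases hker : ∀ P, l • P = 0 → α P = 0
  · left
    obtain ⟨γ, hγ, hγ'⟩ := factor (mulN_rat l) (mulN_ne h) (mulN_sep h) hα (fun P hP => hker P hP)
    simp only [mulN_apply] at hγ'
    refine ⟨γ, hγ, fun P => ?_⟩
    obtain ⟨Q, rfl⟩ := hs P
    obtain ⟨R, rfl⟩ := hs Q
    dsimp only
    rw [hγ', map_nsmul, hγ', hsq, hll]
  right
  push Not at hker
  have h2 : ∀ P, l • P = 0 → α (α P) = 0 := by
    intro P hP
    rw [hsq, hll, hP]; simp
  obtain ⟨H, hHc, hH⟩ := range_card hl h h2 hker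
  have hfin : Finite H := Nat.finite_of_card_ne_zero (by rw [hHc]; exact hl.ne_zero)
  obtain ⟨E0, c, hc, hc0, hcd, hcs, hck, -⟩ := exists_quotient H (by rw [hHc]; exact h)
  rw [hHc] at hcd
  have hcm : ∀ P, c P = 0 ↔ P ∈ H := fun P => by rw [← hck, AddMonoidHom.mem_ker]
  obtain ⟨δ, hδ, hδ'⟩ := factor (mulN_rat l) (mulN_ne h) (mulN_sep h) (rat_comp hα hc) (by
    intro P hP
    rw [AddMonoidHom.mem_ker, AddMonoidHom.comp_apply, hcm, hH]
    exact ⟨P, hP, rfl⟩)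
  simp only [mulN_apply, AddMonoidHom.comp_apply] at hδ'
  obtain ⟨β, hβ, hβ'⟩ := factor hc hc0 hcs hδ (by
    intro Q hQ
    rw [AddMonoidHom.mem_ker, hcm, hH] at hQ
    obtain ⟨S, hS, rfl⟩ := hQ
    obtain ⟨R, rfl⟩ := hs S
    rw [AddMonoidHom.mem_ker]
    dsimp only
    rw [map_nsmul, hδ', hsq, hll, map_zsmul, (by simpa using hS : l • (l • R) = 0)]
    simp)
  obtain ⟨e, he, he'⟩ := factor hc hc0 hcs (mulN_rat l) (by
    intro Q hQ
    rw [AddMonoidHom.mem_ker, hcm, hH] at hQ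
    obtain ⟨S, hS, rfl⟩ := hQ
    rw [AddMonoidHom.mem_ker, mulN_apply, ← map_nsmul, hS, map_zero])
  refine ⟨E0, e, ⟨β, hβ, fun P => ?_⟩, he, ?_⟩
  · obtain ⟨Q, rfl⟩ := hom_surj hc hc0 P
    obtain ⟨R, rfl⟩ := hs Q
    obtain ⟨S, rfl⟩ := hs R
    dsimp only
    rw [hβ', hδ', hβ', map_nsmul α, hδ', hsq, hll, map_zsmul]
  · have h3 : e.comp c = mulN E l := AddMonoidHom.ext he'
    have h4 := hdeg_comp hc he
    rw [h3, mulN_hdeg, hcd, sq] at h4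
    exact (Nat.eq_of_mul_eq_mul_right hl.pos h4).symm

end Ell

namespace Ell
variable {k : Type*} [Field k] [IsAlgClosed k] [CharGood k] {E E' E'' : Ell k}

/-- The `j`-invariant, up to a constant factor. -/
def jj (E : Ell k) : k := E.A ^ 3 / (4 * E.A ^ 3 + 27 * E.B ^ 2)

lemma jj_cross (h : jj E = jj E') : E.A ^ 3 * E'.B ^ 2 = E'.A ^ 3 * E.B ^ 2 := by
  have h3 : (27 : k) ≠ 0 := by
    rw [show (27 : k) = 3 ^ 3 by norm_num]; exact pow_ne_zero 3 CharGood.three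
  rw [jj, jj, div_eq_div_iff E.disc E'.disc] at h
  apply mul_left_cancel₀ h3
  linear_combination h

lemma jj_of_scale {a : k} (hA : E'.A = a ^ 2 * E.A) (hB : E'.B = a ^ 3 * E.B) : jj E = jj E' := by
  rw [jj, jj, div_eq_div_iff E.disc E'.disc, hA, hB]; ring

lemma exists_scale (h : jj E = jj E') : ∃ u : k, u ≠ 0 ∧ E'.A = u ^ 4 * E.A ∧ E'.B = u ^ 6 * E.B := by
  have hx := jj_cross h
  by_cases hA : E.A = 0
  · have hB : E.B ≠ 0 := fun hB => E.disc (by rw [hA, hB]; ring)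
    have hA' : E'.A = 0 := by
      rw [hA] at hx
      have : E'.A ^ 3 = 0 := by
        apply mul_right_cancel₀ (pow_ne_zero 2 hB); linear_combination -hx
      exact pow_eq_zero_iff (by norm_num) |>.1 this
    have hB' : E'.B ≠ 0 := fun hB => E'.disc (by rw [hA', hB]; ring)
    obtain ⟨u, hu⟩ := IsAlgClosed.exists_pow_nat_eq (E'.B / E.B) (n := 6) (by norm_num)
    refine ⟨u, ?_, by rw [hA, hA']; ring, by rw [hu]; field_simp⟩
    rintro rfl
    exact div_ne_zero hB' hB (by rw [← hu]; norm_num)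
  have hA' : E'.A ≠ 0 := by
    intro h0
    rw [h0] at hx
    have : E'.B ^ 2 = 0 := by
      apply mul_left_cancel₀ (pow_ne_zero 3 hA); linear_combination hx
    exact E'.disc (by rw [h0, this]; ring)
  by_cases hB : E.B = 0
  · have hB' : E'.B = 0 := by
      rw [hB] at hx
      have : E'.B ^ 2 = 0 := by
        apply mul_left_cancel₀ (pow_ne_zero 3 hA); linear_combination hx
      simpa using this
    obtain ⟨u, hu⟩ := IsAlgClosed.exists_pow_nat_eq (E'.A / E.A) (n := 4) (by norm_num)
    refine ⟨u, ?_, by rw [hu]; field_simp, by rw [hB, hB']; ring⟩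
    rintro rfl
    exact div_ne_zero hA' hA (by rw [← hu]; norm_num)
  have hB' : E'.B ≠ 0 := by
    intro h0
    rw [h0] at hx
    have : E'.A ^ 3 = 0 := by
      apply mul_right_cancel₀ (pow_ne_zero 2 hB); linear_combination -hx
    exact hA' (pow_eq_zero_iff (by norm_num) |>.1 this)
  obtain ⟨u, hu⟩ := IsAlgClosed.exists_pow_nat_eq ((E'.B / E.B) / (E'.A / E.A)) (n := 2) (by norm_num)
  refine ⟨u, ?_, ?_, ?_⟩
  · rintro rfl
    exact div_ne_zero (div_ne_zero hB' hB) (div_ne_zero hA' hA) (by rw [← hu]; norm_num)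
  · rw [show u ^ 4 = (u ^ 2) ^ 2 by ring, hu]
    field_simp
    linear_combination -hx
  · rw [show u ^ 6 = (u ^ 2) ^ 3 by ring, hu]
    field_simp
    linear_combination -hx

lemma exists_iso (h : jj E = jj E') : ∃ θ : E.Pt →+ E'.Pt, IsRatPt θ ∧ hdeg θ = 1 := by
  obtain ⟨u, hu, hA, hB⟩ := exists_scale h
  have hd : (C (u ^ 2) * X : k[X]).natDegree = 1 := natDegree_C_mul_X _ (pow_ne_zero 2 hu)
  obtain ⟨c, hc, H, -⟩ := exists_of_curve (E := E) (E' := E') (U := C (u ^ 2) * X) (V := 1)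
    (W := C (u ^ 3)) isCoprime_one_right (by rw [hd]; simp) one_ne_zero (by
      rw [hA, hB, f]; simp only [map_mul, map_pow]; ring)
  exact ⟨c, hc, by rw [H.hdeg_eq, hd]⟩

lemma cubic_roots {A B r s t : k} (hrs : r ≠ s) (hrt : r ≠ t) (hst : s ≠ t)
    (hr : r ^ 3 + A * r + B = 0) (hs : s ^ 3 + A * s + B = 0) (ht : t ^ 3 + A * t + B = 0) :
    r + s + t = 0 ∧ A = r * s + r * t + s * t ∧ B = -(r * s * t) := by
  have h1 : r ^ 2 + r * s + s ^ 2 + A = 0 := by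
    apply mul_left_cancel₀ (sub_ne_zero.2 hrs); linear_combination hr - hs
  have h2 : r ^ 2 + r * t + t ^ 2 + A = 0 := by
    apply mul_left_cancel₀ (sub_ne_zero.2 hrt); linear_combination hr - ht
  have h3 : r + s + t = 0 := by
    apply mul_left_cancel₀ (sub_ne_zero.2 hst); linear_combination h1 - h2
  have h4 : A = r * s + r * t + s * t := by linear_combination h1 - (r + s) * h3
  refine ⟨h3, h4, ?_⟩
  rw [h4] at hr
  linear_combination hr - r ^ 2 * h3

lemma scale_of_hdeg_one {θ : E.Pt →+ E'.Pt} (hθ : IsRatPt θ) (h : hdeg θ = 1) :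
    ∃ a : k, a ≠ 0 ∧ (∀ P, P ≠ 0 → θ P ≠ 0 ∧ xc (θ P) = a * xc P) ∧ E'.A = a ^ 2 * E.A ∧
      E'.B = a ^ 3 * E.B := by
  have h0 : θ ≠ 0 := by rintro rfl; simp [hdeg_zero] at h
  obtain ⟨U, V, H⟩ := exists_AeR hθ h0
  rw [H.hdeg_eq] at h
  have hV : V.natDegree = 0 := by have := H.deg; omega
  obtain ⟨v, rfl⟩ : ∃ v, V = C v := ⟨_, eq_C_of_natDegree_eq_zero hV⟩
  have hv : v ≠ 0 := by have := H.nz; simpa using this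
  obtain ⟨a', ha', b', rfl⟩ := natDegree_eq_one.1 h
  have hval : ∃ a b : k, a ≠ 0 ∧ ∀ P, P ≠ 0 → θ P ≠ 0 ∧ xc (θ P) = a * xc P + b := by
    refine ⟨a' / v, b' / v, div_ne_zero ha' hv, fun P hP => ?_⟩
    rcases H.hasR.all P hP with h1 | ⟨h1, h2, h3⟩
    · exact absurd (by simpa using h1.2) hv
    · refine ⟨h1, ?_⟩
      rw [h3]; simp; field_simp
  obtain ⟨a, b, ha, hab⟩ := hval
  obtain ⟨e1, e2, e3, h12, h13, h23, hs, hA, hB, hf⟩ := exists_roots E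
  have hroot : ∀ e, E.f.eval e = 0 → (a * e + b) ^ 3 + E'.A * (a * e + b) + E'.B = 0 := by
    intro e he
    obtain ⟨P, hP, hx, hy⟩ := exists_pt (E := E) (x := e) (y := 0) (by rw [← eval_f, he]; ring)
    have h2 : P + P = 0 := Y_eq_zero_iff.1 hy
    obtain ⟨h3, h4⟩ := hab P hP
    have h5 : yc (θ P) = 0 := Y_eq_zero_iff.2 (by rw [← map_add, h2, map_zero])
    have h6 := eqn h3
    rw [h5, h4, hx] at h6
    linear_combination -h6
  have inj : ∀ e e', e ≠ e' → a * e + b ≠ a * e' + b := fun e e' hne h =>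
    hne (mul_left_cancel₀ ha (add_right_cancel h))
  obtain ⟨s0, sA, sB⟩ := cubic_roots (inj _ _ h12) (inj _ _ h13) (inj _ _ h23)
    (hroot e1 (by rw [hf]; ring)) (hroot e2 (by rw [hf]; ring)) (hroot e3 (by rw [hf]; ring))
  have hb : b = 0 := by
    have : 3 * b = 0 := by linear_combination s0 - a * hs
    exact (mul_eq_zero.1 this).resolve_left CharGood.three
  refine ⟨a, ha, fun P hP => ?_, ?_, ?_⟩
  · have := hab P hP
    rwa [hb, add_zero] at this
  · rw [sA, hA, hb]; ring
  · rw [sB, hB, hb]; ring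

lemma jj_of_hdeg_one {θ : E.Pt →+ E'.Pt} (hθ : IsRatPt θ) (h : hdeg θ = 1) : jj E = jj E' := by
  obtain ⟨a, -, -, hA, hB⟩ := scale_of_hdeg_one hθ h
  exact jj_of_scale hA hB

lemma jj_of_ker {E0 : Ell k} {c : E0.Pt →+ E.Pt} {c' : E0.Pt →+ E'.Pt} {l : ℕ} (hl : (l : k) ≠ 0)
    (hc : IsRatPt c) (hc' : IsRatPt c') (h : hdeg c = l) (h' : hdeg c' = l) (hk : c.ker ≤ c'.ker) :
    jj E = jj E' := by
  have hl0 : 0 < l := Nat.pos_of_ne_zero (by rintro rfl; simp at hl)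
  have hc0 : c ≠ 0 := by rintro rfl; rw [hdeg_zero] at h; omega
  obtain ⟨θ, h1, h2⟩ := factor hc hc0 (sep_of_deg hc (by rw [h]; exact hl)) hc' hk
  refine jj_of_hdeg_one h1 ?_
  have h3 := hdeg_comp hc h1
  rw [show θ.comp c = c' from AddMonoidHom.ext h2, h, h'] at h3
  nlinarith

lemma disjoint_ker {E0 : Ell k} {c : E0.Pt →+ E.Pt} {c' : E0.Pt →+ E'.Pt} {l : ℕ} (hp : l.Prime)
    (hl : (l : k) ≠ 0) (hc : IsRatPt c) (hc' : IsRatPt c') (h : hdeg c = l) (h' : hdeg c' = l)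
    {P : E0.Pt} (hP : P ≠ 0) (h1 : c P = 0) (h2 : c' P = 0) : jj E = jj E' := by
  refine jj_of_ker hl hc hc' h h' ?_
  have hs : Nat.card c.ker = l := by
    rw [show Nat.card c.ker = hdeg c from sep_of_deg hc (by rw [h]; exact hl), h]
  have hfin : Finite c.ker := Nat.finite_of_card_ne_zero (by rw [hs]; exact hp.ne_zero)
  have hd := AddSubgroup.card_dvd_of_le (inf_le_left : c.ker ⊓ c'.ker ≤ c.ker)
  rw [hs, Nat.dvd_prime hp] at hd
  rcases hd with hd | hd
  · rw [AddSubgroup.card_eq_one] at hd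
    have : P ∈ c.ker ⊓ c'.ker := ⟨h1, h2⟩
    rw [hd] at this
    exact absurd (by simpa using this) hP
  · have := AddSubgroup.eq_of_le_of_card_ge (inf_le_left : c.ker ⊓ c'.ker ≤ c.ker) (by rw [hs, hd])
    exact inf_eq_left.1 this

lemma encard_quotients (E0 : Ell k) {l : ℕ} (hp : l.Prime) (hl : (l : k) ≠ 0) :
    {j | ∃ (E : Ell k) (c : E0.Pt →+ E.Pt), IsRatPt c ∧ hdeg c = l ∧ jj E = j}.encard ≤
      ((l + 1 : ℕ) : ℕ∞) := by
  by_contra hlt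
  push Not at hlt
  have hle : ((l + 2 : ℕ) : ℕ∞) ≤ {j | ∃ (E : Ell k) (c : E0.Pt →+ E.Pt),
      IsRatPt c ∧ hdeg c = l ∧ jj E = j}.encard := by
    have := Order.add_one_le_of_lt hlt
    exact_mod_cast this
  obtain ⟨S, hS, hcard⟩ := Set.exists_subset_encard_eq hle
  have hfin : S.Finite := Set.finite_of_encard_eq_coe hcard
  lift S to Finset k using hfin
  have hcard' : S.card = l + 2 := by
    rw [Set.encard_coe_eq_coe_finsetCard] at hcard; exact_mod_cast hcard
  have hex : ∀ j : k, ∃ (E : Ell k) (c : E0.Pt →+ E.Pt), j ∈ S →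
      IsRatPt c ∧ hdeg c = l ∧ jj E = j := by
    intro j
    by_cases h : j ∈ S
    · obtain ⟨E, c, h1⟩ := hS (mem_coe.2 h)
      exact ⟨E, c, fun _ => h1⟩
    · exact ⟨E0, 0, fun h' => absurd h' h⟩
  choose Ej cj hcj using hex
  have hr := fun j hj => (hcj j hj).1
  have hd := fun j hj => (hcj j hj).2.1
  have hjj := fun j hj => (hcj j hj).2.2
  have hlpos := hp.two_le
  have hkc : ∀ j ∈ S, Nat.card (cj j).ker = l := fun j hj => by
    rw [show Nat.card (cj j).ker = hdeg (cj j) from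
      sep_of_deg (hr j hj) (by rw [hd j hj]; exact hl), hd j hj]
  have hT : Nat.card (mulN E0 l).ker = l ^ 2 := card_tors hl
  have hTf : ((mulN E0 l).ker : Set E0.Pt).Finite := by
    apply Set.finite_coe_iff.1
    exact Nat.finite_of_card_ne_zero (hT.trans_ne (pow_ne_zero 2 hp.ne_zero))
  have hsub : ∀ j ∈ S, ((cj j).ker : Set E0.Pt) ⊆ (mulN E0 l).ker := by
    intro j hj P hP
    have : Nat.card (cj j).ker • (⟨P, hP⟩ : (cj j).ker) = 0 := card_nsmul_eq_zero'
    rw [hkc j hj] at this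
    have h2 := congrArg (fun z : (cj j).ker => (z : E0.Pt)) this
    exact h2
  let Z : k → Finset E0.Pt := fun j => hTf.toFinset.filter fun P => cj j P = 0 ∧ P ≠ 0
  have hZ : ∀ j ∈ S, (Z j).card = l - 1 := by
    intro j hj
    have hf : ((cj j).ker : Set E0.Pt).Finite := hTf.subset (hsub j hj)
    have : Z j = hf.toFinset.erase 0 := by
      ext P
      simp only [Z, mem_filter, Set.Finite.mem_toFinset, SetLike.mem_coe, mem_erase]
      constructor
      · rintro ⟨_, h1, h2⟩; exact ⟨h2, h1⟩
      · rintro ⟨h2, h1⟩; exact ⟨hsub j hj h1, h1, h2⟩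
    rw [this, card_erase_of_mem (by simp [(cj j).ker.zero_mem]), ← Nat.card_eq_card_finite_toFinset]
    exact congrArg (· - 1) (hkc j hj)
  have hdis : (S : Set k).PairwiseDisjoint Z := by
    intro i hi j hj hij
    rw [Function.onFun, Finset.disjoint_left]
    intro P hPi hPj
    simp only [Z, mem_filter] at hPi hPj
    refine hij ?_
    have := disjoint_ker hp hl (hr i hi) (hr j hj) (hd i hi) (hd j hj) hPi.2.2 hPi.2.1 hPj.2.1
    rwa [hjj i hi, hjj j hj] at this
  have hU : S.biUnion Z ⊆ hTf.toFinset.erase 0 := by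
    intro P hP
    obtain ⟨j, _, h2⟩ := mem_biUnion.1 hP
    simp only [Z, mem_filter] at h2
    exact mem_erase.2 ⟨h2.2.2, h2.1⟩
  have h1 := card_le_card hU
  rw [card_biUnion hdis, sum_congr rfl hZ, sum_const, smul_eq_mul, hcard',
    card_erase_of_mem (by simp [(mulN E0 l).ker.zero_mem]), ← Nat.card_eq_card_finite_toFinset] at h1
  have h2 : Nat.card ((mulN E0 l).ker : Set E0.Pt) = l ^ 2 := hT
  rw [h2] at h1
  obtain ⟨n, rfl⟩ : ∃ n, l = n + 2 := ⟨l - 2, by omega⟩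
  have h3 : (n + 2) ^ 2 - 1 = n ^ 2 + 4 * n + 3 := by
    have : (n + 2) ^ 2 = n ^ 2 + 4 * n + 3 + 1 := by ring
    omega
  rw [h3, show n + 2 - 1 = n + 1 by omega] at h1
  nlinarith

/-- The `j`-invariants of the curves having an endomorphism with square `D`. -/
def jSet (k : Type*) [Field k] [IsAlgClosed k] [CharGood k] (D : ℤ) : Set k :=
  {j | ∃ E : Ell k, HasSqrt D E ∧ jj E = j}

lemma encard_jSet_step {l : ℕ} (hp : l.Prime) (hl : (l : k) ≠ 0) {D : ℤ} {n : ℕ}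
    (h : (jSet k D).encard ≤ n) : (jSet k (D * l ^ 2)).encard ≤ ((l + 2) * n : ℕ) := by
  have hfin : (jSet k D).Finite := Set.finite_of_encard_le_coe h
  obtain ⟨S, hS⟩ := hfin.exists_finset_coe
  rw [← hS, Set.encard_coe_eq_coe_finsetCard] at h
  have hn : S.card ≤ n := by exact_mod_cast h
  have hex : ∀ j ∈ S, ∃ E : Ell k, jj E = j := fun j hj => by
    have : j ∈ jSet k D := by rw [← hS]; exact hj
    obtain ⟨E, _, h2⟩ := this
    exact ⟨E, h2⟩
  have : Nonempty (Ell k) := ⟨⟨1, 0, by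
    have h2 : (2 : k) ≠ 0 := CharGood.two
    rw [show (4 * 1 ^ 3 + 27 * 0 ^ 2 : k) = 2 ^ 2 by norm_num]
    exact pow_ne_zero 2 h2⟩⟩
  choose! R hR using hex
  have hb := fun j => encard_quotients (R j) hp hl
  have hQ : ∀ j, ∃ Q : Finset k, (Q : Set k) = {i | ∃ (E : Ell k) (c : (R j).Pt →+ E.Pt),
      IsRatPt c ∧ hdeg c = l ∧ jj E = i} := fun j =>
    (Set.finite_of_encard_le_coe (hb j)).exists_finset_coe
  choose Q hQ using hQ
  have hQc : ∀ j, (Q j).card ≤ l + 1 := fun j => by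
    have := hb j
    rw [← hQ, Set.encard_coe_eq_coe_finsetCard] at this
    exact_mod_cast this
  have hsub : jSet k (D * l ^ 2) ⊆ ((S ∪ S.biUnion Q : Finset k) : Set k) := by
    rintro j ⟨E, hE, rfl⟩
    rw [mem_coe, mem_union]
    rcases hE.descend hp hl with h1 | ⟨E0, c, h1, h2, h3⟩
    · left
      rw [← mem_coe, hS]
      exact ⟨E, h1, rfl⟩
    · right
      have hj : jj E0 ∈ S := by rw [← mem_coe, hS]; exact ⟨E0, h1, rfl⟩
      refine mem_biUnion.2 ⟨jj E0, hj, ?_⟩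
      rw [← mem_coe, hQ]
      obtain ⟨θ, h4, h5⟩ := exists_iso (hR _ hj)
      exact ⟨E, c.comp θ, rat_comp h4 h2, by rw [hdeg_comp h4 h2, h3, h5, mul_one], rfl⟩
  refine (Set.encard_le_encard hsub).trans ?_
  rw [Set.encard_coe_eq_coe_finsetCard]
  have h1 := card_union_le S (S.biUnion Q)
  have h2 := card_biUnion_le_card_mul S Q (l + 1) (fun j _ => hQc j)
  have h3 : (l + 2) * S.card ≤ (l + 2) * n := Nat.mul_le_mul_left _ hn
  have : (S ∪ S.biUnion Q).card ≤ (l + 2) * n := by nlinarith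
  exact_mod_cast this

/-- The completely multiplicative function with value `p + 2` at each prime `p`. -/
def gMul (m : ℕ) : ℕ := (m.primeFactorsList.map (· + 2)).prod

lemma gMul_mul {a b : ℕ} (ha : a ≠ 0) (hb : b ≠ 0) : gMul (a * b) = gMul a * gMul b := by
  rw [gMul, ((Nat.perm_primeFactorsList_mul ha hb).map _).prod_eq, List.map_append, List.prod_append]
  rfl

lemma gMul_prime {l : ℕ} (hl : l.Prime) : gMul l = l + 2 := by
  simp [gMul, Nat.primeFactorsList_prime hl]

lemma gMul_one : gMul 1 = 1 := by simp [gMul]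

lemma encard_jSet_mul {D : ℤ} {n : ℕ} (h : (jSet k D).encard ≤ n) (m : ℕ) (hm : m ≠ 0)
    (hp : ∀ l : ℕ, l.Prime → l ∣ m → (l : k) ≠ 0) :
    (jSet k (D * m ^ 2)).encard ≤ (gMul m * n : ℕ) := by
  induction m using induction_on_primes with
  | zero => exact absurd rfl hm
  | one => simpa [gMul_one] using h
  | prime_mul l a hl ih =>
    have ha : a ≠ 0 := right_ne_zero_of_mul hm
    have h1 := encard_jSet_step hl (hp l hl (dvd_mul_right _ _))
      (ih ha fun q hq hqa => hp q hq (hqa.mul_left _))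
    rw [gMul_mul hl.ne_zero ha, gMul_prime hl, mul_assoc]
    rwa [show D * ((l * a : ℕ) : ℤ) ^ 2 = D * (a : ℤ) ^ 2 * (l : ℤ) ^ 2 by push_cast; ring]

end Ell

namespace Ell
variable {k : Type*} [Field k] [IsAlgClosed k] [CharGood k] {E E' E'' : Ell k}

/-- `h` is a rational function of the `x`-coordinate, equal to `r x ^ m` to leading order. -/
def Lead (h : E.Pt → k) (m : ℕ) (r : k) : Prop := ∃ U V : k[X], V.Monic ∧
  U.natDegree ≤ V.natDegree + m ∧ U.coeff (V.natDegree + m) = r ∧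
  ∀ᶠ P in Filter.cofinite, V.eval (xc P) * h P = U.eval (xc P)

namespace Lead
variable {h h' : E.Pt → k} {m m' : ℕ} {r r' : k}

lemma const (a : k) : Lead (fun _ : E.Pt => a) 0 a :=
  ⟨C a, 1, monic_one, by simp, by simp, by simp⟩

lemma x : Lead (xc : E.Pt → k) 1 1 := ⟨X, 1, monic_one, by simp, by simp, by simp⟩

lemma congr (H : Lead h m r) (e : ∀ᶠ P in Filter.cofinite, h' P = h P) : Lead h' m r := by
  obtain ⟨U, V, h1, h2, h3, h4⟩ := H
  refine ⟨U, V, h1, h2, h3, ?_⟩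
  filter_upwards [h4, e] with P h5 h6
  rw [h6, h5]

lemma raise (H : Lead h m r) {n : ℕ} (hn : m < n) : Lead h n 0 := by
  obtain ⟨U, V, h1, h2, h3, h4⟩ := H
  exact ⟨U, V, h1, by omega, coeff_eq_zero_of_natDegree_lt (by omega), h4⟩

lemma mul (H : Lead h m r) (H' : Lead h' m' r') :
    Lead (fun P => h P * h' P) (m + m') (r * r') := by
  obtain ⟨U, V, h1, h2, h3, h4⟩ := H
  obtain ⟨U', V', h1', h2', h3', h4'⟩ := H'
  have hd : (V * V').natDegree + (m + m') = (V.natDegree + m) + (V'.natDegree + m') := by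
    rw [h1.natDegree_mul h1']; ring
  refine ⟨U * U', V * V', h1.mul h1', ?_, ?_, ?_⟩
  · rw [hd]; exact natDegree_mul_le.trans (by omega)
  · rw [hd, coeff_mul_add_eq_of_natDegree_le h2 h2', h3, h3']
  · filter_upwards [h4, h4'] with P h5 h6
    rw [eval_mul, eval_mul, ← h5, ← h6]; ring

lemma add (H : Lead h m r) (H' : Lead h' m r') :
    Lead (fun P => h P + h' P) m (r + r') := by
  obtain ⟨U, V, h1, h2, h3, h4⟩ := H
  obtain ⟨U', V', h1', h2', h3', h4'⟩ := H'
  have hd : (V * V').natDegree + m = (V.natDegree + m) + V'.natDegree := by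
    rw [h1.natDegree_mul h1']; ring
  have hd' : (V * V').natDegree + m = V.natDegree + (V'.natDegree + m) := by
    rw [h1.natDegree_mul h1']; ring
  refine ⟨U * V' + V * U', V * V', h1.mul h1', ?_, ?_, ?_⟩
  · refine natDegree_add_le_of_degree_le ?_ ?_
    · rw [hd]; exact natDegree_mul_le.trans (by omega)
    · rw [hd']; exact natDegree_mul_le.trans (by omega)
  · rw [coeff_add, hd, coeff_mul_add_eq_of_natDegree_le h2 le_rfl, ← hd, hd',
      coeff_mul_add_eq_of_natDegree_le le_rfl h2', h3, h3', h1.coeff_natDegree, h1'.coeff_natDegree]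
    ring
  · filter_upwards [h4, h4'] with P h5 h6
    rw [eval_add, eval_mul, eval_mul, eval_mul, ← h5, ← h6]; ring

lemma smul (H : Lead h m r) (a : k) : Lead (fun P => a * h P) m (a * r) := by
  simpa using (const a).mul H

lemma neg (H : Lead h m r) : Lead (fun P => - h P) m (-r) := by
  simpa using H.smul (-1)

lemma pow (H : Lead h m r) (n : ℕ) : Lead (fun P => h P ^ n) (n * m) (r ^ n) := by
  induction n with
  | zero => simpa using const (E := E) (1 : k)
  | succ n ih => simpa only [pow_succ, Nat.succ_mul] using ih.mul H

lemma div {h'' : E.Pt → k} (H : Lead h m r) (H' : Lead h' m' r') (hr : r' ≠ 0) {n : ℕ}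
    (hn : m = m' + n) (e : ∀ᶠ P in Filter.cofinite, h'' P * h' P = h P) : Lead h'' n (r / r') := by
  obtain ⟨U, V, h1, h2, h3, h4⟩ := H
  obtain ⟨U', V', h1', h2', h3', h4'⟩ := H'
  have hU' : U'.natDegree = V'.natDegree + m' :=
    le_antisymm h2' (le_natDegree_of_ne_zero (by rwa [h3']))
  have hU0 : U' ≠ 0 := by rintro rfl; simp at h3'; exact hr h3'.symm
  have hlc : U'.leadingCoeff = r' := by rw [leadingCoeff, hU', h3']
  have hm : (U' * C r'⁻¹).Monic := by rw [← hlc]; exact monic_mul_leadingCoeff_inv hU0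
  have hmd : (U' * C r'⁻¹).natDegree = V'.natDegree + m' := by
    rw [natDegree_mul_C (inv_ne_zero hr), hU']
  have hd : (V * (U' * C r'⁻¹)).natDegree + n = (V.natDegree + m) + V'.natDegree := by
    rw [h1.natDegree_mul hm, hmd, hn]; ring
  refine ⟨U * V' * C r'⁻¹, V * (U' * C r'⁻¹), h1.mul hm, ?_, ?_, ?_⟩
  · rw [hd]
    exact (natDegree_mul_C_le _ _).trans (natDegree_mul_le.trans (by omega))
  · rw [hd, coeff_mul_C, coeff_mul_add_eq_of_natDegree_le h2 le_rfl, h3, h1'.coeff_natDegree]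
    field_simp
  · filter_upwards [h4, h4', e] with P h5 h6 h7
    simp only [eval_mul, eval_C, ← h5, ← h6, ← h7]; ring

lemma unique (H : Lead h m r) (H' : Lead h m r') : r = r' := by
  obtain ⟨U, V, h1, h2, h3, h4⟩ := H
  obtain ⟨U', V', h1', h2', h3', h4'⟩ := H'
  have key : U * V' = V * U' := by
    apply poly_eq_of_evX (E := E)
    filter_upwards [h4, h4'] with P h5 h6
    simp only [eval_mul, ← h5, ← h6]; ring
  have h5 := congrArg (fun p => coeff p ((V.natDegree + m) + V'.natDegree)) key
  rw [coeff_mul_add_eq_of_natDegree_le h2 le_rfl, add_assoc, add_comm m,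
    coeff_mul_add_eq_of_natDegree_le le_rfl h2', h3, h3', h1.coeff_natDegree, h1'.coeff_natDegree] at h5
  simpa using h5

lemma poly (H : Lead h 1 r) {n : ℕ} : ∀ {p : k[X]}, p.natDegree ≤ n →
    Lead (fun P => p.eval (h P)) n (p.coeff n * r ^ n) := by
  induction n with
  | zero =>
    intro p hp
    obtain ⟨c, rfl⟩ : ∃ c, p = C c := ⟨_, eq_C_of_natDegree_le_zero hp⟩
    simpa using const (E := E) c
  | succ n ih =>
    intro p hp
    have h1 : p.divX.natDegree ≤ n := by rw [natDegree_divX_eq_natDegree_tsub_one]; omega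
    have h2 := ((ih h1).mul H).add ((const (E := E) (p.coeff 0)).raise (Nat.succ_pos n))
    have h3 := h2.congr (h' := fun P => p.eval (h P)) (.of_forall fun P => by
      conv_lhs => rw [← divX_mul_X_add p]
      simp)
    convert h3 using 1
    rw [coeff_divX]; ring

end Lead

lemma lead_nsmul {n : ℕ} (hn : 1 ≤ n) (h : ∀ i : ℕ, 1 ≤ i → i ≤ n → (i : k) ≠ 0) :
    Lead (fun P : E.Pt => xc (n • P)) 1 (1 / (n : k) ^ 2) := by
  induction n using Nat.strong_induction_on with
  | _ n ih =>
  rcases Nat.lt_or_ge n 3 with h3 | h3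
  · interval_cases n
    · simpa using Lead.x (E := E)
    · have h4 : (4 : k) ≠ 0 := four_ne
      have h8 : E.dblNum.natDegree = 4 := by unfold dblNum; compute_degree!
      have h9 : E.dblNum.coeff 4 = 1 := by
        have : E.dblNum.Monic := by unfold dblNum; monicity!
        rw [← h8]; exact this
      have hf3 : (C 4 * E.f).natDegree ≤ 3 := (natDegree_C_mul_le _ _).trans E.f_natDegree.le
      have e1 := (Lead.x (E := E)).poly (n := 4) (p := E.dblNum) h8.le
      have e2 := (Lead.x (E := E)).poly (n := 3) hf3
      have hc : (C 4 * E.f).coeff 3 = 4 := by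
        have : E.f.coeff 3 = 1 := by rw [← E.f_natDegree]; exact E.f_monic
        rw [coeff_C_mul, this, mul_one]
      have := e1.div e2 (h'' := fun P => xc (2 • P)) (n := 1) (by rw [hc]; simpa using h4) rfl (by
        filter_upwards [(AeR_two (E := E)).ev] with P ⟨h5, _, h7⟩
        rw [two_nsmul, h7]; field_simp)
      rw [h9, hc] at this
      convert this using 1
      norm_num
  obtain ⟨m, rfl⟩ : ∃ m, n = m + 1 := ⟨n - 1, by omega⟩
  obtain ⟨l, rfl⟩ : ∃ l, m = l + 1 := ⟨m - 1, by omega⟩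
  have i1 := ih (l + 1) (by omega) (by omega) (fun i a b => h i a (by omega))
  have i0 := ih l (by omega) (by omega) (fun i a b => h i a (by omega))
  have n0 : (l : k) ≠ 0 := h l (by omega) (by omega)
  have n1 : ((l : k) + 1) ≠ 0 := by exact_mod_cast h (l + 1) (by omega) (by omega)
  have n2 : ((l : k) + 2) ≠ 0 := by exact_mod_cast h (l + 2) (by omega) (by omega)
  have nm : mulN E l ≠ 0 := mulN_ne n0
  have nm1 : mulN E (l + 1) ≠ 0 := mulN_ne (by exact_mod_cast n1)
  have nm2 : mulN E (l + 2) ≠ 0 := mulN_ne (by exact_mod_cast n2)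
  push_cast at i1 ⊢
  set s : k := 1 / ((l : k) + 1) ^ 2 with hs
  have hs1 : s + -1 = -(l * (l + 2)) * s := by rw [hs]; field_simp; ring
  have hs0 : s + -1 ≠ 0 := by
    rw [hs1]; exact mul_ne_zero (neg_ne_zero.2 (mul_ne_zero n0 n2)) (by rw [hs]; exact one_div_ne_zero (pow_ne_zero 2 n1))
  have num := ((((i1.mul Lead.x).add ((Lead.const E.A).raise (by norm_num))).mul
    (i1.add Lead.x)).smul 2).add ((Lead.const (4 * E.B)).raise (n := 3) (by norm_num))
  have den := (i1.add Lead.x.neg).pow 2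
  have e := (num.div den (h'' := fun P => xc ((l + 2) • P) + xc (l • P)) (n := 1)
    (pow_ne_zero 2 hs0) rfl (by
      filter_upwards [hom_ev_ne (mulN_rat l) nm, hom_ev_ne (mulN_rat (l + 1)) nm1,
        hom_ev_ne (mulN_rat (l + 2)) nm2, ev_ne 0] with P a0 a1 a2 a3
      simp only [mulN_apply] at a0 a1 a2
      have hne : xc ((l + 1) • P) ≠ xc P := by
        intro hx
        rcases eq_or_neg_of_X_eq a1 a3 hx with h5 | h5
        · apply a0; rw [add_smul, one_smul] at h5; simpa using h5
        · apply a2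
          rw [show l + 2 = (l + 1) + 1 from rfl, add_smul, one_smul, h5]; simp
      have h6 := sum_X a1 a3 hne
      rw [show (l + 1) • P + P = (l + 2) • P by
        rw [show l + 2 = (l + 1) + 1 from rfl, add_smul (l + 1) 1, one_smul],
        show (l + 1) • P - P = l • P by rw [add_smul, one_smul]; simp] at h6
      rw [← sub_eq_add_neg, h6]; ring)).add i0.neg
  have H := e.congr (h' := fun P => xc ((l + 1 + 1) • P)) (.of_forall fun P => by ring)
  convert H using 1
  rw [hs1, hs, show ((l : k) + 1 + 1) = l + 2 by ring]
  field_simp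
  ring

end Ell

namespace Ell
variable {k : Type*} [Field k] [IsAlgClosed k] [CharGood k] {E E' E'' : Ell k}

lemma HasSqrt.of_jj {D : ℤ} (h : HasSqrt D E) (hj : jj E = jj E') : HasSqrt D E' := by
  obtain ⟨α, hα, hsq⟩ := h
  obtain ⟨θ, hθ, hd⟩ := exists_iso hj
  have h0 : θ ≠ 0 := by rintro rfl; simp [hdeg_zero] at hd
  have hs : Sep θ := sep_of_deg hθ (by simp [hd])
  have hk : θ.ker ≤ (AddMonoidHom.id E.Pt).ker := by
    have : Nat.card θ.ker = 1 := by rw [← hd]; exact hs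
    rw [AddSubgroup.card_eq_one.1 this]; exact bot_le
  obtain ⟨γ, hγ, hγ'⟩ := factor hθ h0 hs rat_id hk
  refine ⟨θ.comp (α.comp γ), rat_comp (rat_comp hγ hα) hθ, fun P => ?_⟩
  obtain ⟨Q, rfl⟩ := hom_surj hθ h0 P
  simp only [AddMonoidHom.comp_apply, hγ', AddMonoidHom.id_apply, hsq, map_zsmul]

lemma sqrt_hdeg {α : E.Pt →+ E.Pt} {D : ℤ} (hα : IsRatPt α) (hsq : ∀ P, α (α P) = D • P) :
    hdeg α = D.natAbs := by
  have h1 := hdeg_comp hα hα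
  have h2 : α.comp α = D • AddMonoidHom.id E.Pt := by ext P; simp [hsq]
  have h3 := hdeg_zsmul (rat_id (E := E)) D
  rw [← h2, h1, hdeg_id] at h3
  have h4 : (hdeg α) * (hdeg α) = D.natAbs * D.natAbs := by
    zify; push_cast at h3; rw [h3, abs_mul_abs_self]; ring
  exact Nat.mul_self_inj.1 h4

theorem HasSqrt.exists_form {D : ℤ} (hD : D ≠ 0)
    (hN : ∀ i : ℕ, 1 ≤ i → i ≤ D.natAbs → (i : k) ≠ 0) (h : HasSqrt D E) :
    ∃ (α : E.Pt →+ E.Pt) (U V : k[X]) (a : k), (∀ P, α (α P) = D • P) ∧ IsRatPt α ∧ AeR α U V ∧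
      a ^ 2 * (D : k) ^ 2 = 1 ∧ U.natDegree = D.natAbs ∧ V.natDegree + 1 = D.natAbs ∧ V.Monic ∧
      U.leadingCoeff = a ∧
      C a * (E.f * wr U V ^ 2) = (U ^ 3 + C E.A * U * V ^ 2 + C E.B * V ^ 3) * V := by
  obtain ⟨α, hα, hsq⟩ := h
  have hd := sqrt_hdeg hα hsq
  have hN1 : 1 ≤ D.natAbs := Int.natAbs_pos.2 hD
  have hDk : (D.natAbs : k) ≠ 0 := hN _ hN1 le_rfl
  have h0 : α ≠ 0 := by rintro rfl; rw [hdeg_zero] at hd; omega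
  have hs : Sep α := sep_of_deg hα (by rw [hd]; exact hDk)
  have hc : Nat.card α.ker = D.natAbs := by rw [← hd]; exact hs
  have hfin : Finite α.ker := Nat.finite_of_card_ne_zero (by omega)
  obtain ⟨E0, c, r, c0, cd, cs, ck, U0, V0, hR, hU, hV, hUV, hw⟩ :=
    exists_quotient α.ker (by rw [hc]; exact hDk)
  obtain ⟨θ, hθ, hθ'⟩ := factor r c0 cs hα (by rw [ck])
  have hθd : hdeg θ = 1 := by
    have h3 := hdeg_comp r hθ
    rw [show θ.comp c = α from AddMonoidHom.ext hθ', cd, hc, hd] at h3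
    nlinarith
  obtain ⟨a, ha, hax, hA, hB⟩ := scale_of_hdeg_one hθ hθd
  have hUd : U0.natDegree = D.natAbs := by rw [← hR.hdeg_eq, cd, hc]
  have hCa : (C a : k[X]) ≠ 0 := by simpa using ha
  have hUd' : (C a * U0).natDegree = D.natAbs := by rw [natDegree_C_mul ha, hUd]
  have hlc : (C a * U0).leadingCoeff = a := by rw [leadingCoeff_mul, leadingCoeff_C, hU.leadingCoeff, mul_one]
  have hRα : AeR α (C a * U0) V0 := by
    refine ⟨?_, by rw [hUd']; omega, hV.ne_zero, ?_⟩
    · exact (isCoprime_mul_unit_left_left (isUnit_C.2 ha.isUnit) _ _).2 hR.cop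
    · filter_upwards [hR.ev] with P ⟨h1, h2, h3⟩
      rw [← hθ']
      refine ⟨h1, (hax _ h2).1, ?_⟩
      rw [(hax _ h2).2, h3, eval_mul, eval_C, mul_div_assoc]
  refine ⟨α, C a * U0, V0, a, hsq, hα, hRα, ?_, hUd', by omega, hV, hlc, ?_⟩
  · have e1 : Lead (fun P => xc (α P)) 1 a := by
      refine ⟨C a * U0, V0, hV, by omega, ?_, ?_⟩
      · rw [show V0.natDegree + 1 = (C a * U0).natDegree by omega]; exact hlc
      · filter_upwards [hRα.ev] with P ⟨h1, h2, h3⟩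
        rw [h3]; field_simp
    have e2 := (e1.poly hUd'.le).div (e1.poly (p := V0) (n := D.natAbs - 1) (by omega))
      (h'' := fun P => xc (α (α P))) (n := 1) ?_ (by omega) ?_
    rotate_left
    · rw [show D.natAbs - 1 = V0.natDegree by omega, hV.coeff_natDegree, one_mul]
      exact pow_ne_zero _ ha
    · filter_upwards [(hom_tendsto hα h0).eventually hRα.ev] with P ⟨h1, h2, h3⟩
      rw [h3]; field_simp
    have e3 := (lead_nsmul (E := E) hN1 hN).congr (h' := fun P => xc (α (α P))) (by
      refine .of_forall fun P => ?_
      simp only [hsq]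
      rcases Int.natAbs_eq D with h | h
      · conv_lhs => rw [h, natCast_zsmul]
      · conv_lhs => rw [h, neg_smul, X_neg, natCast_zsmul])
    have e4 := e2.unique e3
    rw [show D.natAbs - 1 = V0.natDegree by omega, hV.coeff_natDegree, one_mul,
      show (C a * U0).coeff D.natAbs = a by rw [← hUd', coeff_natDegree, hlc],
      show D.natAbs = V0.natDegree + 1 by omega] at e4
    have e5 : (D : k) ^ 2 = ((V0.natDegree + 1 : ℕ) : k) ^ 2 := by
      rw [show V0.natDegree + 1 = D.natAbs by omega]
      have : (D : ℤ) ^ 2 = (D.natAbs : ℤ) ^ 2 := (Int.natAbs_sq D).symm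
      exact_mod_cast congrArg (Int.cast : ℤ → k) this
    have e6 : ((V0.natDegree + 1 : ℕ) : k) ≠ 0 := by
      rwa [show V0.natDegree + 1 = D.natAbs by omega]
    rw [e5]
    field_simp at e4
    apply mul_left_cancel₀ (pow_ne_zero V0.natDegree ha)
    linear_combination e4
  · rw [show wr (C a * U0) V0 = C a * wr U0 V0 by
      simp only [wr, derivative_mul, derivative_C]; ring, hA, hB]
    simp only [map_mul, map_pow]
    linear_combination (C a) ^ 3 * hw

end Ell

namespace Isog

section ring
variable {R : Type*} [CommRing R]

/-- The numerator of `r - z r'` for `r = U / V`. -/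
def dd (U V : R[X]) : R[X] := U * V - X * (derivative U * V - U * derivative V)

/-- The numerator of the differential equation at infinity satisfied by an isogeny from
`y² = x³ - 3x + 2t` to itself. -/
def ode (t L : R) (U V : R[X]) : R[X] :=
  (1 - 3 * X ^ 2 + 2 * C t * X ^ 3) * dd U V ^ 2 -
    C L * (U ^ 3 * V - 3 * X ^ 2 * U * V ^ 3 + 2 * C t * X ^ 3 * V ^ 4)

lemma dd_hom (h U V : R[X]) : dd (h * U) (h * V) = h ^ 2 * dd U V := by
  simp only [dd, derivative_mul]; ring

lemma ode_hom (t L : R) (h U V : R[X]) : ode t L (h * U) (h * V) = h ^ 4 * ode t L U V := by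
  rw [ode, dd_hom, ode]; ring

lemma ode_sub {t L a : R} (hL : L * a = 1) {n : ℕ} (hn : 1 ≤ n) (G V Q : R[X])
    (hG : G.eval 0 = a) : ∃ T : R[X], ode t L (V * G - X ^ n * Q) V = V ^ 4 * ode t L G 1 +
      X ^ n * T ∧ T.eval 0 = (2 * n + 1) * a * V.eval 0 ^ 3 * Q.eval 0 := by
  obtain ⟨m, rfl⟩ : ∃ m, n = m + 1 := ⟨n - 1, by omega⟩
  have h1 : dd (V * G) V = V ^ 2 * dd G 1 := by rw [← dd_hom, mul_one]
  set K : R[X] := (1 - ((m + 1 : ℕ) : R[X])) * Q * V - X * (derivative Q * V - Q * derivative V)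
    with hK
  have h2 : dd (V * G - X ^ (m + 1) * Q) V = V ^ 2 * dd G 1 - X ^ (m + 1) * K := by
    rw [← h1]
    simp only [dd, hK, derivative_sub, derivative_mul, derivative_X_pow]
    simp only [map_natCast, Nat.add_sub_cancel]
    ring
  refine ⟨(1 - 3 * X ^ 2 + 2 * C t * X ^ 3) * (-2 * V ^ 2 * dd G 1 * K + X ^ (m + 1) * K ^ 2) -
    C L * (-3 * (V * G) ^ 2 * Q * V + 3 * (V * G) * X ^ (m + 1) * Q ^ 2 * V -
      X ^ (2 * (m + 1)) * Q ^ 3 * V + 3 * X ^ 2 * Q * V ^ 3), ?_, ?_⟩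
  · rw [ode, h2, ode]; ring
  · simp [dd, hK, hG]
    linear_combination (3 * a * V.eval 0 ^ 3 * Q.eval 0) * hL

end ring

section field
variable {k : Type*} [Field k]

/-- Polynomials over `k[t]` whose coefficient at `n` has degree at most `n` in `t`. -/
def Fil (p : k[X][X]) : Prop := ∀ n, (p.coeff n).natDegree ≤ n

namespace Fil
variable {p q : k[X][X]}

lemma add (hp : Fil p) (hq : Fil q) : Fil (p + q) := fun n => by
  rw [coeff_add]; exact natDegree_add_le_of_degree_le (hp n) (hq n)

lemma neg (hp : Fil p) : Fil (-p) := fun n => by rw [coeff_neg, natDegree_neg]; exact hp n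

lemma sub (hp : Fil p) (hq : Fil q) : Fil (p - q) := by
  rw [sub_eq_add_neg]; exact hp.add hq.neg

lemma mul (hp : Fil p) (hq : Fil q) : Fil (p * q) := fun n => by
  rw [coeff_mul]
  refine natDegree_sum_le_of_forall_le _ _ fun x hx => ?_
  rw [← mem_antidiagonal.1 hx]
  exact natDegree_mul_le.trans (add_le_add (hp _) (hq _))

lemma C_X_pow {c : k[X]} {n : ℕ} (h : c.natDegree ≤ n) : Fil (C c * X ^ n) := fun m => by
  rw [coeff_C_mul_X_pow]
  split_ifs with h1
  · rwa [h1]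
  · simp

lemma const (c : k) : Fil (C (C c)) := by
  simpa using C_X_pow (c := C c) (n := 0) (by simp)

lemma ofNat (n : ℕ) : Fil (n : k[X][X]) := by
  simpa using const (n : k)

lemma X : Fil (X : k[X][X]) := by simpa using C_X_pow (c := (1 : k[X])) (n := 1) (by simp)

lemma pow (hp : Fil p) (n : ℕ) : Fil (p ^ n) := by
  induction n with
  | zero => simpa using const (1 : k)
  | succ n ih => rw [pow_succ]; exact ih.mul hp

lemma X_der (hp : Fil p) : Fil (Polynomial.X * derivative p) := fun n => by
  cases n with
  | zero => simp
  | succ n =>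
    rw [coeff_X_mul, coeff_derivative]
    refine natDegree_mul_le.trans ?_
    have : ((n : k[X]) + 1).natDegree = 0 := by exact_mod_cast natDegree_natCast (n + 1)
    rw [this]; exact hp _

lemma ode (hp : Fil p) (L : k) : Fil (ode Polynomial.X (C L) p 1) := by
  have h1 : Fil (1 : k[X][X]) := by simpa using ofNat (k := k) 1
  have ht : Fil (C (Polynomial.X : k[X]) * Polynomial.X ^ 3 : k[X][X]) := C_X_pow (by simp)
  have h2 : Fil (2 * (C (Polynomial.X : k[X]) * Polynomial.X ^ 3) : k[X][X]) :=
    (ofNat (k := k) 2).mul ht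
  have h3 : Fil (3 * Polynomial.X ^ 2 : k[X][X]) := (ofNat (k := k) 3).mul (X.pow 2)
  have hd : Fil (dd p 1) := by
    have := hp.sub hp.X_der
    simpa [dd] using this
  rw [show Isog.ode Polynomial.X (C L) p 1 =
    (1 - 3 * Polynomial.X ^ 2 + 2 * (C (Polynomial.X : k[X]) * Polynomial.X ^ 3)) * dd p 1 ^ 2 -
    C (C L) * (p ^ 3 - 3 * Polynomial.X ^ 2 * p + 2 * (C (Polynomial.X : k[X]) * Polynomial.X ^ 3))
    by rw [Isog.ode]; ring]
  exact (((h1.sub h3).add h2).mul (hd.pow 2)).sub ((const L).mul (((hp.pow 3).sub (h3.mul hp)).add h2))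

end Fil

lemma exists_series {L a : k} (hL : L * a = 1) (M : ℕ) (hM : ∀ n : ℕ, n ≤ M → (2 * n + 1 : k) ≠ 0) :
    ∃ G : k[X][X], Fil G ∧ G.eval 0 = C a ∧ X ^ (M + 1) ∣ ode X (C L) G 1 := by
  have ha : a ≠ 0 := by rintro rfl; simp at hL
  induction M with
  | zero =>
    refine ⟨C (C a), Fil.const a, by simp, ?_⟩
    rw [zero_add, pow_one, X_dvd_iff, coeff_zero_eq_eval_zero]
    simp only [ode, dd, eval_sub, eval_mul, eval_add, eval_pow, eval_X, eval_C]
    have hLc : C L * C a = 1 := by rw [← map_mul, hL, map_one]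
    simp
    linear_combination (-C a ^ 2) * hLc
  | succ M ih =>
    obtain ⟨G, hF, h0, S, hS⟩ := ih fun n hn => hM n (by omega)
    have h1 : (2 * ((M + 1 : ℕ) : k) + 1) * a ≠ 0 := mul_ne_zero (hM _ le_rfl) ha
    set c : k[X] := -(S.eval 0 * C ((2 * ((M + 1 : ℕ) : k) + 1) * a)⁻¹) with hc
    have hcd : c.natDegree ≤ M + 1 := by
      have := hF.ode L (M + 1)
      rw [hS, coeff_X_pow_mul', if_pos le_rfl, Nat.sub_self, coeff_zero_eq_eval_zero] at this
      rw [hc, natDegree_neg]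
      exact (natDegree_mul_C_le _ _).trans this
    obtain ⟨T, hT, hT0⟩ := ode_sub (t := (X : k[X])) (L := C L) (a := C a)
      (by rw [← map_mul, hL, map_one]) (n := M + 1) (by omega) G 1 (C c) h0
    refine ⟨1 * G - X ^ (M + 1) * C c, ?_, by simp [h0], ?_⟩
    · rw [one_mul, mul_comm]; exact hF.sub (Fil.C_X_pow hcd)
    · rw [hT, hS, one_pow, one_mul, ← mul_add, pow_succ (X : k[X][X]) (M + 1)]
      refine mul_dvd_mul_left _ (X_dvd_iff.2 ?_)
      rw [coeff_zero_eq_eval_zero, eval_add, hT0, hc]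
      have : (2 * ((M + 1 : ℕ) : k[X]) + 1) * C a * C ((2 * ((M + 1 : ℕ) : k) + 1) * a)⁻¹ = 1 := by
        rw [show (2 * ((M + 1 : ℕ) : k[X]) + 1) = C (2 * ((M + 1 : ℕ) : k) + 1) by
          simp only [map_add, map_mul, map_ofNat, map_natCast, map_one], ← map_mul, ← map_mul,
          mul_inv_cancel₀ h1, map_one]
      simp only [eval_one, one_pow, eval_C]
      linear_combination (-S.eval 0) * this

lemma series_dvd {t L a : k} (hL : L * a = 1) {M : ℕ} (hM : ∀ n : ℕ, n ≤ M → (2 * n + 1 : k) ≠ 0)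
    {G U V : k[X]} (hG : G.eval 0 = a) (hGd : X ^ (M + 1) ∣ ode t L G 1) (h : ode t L U V = 0)
    (h0 : U.eval 0 = a * V.eval 0) (hV : V.eval 0 ≠ 0) : X ^ (M + 1) ∣ V * G - U := by
  have ha : a ≠ 0 := by rintro rfl; simp at hL
  suffices ∀ n, n ≤ M → X ^ (n + 1) ∣ V * G - U from this M le_rfl
  intro n
  induction n with
  | zero =>
    intro _
    rw [zero_add, pow_one, X_dvd_iff, coeff_zero_eq_eval_zero, eval_sub, eval_mul, hG, h0]; ring
  | succ n ih =>
    intro hn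
    obtain ⟨Q, hQ⟩ := ih (by omega)
    obtain ⟨T, hT, hT0⟩ := ode_sub (t := t) hL (n := n + 1) (by omega) G V Q hG
    rw [← hQ, sub_sub_cancel, h] at hT
    have h1 : X ^ (n + 1 + 1) ∣ X ^ (n + 1) * T := by
      have : X ^ (n + 1) * T = -(V ^ 4 * ode t L G 1) := by linear_combination -hT
      rw [this, dvd_neg]
      exact ((pow_dvd_pow X (by omega)).trans hGd).mul_left _
    rw [pow_succ, mul_dvd_mul_iff_left (pow_ne_zero _ X_ne_zero), X_dvd_iff,
      coeff_zero_eq_eval_zero, hT0] at h1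
    have h2 : Q.eval 0 = 0 := (mul_eq_zero.1 h1).resolve_left
      (mul_ne_zero (mul_ne_zero (hM _ hn) ha) (pow_ne_zero 3 hV))
    rw [hQ, pow_succ]
    exact mul_dvd_mul_left _ (X_dvd_iff.2 (by rw [coeff_zero_eq_eval_zero, h2]))

end field
end Isog

namespace Isog
variable {k : Type*} [Field k]

lemma exists_pow_mul {p : k[X]} (hp : p ≠ 0) (h : p.eval 1 = 0) :
    ∃ (e : ℕ) (F : k[X]), p = (X - 1) ^ (e + 1) * F ∧ F.eval 1 ≠ 0 := by
  obtain ⟨F, h1, h2⟩ := exists_eq_pow_rootMultiplicity_mul_and_not_dvd p hp 1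
  rw [dvd_iff_isRoot, IsRoot] at h2
  have h3 : 0 < p.rootMultiplicity 1 := (rootMultiplicity_pos hp).2 h
  refine ⟨p.rootMultiplicity 1 - 1, F, ?_, h2⟩
  rw [Nat.sub_add_cancel h3, ← C_1]
  exact h1

lemma dd_left (e : ℕ) (F V : k[X]) : dd ((X - 1) ^ (e + 1) * F) V = (X - 1) ^ e *
    ((X - 1) * F * V - X * (((e : k[X]) + 1) * F * V + (X - 1) * derivative F * V -
      (X - 1) * F * derivative V)) := by
  simp only [dd, derivative_mul, derivative_pow, derivative_sub, derivative_X, derivative_one]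
  simp only [Nat.add_sub_cancel, map_natCast]
  push_cast
  ring

lemma dd_right (e : ℕ) (F U : k[X]) : dd U ((X - 1) ^ (e + 1) * F) = (X - 1) ^ e *
    ((X - 1) * F * U - X * ((X - 1) * derivative U * F - U * (((e : k[X]) + 1) * F +
      (X - 1) * derivative F))) := by
  simp only [dd, derivative_mul, derivative_pow, derivative_sub, derivative_X, derivative_one]
  simp only [Nat.add_sub_cancel, map_natCast]
  push_cast
  ring

lemma dd_add (c : k[X]) (hc : derivative c = 0) (D V : k[X]) : dd (D + c * X * V) V = dd D V := by
  simp only [dd, derivative_mul, derivative_add, derivative_X, hc]; ring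

lemma natDegree_sub_le_max {p q : k[X]} {m : ℕ} (hp : p.natDegree ≤ m) (hq : q.natDegree ≤ m) :
    (p - q).natDegree ≤ m := (natDegree_sub_le_of_le hp hq).trans (max_self m).le

lemma no_nodal {L : k} (h3 : (3 : k) ≠ 0) (hL : L ≠ 0) {U V : k[X]} (hc : IsCoprime U V)
    (h : ode 1 L U V = 0) (hU0 : U.eval 0 ≠ 0) (hV0 : V.eval 0 ≠ 0) {N : ℕ}
    (hN : ∀ e : ℕ, 1 ≤ e → e ≤ N → (e : k) ^ 2 ≠ L) (hdU : U.natDegree ≤ N)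
    (hdV : V.natDegree + 1 ≤ N) : False := by
  have hY : (X - 1 : k[X]) ≠ 0 := by simpa using X_sub_C_ne_zero (1 : k)
  have key : (X - 1) ^ 2 * (1 + 2 * X) * dd U V ^ 2 =
      C L * (V * (U - X * V) ^ 2 * (U + 2 * X * V)) := by
    rw [ode, C_1] at h; linear_combination h
  have hnot : U.eval 1 = 0 → V.eval 1 = 0 → False := by
    intro h1 h2
    obtain ⟨r, s, hrs⟩ := hc
    have := congrArg (eval 1) hrs
    simp [h1, h2] at this
  by_cases hV1 : V.eval 1 = 0
  · have hV : V ≠ 0 := by rintro rfl; simp at hV0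
    obtain ⟨e, F, rfl, hF⟩ := exists_pow_mul hV hV1
    rw [dd_right] at key
    set S := ((X - 1) * F * U - X * ((X - 1) * derivative U * F - U * (((e : k[X]) + 1) * F +
      (X - 1) * derivative F)))
    have k2 : (X - 1) ^ (e + 1) * ((X - 1) ^ (e + 1) * (1 + 2 * X) * S ^ 2) = (X - 1) ^ (e + 1) *
        (C L * (F * (U - X * ((X - 1) ^ (e + 1) * F)) ^ 2 *
          (U + 2 * X * ((X - 1) ^ (e + 1) * F)))) := by
      linear_combination key
    have k3 := congrArg (eval 1) (mul_left_cancel₀ (pow_ne_zero _ hY) k2)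
    simp only [eval_mul, eval_add, eval_sub, eval_pow, eval_X, eval_one, eval_C, sub_self] at k3
    simp [hL, hF] at k3
    exact hnot k3 hV1
  set K := U + 2 * X * V with hK
  by_cases hK1 : K.eval 1 = 0
  · have hK0 : K ≠ 0 := by intro h0; apply hU0; have := congrArg (eval 0) h0; simpa [hK] using this
    obtain ⟨e, F, hKF, hF⟩ := exists_pow_mul hK0 hK1
    have hU : U = K + (-2) * X * V := by rw [hK]; ring
    have hdd : dd U V = dd K V := by
      conv_lhs => rw [hU]
      exact dd_add _ (by simp) _ _
    rw [hdd, hKF, dd_left] at key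
    set S := (X - 1) * F * V - X * (((e : k[X]) + 1) * F * V + (X - 1) * derivative F * V -
      (X - 1) * F * derivative V)
    have k2 : (X - 1) ^ (e + 1) * ((X - 1) ^ (e + 1) * (1 + 2 * X) * S ^ 2) = (X - 1) ^ (e + 1) *
        (C L * (V * (U - X * V) ^ 2 * F)) := by
      linear_combination key
    have k3 := congrArg (eval 1) (mul_left_cancel₀ (pow_ne_zero _ hY) k2)
    simp only [eval_mul, eval_add, eval_sub, eval_pow, eval_X, eval_one, eval_C, sub_self] at k3
    simp [hL, hF, hV1] at k3
    apply hV1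
    rw [hK] at hK1
    simp at hK1
    have : (3 : k) * V.eval 1 = 0 := by linear_combination hK1 - k3
    exact (mul_eq_zero.1 this).resolve_left h3
  set D := U - X * V with hD
  by_cases hD1 : D.eval 1 = 0
  · have hD0 : D ≠ 0 := by intro h0; apply hU0; have := congrArg (eval 0) h0; simpa [hD] using this
    obtain ⟨e, F, hDF, hF⟩ := exists_pow_mul hD0 hD1
    have hU : U = D + 1 * X * V := by rw [hD]; ring
    have hdd : dd U V = dd D V := by
      conv_lhs => rw [hU]
      exact dd_add _ (by simp) _ _
    rw [hdd, hDF, dd_left] at key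
    set S := (X - 1) * F * V - X * (((e : k[X]) + 1) * F * V + (X - 1) * derivative F * V -
      (X - 1) * F * derivative V) with hS
    have k2 : (X - 1) ^ (2 * e + 2) * ((1 + 2 * X) * S ^ 2) = (X - 1) ^ (2 * e + 2) *
        (C L * (V * F ^ 2 * K)) := by
      linear_combination key
    have k3 := congrArg (eval 1) (mul_left_cancel₀ (pow_ne_zero _ hY) k2)
    rw [hK, hS] at k3
    have hUV : U.eval 1 = V.eval 1 := by
      rw [hD] at hD1; simp at hD1; linear_combination hD1
    simp [hUV] at k3
    refine hN (e + 1) (by omega) ?_ ?_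
    · have h5 : D.natDegree ≤ N := by
        rw [hD]
        refine natDegree_sub_le_max hdU (natDegree_mul_le.trans ?_)
        rw [natDegree_X]; omega
      rw [hDF, natDegree_mul (pow_ne_zero _ hY) (by rintro rfl; simp at hF), natDegree_pow,
        show (X - 1 : k[X]).natDegree = 1 by rw [← C_1]; exact natDegree_X_sub_C 1] at h5
      omega
    · push_cast
      apply mul_left_cancel₀ (mul_ne_zero h3 (mul_ne_zero (pow_ne_zero 2 hF) (pow_ne_zero 2 hV1)))
      linear_combination k3
  have k3 := congrArg (eval 1) key
  simp [hL, hV1, hK1, hD1] at k3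

lemma natDegree_ode {L t : k} {U V : k[X]} {N : ℕ} (hdU : U.natDegree ≤ N)
    (hdV : V.natDegree + 1 ≤ N) : (ode t L U V).natDegree ≤ 4 * N + 1 := by
  have hU' := natDegree_derivative_le U
  have hV' := natDegree_derivative_le V
  have hb : ∀ {p q : k[X]} {m n : ℕ}, p.natDegree ≤ m → q.natDegree ≤ n →
      (p * q).natDegree ≤ m + n := fun hp hq => natDegree_mul_le.trans (add_le_add hp hq)
  have hp : ∀ {p : k[X]} {m : ℕ} (n : ℕ), p.natDegree ≤ m → (p ^ n).natDegree ≤ n * m :=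
    fun n h => natDegree_pow_le.trans (Nat.mul_le_mul_left n h)
  have hx : (X : k[X]).natDegree ≤ 1 := natDegree_X_le
  have hX : ∀ n, ((X : k[X]) ^ n).natDegree ≤ n := natDegree_X_pow_le
  have hdVV : V.natDegree ≤ N - 1 := by omega
  have hd : (dd U V).natDegree ≤ 2 * N - 1 := by
    rw [dd]
    refine natDegree_sub_le_max ((hb hdU hdVV).trans (by omega)) ?_
    by_cases h0 : V.natDegree = 0
    · rw [derivative_of_natDegree_zero h0, mul_zero, sub_zero]
      exact (hb hx (hb (hU'.trans (Nat.sub_le_sub_right hdU 1)) hdVV)).trans (by omega)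
    · refine (hb hx (natDegree_sub_le_max (hb (hU'.trans (Nat.sub_le_sub_right hdU 1)) hdVV)
        ((hb hdU (hV'.trans (Nat.sub_le_sub_right hdVV 1))).trans (by omega)))).trans (by omega)
  rw [ode]
  refine natDegree_sub_le_max ?_ ((natDegree_C_mul_le _ _).trans ?_)
  · refine (hb (m := 3) ?_ (hp 2 hd)).trans (by omega)
    compute_degree
  · refine natDegree_add_le_of_degree_le (natDegree_sub_le_max ?_ ?_) ?_
    · exact (hb (hp 3 hdU) hdVV).trans (by omega)
    · refine (hb (hb (m := 2) ?_ hdU) (hp 3 hdVV)).trans (by omega)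
      compute_degree
    · refine (hb (m := 3) ?_ (hp 4 hdVV)).trans (by omega)
      compute_degree

lemma kernel_trivial {L a : k} (h3 : (3 : k) ≠ 0) (hL : L * a = 1) {N : ℕ}
    (hN : ∀ e : ℕ, 1 ≤ e → e ≤ N → (e : k) ^ 2 ≠ L) {G U V : k[X]} (hG : G.eval 0 = a)
    (hGd : X ^ (4 * N + 2) ∣ ode 1 L G 1) (hdU : U.natDegree ≤ N) (hdV : V.natDegree + 1 ≤ N)
    (hUV : X ^ (4 * N + 2) ∣ V * G - U) : V = 0 := by
  by_contra hV
  have ha : a ≠ 0 := by rintro rfl; simp at hL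
  obtain ⟨Q, hQ⟩ := hUV
  have h0 : ode 1 L U V = 0 := by
    obtain ⟨T, hT, -⟩ := ode_sub (t := (1 : k)) hL (n := 4 * N + 2) (by omega) G V Q hG
    rw [← hQ, sub_sub_cancel] at hT
    refine eq_zero_of_dvd_of_natDegree_lt (p := X ^ (4 * N + 2)) ?_ ?_
    · rw [hT]; exact dvd_add (hGd.mul_left _) (dvd_mul_right _ _)
    · rw [natDegree_X_pow]; exact (natDegree_ode hdU hdV).trans_lt (by omega)
  obtain ⟨h, U1, V1, hc, hU1, hV1⟩ : ∃ h U1 V1 : k[X], IsCoprime U1 V1 ∧ U = h * U1 ∧ V = h * V1 := by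
    obtain ⟨U1, h1⟩ := EuclideanDomain.gcd_dvd_left U V
    obtain ⟨V1, h2⟩ := EuclideanDomain.gcd_dvd_right U V
    have hne : EuclideanDomain.gcd U V ≠ 0 := by
      intro h0; rw [h0, zero_mul] at h2; exact hV h2
    refine ⟨_, U1, V1, ?_, h1, h2⟩
    refine ⟨EuclideanDomain.gcdA U V, EuclideanDomain.gcdB U V, mul_left_cancel₀ hne ?_⟩
    have := EuclideanDomain.gcd_eq_gcd_ab U V
    generalize EuclideanDomain.gcd U V = g at *
    generalize EuclideanDomain.gcdA U V = A at *
    generalize EuclideanDomain.gcdB U V = B at *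
    rw [h1, h2] at this
    linear_combination -this
  have hh : h ≠ 0 := by rintro rfl; simp at hV1; exact hV hV1
  have hV10 : V1 ≠ 0 := by rintro rfl; simp at hV1; exact hV hV1
  rw [hU1, hV1, ode_hom] at h0
  replace h0 := (mul_eq_zero.1 h0).resolve_left (pow_ne_zero 4 hh)
  have hdV1 : V.natDegree = h.natDegree + V1.natDegree := by rw [hV1, natDegree_mul hh hV10]
  have hdU1 : U1.natDegree ≤ N := by
    by_cases hz : U1 = 0
    · simp [hz]
    · rw [hU1, natDegree_mul hh hz] at hdU; omega
  have hu : U1.eval 0 = a * V1.eval 0 := by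
    by_contra hne
    have hcop : IsCoprime (X ^ (4 * N + 2)) (V1 * G - U1) := by
      refine IsCoprime.pow_left ((Irreducible.coprime_iff_not_dvd irreducible_X).2 ?_)
      rw [X_dvd_iff, coeff_zero_eq_eval_zero, eval_sub, eval_mul, hG]
      intro hz; apply hne; linear_combination -hz
    have hdv : X ^ (4 * N + 2) ∣ h := by
      refine hcop.dvd_of_dvd_mul_right ⟨Q, ?_⟩
      rw [← hQ, hU1, hV1]; ring
    have := natDegree_le_of_dvd hdv hh
    rw [natDegree_X_pow] at this
    omega
  have hv : V1.eval 0 ≠ 0 := by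
    intro hz
    rw [hz, mul_zero] at hu
    obtain ⟨r, s, hrs⟩ := hc
    have := congrArg (eval 0) hrs
    simp [hu, hz] at this
  refine no_nodal h3 (left_ne_zero_of_mul_eq_one hL) hc h0 ?_ hv hN hdU1 (by omega)
  rw [hu]; exact mul_ne_zero ha hv

end Isog

namespace Isog
variable {k : Type*} [Field k]

lemma coeff_mul_small {V G : k[X]} {N n : ℕ} (hV : V.natDegree + 1 ≤ N) (hn : N ≤ n) :
    (V * G).coeff n = ∑ j : Fin N, G.coeff (n - j) * V.coeff j := by
  rw [coeff_mul, Finset.Nat.sum_antidiagonal_eq_sum_range_succ (fun i j => V.coeff i * G.coeff j),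
    Fin.sum_univ_eq_sum_range (fun j => G.coeff (n - j) * V.coeff j)]
  symm
  rw [← sum_subset (range_subset_range.2 (by omega : N ≤ n.succ))]
  · exact sum_congr rfl fun i _ => mul_comm _ _
  · intro i _ hi
    rw [coeff_eq_zero_of_natDegree_lt (by simp at hi; omega), zero_mul]

lemma natDegree_det {n d : ℕ} {M : Matrix (Fin n) (Fin n) k[X]} (h : ∀ i j, (M i j).natDegree ≤ d) :
    M.det.natDegree ≤ n * d := by
  rw [Matrix.det_apply]
  refine natDegree_sum_le_of_forall_le _ _ fun σ _ => ?_
  refine (natDegree_smul_le _ _).trans ((natDegree_prod_le _ _).trans ?_)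
  refine (sum_le_card_nsmul _ _ d fun i _ => h _ _).trans (by simp)

lemma map_ode (t L : k) (G : k[X][X]) : (ode X (C L) G 1).map (evalRingHom t) =
    ode t L (G.map (evalRingHom t)) 1 := by
  simp only [ode, dd, Polynomial.map_sub, Polynomial.map_mul, Polynomial.map_add,
    Polynomial.map_pow, map_X, Polynomial.map_one, derivative_map, map_C, coe_evalRingHom, eval_X,
    eval_C, Polynomial.map_ofNat, derivative_one, Polynomial.map_zero]

theorem exists_finset {L a : k} (h3 : (3 : k) ≠ 0) (hL : L * a = 1) {N : ℕ}
    (hN : ∀ e : ℕ, 1 ≤ e → e ≤ N → (e : k) ^ 2 ≠ L)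
    (hM : ∀ n : ℕ, n ≤ 4 * N + 1 → (2 * n + 1 : k) ≠ 0) :
    ∃ S : Finset k, S.card ≤ N * (4 * N + 1) ∧ ∀ (t : k) (U V : k[X]), U.natDegree ≤ N →
      V.natDegree + 1 ≤ N → ode t L U V = 0 → U.eval 0 = a * V.eval 0 → V.eval 0 ≠ 0 → t ∈ S := by
  obtain ⟨G, hF, hG0, hGd⟩ := exists_series hL (4 * N + 1) hM
  obtain ⟨Gt, hGt⟩ : ∃ Gt : k → k[X], ∀ t, Gt t = G.map (evalRingHom t) := ⟨_, fun _ => rfl⟩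
  have hGc : ∀ t n, (Gt t).coeff n = (G.coeff n).eval t := fun t n => by
    rw [hGt, coeff_map, coe_evalRingHom]
  have hGt0 : ∀ t, (Gt t).eval 0 = a := fun t => by
    rw [← coeff_zero_eq_eval_zero, hGc, coeff_zero_eq_eval_zero, hG0, eval_C]
  have hGtd : ∀ t, X ^ (4 * N + 2) ∣ ode t L (Gt t) 1 := fun t => by
    rw [hGt, ← map_ode]
    have := Polynomial.map_dvd (evalRingHom t) hGd
    rwa [Polynomial.map_pow, map_X] at this
  obtain ⟨Mx, hMx⟩ : ∃ Mx : Matrix (Fin (3 * N + 1)) (Fin N) k[X],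
    ∀ i j, Mx i j = G.coeff (i + N + 1 - j) := ⟨fun i j => G.coeff (i + N + 1 - j), fun _ _ => rfl⟩
  obtain ⟨Mt, hMt⟩ : ∃ Mt : k → Matrix (Fin (3 * N + 1)) (Fin N) k,
    ∀ t, Mt t = Mx.map (evalRingHom t) := ⟨fun t => Mx.map (evalRingHom t), fun _ => rfl⟩
  have hker : ∀ t (V : k[X]), V.natDegree + 1 ≤ N → ∀ i : Fin (3 * N + 1),
      (Mt t).mulVec (fun j => V.coeff j) i = (V * Gt t).coeff (i + N + 1) := by
    intro t V hV i
    rw [coeff_mul_small hV (by omega), Matrix.mulVec, dotProduct]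
    refine sum_congr rfl fun j _ => ?_
    rw [hMt, Matrix.map_apply, hMx, hGc, coe_evalRingHom]
  have hinj : LinearMap.ker (Matrix.toLin' (Mt 1)) = ⊥ := by
    rw [LinearMap.ker_eq_bot']
    intro v hv
    rw [Matrix.toLin'_apply] at hv
    by_cases hN0 : N = 0
    · subst hN0; exact Subsingleton.elim _ _
    let V : k[X] := ∑ j : Fin N, C (v j) * X ^ (j : ℕ)
    have hVc : ∀ j : Fin N, V.coeff j = v j := by
      intro j
      simp only [V, finsetSum_coeff, coeff_C_mul_X_pow]
      rw [sum_eq_single j]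
      · simp
      · intro i _ hi
        rw [if_neg (fun h => hi (Fin.ext h.symm))]
      · simp
    have hVd : V.natDegree + 1 ≤ N := by
      have : V.natDegree ≤ N - 1 := natDegree_sum_le_of_forall_le _ _ fun j _ =>
        (natDegree_C_mul_X_pow_le _ _).trans (by omega)
      omega
    have hk := hker 1 V hVd
    rw [show (fun j : Fin N => V.coeff j) = v from funext hVc, hv] at hk
    let U : k[X] := ∑ i ∈ range (N + 1), C ((V * Gt 1).coeff i) * X ^ i
    have hUd : U.natDegree ≤ N := natDegree_sum_le_of_forall_le _ _ fun j hj =>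
        (natDegree_C_mul_X_pow_le _ _).trans (by rw [mem_range] at hj; omega)
    have hV0 := kernel_trivial h3 hL hN (hGt0 1) (hGtd 1) hUd hVd (by
      rw [X_pow_dvd_iff]
      intro n hn
      rw [coeff_sub]
      rcases Nat.lt_or_ge n (N + 1) with h | h
      · simp only [U, finsetSum_coeff, coeff_C_mul_X_pow]
        rw [sum_ite_eq, if_pos (mem_range.2 h), sub_self]
      · rw [coeff_eq_zero_of_natDegree_lt (p := U) (by omega), sub_zero]
        have := hk ⟨n - N - 1, by omega⟩
        rw [show (n - N - 1) + N + 1 = n by omega] at this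
        exact this.symm)
    funext j
    rw [← hVc, hV0]; simp
  obtain ⟨g, hg⟩ := LinearMap.exists_leftInverse_of_injective _ hinj
  set B := LinearMap.toMatrix' g
  have hB : B * Mt 1 = 1 := by
    rw [← LinearMap.toMatrix'_toLin' (Mt 1), ← LinearMap.toMatrix'_comp, hg, LinearMap.toMatrix'_id]
  set δ := (B.map C * Mx).det with hδ
  have hδe : ∀ t, δ.eval t = (B * Mt t).det := by
    intro t
    rw [hδ, ← coe_evalRingHom, RingHom.map_det, RingHom.mapMatrix_apply, Matrix.map_mul, hMt]
    congr 2
    ext i j; simp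
  have hδ1 : δ.eval 1 = 1 := by rw [hδe, hB, Matrix.det_one]
  have hδ0 : δ ≠ 0 := by intro h; rw [h, eval_zero] at hδ1; exact zero_ne_one hδ1
  refine ⟨δ.roots.toFinset, ?_, ?_⟩
  · refine (Multiset.toFinset_card_le _).trans ((card_roots' _).trans (natDegree_det fun i j => ?_))
    rw [Matrix.mul_apply]
    refine natDegree_sum_le_of_forall_le _ _ fun l _ => ?_
    rw [Matrix.map_apply, hMx]
    exact (natDegree_C_mul_le _ _).trans ((hF _).trans (by omega))
  · intro t U V hU hV ho h0 hV0
    rw [Multiset.mem_toFinset, mem_roots hδ0, IsRoot, hδe]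
    have hd := series_dvd hL hM (hGt0 t) (hGtd t) ho h0 hV0
    have hz : (Mt t).mulVec (fun j : Fin N => V.coeff j) = 0 := by
      funext i
      rw [hker t V hV]
      have := (X_pow_dvd_iff.1 hd) (i + N + 1) (by omega)
      rwa [coeff_sub, coeff_eq_zero_of_natDegree_lt (p := U) (by omega), sub_zero] at this
    refine Matrix.exists_mulVec_eq_zero_iff.1 ⟨fun j : Fin N => V.coeff j, ?_, ?_⟩
    · intro hzero
      apply hV0
      have := congrFun hzero ⟨0, by omega⟩
      rw [← coeff_zero_eq_eval_zero]; exact this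
    · rw [← Matrix.mulVec_mulVec, hz, Matrix.mulVec_zero]

end Isog

namespace Ell

lemma eval_reflect {k : Type*} [Field k] {n : ℕ} {z : k} (hz : z ≠ 0) {p : k[X]} (hp : p.natDegree ≤ n) :
    (reflect n p).eval z = z ^ n * p.eval z⁻¹ ∧
    z * (derivative (reflect n p)).eval z =
      n * z ^ n * p.eval z⁻¹ - z ^ n * z⁻¹ * (derivative p).eval z⁻¹ := by
  refine Polynomial.induction_with_natDegree_le (fun p => (reflect n p).eval z = z ^ n * p.eval z⁻¹ ∧
    z * (derivative (reflect n p)).eval z =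
      n * z ^ n * p.eval z⁻¹ - z ^ n * z⁻¹ * (derivative p).eval z⁻¹) n (by simp) ?_ ?_ p hp
  · intro m r hr hm
    obtain ⟨s, rfl⟩ := Nat.exists_eq_add_of_le hm
    rw [reflect_C_mul_X_pow, revAt_le hm, Nat.add_sub_cancel_left]
    constructor
    · simp; field_simp; ring
    · rcases m with _ | m <;> rcases s with _ | s <;>
        simp <;> field_simp <;> ring
  · intro f g _ _ hf hg
    rw [reflect_add]
    simp only [eval_add, derivative_add]
    exact ⟨by rw [hf.1, hg.1]; ring, by rw [mul_add, hf.2, hg.2]; ring⟩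

variable {k : Type*} [Field k] [IsAlgClosed k] [CharGood k] {E E' E'' : Ell k}

lemma ode_of_form {a t : k} (ha : a ≠ 0) {n : ℕ} {U V : k[X]} (hU : U.natDegree ≤ n + 1)
    (hV : V.natDegree ≤ n) (hA : E.A = -3) (hB : E.B = 2 * t)
    (h : C a * (E.f * wr U V ^ 2) = (U ^ 3 + C E.A * U * V ^ 2 + C E.B * V ^ 3) * V) :
    Isog.ode t a⁻¹ (reflect (n + 1) U) (reflect n V) = 0 := by
  have : X * Isog.ode t a⁻¹ (reflect (n + 1) U) (reflect n V) = 0 := by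
    refine Polynomial.funext fun z => ?_
    rcases eq_or_ne z 0 with rfl | hz
    · simp
    obtain ⟨u1, u2⟩ := eval_reflect hz hU
    obtain ⟨v1, v2⟩ := eval_reflect hz hV
    have hd : (Isog.dd (reflect (n + 1) U) (reflect n V)).eval z =
        z ^ (2 * n) * (wr U V).eval z⁻¹ := by
      simp only [Isog.dd, wr, eval_sub, eval_mul, eval_X]
      rw [mul_sub z, ← mul_assoc z, u2, mul_left_comm z, v2, u1, v1]
      push_cast
      field_simp
      ring
    have h' := congrArg (eval z⁻¹) h
    simp only [Isog.ode, eval_mul, eval_sub, eval_add, eval_pow, eval_X, eval_C, eval_one,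
      eval_ofNat, hd, u1, v1, E.eval_f, hA, hB] at h' ⊢
    generalize (wr U V).eval z⁻¹ = w at *
    generalize U.eval z⁻¹ = p at *
    generalize V.eval z⁻¹ = q at *
    field_simp at h' ⊢
    simp only [eval_zero]
    linear_combination z ^ (4 * n + 1) *h'
  exact (mul_eq_zero.1 this).resolve_left X_ne_zero

lemma neg_one_case (hsq : HasSqrt (-1) E) : jj E = 1 / 4 := by
  obtain ⟨α, U, V, a, h1, -, hR, ha, hU, hV, hVm, hlc, hf⟩ := hsq.exists_form (by norm_num) (by
    intro i h1 h2
    have : i = 1 := by simp at h2; omega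
    simp [this])
  have hV1 : V = 1 := by
    simp at hV
    exact hVm.natDegree_eq_zero.1 hV
  obtain ⟨b, hUab⟩ : ∃ b, U = C a * X + C b := by
    refine ⟨U.coeff 0, ?_⟩
    have hU1 : U.natDegree = 1 := by simpa using hU
    rw [eq_X_add_C_of_natDegree_le_one hU1.le]
    simp [← hlc, leadingCoeff, hU1]
  have ha2 : a ^ 2 = 1 := by simpa using ha
  have h3 : (3 : k) ≠ 0 := CharGood.three
  rw [hV1, hUab] at hf
  have hf' : C (3 * b) * X ^ 2 + C (3 * a * b ^ 2) * X +
      C (b ^ 3 + E.A * b + E.B - a * E.B) = 0 := by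
    refine Polynomial.funext fun z => ?_
    have := congrArg (eval z) hf
    simp [wr] at this ⊢
    linear_combination -this + (a * (z ^ 3 + E.A * z + E.B) - a * z ^ 3 - 3 * b * z ^ 2) * ha2
  have hb : b = 0 := by
    have := congrArg (fun p => coeff p 2) hf'
    simp [-map_sub, -map_add, -map_mul] at this
    exact this.resolve_left h3
  have hB : E.B - a * E.B = 0 := by
    have := congrArg (fun p => coeff p 0) hf'
    simpa [hb] using this
  by_cases hB0 : E.B = 0
  · have hA : E.A ≠ 0 := fun hA => E.disc (by rw [hA, hB0]; ring)
    rw [jj, hB0]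
    have h2 : (2 : k) ≠ 0 := CharGood.two
    have h4 : (4 : k) ≠ 0 := by
      rw [show (4 : k) = 2 ^ 2 by norm_num]; exact pow_ne_zero _ h2
    field_simp
    ring
  · exfalso
    have ha1 : a = 1 := by
      apply mul_right_cancel₀ hB0; linear_combination -hB
    have := (hR.ev.and (ev_Y_ne.and (ev_ne 0))).exists
    obtain ⟨P, ⟨-, hP1, hP2⟩, hP3, hP4⟩ := this
    apply hP3
    rw [Y_eq_zero_iff]
    simp [hV1, hUab, ha1, hb] at hP2
    have h5 := h1 P
    have h6 : α (α P) = P := by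
      rcases eq_or_neg_of_X_eq hP1 hP4 hP2 with h | h
      · rw [h, h]
      · rw [h, map_neg, h, neg_neg]
    rw [h6] at h5
    nth_rewrite 1 [h5]
    simp

lemma cast_ne {p : ℕ} [CharP k p] {z : ℤ} (h0 : z ≠ 0) (h : z.natAbs < p) : (z : k) ≠ 0 := by
  intro h1
  rw [CharP.intCast_eq_zero_iff k p, Int.natCast_dvd] at h1
  exact absurd (Nat.le_of_dvd (Int.natAbs_pos.2 h0) h1) (by omega)

theorem encard_jSet_base {d : ℤ} (hd : d < 0) (hsf : Squarefree d) (p : ℕ) [CharP k p]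
    (hp : 8 * d.natAbs ^ 2 + 8 * d.natAbs + 3 < p) :
    (jSet k d).encard ≤ (1 + 2 * (d.natAbs * (4 * d.natAbs + 1)) : ℕ) := by
  set N := d.natAbs with hNd
  have hN1 : 1 ≤ N := by omega
  have hNN : N ≤ N ^ 2 := by nlinarith
  rcases eq_or_ne d (-1) with rfl | hd1
  · refine (Set.encard_le_encard (t := {1 / 4}) ?_).trans ?_
    · rintro _ ⟨E, hE, rfl⟩
      exact neg_one_case hE
    · simp
  have hd0 : (d : k) ≠ 0 := cast_ne hd.ne (by omega)
  have key : ∀ s : ℤ, s.natAbs = 1 → ∃ S : Finset k, S.card ≤ N * (4 * N + 1) ∧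
      ∀ (t : k) (U V : k[X]), U.natDegree ≤ N →
      V.natDegree + 1 ≤ N → Isog.ode t (s * d : k) U V = 0 → U.eval 0 = (s * d : k)⁻¹ * V.eval 0 →
      V.eval 0 ≠ 0 → t ∈ S := by
    intro s hs
    have hs0 : (s : k) ≠ 0 := cast_ne (p := p) (by omega) (by omega)
    refine Isog.exists_finset CharGood.three (mul_inv_cancel₀ (mul_ne_zero hs0 hd0)) ?_ ?_
    · intro e he1 he2 h
      have h1 : (((e : ℤ) ^ 2 - s * d : ℤ) : k) = 0 := by push_cast; rw [h, sub_self]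
      have h2 : (e : ℤ) ^ 2 - s * d = 0 := by
        by_contra h2
        refine cast_ne (p := p) h2 ?_ h1
        refine (Int.natAbs_sub_le _ _).trans_lt ?_
        rw [Int.natAbs_pow, Int.natAbs_mul, hs, Int.natAbs_natCast, one_mul]
        have : e ^ 2 ≤ N ^ 2 := Nat.pow_le_pow_left he2 2
        omega
      have h3 : (e : ℤ) * e ∣ d := by
        have : (e : ℤ) * e ∣ s * d := ⟨1, by linear_combination -h2⟩
        exact (Int.isUnit_iff_natAbs_eq.2 hs).dvd_mul_left.1 this
      have h4 : e = 1 := by simpa [Int.isUnit_iff_natAbs_eq] using hsf _ h3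
      subst h4
      have := congrArg Int.natAbs (show s * d = 1 by simpa using (sub_eq_zero.1 h2).symm)
      rw [Int.natAbs_mul, hs] at this
      simp at this
      omega
    · intro n hn
      have := cast_ne (k := k) (p := p) (z := 2 * n + 1) (by omega) (by omega)
      push_cast at this; exact this
  obtain ⟨S1, hS1, hS1'⟩ := key 1 (by simp)
  obtain ⟨S2, hS2, hS2'⟩ := key (-1) (by simp)
  have hsub : jSet k d ⊆ ((insert 0 ((S1 ∪ S2).image fun t => -1 / (4 * (t ^ 2 - 1))) : Finset k) : Set k) := by
    rintro _ ⟨E, hE, rfl⟩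
    have h2 : (2 : k) ≠ 0 := CharGood.two
    have h3 : (3 : k) ≠ 0 := CharGood.three
    have h4 : (4 : k) ≠ 0 := by
      rw [show (4 : k) = 2 ^ 2 by norm_num]; exact pow_ne_zero _ h2
    have h27 : (27 : k) ≠ 0 := by
      rw [show (27 : k) = 3 ^ 3 by norm_num]; exact pow_ne_zero _ h3
    by_cases hA : E.A = 0
    · simp [jj, hA]
    obtain ⟨t, ht⟩ := IsAlgClosed.exists_pow_nat_eq (-27 * E.B ^ 2 / (4 * E.A ^ 3)) (n := 2) (by norm_num)
    have ht1 : t ^ 2 - 1 = -(4 * E.A ^ 3 + 27 * E.B ^ 2) / (4 * E.A ^ 3) := by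
      rw [ht]; field_simp; ring
    have ht0 : t ^ 2 - 1 ≠ 0 := by
      rw [ht1]; exact div_ne_zero (neg_ne_zero.2 E.disc) (mul_ne_zero h4 (pow_ne_zero _ hA))
    obtain ⟨E', hA', hB'⟩ : ∃ E' : Ell k, E'.A = -3 ∧ E'.B = 2 * t := by
      refine ⟨⟨-3, 2 * t, ?_⟩, rfl, rfl⟩
      rw [show (4 : k) * (-3) ^ 3 + 27 * (2 * t) ^ 2 = 27 * 4 * (t ^ 2 - 1) by ring]
      exact mul_ne_zero (mul_ne_zero h27 h4) ht0
    have hj' : jj E' = -1 / (4 * (t ^ 2 - 1)) := by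
      rw [jj, hA', hB', show (4 : k) * (-3) ^ 3 + 27 * (2 * t) ^ 2 = 27 * 4 * (t ^ 2 - 1) by ring]
      field_simp; ring
    have hj : jj E = jj E' := by
      rw [hj', ht1, jj]
      have := E.disc
      field_simp
    obtain ⟨α, U, V, a, -, -, -, ha, hU, hV, hVm, hlc, hf⟩ :=
      (hE.of_jj hj).exists_form hd.ne (by
        intro i h1 h2
        have := cast_ne (k := k) (p := p) (z := i) (by omega) (by omega)
        exact_mod_cast this)
    rw [← hNd] at hU hV
    have ha0 : a ≠ 0 := by rintro rfl; simp at ha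
    have hode := ode_of_form ha0 (n := N - 1) (t := t) (by omega) (by omega) hA' hB' hf
    rw [Nat.sub_add_cancel hN1] at hode
    have e1 : (reflect N U).eval 0 = a := by
      rw [← coeff_zero_eq_eval_zero, coeff_reflect, revAt_le (by omega), Nat.sub_zero, ← hU, ← hlc]
      rfl
    have e2 : (reflect (N - 1) V).eval 0 = 1 := by
      rw [← coeff_zero_eq_eval_zero, coeff_reflect, revAt_le (by omega), Nat.sub_zero,
        show N - 1 = V.natDegree by omega, hVm.coeff_natDegree]
    have d1 : (reflect N U).natDegree ≤ N := natDegree_reflect_le.trans (by omega)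
    have d2 : (reflect (N - 1) V).natDegree + 1 ≤ N := by
      have := natDegree_reflect_le (N := N - 1) (p := V)
      omega
    rw [hj, hj']
    have hmem : t ∈ S1 ∪ S2 := by
      have : (a * d - 1) * (a * d + 1) = 0 := by linear_combination ha
      rw [mem_union]
      rcases mul_eq_zero.1 this with h | h
      · left
        have hai : a⁻¹ = d := by exact inv_eq_iff_eq_inv.2 (eq_inv_of_mul_eq_one_left (by linear_combination h))
        have hai' : a = (d : k)⁻¹ := by rw [← hai, inv_inv]
        refine hS1' t _ _ d1 d2 ?_ ?_ (by rw [e2]; exact one_ne_zero)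
        · rw [← hode, hai]; simp
        · rw [e1, e2, hai']; simp
      · right
        have hai : a⁻¹ = -d := by exact inv_eq_iff_eq_inv.2 (eq_inv_of_mul_eq_one_left (by linear_combination -h))
        have hai' : a = (-d : k)⁻¹ := by rw [← hai, inv_inv]
        refine hS2' t _ _ d1 d2 ?_ ?_ (by rw [e2]; exact one_ne_zero)
        · rw [← hode, hai]; simp
        · rw [e1, e2, hai']; simp
    simp only [coe_insert, coe_image, Set.mem_insert_iff, Set.mem_image]
    exact .inr ⟨t, hmem, rfl⟩
  refine (Set.encard_le_encard hsub).trans ?_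
  rw [Set.encard_coe_eq_coe_finsetCard]
  have h3 := card_union_le S1 S2
  rw [Nat.cast_le]
  refine (card_insert_le _ _).trans ?_
  refine (Nat.add_le_add_right card_image_le 1).trans ?_
  omega

end Ell

namespace Ell

lemma gMul_pow_three_le {m : ℕ} (h2 : ¬ 2 ∣ m) (h3 : ¬ 3 ∣ m) : gMul m ^ 3 ≤ m ^ 4 := by
  induction m using Nat.recOnMul with
  | zero => simp at h2
  | one => simp [gMul_one]
  | prime p hp =>
    rw [gMul_prime hp]
    have h2' : p ≠ 2 := by rintro rfl; simp at h2
    have h3' : p ≠ 3 := by rintro rfl; simp at h3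
    have h4' : p ≠ 4 := by rintro rfl; exact absurd hp (by norm_num)
    have h5 : 5 ≤ p := by have := hp.two_le; omega
    obtain ⟨q, rfl⟩ := Nat.exists_eq_add_of_le h5
    nlinarith [sq_nonneg q, Nat.zero_le (q ^ 3), Nat.zero_le (q ^ 4)]
  | mul a b ha hb =>
    have e1 : ¬ 2 ∣ a := fun h => h2 (h.mul_right b)
    have e2 : ¬ 3 ∣ a := fun h => h3 (h.mul_right b)
    have e3 : ¬ 2 ∣ b := fun h => h2 (h.mul_left a)
    have e4 : ¬ 3 ∣ b := fun h => h3 (h.mul_left a)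
    rw [gMul_mul (by rintro rfl; simp at e1) (by rintro rfl; simp at e3), mul_pow, mul_pow]
    exact Nat.mul_le_mul (ha e1 e2) (hb e3 e4)

lemma gMul_le_rpow {m : ℕ} (h2 : ¬ 2 ∣ m) (h3 : ¬ 3 ∣ m) : (gMul m : ℝ) ≤ (m : ℝ) ^ (4 / 3 : ℝ) := by
  have h := gMul_pow_three_le h2 h3
  have h' : (gMul m : ℝ) ^ 3 ≤ (m : ℝ) ^ 4 := by exact_mod_cast h
  rw [← Real.rpow_le_rpow_iff (by positivity) (by positivity) (show (0 : ℝ) < 3 by norm_num),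
    ← Real.rpow_mul (by positivity)]
  norm_num
  exact_mod_cast h'

lemma recursion_bound {F : ℕ → ℝ} {l : ℕ} {q s c : ℝ} (hl : 2 ≤ l) (hq : 0 ≤ q) (hc : 0 ≤ c)
    (hs : 0 ≤ s) (hql : q < (l : ℝ) ^ s) (h0 : F 0 ≤ 0)
    (h : ∀ y, 1 ≤ y → F y ≤ c * (y : ℝ) ^ s + q * F (y / l)) :
    ∃ C, 0 ≤ C ∧ ∀ y, F y ≤ C * (y : ℝ) ^ s := by
  have hl0 : (0 : ℝ) < (l : ℝ) ^ s := Real.rpow_pos_of_pos (by positivity) _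
  have hr : q / (l : ℝ) ^ s < 1 := (div_lt_one hl0).2 hql
  refine ⟨c / (1 - q / (l : ℝ) ^ s), div_nonneg hc (by linarith), fun y => ?_⟩
  set C := c / (1 - q / (l : ℝ) ^ s) with hC
  have hC0 : 0 ≤ C := div_nonneg hc (by linarith)
  have hCe : c + q * (C / (l : ℝ) ^ s) = C := by
    have : (1 - q / (l : ℝ) ^ s) ≠ 0 := by linarith
    have h1 : C * (1 - q / (l : ℝ) ^ s) = c := div_mul_cancel₀ _ this
    have h2 : q * (C / (l : ℝ) ^ s) = C * (q / (l : ℝ) ^ s) := by ring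
    linarith
  induction y using Nat.strong_induction_on with
  | _ y ih =>
    rcases Nat.eq_zero_or_pos y with rfl | hy
    · exact h0.trans (by positivity)
    · have h1 := ih (y / l) (Nat.div_lt_self hy hl)
      have h2 : ((y / l : ℕ) : ℝ) ^ s ≤ (y : ℝ) ^ s / (l : ℝ) ^ s := by
        rw [← Real.div_rpow (by positivity) (by positivity)]
        exact Real.rpow_le_rpow (by positivity) Nat.cast_div_le hs
      calc F y ≤ c * (y : ℝ) ^ s + q * F (y / l) := h y hy
        _ ≤ c * (y : ℝ) ^ s + q * (C * ((y : ℝ) ^ s / (l : ℝ) ^ s)) := by gcongr; exact h1.trans (by gcongr)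
        _ = (c + q * (C / (l : ℝ) ^ s)) * (y : ℝ) ^ s := by ring
        _ = C * (y : ℝ) ^ s := by rw [hCe]

lemma sum_gMul_split {l : ℕ} (hl : l.Prime) (Q : ℕ → Prop) [DecidablePred Q] (hQ : ∀ m, Q (l * m) → Q m) (y : ℕ) :
    (∑ m ∈ (Icc 1 y).filter Q, (gMul m : ℝ)) ≤
      (∑ m ∈ (Icc 1 y).filter (fun m => Q m ∧ ¬ l ∣ m), (gMul m : ℝ)) +
        (l + 2) * ∑ m ∈ (Icc 1 (y / l)).filter Q, (gMul m : ℝ) := by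
  rw [← sum_filter_add_sum_filter_not _ (fun m => ¬ l ∣ m), filter_filter, filter_filter]
  gcongr 1
  rw [mul_sum]
  have hl0 := hl.pos
  refine (sum_le_sum_of_subset_of_nonneg (t := ((Icc 1 (y / l)).filter Q).image (l * ·)) ?_ ?_).trans ?_
  · intro m hm
    simp only [mem_filter, mem_Icc, not_not] at hm
    obtain ⟨⟨h1, h2⟩, h3, n, rfl⟩ := hm
    simp only [mem_image, mem_filter, mem_Icc]
    exact ⟨n, ⟨⟨by rcases n with _ | n <;> simp at h1 ⊢, (Nat.le_div_iff_mul_le hl0).2 (by rwa [mul_comm])⟩, hQ _ h3⟩, rfl⟩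
  · intros; positivity
  · rw [sum_image (fun a _ b _ h => Nat.eq_of_mul_eq_mul_left hl0 h)]
    refine sum_le_sum fun m hm => ?_
    simp only [mem_filter, mem_Icc] at hm
    rw [gMul_mul hl.ne_zero (by omega), gMul_prime hl]
    push_cast; rfl

lemma exists_sum_gMul : ∃ C : ℝ, 0 ≤ C ∧ ∀ y : ℕ,
    (∑ m ∈ Icc 1 y, (gMul m : ℝ)) ≤ C * (y : ℝ) ^ (7 / 3 : ℝ) := by
  have h6 : ∀ y : ℕ, 1 ≤ y → (∑ m ∈ (Icc 1 y).filter (fun m => ¬ 2 ∣ m ∧ ¬ 3 ∣ m), (gMul m : ℝ)) ≤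
      1 * (y : ℝ) ^ (7 / 3 : ℝ) := by
    intro y hy
    refine (sum_le_card_nsmul _ _ ((y : ℝ) ^ (4 / 3 : ℝ)) ?_).trans ?_
    · intro m hm
      simp only [mem_filter, mem_Icc] at hm
      refine (gMul_le_rpow hm.2.1 hm.2.2).trans (Real.rpow_le_rpow (by positivity) ?_ (by norm_num))
      exact_mod_cast hm.1.2
    · have : ((#((Icc 1 y).filter (fun m => ¬ 2 ∣ m ∧ ¬ 3 ∣ m)) : ℕ) : ℝ) ≤ y := by
        exact_mod_cast (card_filter_le _ _).trans (by simp)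
      rw [nsmul_eq_mul, one_mul, show (7 / 3 : ℝ) = 1 + 4 / 3 by norm_num,
        Real.rpow_add (by exact_mod_cast hy), Real.rpow_one]
      gcongr
  have h3 : (5 : ℝ) < ((3 : ℕ) : ℝ) ^ (7 / 3 : ℝ) := by
    have := Real.rpow_le_rpow_of_exponent_le (x := ((3 : ℕ) : ℝ)) (by norm_num) (show (2 : ℝ) ≤ 7 / 3 by norm_num)
    norm_num at this ⊢
    linarith
  have h2 : (4 : ℝ) < ((2 : ℕ) : ℝ) ^ (7 / 3 : ℝ) := by
    have := Real.rpow_lt_rpow_of_exponent_lt (x := ((2 : ℕ) : ℝ)) (by norm_num) (show (2 : ℝ) < 7 / 3 by norm_num)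
    norm_num at this ⊢
    linarith
  obtain ⟨C1, hC1, hF1⟩ := recursion_bound
    (F := fun y => ∑ m ∈ (Icc 1 y).filter (fun m => ¬ 2 ∣ m), (gMul m : ℝ)) (c := 1)
    (by norm_num) (by norm_num) (by norm_num) (by norm_num) h3 (by simp) (by
      intro y hy
      refine (sum_gMul_split Nat.prime_three (fun m => ¬ 2 ∣ m)
        (fun m h h' => h (h'.mul_left 3)) y).trans ?_
      refine add_le_add (h6 y hy) (by norm_num))
  obtain ⟨C2, hC2, hF2⟩ := recursion_bound
    (F := fun y => ∑ m ∈ (Icc 1 y).filter (fun _ => True), (gMul m : ℝ)) (c := C1)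
    (by norm_num) (by norm_num) hC1 (by norm_num) h2 (by simp) (by
      intro y hy
      refine (sum_gMul_split Nat.prime_two (fun _ => True) (fun m h => h) y).trans ?_
      refine add_le_add ?_ (by norm_num)
      simpa using hF1 y)
  exact ⟨C2, hC2, fun y => by simpa using hF2 y⟩

end Ell

lemma exists_minor {f g : ℤ[X]} (h : Nondeg f g) : ∃ i j : ℕ,
    (f ^ 3).coeff i * (g ^ 2).coeff j - (f ^ 3).coeff j * (g ^ 2).coeff i ≠ 0 := by
  by_contra! hz
  obtain ⟨h0, h1⟩ := h
  obtain ⟨i, hi⟩ : ∃ i, (4 * f ^ 3 + 27 * g ^ 2).coeff i ≠ 0 := by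
    by_contra! hi
    apply h0
    rw [Dpoly, Polynomial.ext (p := 4 * f ^ 3 + 27 * g ^ 2) (q := 0) (by simpa using hi), mul_zero]
  set δ := (4 * f ^ 3 + 27 * g ^ 2).coeff i with hδ
  have hc : ∀ j, (4 * f ^ 3 + 27 * g ^ 2).coeff j = 4 * (f ^ 3).coeff j + 27 * (g ^ 2).coeff j := by
    intro j
    rw [coeff_add, ← C_ofNat, ← C_ofNat, coeff_C_mul, coeff_C_mul]
  have h2 : C δ * f ^ 3 = C ((f ^ 3).coeff i) * (4 * f ^ 3 + 27 * g ^ 2) := by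
    ext j
    rw [coeff_C_mul, coeff_C_mul, hδ, hc, hc]
    linear_combination 27 * hz j i
  apply h1
  have h3 := congrArg (Polynomial.map (Int.castRingHom ℚ)) h2
  simp only [Dpoly, Polynomial.map_mul, Polynomial.map_C, Polynomial.map_pow, Polynomial.map_add,
    Polynomial.map_ofNat, Polynomial.map_neg] at h3 ⊢
  refine ⟨6912 * (f ^ 3).coeff i / δ, ?_⟩
  have hδ' : (δ : ℚ) ≠ 0 := by exact_mod_cast hi
  have h4 : (C (δ : ℚ)) ≠ 0 := by simpa using hi
  apply mul_left_cancel₀ h4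
  rw [← mul_assoc (C (δ : ℚ)) (C _), ← C_mul, mul_div_cancel₀ _ hδ', C_mul]
  simp only [eq_intCast, map_ofNat] at h3 ⊢
  linear_combination (-110592) * h3

/-- The residues at which the reduction has its Frobenius in `ℚ(√d)`. -/
def frobSet (f g : ℤ[X]) (d : ℤ) (p : ℕ) : Set (ZMod p) :=
  {c | ((Dpoly f g).map (Int.castRingHom (ZMod p))).eval c ≠ 0 ∧ ∃ m : ℤ, 0 < m ∧
    frobTrace p ((f.map (Int.castRingHom (ZMod p))).eval c)
      ((g.map (Int.castRingHom (ZMod p))).eval c) ^ 2 - 4 * (p : ℤ) = d * m ^ 2}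

lemma ncard_frobSet_le_self (f g : ℤ[X]) (d : ℤ) {p : ℕ} (hp : p.Prime) :
    (frobSet f g d p).ncard ≤ p := by
  have := Fact.mk hp
  refine (Set.ncard_le_card _).trans ?_
  simp [Nat.card_eq_fintype_card, ZMod.card]

namespace Ell

lemma card_jFiber_le {k : Type*} [Field k] {f g : ℤ[X]} {i j : ℕ}
    (h : (((f ^ 3).coeff i * (g ^ 2).coeff j - (f ^ 3).coeff j * (g ^ 2).coeff i : ℤ) : k) ≠ 0)
    (h27 : (27 : k) ≠ 0) (w : k) (S : Finset k)
    (hS : ∀ c ∈ S, ((f.map (Int.castRingHom k)).eval c) ^ 3 =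
      w * (4 * ((f.map (Int.castRingHom k)).eval c) ^ 3 + 27 * ((g.map (Int.castRingHom k)).eval c) ^ 2)) :
    #S ≤ 3 * f.natDegree + 2 * g.natDegree := by
  obtain ⟨P, hP⟩ : ∃ P, P = (C (1 - 4 * w) * (f.map (Int.castRingHom k)) ^ 3 -
      C (27 * w) * (g.map (Int.castRingHom k)) ^ 2) := ⟨_, rfl⟩
  have hco : ∀ n, P.coeff n = (1 - 4 * w) * ((f ^ 3).coeff n : k) - (27 * w) * ((g ^ 2).coeff n : k) := by
    intro n
    rw [hP, coeff_sub, coeff_C_mul, coeff_C_mul, ← Polynomial.map_pow, ← Polynomial.map_pow,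
      coeff_map, coeff_map]
    rfl
  have hP0 : P ≠ 0 := by
    intro h0
    have e1 := hco i
    have e2 := hco j
    rw [h0, coeff_zero] at e1 e2
    push_cast at h
    have e3 : (1 - 4 * w) = 0 := by
      apply mul_right_cancel₀ h; linear_combination -((g ^ 2).coeff j : k) * e1 + ((g ^ 2).coeff i : k) * e2
    have e4 : w = 0 := by
      apply mul_left_cancel₀ h27
      apply mul_right_cancel₀ h; linear_combination -((f ^ 3).coeff j : k) * e1 + ((f ^ 3).coeff i : k) * e2
    simp [e4] at e3
  have hsub : S ⊆ P.roots.toFinset := by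
    intro c hc
    rw [Multiset.mem_toFinset, mem_roots hP0, IsRoot, hP]
    simp only [eval_sub, eval_mul, eval_C, eval_pow]
    linear_combination hS c hc
  refine (card_le_card hsub).trans ((Multiset.toFinset_card_le _).trans ((card_roots' _).trans ?_))
  have m1 := natDegree_map_le (p := f) (f := Int.castRingHom k)
  have m2 := natDegree_map_le (p := g) (f := Int.castRingHom k)
  rw [hP]
  refine (natDegree_sub_le _ _).trans (max_le ?_ ?_)
  · refine (natDegree_C_mul_le _ _).trans (natDegree_pow_le.trans ?_); omega
  · refine (natDegree_C_mul_le _ _).trans (natDegree_pow_le.trans ?_); omega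

theorem exists_ncard_frobSet {f g : ℤ[X]} (hfg : Nondeg f g) {d : ℤ} (hd : d < 0)
    (hsf : Squarefree d) : ∃ p0 D : ℕ, ∀ p : ℕ, p.Prime → p0 < p → (frobSet f g d p).ncard ≤
      D * ∑ m ∈ (Icc 1 (Nat.sqrt (4 * p))).filter (fun m : ℕ => ∃ a : ℕ, (a : ℤ) ^ 2 - d * (m : ℤ) ^ 2 = 4 * p),
        gMul m := by
  obtain ⟨i, j, hM⟩ := exists_minor hfg
  set M := (f ^ 3).coeff i * (g ^ 2).coeff j - (f ^ 3).coeff j * (g ^ 2).coeff i with hMd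
  refine ⟨8 * d.natAbs ^ 2 + 8 * d.natAbs + 10 + M.natAbs,
    (3 * f.natDegree + 2 * g.natDegree) * (1 + 2 * (d.natAbs * (4 * d.natAbs + 1))), fun p hp hlt => ?_⟩
  have := Fact.mk hp
  let k := AlgebraicClosure (ZMod p)
  have : CharP k p := charP_of_injective_algebraMap (algebraMap (ZMod p) k).injective p
  have hc : ∀ z : ℤ, z ≠ 0 → z.natAbs < p → (z : k) ≠ 0 := by
    intro z h0 h h1
    rw [CharP.intCast_eq_zero_iff k p, Int.natCast_dvd] at h1
    exact absurd (Nat.le_of_dvd (Int.natAbs_pos.2 h0) h1) (by omega)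
  have : CharGood k := ⟨by exact_mod_cast hc 2 (by norm_num) (by norm_num; omega),
    by exact_mod_cast hc 3 (by norm_num) (by norm_num; omega)⟩
  have h27 : (27 : k) ≠ 0 := by
    rw [show (27 : k) = 3 ^ 3 by norm_num]; exact pow_ne_zero 3 CharGood.three
  set ι := algebraMap (ZMod p) k with hι
  have hφ : ∀ (h : ℤ[X]) c, ι ((h.map (Int.castRingHom (ZMod p))).eval c) =
      (h.map (Int.castRingHom k)).eval (ι c) := by
    intro h c
    rw [eval_map, eval_map, hom_eval₂]
    congr 1
  let F : ZMod p → k := fun c => ι ((f.map (Int.castRingHom (ZMod p))).eval c)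
  let G : ZMod p → k := fun c => ι ((g.map (Int.castRingHom (ZMod p))).eval c)
  let J : ZMod p → k := fun c => F c ^ 3 / (4 * F c ^ 3 + 27 * G c ^ 2)
  have hdisc : ∀ c ∈ frobSet f g d p, 4 * F c ^ 3 + 27 * G c ^ 2 ≠ 0 := by
    rintro c ⟨h, -⟩ h0
    apply h
    apply ι.injective
    rw [map_zero, hφ]
    simp only [F, G, hφ] at h0
    simp only [Dpoly, Polynomial.map_mul, Polynomial.map_pow, Polynomial.map_add, Polynomial.map_neg,
      Polynomial.map_ofNat, eval_mul, eval_add, eval_pow, eval_neg, eval_ofNat]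
    rw [h0, mul_zero]
  set I := (Icc 1 (Nat.sqrt (4 * p))).filter
    (fun m : ℕ => ∃ a : ℕ, (a : ℤ) ^ 2 - d * (m : ℤ) ^ 2 = 4 * p) with hI
  have hcard : ∀ m ∈ I, (jSet k (d * (m : ℤ) ^ 2)).encard ≤
      (gMul m * (1 + 2 * (d.natAbs * (4 * d.natAbs + 1))) : ℕ) := by
    intro m hm
    rw [hI, mem_filter, mem_Icc, Nat.le_sqrt] at hm
    refine encard_jSet_mul (encard_jSet_base hd hsf p (by omega)) m (by omega) fun l hl hlm => ?_
    have h1 := Nat.le_of_dvd (by omega) hlm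
    have h2 : l < p := by
      by_contra! h
      have : p * p ≤ m * m := Nat.mul_le_mul (h.trans h1) (h.trans h1)
      have : 5 * p ≤ p * p := Nat.mul_le_mul_right _ (by omega)
      have := hp.pos
      omega
    exact_mod_cast hc l (by exact_mod_cast hl.ne_zero) (by simpa using h2)
  have hmem : ∀ c ∈ frobSet f g d p, ∃ m ∈ I, J c ∈ jSet k (d * (m : ℤ) ^ 2) := by
    rintro c hcm
    obtain ⟨h, m, hm, he⟩ := id hcm
    obtain ⟨n, rfl⟩ := Int.eq_ofNat_of_zero_le hm.le
    refine ⟨n, ?_, ⟨F c, G c, hdisc c hcm⟩, ?_, rfl⟩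
    · rw [hI, mem_filter, mem_Icc, Nat.le_sqrt]
      refine ⟨⟨by omega, ?_⟩, (frobTrace p ((f.map (Int.castRingHom (ZMod p))).eval c)
          ((g.map (Int.castRingHom (ZMod p))).eval c)).natAbs, ?_⟩
      · zify
        nlinarith [sq_nonneg (frobTrace p ((f.map (Int.castRingHom (ZMod p))).eval c)
          ((g.map (Int.castRingHom (ZMod p))).eval c)), sq_nonneg (n : ℤ)]
      · rw [Int.natAbs_sq]
        linear_combination he
    · rw [HasSqrt, ← he]
      exact exists_sq p ((f.map (Int.castRingHom (ZMod p))).eval c)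
        ((g.map (Int.castRingHom (ZMod p))).eval c) rfl rfl
  have hfin : ∀ m ∈ I, (jSet k (d * (m : ℤ) ^ 2)).Finite := fun m hm =>
    Set.finite_of_encard_le_coe (hcard m hm)
  obtain ⟨Z, hZ⟩ : ∃ Z : Finset (ZMod p), ∀ c, c ∈ Z ↔ c ∈ frobSet f g d p :=
    ⟨(Set.toFinite (frobSet f g d p)).toFinset, by simp⟩
  have hZ' : (frobSet f g d p).ncard = #Z := by
    rw [← Set.ncard_coe_finset]
    congr 1
    ext c; exact (hZ c).symm
  have hstep : ∀ m ∈ I, #(Z.filter fun c => J c ∈ jSet k (d * (m : ℤ) ^ 2)) ≤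
      (3 * f.natDegree + 2 * g.natDegree) *
        (gMul m * (1 + 2 * (d.natAbs * (4 * d.natAbs + 1)))) := by
    intro m hm
    refine (card_le_mul_card_image_of_maps_to (f := J) (t := (hfin m hm).toFinset) ?_
      (3 * f.natDegree + 2 * g.natDegree) ?_).trans (Nat.mul_le_mul_left _ ?_)
    · intro c hc
      simpa using (mem_filter.1 hc).2
    · intro w _
      rw [← card_image_of_injective _ ι.injective]
      refine card_jFiber_le (hc M hM (by omega)) h27 w _ ?_
      simp only [mem_image, mem_filter]
      rintro _ ⟨c, ⟨⟨h1, -⟩, h2⟩, rfl⟩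
      rw [← hφ, ← hφ, ← h2]
      exact (div_mul_cancel₀ _ (hdisc c ((hZ c).1 h1))).symm
    · have := hcard m hm
      rwa [← (hfin m hm).coe_toFinset, Set.encard_coe_eq_coe_finsetCard, Nat.cast_le] at this
  rw [hZ']
  calc #Z ≤ #(I.biUnion fun m => Z.filter fun c => J c ∈ jSet k (d * (m : ℤ) ^ 2)) := by
        refine card_le_card fun c hcz => ?_
        obtain ⟨m, hm, hj⟩ := hmem c ((hZ c).1 hcz)
        exact mem_biUnion.2 ⟨m, hm, mem_filter.2 ⟨hcz, hj⟩⟩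
    _ ≤ ∑ m ∈ I, #(Z.filter fun c => J c ∈ jSet k (d * (m : ℤ) ^ 2)) := card_biUnion_le
    _ ≤ ∑ m ∈ I, (3 * f.natDegree + 2 * g.natDegree) *
        (gMul m * (1 + 2 * (d.natAbs * (4 * d.natAbs + 1)))) := sum_le_sum hstep
    _ = _ := by rw [mul_sum]; exact sum_congr rfl fun m _ => by ring

end Ell

namespace Ell

theorem exists_sum_ncard_frobSet {f g : ℤ[X]} (hfg : Nondeg f g) {d : ℤ} (hd : d < 0)
    (hsf : Squarefree d) : ∃ C : ℝ, 0 ≤ C ∧ ∀ N : ℕ,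
      (∑ p ∈ (Icc 1 N).filter Nat.Prime, ((frobSet f g d p).ncard : ℝ)) ≤ C * (N : ℝ) ^ (5 / 3 : ℝ) := by
  obtain ⟨p0, D, hD⟩ := exists_ncard_frobSet hfg hd hsf
  obtain ⟨C, hC, hg⟩ := exists_sum_gMul
  refine ⟨p0 * p0 + D * (2 * C * 2 ^ (10 / 3 : ℝ)), by positivity, fun N => ?_⟩
  rcases Nat.eq_zero_or_pos N with rfl | hN
  · simp
  set Y := Nat.sqrt (4 * N) with hY
  have hY1 : 1 ≤ Y := Nat.le_sqrt.2 (by omega)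
  let Q : ℕ → ℕ → Prop := fun p m => ∃ a : ℕ, (a : ℤ) ^ 2 - d * (m : ℤ) ^ 2 = 4 * p
  have hcount : ∀ m, #((Icc 1 N).filter fun p => Q p m) ≤ Y + 1 := by
    intro m
    rw [← card_range (Y + 1)]
    refine (card_le_card (t := (range (Y + 1)).image
      fun a : ℕ => (((a : ℤ) ^ 2 - d * (m : ℤ) ^ 2) / 4).natAbs) ?_).trans card_image_le
    intro p hp
    rw [mem_filter, mem_Icc] at hp
    obtain ⟨⟨h1, h2⟩, a, ha⟩ := hp
    rw [mem_image]
    refine ⟨a, ?_, ?_⟩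
    · rw [mem_range, Nat.lt_succ_iff, hY, Nat.le_sqrt]
      zify
      nlinarith [sq_nonneg (m : ℤ)]
    · rw [ha]; omega
  have hbig : (∑ p ∈ ((Icc 1 N).filter Nat.Prime).filter (p0 < ·), (frobSet f g d p).ncard) ≤
      D * ((Y + 1) * ∑ m ∈ Icc 1 Y, gMul m) := by
    calc _ ≤ ∑ p ∈ ((Icc 1 N).filter Nat.Prime).filter (p0 < ·),
          D * ∑ m ∈ (Icc 1 Y).filter (fun m => Q p m), gMul m := by
          refine sum_le_sum fun p hp => ?_
          simp only [mem_filter, mem_Icc] at hp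
          refine (hD p hp.1.2 hp.2).trans (Nat.mul_le_mul_left _ (sum_le_sum_of_subset ?_))
          refine filter_subset_filter _ (Icc_subset_Icc_right (Nat.sqrt_le_sqrt ?_))
          omega
      _ ≤ ∑ p ∈ Icc 1 N, D * ∑ m ∈ (Icc 1 Y).filter (fun m => Q p m), gMul m :=
          sum_le_sum_of_subset ((filter_subset _ _).trans (filter_subset _ _))
      _ = D * ∑ m ∈ Icc 1 Y, #((Icc 1 N).filter fun p => Q p m) * gMul m := by
          rw [← mul_sum]
          congr 1
          simp_rw [sum_filter]
          rw [sum_comm]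
          refine sum_congr rfl fun m _ => ?_
          rw [← sum_filter, sum_const, smul_eq_mul]
      _ ≤ _ := by
          rw [mul_sum (Icc 1 Y) _ (Y + 1)]
          exact Nat.mul_le_mul_left _ (sum_le_sum fun m _ => Nat.mul_le_mul_right _ (hcount m))
  have hsmall : (∑ p ∈ ((Icc 1 N).filter Nat.Prime).filter (¬ p0 < ·), (frobSet f g d p).ncard) ≤
      p0 * p0 := by
    refine (sum_le_card_nsmul _ _ p0 fun p hp => ?_).trans ?_
    · simp only [mem_filter, mem_Icc] at hp
      exact (ncard_frobSet_le_self f g d hp.1.2).trans (by omega)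
    · rw [smul_eq_mul]
      refine Nat.mul_le_mul_right _ ?_
      refine (card_le_card (t := Icc 1 p0) fun p hp => ?_).trans (by simp)
      simp only [mem_filter, mem_Icc] at hp ⊢
      omega
  have hN1 : (1 : ℝ) ≤ (N : ℝ) ^ (5 / 3 : ℝ) := Real.one_le_rpow (by exact_mod_cast hN) (by norm_num)
  have hYr : (Y : ℝ) ≤ 2 * (N : ℝ) ^ (1 / 2 : ℝ) := by
    rw [← Real.sqrt_eq_rpow]
    rw [show (2 : ℝ) * √(N : ℝ) = √(4 * N : ℝ) by
      rw [Real.sqrt_mul (by norm_num), show (4 : ℝ) = 2 ^ 2 by norm_num, Real.sqrt_sq (by norm_num)]]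
    refine Real.le_sqrt_of_sq_le ?_
    exact_mod_cast (sq Y).trans_le (Nat.sqrt_le (4 * N))
  have hYY : ((Y : ℝ) + 1) * (Y : ℝ) ^ (7 / 3 : ℝ) ≤ 2 * 2 ^ (10 / 3 : ℝ) * (N : ℝ) ^ (5 / 3 : ℝ) := by
    have hY1' : (1 : ℝ) ≤ Y := by exact_mod_cast hY1
    calc ((Y : ℝ) + 1) * (Y : ℝ) ^ (7 / 3 : ℝ) ≤ (2 * Y) * (Y : ℝ) ^ (7 / 3 : ℝ) := by gcongr; linarith
      _ = 2 * (Y : ℝ) ^ (10 / 3 : ℝ) := by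
          rw [show (10 / 3 : ℝ) = 1 + 7 / 3 by norm_num, Real.rpow_add (by linarith), Real.rpow_one]; ring
      _ ≤ 2 * (2 * (N : ℝ) ^ (1 / 2 : ℝ)) ^ (10 / 3 : ℝ) := by gcongr
      _ = _ := by
          rw [Real.mul_rpow (by norm_num) (by positivity), ← Real.rpow_mul (by positivity)]
          norm_num
          ring
  rw [← sum_filter_add_sum_filter_not _ (p0 < ·)]
  have h1 : (∑ p ∈ ((Icc 1 N).filter Nat.Prime).filter (p0 < ·), ((frobSet f g d p).ncard : ℝ)) ≤
      D * ((Y + 1) * ∑ m ∈ Icc 1 Y, (gMul m : ℝ)) := by exact_mod_cast hbig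
  have h2 : (∑ p ∈ ((Icc 1 N).filter Nat.Prime).filter (¬ p0 < ·), ((frobSet f g d p).ncard : ℝ)) ≤
      p0 * p0 := by exact_mod_cast hsmall
  have h3 : (D : ℝ) * ((Y + 1) * ∑ m ∈ Icc 1 Y, (gMul m : ℝ)) ≤
      D * (2 * C * 2 ^ (10 / 3 : ℝ)) * (N : ℝ) ^ (5 / 3 : ℝ) := by
    calc _ ≤ (D : ℝ) * ((Y + 1) * (C * (Y : ℝ) ^ (7 / 3 : ℝ))) := by gcongr; exact hg Y
      _ = D * C * ((Y + 1) * (Y : ℝ) ^ (7 / 3 : ℝ)) := by ring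
      _ ≤ D * C * (2 * 2 ^ (10 / 3 : ℝ) * (N : ℝ) ^ (5 / 3 : ℝ)) := by gcongr
      _ = _ := by ring
  have h4 : (p0 * p0 : ℝ) ≤ p0 * p0 * (N : ℝ) ^ (5 / 3 : ℝ) := le_mul_of_one_le_right (by positivity) hN1
  rw [add_mul]
  linarith

end Ell

theorem exists_card_divisors_le {ε : ℝ} (hε : 0 < ε) : ∃ C : ℝ, 0 ≤ C ∧ ∀ n : ℕ, n ≠ 0 →
    (#n.divisors : ℝ) ≤ C * (n : ℝ) ^ ε := by
  obtain ⟨P, hP⟩ := exists_nat_gt ((2 : ℝ) ^ (1 / ε))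
  obtain ⟨K, hK, hK1⟩ : ∃ K : ℝ, K = max 1 (1 / (ε * Real.log 2)) ∧ 1 ≤ K := ⟨_, rfl, le_max_left _ _⟩
  have hlog : 0 < ε * Real.log 2 := mul_pos hε (Real.log_pos (by norm_num))
  have hKe : 1 ≤ K * (ε * Real.log 2) := by
    rw [← div_le_iff₀ hlog, hK]; exact le_max_right _ _
  let c : ℕ → ℝ := fun p => if p < P then K else 1
  have key : ∀ n : ℕ, n ≠ 0 → (#n.divisors : ℝ) ≤ (∏ p ∈ n.primeFactors, c p) * (n : ℝ) ^ ε := by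
    intro n
    induction n using Nat.recOnPosPrimePosCoprime with
    | zero => simp
    | one => simp
    | prime_pow p e hp he =>
      intro _
      rw [Nat.primeFactors_prime_pow he.ne' hp, prod_singleton, Nat.divisors_prime_pow hp, card_map,
        card_range]
      push_cast
      rw [← Real.rpow_natCast, ← Real.rpow_mul (by positivity), mul_comm (e : ℝ), Real.rpow_mul (by positivity),
        Real.rpow_natCast]
      by_cases h : p < P
      · simp only [c, if_pos h]
        have h1 : (1 + ε * Real.log 2) ≤ (p : ℝ) ^ ε := by
          calc (1 + ε * Real.log 2) ≤ Real.exp (ε * Real.log 2) := by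
                linarith [Real.add_one_le_exp (ε * Real.log 2)]
            _ = (2 : ℝ) ^ ε := by rw [Real.rpow_def_of_pos (by norm_num), mul_comm]
            _ ≤ _ := Real.rpow_le_rpow (by norm_num) (by exact_mod_cast hp.two_le) hε.le
        have h2 := one_add_mul_le_pow (a := ε * Real.log 2) (by linarith) e
        calc (e + 1 : ℝ) ≤ K + K * (ε * Real.log 2) * e := by
              nlinarith [(Nat.cast_nonneg e : (0 : ℝ) ≤ e)]
          _ = K * (1 + e * (ε * Real.log 2)) := by ring
          _ ≤ K * ((p : ℝ) ^ ε) ^ e := by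
              gcongr
              exact h2.trans (pow_le_pow_left₀ (by positivity) h1 e)
      · simp only [c, if_neg h, one_mul]
        have h1 : (2 : ℝ) ≤ (p : ℝ) ^ ε := by
          calc (2 : ℝ) = ((2 : ℝ) ^ (1 / ε)) ^ ε := by
                rw [← Real.rpow_mul (by norm_num), one_div, inv_mul_cancel₀ hε.ne', Real.rpow_one]
            _ ≤ _ := Real.rpow_le_rpow (by positivity) (hP.le.trans (by exact_mod_cast not_lt.1 h)) hε.le
        calc (e + 1 : ℝ) ≤ 2 ^ e := by exact_mod_cast Nat.lt_two_pow_self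
          _ ≤ _ := pow_le_pow_left₀ (by norm_num) h1 e
    | coprime a b ha hb hab iha ihb =>
      intro _
      rw [hab.card_divisors_mul, hab.primeFactors_mul, prod_union hab.disjoint_primeFactors]
      push_cast
      rw [Real.mul_rpow (by positivity) (by positivity)]
      refine (mul_le_mul (iha (by omega)) (ihb (by omega)) (by positivity) ?_).trans_eq (by ring)
      exact (Nat.cast_nonneg _).trans (iha (by omega))
  refine ⟨K ^ P, by positivity, fun n hn => (key n hn).trans ?_⟩
  gcongr
  rw [prod_ite, prod_const, prod_const_one, mul_one]
  refine pow_le_pow_right₀ hK1 ?_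
  refine (card_le_card (t := range P) fun p hp => ?_).trans (by simp)
  simp only [mem_filter, mem_range] at hp ⊢
  exact hp.2

namespace SumRep

/-- The common part of the two denominators. -/
def gg (z : ℚ × ℚ) : ℕ := z.1.den.gcd z.2.den
/-- The part of the first denominator not in the second. -/
def w1 (z : ℚ × ℚ) : ℕ := z.1.den / gg z
/-- The part of the second denominator not in the first. -/
def w2 (z : ℚ × ℚ) : ℕ := z.2.den / gg z
/-- The cancellation in the sum. -/
def hh (z : ℚ × ℚ) : ℕ := (z.1.num.natAbs * w2 z + z.2.num.natAbs * w1 z).gcd (gg z)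

lemma gg_pos (z : ℚ × ℚ) : 0 < gg z := Nat.gcd_pos_of_pos_left _ z.1.den_pos
lemma hh_pos (z : ℚ × ℚ) : 0 < hh z := Nat.gcd_pos_of_pos_right _ (gg_pos z)
lemma den1 (z : ℚ × ℚ) : z.1.den = gg z * w1 z := (Nat.mul_div_cancel' (Nat.gcd_dvd_left _ _)).symm
lemma den2 (z : ℚ × ℚ) : z.2.den = gg z * w2 z := (Nat.mul_div_cancel' (Nat.gcd_dvd_right _ _)).symm
lemma w1_pos (z : ℚ × ℚ) : 0 < w1 z := Nat.pos_of_mul_pos_left (den1 z ▸ z.1.den_pos)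
lemma w2_pos (z : ℚ × ℚ) : 0 < w2 z := Nat.pos_of_mul_pos_left (den2 z ▸ z.2.den_pos)
lemma coprime_w (z : ℚ × ℚ) : (w1 z).Coprime (w2 z) := Nat.coprime_div_gcd_div_gcd (gg_pos z)

lemma hh_mul {z : ℚ × ℚ} (h1 : 0 < z.1) (h2 : 0 < z.2) :
    hh z * (z.1 + z.2).num.natAbs = z.1.num.natAbs * w2 z + z.2.num.natAbs * w1 z ∧
    hh z * (z.1 + z.2).den = gg z * w1 z * w2 z := by
  obtain ⟨N, hN⟩ : hh z ∣ z.1.num.natAbs * w2 z + z.2.num.natAbs * w1 z := Nat.gcd_dvd_left _ _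
  obtain ⟨G, hG⟩ : hh z ∣ gg z := Nat.gcd_dvd_right _ _
  have hp := hh_pos z
  have hg := gg_pos z
  have hw1 := w1_pos z
  have hw2 := w2_pos z
  have hGp : 0 < G := Nat.pos_of_mul_pos_left (hG ▸ hg)
  have c1 : N.Coprime G := by
    have := Nat.coprime_div_gcd_div_gcd (m := z.1.num.natAbs * w2 z + z.2.num.natAbs * w1 z) (n := gg z) hp
    change Nat.Coprime (_ / hh z) (_ / hh z) at this
    rwa [hN, Nat.mul_div_cancel_left _ hp, show gg z / hh z = G by
      conv_lhs => rw [hG]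
      exact Nat.mul_div_cancel_left _ hp] at this
  have c2 : N.Coprime (w1 z) := by
    have e : (z.1.num.natAbs * w2 z + z.2.num.natAbs * w1 z).Coprime (w1 z) := by
      rw [Nat.coprime_add_mul_right_left]
      exact Nat.Coprime.mul_left (z.1.reduced.coprime_dvd_right ⟨gg z, by rw [den1]; ring⟩)
        (coprime_w z).symm
    exact e.coprime_dvd_left ⟨hh z, by rw [hN]; ring⟩
  have c3 : N.Coprime (w2 z) := by
    have e : (z.1.num.natAbs * w2 z + z.2.num.natAbs * w1 z).Coprime (w2 z) := by
      rw [add_comm, Nat.coprime_add_mul_right_left]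
      exact Nat.Coprime.mul_left (z.2.reduced.coprime_dvd_right ⟨gg z, by rw [den2]; ring⟩)
        (coprime_w z)
    exact e.coprime_dvd_left ⟨hh z, by rw [hN]; ring⟩
  have c4 : N.Coprime (G * w1 z * w2 z) := (c1.mul_right c2).mul_right c3
  have e : z.1 + z.2 = ((N : ℤ) : ℚ) / ((G * w1 z * w2 z : ℕ) : ℤ) := by
    have n1 : (z.1.num : ℚ) = z.1.num.natAbs := by
      rw [← Int.cast_natCast, Int.natAbs_of_nonneg (Rat.num_pos.2 h1).le]
    have n2 : (z.2.num : ℚ) = z.2.num.natAbs := by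
      rw [← Int.cast_natCast, Int.natAbs_of_nonneg (Rat.num_pos.2 h2).le]
    have hN' : (z.1.num.natAbs * w2 z + z.2.num.natAbs * w1 z : ℚ) = hh z * N := by exact_mod_cast hN
    have hG' : (gg z : ℚ) = hh z * G := by exact_mod_cast hG
    have f1 : (w1 z : ℚ) ≠ 0 := by positivity
    have f2 : (w2 z : ℚ) ≠ 0 := by positivity
    have f3 : (G : ℚ) ≠ 0 := by positivity
    have f4 : (hh z : ℚ) ≠ 0 := by positivity
    conv_lhs => rw [← Rat.num_div_den z.1, ← Rat.num_div_den z.2, n1, n2, den1, den2]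
    push_cast
    rw [hG']
    field_simp
    linear_combination hN'
  have hpos : (0 : ℤ) < (G * w1 z * w2 z : ℕ) := by positivity
  have hn : (z.1 + z.2).num = N := by rw [e]; exact Rat.num_div_eq_of_coprime hpos c4
  have hd : ((z.1 + z.2).den : ℤ) = (G * w1 z * w2 z : ℕ) := by
    rw [e]; exact Rat.den_div_eq_of_coprime hpos c4
  rw [hn, Nat.cast_inj.1 hd]
  refine ⟨by rw [hN]; simp, ?_⟩
  conv_rhs => rw [hG]
  ring

variable {S : Finset ℚ} {n : ℕ}

lemma fiber_bound (hS : ∀ q ∈ S, 0 < q ∧ q.num.natAbs ≤ n ∧ q.den ≤ n) (ρ : ℚ) (x y h : ℕ) :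
    #((S ×ˢ S).filter fun z => z.1 + z.2 = ρ ∧ w1 z = x ∧ w2 z = y ∧ hh z = h) ≤ n / max x y + 1 := by
  have key : ∀ z ∈ (S ×ˢ S).filter (fun z => z.1 + z.2 = ρ ∧ w1 z = x ∧ w2 z = y ∧ hh z = h),
      ∀ z' ∈ (S ×ˢ S).filter (fun z => z.1 + z.2 = ρ ∧ w1 z = x ∧ w2 z = y ∧ hh z = h),
      z.1.den = z'.1.den ∧ z.2.den = z'.2.den ∧ x.Coprime y ∧
      z.1.num.natAbs * y + z.2.num.natAbs * x = z'.1.num.natAbs * y + z'.2.num.natAbs * x := by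
    intro z hz z' hz'
    simp only [mem_filter, mem_product] at hz hz'
    obtain ⟨⟨h1, h2⟩, h3, h4, h5, h6⟩ := hz
    obtain ⟨⟨h1', h2'⟩, h3', h4', h5', h6'⟩ := hz'
    obtain ⟨e1, e2⟩ := hh_mul (hS _ h1).1 (hS _ h2).1
    obtain ⟨e1', e2'⟩ := hh_mul (hS _ h1').1 (hS _ h2').1
    rw [h3, h4, h5, h6] at e1 e2
    rw [h3', h4', h5', h6'] at e1' e2'
    have hx := h4 ▸ w1_pos z
    have hy := h5 ▸ w2_pos z
    have hg : gg z = gg z' := by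
      have := e2.symm.trans e2'
      exact Nat.eq_of_mul_eq_mul_right hx (Nat.eq_of_mul_eq_mul_right hy this)
    refine ⟨?_, ?_, h4 ▸ h5 ▸ coprime_w z, e1.symm.trans e1'⟩
    · rw [den1, den1, h4, h4', hg]
    · rw [den2, den2, h5, h5', hg]
  have mod_eq : ∀ {u u' t t' x y : ℕ}, x.Coprime y → u * y + t * x = u' * y + t' * x →
      u / x = u' / x → u = u' := by
    intro u u' t t' x y hc he hq
    have h1 : u * y ≡ u' * y [MOD x] := by
      have : (u * y + t * x) % x = (u' * y + t' * x) % x := by rw [he]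
      rwa [Nat.add_mul_mod_self_right, Nat.add_mul_mod_self_right] at this
    have h2 : u % x = u' % x := Nat.ModEq.cancel_right_of_coprime hc h1
    rw [← Nat.div_add_mod u x, ← Nat.div_add_mod u' x, h2, hq]
  rw [← card_range (n / max x y + 1)]
  rcases le_total y x with hxy | hxy
  · rw [max_eq_left hxy]
    refine card_le_card_of_injOn (fun z => z.1.num.natAbs / x) ?_ ?_
    · intro z hz
      simp only [coe_filter, mem_product, Set.mem_ofPred_eq, coe_range, Set.mem_Iio] at hz ⊢
      exact Nat.lt_succ_of_le (Nat.div_le_div_right (hS _ hz.1.1).2.1)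
    · intro z hz z' hz' he
      obtain ⟨e1, e2, e3, e4⟩ := key z hz z' hz'
      have h1 := mod_eq e3 e4 he
      rw [mem_coe, mem_filter, mem_product] at hz hz'
      have h2 : z.1 = z'.1 := Rat.ext (by
        have p1 := Rat.num_pos.2 (hS _ hz.1.1).1
        have p2 := Rat.num_pos.2 (hS _ hz'.1.1).1
        omega) e1
      exact Prod.ext h2 (by linarith [hz.2.1, hz'.2.1])
  · rw [max_eq_right hxy]
    refine card_le_card_of_injOn (fun z => z.2.num.natAbs / y) ?_ ?_
    · intro z hz
      simp only [coe_filter, mem_product, Set.mem_ofPred_eq, coe_range, Set.mem_Iio] at hz ⊢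
      exact Nat.lt_succ_of_le (Nat.div_le_div_right (hS _ hz.1.2).2.1)
    · intro z hz z' hz' he
      obtain ⟨e1, e2, e3, e4⟩ := key z hz z' hz'
      have h1 := mod_eq (t := z.1.num.natAbs) (t' := z'.1.num.natAbs) e3.symm (by linarith) he
      rw [mem_coe, mem_filter, mem_product] at hz hz'
      have h2 : z.2 = z'.2 := Rat.ext (by
        have p1 := Rat.num_pos.2 (hS _ hz.1.2).1
        have p2 := Rat.num_pos.2 (hS _ hz'.1.2).1
        omega) e2
      exact Prod.ext (by linarith [hz.2.1, hz'.2.1]) h2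

lemma fiber_bound' (hS : ∀ q ∈ S, 0 < q ∧ q.num.natAbs ≤ n ∧ q.den ≤ n) (ρ : ℚ) (x y : ℕ) :
    #((S ×ˢ S).filter fun z => z.1 + z.2 = ρ ∧ w1 z = x ∧ w2 z = y) * max ρ.num.natAbs ρ.den ≤
      4 * n ^ 2 := by
  rcases ((S ×ˢ S).filter fun z => z.1 + z.2 = ρ ∧ w1 z = x ∧ w2 z = y).eq_empty_or_nonempty with
    h0 | ⟨z0, hz0⟩
  · rw [h0]; simp
  have key : ∀ z ∈ (S ×ˢ S).filter (fun z => z.1 + z.2 = ρ ∧ w1 z = x ∧ w2 z = y),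
      0 < x ∧ 0 < y ∧ hh z * ρ.den = gg z * x * y ∧ gg z * max x y ≤ n ∧ max x y ≤ n ∧
      hh z * ρ.num.natAbs ≤ 2 * n * max x y := by
    intro z hz
    simp only [mem_filter, mem_product] at hz
    obtain ⟨⟨h1, h2⟩, h3, h4, h5⟩ := hz
    obtain ⟨e1, e2⟩ := hh_mul (hS _ h1).1 (hS _ h2).1
    rw [h3, h4, h5] at e1 e2
    have hx := h4 ▸ w1_pos z
    have hy := h5 ▸ w2_pos z
    have d1 := (hS _ h1).2.2
    have d2 := (hS _ h2).2.2
    rw [den1, h4] at d1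
    rw [den2, h5] at d2
    have hgm : gg z * max x y ≤ n := by
      rcases le_total x y with h | h
      · rwa [max_eq_right h]
      · rwa [max_eq_left h]
    refine ⟨hx, hy, e2, hgm, (Nat.le_mul_of_pos_left _ (gg_pos z)).trans hgm, ?_⟩
    rw [e1]
    have := Nat.mul_le_mul (hS _ h1).2.1 (le_max_right x y)
    have := Nat.mul_le_mul (hS _ h2).2.1 (le_max_left x y)
    linarith
  obtain ⟨hx, hy, k1, k2, k3, k4⟩ := key z0 hz0
  set m := max x y with hm
  have hm0 : 0 < m := lt_max_of_lt_left hx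
  have hxy : x * y ≤ m * m := Nat.mul_le_mul (le_max_left _ _) (le_max_right _ _)
  have hh0 : hh z0 ∣ gg z0 := Nat.gcd_dvd_right _ _
  obtain ⟨g1, hg1⟩ := hh0
  have hb : ρ.den = g1 * x * y := by
    apply Nat.eq_of_mul_eq_mul_left (hh_pos z0)
    rw [k1, hg1]; ring
  have hg1p : 0 < g1 := by
    rcases Nat.eq_zero_or_pos g1 with h | h
    · rw [h] at hb; exact absurd hb (by simp)
    · exact h
  have hdm : (n / m + 1) * m ≤ 2 * n := by
    have := Nat.div_mul_le_self n m
    rw [add_mul]; omega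
  have hH : ∀ H : ℕ, (∀ z ∈ (S ×ˢ S).filter (fun z => z.1 + z.2 = ρ ∧ w1 z = x ∧ w2 z = y), hh z ≤ H) →
      #((S ×ˢ S).filter fun z => z.1 + z.2 = ρ ∧ w1 z = x ∧ w2 z = y) ≤ (n / m + 1) * H := by
    intro H hH
    refine (card_le_mul_card_image_of_maps_to (f := hh) (t := Icc 1 H) (fun z hz =>
      mem_Icc.2 ⟨hh_pos z, hH z hz⟩) (n / m + 1) ?_).trans (by simp)
    intro h _
    rw [filter_filter]
    refine le_trans (card_le_card ?_) (fiber_bound hS ρ x y h)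
    intro z
    simp only [mem_filter]
    tauto
  have hm2 : ∀ H k : ℕ, (∀ z ∈ (S ×ˢ S).filter (fun z => z.1 + z.2 = ρ ∧ w1 z = x ∧ w2 z = y),
      hh z ≤ H) → H * k ≤ 2 * n * m →
      #((S ×ˢ S).filter fun z => z.1 + z.2 = ρ ∧ w1 z = x ∧ w2 z = y) * k ≤ 4 * n ^ 2 := by
    intro H k h1 h2
    calc _ ≤ (n / m + 1) * H * k := Nat.mul_le_mul_right _ (hH H h1)
      _ = (n / m + 1) * (H * k) := mul_assoc _ _ _
      _ ≤ (n / m + 1) * (2 * n * m) := Nat.mul_le_mul_left _ h2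
      _ = ((n / m + 1) * m) * (2 * n) := by ring
      _ ≤ 2 * n * (2 * n) := Nat.mul_le_mul_right _ hdm
      _ = 4 * n ^ 2 := by ring
  rcases le_total ρ.num.natAbs ρ.den with h | h
  · rw [max_eq_right h]
    have hp : 0 < g1 * m := Nat.mul_pos hg1p hm0
    refine hm2 (n / (g1 * m)) _ (fun z hz => ?_) ?_
    · obtain ⟨-, -, j1, j2, -, -⟩ := key z hz
      rw [Nat.le_div_iff_mul_le hp]
      have : hh z * g1 = gg z := by
        apply Nat.eq_of_mul_eq_mul_right (Nat.mul_pos hx hy)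
        rw [hb] at j1
        linarith
      rwa [← mul_assoc, this]
    · have h1 := Nat.div_mul_le_self n (g1 * m)
      calc n / (g1 * m) * ρ.den = n / (g1 * m) * (g1 * (x * y)) := by rw [hb, mul_assoc]
        _ ≤ n / (g1 * m) * (g1 * (m * m)) := by gcongr
        _ = n / (g1 * m) * (g1 * m) * m := by ring
        _ ≤ n * m := Nat.mul_le_mul_right _ h1
        _ ≤ 2 * n * m := Nat.mul_le_mul_right _ (by omega)
  · rw [max_eq_left h]
    have hp : 0 < ρ.num.natAbs := lt_of_lt_of_le ρ.den_pos h
    refine hm2 (2 * n * m / ρ.num.natAbs) _ (fun z hz => ?_) (Nat.div_mul_le_self _ _)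
    obtain ⟨-, -, -, -, -, j2⟩ := key z hz
    exact (Nat.le_div_iff_mul_le hp).2 j2

lemma rep_bound (hS : ∀ q ∈ S, 0 < q ∧ q.num.natAbs ≤ n ∧ q.den ≤ n) (ρ : ℚ) :
    #((S ×ˢ S).filter fun z => z.1 + z.2 = ρ) * max ρ.num.natAbs ρ.den ≤
      4 * n ^ 2 * #ρ.den.divisors ^ 2 := by
  have h := card_eq_sum_card_fiberwise (s := (S ×ˢ S).filter fun z => z.1 + z.2 = ρ)
    (f := fun z => (w1 z, w2 z)) (t := ρ.den.divisors ×ˢ ρ.den.divisors) (by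
      intro z hz
      simp only [coe_filter, mem_product, Set.mem_ofPred_eq] at hz
      obtain ⟨⟨h1, h2⟩, h3⟩ := hz
      obtain ⟨-, e⟩ := hh_mul (hS _ h1).1 (hS _ h2).1
      obtain ⟨G, hG⟩ : hh z ∣ gg z := Nat.gcd_dvd_right _ _
      have e2 : ρ.den = G * w1 z * w2 z := by
        apply Nat.eq_of_mul_eq_mul_left (hh_pos z)
        rw [← h3, e]
        conv_lhs => rw [hG]
        ring
      simp only [coe_product, Set.mem_prod, mem_coe, Nat.mem_divisors]
      exact ⟨⟨⟨G * w2 z, by rw [e2]; ring⟩, ρ.den_nz⟩, ⟨⟨G * w1 z, by rw [e2]; ring⟩, ρ.den_nz⟩⟩)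
  rw [h, sum_mul]
  refine (sum_le_card_nsmul _ _ (4 * n ^ 2) fun xy _ => ?_).trans (by
    rw [card_product, smul_eq_mul]; apply le_of_eq; ring)
  refine le_trans (Nat.mul_le_mul_right _ (card_le_card ?_)) (fiber_bound' hS ρ xy.1 xy.2)
  intro z
  simp only [mem_filter, Prod.ext_iff]
  tauto

end SumRep

namespace SumRep

lemma sum_height {q r : ℚ} {n : ℕ} (hq : 0 < q ∧ q.num.natAbs ≤ n ∧ q.den ≤ n)
    (hr : 0 < r ∧ r.num.natAbs ≤ n ∧ r.den ≤ n) :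
    0 < q + r ∧ (q + r).num.natAbs ≤ 2 * n ^ 2 ∧ (q + r).den ≤ n ^ 2 := by
  obtain ⟨e1, e2⟩ := hh_mul (z := (q, r)) hq.1 hr.1
  have hp := hh_pos (q, r)
  have hg := gg_pos (q, r)
  have d1 := den1 (q, r)
  have d2 := den2 (q, r)
  have b1 : w1 (q, r) ≤ n := (Nat.le_mul_of_pos_left _ hg).trans (d1 ▸ hq.2.2)
  have b2 : w2 (q, r) ≤ n := (Nat.le_mul_of_pos_left _ hg).trans (d2 ▸ hr.2.2)
  refine ⟨add_pos hq.1 hr.1, ?_, ?_⟩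
  · refine (Nat.le_mul_of_pos_left _ hp).trans ?_
    rw [e1]
    have := Nat.mul_le_mul hq.2.1 b2
    have := Nat.mul_le_mul hr.2.1 b1
    nlinarith
  · refine (Nat.le_mul_of_pos_left _ hp).trans ?_
    rw [e2, ← d1, sq]
    exact Nat.mul_le_mul hq.2.2 b2

lemma harmonic_sum_le (M : ℕ) : ∑ k ∈ Icc 1 M, (1 / (k : ℝ)) ≤ 1 + Real.log M := by
  have h := harmonic_le_one_add_log M
  rw [harmonic_eq_sum_Icc] at h
  push_cast at h
  simpa using h

/-- The additive energy of a set of rationals of height at most `n`. -/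
lemma exists_energy_le {ε : ℝ} (hε : 0 < ε) : ∃ C : ℝ, 0 ≤ C ∧ ∀ (n : ℕ) (S : Finset ℚ), 1 ≤ n →
    (∀ q ∈ S, 0 < q ∧ q.num.natAbs ≤ n ∧ q.den ≤ n) →
    (#(((S ×ˢ S) ×ˢ (S ×ˢ S)).filter fun w => w.1.1 + w.1.2 = w.2.1 + w.2.2) : ℝ) ≤
      C * (n : ℝ) ^ (4 + ε) := by
  set δ := ε / 12 with hδ
  have hδ0 : 0 < δ := by positivity
  obtain ⟨C1, hC1, hdiv⟩ := exists_card_divisors_le hδ0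
  refine ⟨16 * C1 ^ 4 * (1 + 1 / δ) ^ 2 * (2 : ℝ) ^ (6 * δ), by positivity, ?_⟩
  intro n S hn hS
  set M : ℕ := 2 * n ^ 2 with hM
  have hM1 : 1 ≤ M := by have := Nat.one_le_pow 2 n hn; omega
  have hn0 : (0 : ℝ) < n := by exact_mod_cast hn
  have hMR : (1 : ℝ) ≤ M := by exact_mod_cast hM1
  have hM0 : (0 : ℝ) < M := by linarith
  set I := (S ×ˢ S).image (fun z : ℚ × ℚ => z.1 + z.2) with hI
  set R : ℚ → ℕ := fun ρ => #((S ×ˢ S).filter fun z => z.1 + z.2 = ρ) with hR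
  have hE : #(((S ×ˢ S) ×ˢ (S ×ˢ S)).filter fun w => w.1.1 + w.1.2 = w.2.1 + w.2.2) =
      ∑ ρ ∈ I, R ρ ^ 2 := by
    rw [card_eq_sum_card_fiberwise (f := fun w => w.1.1 + w.1.2) (t := I)]
    · refine sum_congr rfl fun ρ _ => ?_
      rw [hR, sq, ← card_product]
      congr 1
      ext w
      simp only [mem_filter, mem_product]
      constructor
      · rintro ⟨⟨⟨h1, h2⟩, h3⟩, h4⟩
        exact ⟨⟨h1, h4⟩, h2, h3 ▸ h4⟩
      · rintro ⟨⟨h1, h4⟩, h2, h3⟩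
        exact ⟨⟨⟨h1, h2⟩, h4.trans h3.symm⟩, h4⟩
    · intro w hw
      rw [mem_coe, mem_filter, mem_product] at hw
      exact mem_coe.2 (mem_image_of_mem _ hw.1.1)
  have hIb : ∀ ρ ∈ I, 0 < ρ ∧ ρ.num.natAbs ≤ M ∧ ρ.den ≤ M := by
    intro ρ hρ
    obtain ⟨z, hz, rfl⟩ := mem_image.1 hρ
    rw [mem_product] at hz
    obtain ⟨h1, h2, h3⟩ := sum_height (hS _ hz.1) (hS _ hz.2)
    exact ⟨h1, h2, by omega⟩
  set K : ℝ := (4 * (n : ℝ) ^ 2 * (C1 * (M : ℝ) ^ δ) ^ 2) ^ 2 with hK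
  have hterm : ∀ ρ ∈ I, ((R ρ : ℝ)) ^ 2 ≤ K * (1 / (ρ.num.natAbs : ℝ) * (1 / (ρ.den : ℝ))) := by
    intro ρ hρ
    obtain ⟨h1, h2, h3⟩ := hIb ρ hρ
    have ha : 0 < ρ.num.natAbs := Int.natAbs_pos.2 (Rat.num_pos.2 h1).ne'
    have ha' : (0 : ℝ) < ρ.num.natAbs := by exact_mod_cast ha
    have hb' : (0 : ℝ) < ρ.den := by exact_mod_cast ρ.den_pos
    have hr : (R ρ : ℝ) * max (ρ.num.natAbs : ℝ) ρ.den ≤ 4 * (n : ℝ) ^ 2 * (#ρ.den.divisors : ℝ) ^ 2 := by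
      exact_mod_cast rep_bound hS ρ
    have hτ : (#ρ.den.divisors : ℝ) ≤ C1 * (M : ℝ) ^ δ :=
      (hdiv _ ρ.den_nz).trans (mul_le_mul_of_nonneg_left
        (Real.rpow_le_rpow (by positivity) (by exact_mod_cast h3) hδ0.le) hC1)
    have hr2 : (R ρ : ℝ) * max (ρ.num.natAbs : ℝ) ρ.den ≤ 4 * (n : ℝ) ^ 2 * (C1 * (M : ℝ) ^ δ) ^ 2 :=
      hr.trans (by gcongr)
    have hab : (ρ.num.natAbs : ℝ) * ρ.den ≤ max (ρ.num.natAbs : ℝ) ρ.den ^ 2 := by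
      rw [sq]; exact mul_le_mul (le_max_left _ _) (le_max_right _ _) hb'.le (ha'.le.trans (le_max_left _ _))
    rw [one_div_mul_one_div, mul_one_div, le_div_iff₀ (by positivity)]
    calc (R ρ : ℝ) ^ 2 * (ρ.num.natAbs * ρ.den) ≤ (R ρ : ℝ) ^ 2 * max (ρ.num.natAbs : ℝ) ρ.den ^ 2 := by gcongr
      _ = (R ρ * max (ρ.num.natAbs : ℝ) ρ.den) ^ 2 := by ring
      _ ≤ K := by
        rw [hK]
        exact pow_le_pow_left₀ (mul_nonneg (by positivity) (hb'.le.trans (le_max_right _ _))) hr2 2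
  have hsum : ∑ ρ ∈ I, (1 / (ρ.num.natAbs : ℝ) * (1 / (ρ.den : ℝ))) ≤ (1 + Real.log M) ^ 2 := by
    calc _ = ∑ ab ∈ (I.image (fun ρ : ℚ => (ρ.num.natAbs, ρ.den)) : Finset (ℕ × ℕ)), (1 / (ab.1 : ℝ) * (1 / (ab.2 : ℝ))) := by
          rw [sum_image (s := I) (g := fun ρ : ℚ => (ρ.num.natAbs, ρ.den))]
          intro ρ hρ ρ' hρ' he
          have p1 := Rat.num_pos.2 (hIb ρ hρ).1
          have p2 := Rat.num_pos.2 (hIb ρ' hρ').1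
          rw [Prod.mk.injEq] at he
          exact Rat.ext (by omega) he.2
      _ ≤ ∑ ab ∈ Icc 1 M ×ˢ Icc 1 M, (1 / (ab.1 : ℝ) * (1 / (ab.2 : ℝ))) := by
          refine sum_le_sum_of_subset_of_nonneg ?_ (fun _ _ _ => by positivity)
          intro ab hab
          obtain ⟨ρ, hρ, rfl⟩ := mem_image.1 hab
          obtain ⟨h1, h2, h3⟩ := hIb ρ hρ
          have := Rat.num_pos.2 h1
          have := ρ.den_pos
          simp only [mem_product, mem_Icc]
          omega
      _ = (∑ k ∈ Icc 1 M, (1 / (k : ℝ))) ^ 2 := by rw [sq, sum_mul_sum, sum_product]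
      _ ≤ _ := pow_le_pow_left₀ (sum_nonneg fun _ _ => by positivity) (harmonic_sum_le M) 2
  have hlog : 1 + Real.log M ≤ (1 + 1 / δ) * (M : ℝ) ^ δ := by
    have h1 := Real.log_natCast_le_rpow_div M hδ0
    have h2 := Real.one_le_rpow hMR hδ0.le
    rw [add_mul, one_mul, div_mul_eq_mul_div, one_mul]
    linarith
  have hlog0 : 0 ≤ 1 + Real.log M := by have := Real.log_nonneg hMR; linarith
  have hp : ((M : ℝ) ^ δ) ^ 6 = (2 : ℝ) ^ (6 * δ) * (n : ℝ) ^ ε := by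
    rw [← Real.rpow_natCast, ← Real.rpow_mul hM0.le, hM]
    push_cast
    rw [Real.mul_rpow (by norm_num) (by positivity), ← Real.rpow_natCast (n : ℝ) 2,
      ← Real.rpow_mul hn0.le]
    congr 2
    · ring
    · rw [hδ]; push_cast; ring
  rw [hE]
  push_cast
  calc _ ≤ ∑ ρ ∈ I, K * (1 / (ρ.num.natAbs : ℝ) * (1 / (ρ.den : ℝ))) := sum_le_sum hterm
    _ = K * ∑ ρ ∈ I, (1 / (ρ.num.natAbs : ℝ) * (1 / (ρ.den : ℝ))) := by rw [mul_sum]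
    _ ≤ K * ((1 + 1 / δ) * (M : ℝ) ^ δ) ^ 2 := by
        have := pow_le_pow_left₀ hlog0 hlog 2
        have hK0 : 0 ≤ K := by positivity
        gcongr
        exact hsum.trans this
    _ = 16 * C1 ^ 4 * (1 + 1 / δ) ^ 2 * (n : ℝ) ^ 4 * ((M : ℝ) ^ δ) ^ 6 := by rw [hK]; ring
    _ = _ := by
        rw [hp, Real.rpow_add hn0, show (4 : ℝ) = (4 : ℕ) by norm_num, Real.rpow_natCast]
        ring

end SumRep

namespace SumRep

section Reduction

variable {p : ℕ} [Fact p.Prime]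

lemma den_cast_ne_zero {q : ℚ} (h : ¬p ∣ q.den) : (q.den : ZMod p) ≠ 0 :=
  fun e => h ((ZMod.natCast_eq_zero_iff _ _).1 e)

lemma redQ_mul_den {q : ℚ} (h : ¬p ∣ q.den) : redQ p q * q.den = q.num := by
  rw [redQ, mul_assoc, inv_mul_cancel₀ (den_cast_ne_zero h), mul_one]

lemma dvd_of_redQ_eq {q r : ℚ} (hq : ¬p ∣ q.den) (hr : ¬p ∣ r.den) (h : redQ p q = redQ p r) :
    (p : ℤ) ∣ q.num * r.den - r.num * q.den := by
  rw [← ZMod.intCast_zmod_eq_zero_iff_dvd]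
  push_cast
  rw [← redQ_mul_den hq, ← redQ_mul_den hr, h]
  ring

lemma not_dvd_add_den {q r : ℚ} (hq : ¬p ∣ q.den) (hr : ¬p ∣ r.den) : ¬p ∣ (q + r).den := by
  intro h
  rcases (Fact.out : p.Prime).dvd_mul.1 (h.trans (Rat.add_den_dvd q r)) with h | h
  exacts [hq h, hr h]

lemma redQ_add {q r : ℚ} (hq : ¬p ∣ q.den) (hr : ¬p ∣ r.den) :
    redQ p (q + r) = redQ p q + redQ p r := by
  have h := congrArg (Int.cast : ℤ → ZMod p) (Rat.add_num_den' q r)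
  push_cast at h
  have h1 := den_cast_ne_zero hq
  have h2 := den_cast_ne_zero hr
  have h3 := den_cast_ne_zero (not_dvd_add_den hq hr)
  rw [← redQ_mul_den hq, ← redQ_mul_den hr, ← redQ_mul_den (not_dvd_add_den hq hr)] at h
  apply mul_right_cancel₀ (mul_ne_zero (mul_ne_zero h1 h2) h3)
  linear_combination h

variable {S : Finset ℚ} {n : ℕ}

lemma card_redQ_eq_mul_le (hS : ∀ q ∈ S, 0 < q ∧ q.num.natAbs ≤ n ∧ q.den ≤ n) (hp : p ≤ n)
    (c : ZMod p) : #(S.filter fun q => ¬p ∣ q.den ∧ redQ p q = c) * p ≤ 2 * n ^ 2 := by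
  have h : #(S.filter fun q => ¬p ∣ q.den ∧ redQ p q = c) ≤ n * (n / p + 1) := by
    refine (card_le_card_of_injOn (t := Icc 1 n ×ˢ range (n / p + 1))
      (fun q => (q.den, q.num.natAbs / p)) ?_ ?_).trans (by simp)
    · intro q hq
      rw [mem_coe, mem_filter] at hq
      simp only [mem_coe, mem_product, mem_Icc, mem_range]
      exact ⟨⟨q.den_pos, (hS _ hq.1).2.2⟩, Nat.lt_succ_of_le (Nat.div_le_div_right (hS _ hq.1).2.1)⟩
    · intro q hq r hr he
      rw [mem_coe, mem_filter] at hq hr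
      obtain ⟨e1, e2⟩ := Prod.mk.inj he
      have p1 := Rat.num_pos.2 (hS _ hq.1).1
      have p2 := Rat.num_pos.2 (hS _ hr.1).1
      have e3 : ((q.num.natAbs : ℕ) : ZMod p) = (r.num.natAbs : ℕ) := by
        have a1 : (q.num : ZMod p) = r.num := by
          rw [← redQ_mul_den hq.2.1, ← redQ_mul_den hr.2.1, hq.2.2, hr.2.2, e1]
        have b1 : q.num = (q.num.natAbs : ℤ) := by omega
        have b2 : r.num = (r.num.natAbs : ℤ) := by omega
        rw [b1, b2] at a1
        simpa using a1
      have e4 : q.num.natAbs % p = r.num.natAbs % p := (ZMod.natCast_eq_natCast_iff' _ _ _).1 e3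
      have e5 : q.num.natAbs = r.num.natAbs := by
        rw [← Nat.div_add_mod q.num.natAbs p, ← Nat.div_add_mod r.num.natAbs p, e2, e4]
      exact Rat.ext (by omega) e1
  have h2 := Nat.div_mul_le_self n p
  calc _ ≤ n * (n / p + 1) * p := Nat.mul_le_mul_right _ h
    _ = n * (n / p * p + p) := by ring
    _ ≤ n * (n + n) := by gcongr
    _ = 2 * n ^ 2 := by ring

lemma card_dvd_den_mul_le (hS : ∀ q ∈ S, 0 < q ∧ q.num.natAbs ≤ n ∧ q.den ≤ n) :
    #(S.filter fun q => p ∣ q.den) * p ≤ n ^ 2 := by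
  have hp0 := (Fact.out : p.Prime).pos
  have h : #(S.filter fun q => p ∣ q.den) ≤ n * (n / p) := by
    refine (card_le_card_of_injOn (t := Icc 1 n ×ˢ Icc 1 (n / p))
      (fun q => (q.num.natAbs, q.den / p)) ?_ ?_).trans (by simp)
    · intro q hq
      rw [mem_coe, mem_filter] at hq
      have p1 := Rat.num_pos.2 (hS _ hq.1).1
      simp only [mem_coe, mem_product, mem_Icc]
      exact ⟨⟨by omega, (hS _ hq.1).2.1⟩, Nat.div_pos (Nat.le_of_dvd q.den_pos hq.2) hp0,
        Nat.div_le_div_right (hS _ hq.1).2.2⟩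
    · intro q hq r hr he
      rw [mem_coe, mem_filter] at hq hr
      obtain ⟨e1, e2⟩ := Prod.mk.inj he
      have p1 := Rat.num_pos.2 (hS _ hq.1).1
      have p2 := Rat.num_pos.2 (hS _ hr.1).1
      refine Rat.ext (by omega) ?_
      rw [← Nat.div_mul_cancel hq.2, ← Nat.div_mul_cancel hr.2, e2]
  calc _ ≤ n * (n / p) * p := Nat.mul_le_mul_right _ h
    _ = n * (n / p * p) := by ring
    _ ≤ n * n := Nat.mul_le_mul_left _ (Nat.div_mul_le_self n p)
    _ = n ^ 2 := by ring

end Reduction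

variable {S : Finset ℚ} {n : ℕ}

lemma card_le_sq (hS : ∀ q ∈ S, 0 < q ∧ q.num.natAbs ≤ n ∧ q.den ≤ n) : #S ≤ n ^ 2 := by
  refine (card_le_card_of_injOn (t := Icc 1 n ×ˢ Icc 1 n)
      (fun q => (q.num.natAbs, q.den)) ?_ ?_).trans (by simp [sq])
  · intro q hq
    have p1 := Rat.num_pos.2 (hS _ hq).1
    simp only [mem_coe, mem_product, mem_Icc]
    exact ⟨⟨by omega, (hS _ hq).2.1⟩, q.den_pos, (hS _ hq).2.2⟩
  · intro q hq r hr he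
    obtain ⟨e1, e2⟩ := Prod.mk.inj he
    have p1 := Rat.num_pos.2 (hS _ hq).1
    have p2 := Rat.num_pos.2 (hS _ hr).1
    exact Rat.ext (by omega) e2

/-- The number of pairs whose sum reduces into a given subset of `ZMod p`. -/
def pairCount (S : Finset ℚ) (p : ℕ) (A : Set (ZMod p)) : ℕ :=
  #((S ×ˢ S).filter fun z => ¬p ∣ (z.1 + z.2).den ∧ redQ p (z.1 + z.2) ∈ A)

lemma pairCount_le (hS : ∀ q ∈ S, 0 < q ∧ q.num.natAbs ≤ n ∧ q.den ≤ n) (p : ℕ) (A : Set (ZMod p)) :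
    pairCount S p A ≤ n ^ 4 := by
  refine (card_filter_le _ _).trans ?_
  rw [card_product]
  exact (Nat.mul_le_mul (card_le_sq hS) (card_le_sq hS)).trans (by ring_nf; rfl)

/-- For `p` at most the height bound the sums are nearly equidistributed from above. -/
lemma pairCount_mul_sq_le (hS : ∀ q ∈ S, 0 < q ∧ q.num.natAbs ≤ n ∧ q.den ≤ n) {p : ℕ} (hp : p.Prime)
    (hpn : p ≤ n) (A : Set (ZMod p)) :
    pairCount S p A * p ^ 2 ≤ 2 * A.ncard * n ^ 4 * p + n ^ 4 := by
  have := Fact.mk hp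
  set B := (S ×ˢ S).filter fun z => ¬p ∣ (z.1 + z.2).den ∧ redQ p (z.1 + z.2) ∈ A with hB
  have h1 : #(B.filter fun z => p ∣ z.1.den) ≤ #(S.filter fun q => p ∣ q.den) ^ 2 := by
    rw [sq, ← card_product]
    refine card_le_card fun z hz => ?_
    simp only [hB, mem_filter, mem_product] at hz ⊢
    obtain ⟨⟨⟨a1, a2⟩, a3, -⟩, a4⟩ := hz
    refine ⟨⟨a1, a4⟩, a2, ?_⟩
    by_contra hc
    have : ¬p ∣ (-z.2).den := by rwa [Rat.den_neg_eq_den]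
    have := not_dvd_add_den a3 this
    rw [add_neg_cancel_right] at this
    exact this a4
  have h2 : #(B.filter fun z => ¬p ∣ z.1.den) * p ≤ A.ncard * (n ^ 2 * (2 * n ^ 2)) := by
    have hm := card_eq_sum_card_fiberwise (s := B.filter fun z => ¬p ∣ z.1.den)
      (f := fun z => (redQ p (z.1 + z.2), z.1)) (t := A.toFinset ×ˢ S) (by
        intro z hz
        simp only [hB, coe_filter, mem_filter, mem_product, Set.mem_ofPred_eq] at hz
        simp only [coe_product, Set.mem_prod, mem_coe, Set.mem_toFinset]
        exact ⟨hz.1.2.2, hz.1.1.1⟩)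
    rw [hm, sum_mul]
    refine (sum_le_card_nsmul _ _ (2 * n ^ 2) fun cr hcr => ?_).trans ?_
    · refine le_trans (Nat.mul_le_mul_right _ ?_) (card_redQ_eq_mul_le hS hpn (cr.1 - redQ p cr.2))
      refine card_le_card_of_injOn (fun z => z.2) ?_ ?_
      · intro z hz
        simp only [hB, mem_coe, mem_filter, mem_product, Prod.ext_iff] at hz ⊢
        obtain ⟨⟨⟨⟨a1, a2⟩, a3, -⟩, a4⟩, a5, a6⟩ := hz
        have a7 : ¬p ∣ z.2.den := by
          have : ¬p ∣ (-z.1).den := by rwa [Rat.den_neg_eq_den]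
          have := not_dvd_add_den this a3
          rwa [neg_add_cancel_left] at this
        refine ⟨a2, a7, ?_⟩
        rw [← a5, ← a6, redQ_add a4 a7]; ring
      · intro z hz z' hz' he
        simp only [mem_coe, mem_filter, Prod.ext_iff] at hz hz'
        exact Prod.ext (hz.2.2.trans hz'.2.2.symm) he
    · rw [card_product, smul_eq_mul, Set.ncard_eq_toFinset_card', mul_assoc]
      gcongr
      exact card_le_sq hS
  have h3 := card_dvd_den_mul_le (p := p) hS
  have hsplit : pairCount S p A = #(B.filter fun z => p ∣ z.1.den) + #(B.filter fun z => ¬p ∣ z.1.den) :=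
    (card_filter_add_card_filter_not _).symm
  rw [hsplit]
  calc _ = #(B.filter fun z => p ∣ z.1.den) * p ^ 2 + #(B.filter fun z => ¬p ∣ z.1.den) * p * p := by ring
    _ ≤ #(S.filter fun q => p ∣ q.den) ^ 2 * p ^ 2 + A.ncard * (n ^ 2 * (2 * n ^ 2)) * p := by gcongr
    _ = (#(S.filter fun q => p ∣ q.den) * p) ^ 2 + A.ncard * (n ^ 2 * (2 * n ^ 2)) * p := by ring
    _ ≤ (n ^ 2) ^ 2 + A.ncard * (n ^ 2 * (2 * n ^ 2)) * p := by gcongr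
    _ = _ := by ring

/-- The sums of pairs which coincide modulo `p`. -/
def redEnergy (S : Finset ℚ) (p : ℕ) : ℕ :=
  #(((S ×ˢ S) ×ˢ (S ×ˢ S)).filter fun w => ¬p ∣ (w.1.1 + w.1.2).den ∧ ¬p ∣ (w.2.1 + w.2.2).den ∧
    redQ p (w.1.1 + w.1.2) = redQ p (w.2.1 + w.2.2))

lemma pairCount_sq_le {p : ℕ} (hp : p.Prime) (A : Set (ZMod p)) :
    pairCount S p A ^ 2 ≤ A.ncard * redEnergy S p := by
  have := Fact.mk hp
  set B := (S ×ˢ S).filter fun z => ¬p ∣ (z.1 + z.2).den ∧ redQ p (z.1 + z.2) ∈ A with hB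
  have hm := card_eq_sum_card_fiberwise (s := B)
      (f := fun z => redQ p (z.1 + z.2)) (t := A.toFinset) (by
        intro z hz
        simp only [hB, coe_filter, Set.mem_ofPred_eq] at hz
        simpa using hz.2.2)
  have h2 : ∑ c ∈ A.toFinset, #(B.filter fun z => redQ p (z.1 + z.2) = c) ^ 2 ≤ redEnergy S p := by
    have : ∀ c ∈ A.toFinset, #(B.filter fun z => redQ p (z.1 + z.2) = c) ^ 2 =
        #((B ×ˢ B).filter fun w => redQ p (w.1.1 + w.1.2) = c ∧ redQ p (w.2.1 + w.2.2) = c) := by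
      intro c _
      rw [sq, ← card_product]
      congr 1
      ext w
      simp only [mem_filter, mem_product]
      tauto
    rw [sum_congr rfl this, ← card_biUnion]
    · refine card_le_card fun w hw => ?_
      simp only [hB, mem_biUnion, mem_filter, mem_product] at hw ⊢
      obtain ⟨c, -, ⟨⟨a1, a2, -⟩, b1, b2, -⟩, c1, c2⟩ := hw
      exact ⟨⟨a1, b1⟩, a2, b2, c1.trans c2.symm⟩
    · intro c _ c' _ hcc
      refine disjoint_left.2 fun w hw hw' => hcc ?_
      rw [mem_filter] at hw hw'
      exact hw.2.1.symm.trans hw'.2.1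
  have h3 := sq_sum_le_card_mul_sum_sq (s := A.toFinset)
    (f := fun c => #(B.filter fun z => redQ p (z.1 + z.2) = c))
  rw [pairCount, ← hB, hm, Set.ncard_eq_toFinset_card']
  exact h3.trans (Nat.mul_le_mul_left _ h2)

end SumRep

namespace SumRep

/-- A nonzero integer polynomially bounded in `N` has few prime factors beyond `√N`. -/
lemma card_large_primes_dvd_le {N : ℕ} (hN : 2 ≤ N) {D : ℤ} (hD : D ≠ 0) (hDN : D.natAbs ≤ 2 * N ^ 4) :
    #((Icc 1 N).filter fun p => p.Prime ∧ N < p ^ 2 ∧ (p : ℤ) ∣ D) ≤ 10 := by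
  set P := (Icc 1 N).filter fun p => p.Prime ∧ N < p ^ 2 ∧ (p : ℤ) ∣ D with hP
  have h1 : ∏ p ∈ P, p ∣ D.natAbs := by
    refine Finset.prod_primes_dvd _ (fun p hp => ?_) (fun p hp => ?_)
    · rw [mem_filter] at hp; exact Nat.Prime.prime hp.2.1
    · rw [mem_filter] at hp; exact Int.natCast_dvd.1 hp.2.2.2
  have h2 : ∏ p ∈ P, p ≤ D.natAbs := Nat.le_of_dvd (Int.natAbs_pos.2 hD) h1
  have h3 : N ^ #P ≤ (∏ p ∈ P, p) ^ 2 := by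
    rw [← prod_pow, ← prod_const]
    exact prod_le_prod' fun p hp => by rw [mem_filter] at hp; exact hp.2.2.1.le
  have h4 : N ^ #P ≤ N ^ 10 := by
    calc N ^ #P ≤ (2 * N ^ 4) ^ 2 := h3.trans (Nat.pow_le_pow_left (h2.trans hDN) 2)
      _ ≤ (N * N ^ 4) ^ 2 := by gcongr
      _ = N ^ 10 := by ring
  exact (Nat.pow_le_pow_iff_right hN).1 h4

variable {S : Finset ℚ} {n : ℕ}

lemma sum_redEnergy_le (hS : ∀ q ∈ S, 0 < q ∧ q.num.natAbs ≤ n ∧ q.den ≤ n) {N : ℕ} (hN : 2 ≤ N)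
    (hnN : n ≤ N) :
    ∑ p ∈ (Icc 1 N).filter (fun p => p.Prime ∧ N < p ^ 2), redEnergy S p ≤
      N * #(((S ×ˢ S) ×ˢ (S ×ˢ S)).filter fun w => w.1.1 + w.1.2 = w.2.1 + w.2.2) + 10 * n ^ 8 := by
  set W := (S ×ˢ S) ×ˢ (S ×ˢ S) with hW
  set P := (Icc 1 N).filter (fun p => p.Prime ∧ N < p ^ 2) with hP
  have hsw : ∑ p ∈ P, redEnergy S p = ∑ w ∈ W, #(P.filter fun p =>
      ¬p ∣ (w.1.1 + w.1.2).den ∧ ¬p ∣ (w.2.1 + w.2.2).den ∧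
        redQ p (w.1.1 + w.1.2) = redQ p (w.2.1 + w.2.2)) := by
    simp only [redEnergy, card_filter]
    exact sum_comm
  have hPN : #P ≤ N := (card_filter_le _ _).trans (by simp)
  rw [hsw, ← sum_filter_add_sum_filter_not W (fun w => w.1.1 + w.1.2 = w.2.1 + w.2.2)]
  refine add_le_add ?_ ?_
  · refine (sum_le_card_nsmul _ _ N fun w _ => (card_filter_le _ _).trans hPN).trans ?_
    rw [smul_eq_mul, mul_comm]
  · refine (sum_le_card_nsmul _ _ 10 fun w hw => ?_).trans ?_
    · rw [mem_filter, hW, mem_product, mem_product, mem_product] at hw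
      obtain ⟨⟨⟨a1, a2⟩, a3, a4⟩, a5⟩ := hw
      obtain ⟨b1, b2, b3⟩ := sum_height (hS _ a1) (hS _ a2)
      obtain ⟨c1, c2, c3⟩ := sum_height (hS _ a3) (hS _ a4)
      set s := w.1.1 + w.1.2
      set t := w.2.1 + w.2.2
      have hs := Rat.num_pos.2 b1
      have ht := Rat.num_pos.2 c1
      have hD : s.num * t.den - t.num * s.den ≠ 0 := by
        intro h
        exact a5 (Rat.eq_iff_mul_eq_mul.2 (sub_eq_zero.1 h))
      have e1 : s.num * t.den ≤ 2 * (N : ℤ) ^ 4 := by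
        have : s.num.natAbs * t.den ≤ 2 * n ^ 2 * n ^ 2 := Nat.mul_le_mul b2 c3
        have h4 : n ^ 4 ≤ N ^ 4 := Nat.pow_le_pow_left hnN 4
        have h5 : s.num.natAbs * t.den ≤ 2 * N ^ 4 := by nlinarith
        have h6 : (s.num.natAbs : ℤ) = s.num := by omega
        rw [← h6]
        exact_mod_cast h5
      have e2 : t.num * s.den ≤ 2 * (N : ℤ) ^ 4 := by
        have : t.num.natAbs * s.den ≤ 2 * n ^ 2 * n ^ 2 := Nat.mul_le_mul c2 b3
        have h4 : n ^ 4 ≤ N ^ 4 := Nat.pow_le_pow_left hnN 4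
        have h5 : t.num.natAbs * s.den ≤ 2 * N ^ 4 := by nlinarith
        have h6 : (t.num.natAbs : ℤ) = t.num := by omega
        rw [← h6]
        exact_mod_cast h5
      have e3 : 0 ≤ s.num * t.den := by positivity
      have e4 : 0 ≤ t.num * s.den := by positivity
      have hDN : (s.num * t.den - t.num * s.den).natAbs ≤ 2 * N ^ 4 := by
        zify
        exact abs_le.2 ⟨by linarith, by linarith⟩
      refine le_trans (card_le_card fun p hp => ?_) (card_large_primes_dvd_le hN hD hDN)
      rw [mem_filter, hP, mem_filter] at hp
      obtain ⟨⟨d1, d2, d3⟩, d4, d5, d6⟩ := hp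
      have := Fact.mk d2
      exact mem_filter.2 ⟨d1, d2, d3, dvd_of_redQ_eq d4 d5 d6⟩
    · rw [smul_eq_mul, mul_comm]
      refine Nat.mul_le_mul_left _ ((card_filter_le _ _).trans ?_)
      rw [hW, card_product, card_product]
      have := card_le_sq hS
      calc _ ≤ (n ^ 2 * n ^ 2) * (n ^ 2 * n ^ 2) := by gcongr
        _ = n ^ 8 := by ring

/-- The sum of the pair counts over small primes. -/
lemma sum_pairCount_small_le (hS : ∀ q ∈ S, 0 < q ∧ q.num.natAbs ≤ n ∧ q.den ≤ n) {N : ℕ} (hN : 1 ≤ N)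
    (A : (p : ℕ) → Set (ZMod p)) :
    (∑ p ∈ (Icc 1 N).filter (fun p => p.Prime ∧ ¬N < p ^ 2), (pairCount S p (A p) : ℝ)) ≤
      (n : ℝ) ^ 4 * (N : ℝ) ^ (5 / 6 : ℝ) := by
  have hNR : (1 : ℝ) ≤ N := by exact_mod_cast hN
  have hc : #((Icc 1 N).filter (fun p => p.Prime ∧ ¬N < p ^ 2)) ≤ N.sqrt := by
    refine (card_le_card (t := Icc 1 N.sqrt) fun p hp => ?_).trans (by simp)
    rw [mem_filter, mem_Icc] at hp
    rw [mem_Icc, Nat.le_sqrt']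
    exact ⟨hp.1.1, not_lt.1 hp.2.2⟩
  have hsq : (N.sqrt : ℝ) ≤ (N : ℝ) ^ (5 / 6 : ℝ) := by
    refine (Real.nat_sqrt_le_real_sqrt).trans ?_
    rw [Real.sqrt_eq_rpow]
    exact Real.rpow_le_rpow_of_exponent_le hNR (by norm_num)
  have hc' : (#((Icc 1 N).filter (fun p => p.Prime ∧ ¬N < p ^ 2)) : ℝ) ≤ (N : ℝ) ^ (5 / 6 : ℝ) :=
    le_trans (by exact_mod_cast hc) hsq
  refine (sum_le_card_nsmul _ _ ((n : ℝ) ^ 4) fun p _ => ?_).trans ?_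
  · exact_mod_cast pairCount_le hS p (A p)
  · rw [nsmul_eq_mul, mul_comm]
    gcongr

/-- The bound in the range where the height is at most the length of the prime sum. -/
lemma exists_sum_pairCount_le_of_le {C ε : ℝ} (hC : 0 ≤ C) (hε : 0 < ε) : ∃ C' : ℝ, 0 ≤ C' ∧
    ∀ (N n : ℕ) (S : Finset ℚ) (A : (p : ℕ) → Set (ZMod p)), 2 ≤ N → 1 ≤ n → n ≤ N →
    (∀ q ∈ S, 0 < q ∧ q.num.natAbs ≤ n ∧ q.den ≤ n) →
    (∑ p ∈ (Icc 1 N).filter Nat.Prime, ((A p).ncard : ℝ)) ≤ C * (N : ℝ) ^ (5 / 3 : ℝ) →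
    (∑ p ∈ (Icc 1 N).filter Nat.Prime, (pairCount S p (A p) : ℝ)) ≤
      C' * ((n : ℝ) ^ 4 * (N : ℝ) ^ (5 / 6 : ℝ) + (n : ℝ) ^ (2 + ε) * (N : ℝ) ^ (4 / 3 : ℝ)) := by
  obtain ⟨C2, hC2, hE⟩ := exists_energy_le (ε := 2 * ε) (by positivity)
  refine ⟨1 + Real.sqrt (C * C2 + 10 * C), by positivity, ?_⟩
  intro N n S A hN hn hnN hS hA
  have hN0 : (0 : ℝ) < N := by exact_mod_cast (by omega : 0 < N)
  have hn0 : (0 : ℝ) < n := by exact_mod_cast hn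
  set X : ℝ := (n : ℝ) ^ 4 * (N : ℝ) ^ (5 / 6 : ℝ) with hX
  set Y : ℝ := (n : ℝ) ^ (2 + ε) * (N : ℝ) ^ (4 / 3 : ℝ) with hY
  have hX0 : 0 ≤ X := by positivity
  have hY0 : 0 ≤ Y := by positivity
  set P := (Icc 1 N).filter (fun p => p.Prime ∧ N < p ^ 2) with hP
  have hX2 : X ^ 2 = (n : ℝ) ^ 8 * (N : ℝ) ^ (5 / 3 : ℝ) := by
    rw [hX, mul_pow, ← Real.rpow_natCast ((N : ℝ) ^ (5 / 6 : ℝ)), ← Real.rpow_mul hN0.le]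
    congr 1
    · ring
    · norm_num
  have hY2 : Y ^ 2 = (n : ℝ) ^ (4 + 2 * ε) * (N * (N : ℝ) ^ (5 / 3 : ℝ)) := by
    rw [hY, mul_pow, ← Real.rpow_natCast ((N : ℝ) ^ (4 / 3 : ℝ)), ← Real.rpow_mul hN0.le,
      ← Real.rpow_natCast ((n : ℝ) ^ (2 + ε)), ← Real.rpow_mul hn0.le]
    congr 1
    · congr 1; push_cast; ring
    · nth_rw 2 [← Real.rpow_one (N : ℝ)]
      rw [← Real.rpow_add hN0]
      norm_num
  have hlarge : (∑ p ∈ P, (pairCount S p (A p) : ℝ)) ≤ Real.sqrt (C * C2 + 10 * C) * (X + Y) := by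
    have h1 : (∑ p ∈ P, (pairCount S p (A p) : ℝ)) ^ 2 ≤
        (∑ p ∈ P, ((A p).ncard : ℝ)) * ∑ p ∈ P, (redEnergy S p : ℝ) := by
      refine sum_sq_le_sum_mul_sum_of_sq_le_mul _ (fun _ _ => by positivity) (fun _ _ => by positivity) ?_
      intro p hp
      rw [mem_filter] at hp
      exact_mod_cast pairCount_sq_le hp.2.1 (A p)
    have h2 : (∑ p ∈ P, ((A p).ncard : ℝ)) ≤ C * (N : ℝ) ^ (5 / 3 : ℝ) := by
      refine le_trans (sum_le_sum_of_subset_of_nonneg (fun p hp => ?_) (fun _ _ _ => by positivity)) hA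
      rw [mem_filter] at hp ⊢
      exact ⟨hp.1, hp.2.1⟩
    have h3 : (∑ p ∈ P, (redEnergy S p : ℝ)) ≤ N * (C2 * (n : ℝ) ^ (4 + 2 * ε)) + 10 * (n : ℝ) ^ 8 := by
      have h4 := sum_redEnergy_le hS hN hnN
      have h5 := hE n S hn hS
      have h6 : (∑ p ∈ P, (redEnergy S p : ℝ)) ≤ N * (#(((S ×ˢ S) ×ˢ (S ×ˢ S)).filter fun w =>
          w.1.1 + w.1.2 = w.2.1 + w.2.2) : ℝ) + 10 * (n : ℝ) ^ 8 := by exact_mod_cast h4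
      refine h6.trans ?_
      gcongr
    refine abs_le_of_sq_le_sq' ?_ (by positivity) |>.2
    rw [mul_pow, Real.sq_sqrt (by positivity)]
    calc _ ≤ (C * (N : ℝ) ^ (5 / 3 : ℝ)) * (N * (C2 * (n : ℝ) ^ (4 + 2 * ε)) + 10 * (n : ℝ) ^ 8) :=
          h1.trans (mul_le_mul h2 h3 (by positivity) (by positivity))
      _ = C * C2 * Y ^ 2 + 10 * C * X ^ 2 := by rw [hX2, hY2]; ring
      _ ≤ (C * C2 + 10 * C) * (X + Y) ^ 2 := by
          have a1 : Y ^ 2 ≤ (X + Y) ^ 2 := by gcongr; linarith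
          have a2 : X ^ 2 ≤ (X + Y) ^ 2 := by gcongr; linarith
          have a3 := mul_le_mul_of_nonneg_left a1 (mul_nonneg hC hC2)
          have a4 := mul_le_mul_of_nonneg_left a2 (mul_nonneg (by norm_num : (0 : ℝ) ≤ 10) hC)
          linarith
  have hsmall := sum_pairCount_small_le hS (by omega : 1 ≤ N) A
  rw [← sum_filter_add_sum_filter_not _ (fun p => N < p ^ 2), filter_filter, filter_filter]
  calc _ ≤ Real.sqrt (C * C2 + 10 * C) * (X + Y) + X := add_le_add hlarge hsmall
    _ ≤ _ := by linarith

end SumRep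

namespace SumRep

/-- The bound in the range where the height is at least the length of the prime sum. -/
lemma exists_sum_pairCount_le_of_ge {C : ℝ} (hC : 0 ≤ C) : ∃ C' : ℝ, 0 ≤ C' ∧
    ∀ (N n : ℕ) (S : Finset ℚ) (A : (p : ℕ) → Set (ZMod p)), 2 ≤ N → N ≤ n →
    (∀ q ∈ S, 0 < q ∧ q.num.natAbs ≤ n ∧ q.den ≤ n) →
    (∀ p : ℕ, p.Prime → (A p).ncard ≤ p) →
    (∑ p ∈ (Icc 1 N).filter Nat.Prime, ((A p).ncard : ℝ)) ≤ C * (N : ℝ) ^ (5 / 3 : ℝ) →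
    (∑ p ∈ (Icc 1 N).filter Nat.Prime, (pairCount S p (A p) : ℝ)) ≤
      C' * ((n : ℝ) ^ 4 * (N : ℝ) ^ (5 / 6 : ℝ)) := by
  refine ⟨2 * C + 5, by positivity, ?_⟩
  intro N n S A hN hNn hS hAp hA
  have hN0 : (0 : ℝ) < N := by exact_mod_cast (by omega : 0 < N)
  have hN1 : (1 : ℝ) ≤ N := by exact_mod_cast (by omega : 1 ≤ N)
  set y : ℝ := (N : ℝ) ^ (5 / 6 : ℝ) with hy
  have hy1 : 1 ≤ y := Real.one_le_rpow hN1 (by norm_num)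
  have hy0 : 0 < y := by linarith
  have hyy : (N : ℝ) ^ (5 / 3 : ℝ) = y * y := by
    rw [hy, ← Real.rpow_add hN0]; norm_num
  set P := (Icc 1 N).filter Nat.Prime with hP
  have hterm : ∀ p ∈ P, (pairCount S p (A p) : ℝ) ≤
      (n : ℝ) ^ 4 * (2 * ((if (p : ℝ) ≤ y then 1 else 0) + (A p).ncard / y) + 1 / p) := by
    intro p hp
    rw [hP, mem_filter, mem_Icc] at hp
    obtain ⟨⟨hp1, hpN⟩, hpp⟩ := hp
    have hp1' : (1 : ℝ) ≤ p := by exact_mod_cast hp1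
    have hp0 : (0 : ℝ) < p := by linarith
    have h : (pairCount S p (A p) : ℝ) * (p : ℝ) ^ 2 ≤ 2 * (A p).ncard * (n : ℝ) ^ 4 * p + (n : ℝ) ^ 4 := by
      exact_mod_cast pairCount_mul_sq_le hS hpp (hpN.trans hNn) (A p)
    have h2 : ((A p).ncard : ℝ) / p ≤ (if (p : ℝ) ≤ y then 1 else 0) + (A p).ncard / y := by
      split_ifs with hpy
      · have a1 : ((A p).ncard : ℝ) / p ≤ 1 := by
          rw [div_le_one hp0]; exact_mod_cast hAp p hpp
        have a2 : 0 ≤ ((A p).ncard : ℝ) / y := by positivity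
        linarith
      · rw [zero_add]
        exact div_le_div_of_nonneg_left (by positivity) hy0 (not_le.1 hpy).le
    have h3 : (pairCount S p (A p) : ℝ) ≤ (n : ℝ) ^ 4 * (2 * ((A p).ncard / p) + 1 / p) := by
      have a1 : (n : ℝ) ^ 4 * (2 * ((A p).ncard / p) + 1 / p) * (p : ℝ) ^ 2 =
          2 * (A p).ncard * (n : ℝ) ^ 4 * p + (n : ℝ) ^ 4 * p := by
        field_simp
      have a2 : (n : ℝ) ^ 4 ≤ (n : ℝ) ^ 4 * p := le_mul_of_one_le_right (by positivity) hp1'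
      exact le_of_mul_le_mul_right (by rw [a1]; linarith) (by positivity : (0 : ℝ) < (p : ℝ) ^ 2)
    refine h3.trans ?_
    gcongr
  have hind : (∑ p ∈ P, (if (p : ℝ) ≤ y then 1 else 0 : ℝ)) ≤ y := by
    rw [sum_boole]
    refine le_trans ?_ (Nat.floor_le hy0.le)
    have : #(P.filter fun p : ℕ => (p : ℝ) ≤ y) ≤ #(Icc 1 ⌊y⌋₊) := by
      refine card_le_card fun p hp => ?_
      rw [hP, mem_filter, mem_filter, mem_Icc] at hp
      exact mem_Icc.2 ⟨hp.1.1.1, Nat.le_floor hp.2⟩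
    rw [Nat.card_Icc, Nat.add_sub_cancel] at this
    exact_mod_cast this
  have hA' : ∑ p ∈ P, ((A p).ncard : ℝ) / y ≤ C * y := by
    rw [← sum_div, div_le_iff₀ hy0, mul_assoc, ← hyy]
    exact hA
  have hharm : ∑ p ∈ P, (1 / (p : ℝ)) ≤ 3 * y := by
    refine (sum_le_sum_of_subset_of_nonneg (filter_subset _ _) (fun _ _ _ => by positivity)).trans
      ((harmonic_sum_le N).trans ?_)
    have := Real.log_natCast_le_rpow_div N (show (0 : ℝ) < 5 / 6 by norm_num)
    rw [← hy] at this
    linarith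
  calc _ ≤ ∑ p ∈ P, (n : ℝ) ^ 4 * (2 * ((if (p : ℝ) ≤ y then 1 else 0) + (A p).ncard / y) + 1 / p) :=
        sum_le_sum hterm
    _ = (n : ℝ) ^ 4 * (2 * ((∑ p ∈ P, (if (p : ℝ) ≤ y then 1 else 0 : ℝ)) +
          ∑ p ∈ P, ((A p).ncard : ℝ) / y) + ∑ p ∈ P, (1 / (p : ℝ))) := by
        rw [← mul_sum, sum_add_distrib, ← mul_sum, sum_add_distrib]
    _ ≤ (n : ℝ) ^ 4 * (2 * (y + C * y) + 3 * y) := by gcongr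
    _ = _ := by ring

end SumRep

lemma FT_height {T : ℝ} {q : ℚ} (hq : q ∈ FT T) :
    0 < q ∧ q.num.natAbs ≤ ⌊T⌋₊ ∧ q.den ≤ ⌊T⌋₊ := by
  obtain ⟨w, hw, rfl⟩ := mem_image.1 hq
  rw [mem_filter, mem_product, mem_Icc, mem_Icc] at hw
  obtain ⟨⟨⟨a1, a2⟩, b1, b2⟩, c⟩ := hw
  have hT : (⌊T⌋₊ : ℤ) = ⌊T⌋ := Int.natCast_floor_eq_floor (Int.floor_nonneg.1 (by omega))
  have h1 : ((w.1 : ℚ) / (w.2 : ℚ)).num = w.1 := Rat.num_div_eq_of_coprime (by omega) c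
  have h2 : (((w.1 : ℚ) / (w.2 : ℚ)).den : ℤ) = w.2 := Rat.den_div_eq_of_coprime (by omega) c
  refine ⟨?_, by omega, by omega⟩
  have p1 : (0 : ℚ) < w.1 := by exact_mod_cast a1
  have p2 : (0 : ℚ) < w.2 := by exact_mod_cast b1
  positivity

lemma sum_piK_le (f g : ℤ[X]) (d : ℤ) (T x : ℝ) :
    ∑ w ∈ FT T ×ˢ FT T, piK f g d (w.1 + w.2) x ≤
      ∑ p ∈ (Icc 1 ⌊x⌋₊).filter Nat.Prime, SumRep.pairCount (FT T) p (frobSet f g d p) := by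
  have h : ∀ w ∈ FT T ×ˢ FT T, piK f g d (w.1 + w.2) x ≤ #(((Icc 1 ⌊x⌋₊).filter Nat.Prime).filter fun p =>
      ¬p ∣ (w.1 + w.2).den ∧ redQ p (w.1 + w.2) ∈ frobSet f g d p) := by
    intro w _
    rw [filter_filter]
    refine card_le_card fun p hp => ?_
    rw [mem_filter] at hp ⊢
    exact ⟨hp.1, hp.2.1, hp.2.2.1.1, hp.2.2.1.2, hp.2.2.2.2⟩
  refine (sum_le_sum h).trans (le_of_eq ?_)
  simp only [SumRep.pairCount, card_filter]
  exact sum_comm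

/-- Theorem 1.5 (Lang–Trotter for Frobenius fields on average over sums of two
elements of `F(T)`), for the imaginary quadratic field `K = ℚ(√d)`. -/
theorem LT_fields_average_FT_sums (f g : Polynomial ℤ) (hfg : Nondeg f g)
    (d : ℤ) (hd : d < 0) (hsf : Squarefree d) (ε : ℝ) (hε : 0 < ε) :
    ∃ C : ℝ, 0 < C ∧ ∀ T x : ℝ, 1 ≤ T → 2 ≤ x →
      (∑ rs ∈ (FT T ×ˢ FT T).filter fun rs => aeval (rs.1 + rs.2) (Dpoly f g) ≠ 0,
          (piK f g d (rs.1 + rs.2) x : ℝ)) ≤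
        C * (T ^ 4 * x ^ ((5 : ℝ) / 6) + T ^ (2 + ε) * x ^ ((4 : ℝ) / 3)) := by
  obtain ⟨C, hC, hfrob⟩ := Ell.exists_sum_ncard_frobSet hfg hd hsf
  obtain ⟨C1, hC1, h1⟩ := SumRep.exists_sum_pairCount_le_of_le hC hε
  obtain ⟨C2, hC2, h2⟩ := SumRep.exists_sum_pairCount_le_of_ge hC
  refine ⟨C1 + C2 + 1, by positivity, fun T x hT hx => ?_⟩
  set n := ⌊T⌋₊ with hn
  set N := ⌊x⌋₊ with hN
  have hn1 : 1 ≤ n := Nat.le_floor (by exact_mod_cast hT)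
  have hN2 : 2 ≤ N := Nat.le_floor (by exact_mod_cast hx)
  have hnT : (n : ℝ) ≤ T := Nat.floor_le (by linarith)
  have hNx : (N : ℝ) ≤ x := Nat.floor_le (by linarith)
  have hn0 : (0 : ℝ) ≤ n := by positivity
  have hN0 : (0 : ℝ) ≤ N := by positivity
  have hx0 : 0 ≤ x := by linarith
  have hT0 : 0 ≤ T := by linarith
  have hS : ∀ q ∈ FT T, 0 < q ∧ q.num.natAbs ≤ n ∧ q.den ≤ n := fun q hq => FT_height hq
  have hsum : (∑ rs ∈ (FT T ×ˢ FT T).filter fun rs => aeval (rs.1 + rs.2) (Dpoly f g) ≠ 0,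
      (piK f g d (rs.1 + rs.2) x : ℝ)) ≤
      ∑ p ∈ (Icc 1 N).filter Nat.Prime, (SumRep.pairCount (FT T) p (frobSet f g d p) : ℝ) := by
    refine (sum_le_sum_of_subset_of_nonneg (filter_subset _ _) (fun _ _ _ => by positivity)).trans ?_
    exact_mod_cast sum_piK_le f g d T x
  set X : ℝ := T ^ 4 * x ^ ((5 : ℝ) / 6) with hX
  set Y : ℝ := T ^ (2 + ε) * x ^ ((4 : ℝ) / 3) with hY
  have hX0 : 0 ≤ X := by positivity
  have hY0 : 0 ≤ Y := by positivity
  have hXn : (n : ℝ) ^ 4 * (N : ℝ) ^ ((5 : ℝ) / 6) ≤ X := by rw [hX]; gcongr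
  have hYn : (n : ℝ) ^ (2 + ε) * (N : ℝ) ^ ((4 : ℝ) / 3) ≤ Y := by rw [hY]; gcongr
  refine hsum.trans ?_
  rcases le_total n N with h | h
  · refine (h1 N n (FT T) (frobSet f g d) hN2 hn1 h hS (hfrob N)).trans ?_
    gcongr
    linarith
  · refine (h2 N n (FT T) (frobSet f g d) hN2 h hS
      (fun p hp => ncard_frobSet_le_self f g d hp) (hfrob N)).trans ?_
    calc _ ≤ C2 * X := by gcongr
      _ ≤ (C1 + C2 + 1) * (X + Y) := by
        refine mul_le_mul (by linarith) (by linarith) hX0 (by positivity)
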